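/- Uniformly for 1 ≤ x ≤ T and T ≥ 3, one has 𝓕(x,T) = (T/(2π x²)) (log T)² · (1 + O(1/√(log T))) + (T/(2π)) log x + O(T √(log T)), where 𝓕(x,T) := Σ_{ρ,ρ' : T<γ,γ'≤2T} x^{ρ−ρ'} W(ρ−ρ') with W(u) = 4/(4 − u²), the sums running over pairs of nontrivial zeros ρ = β+iγ, ρ' = β'+iγ' of the Riemann zeta function counted with multiplicity. (This is unconditional; the Riemann Hypothesis is not assumed.) -/

import Mathlib

open Filter Topology MeasureTheory Set
open scoped ArithmeticFunction.vonMangoldt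


/-- The multiplicity of `ρ` as a zero of the Riemann zeta function:
the least `n` such that the `n`-th iterated derivative of `ζ` is nonzero at `ρ`. -/
noncomputable def zetaMult (ρ : ℂ) : ℕ :=
  sInf {n : ℕ | iteratedDeriv n riemannZeta ρ ≠ 0}

/-- `ρ` is a nontrivial zero of the Riemann zeta function. -/
def IsNontrivialZero (ρ : ℂ) : Prop :=
  riemannZeta ρ = 0 ∧ 0 < ρ.re ∧ ρ.re < 1

/-- The set of nontrivial zeros `ρ = β + iγ` with `T < γ ≤ 2T`. -/
def zeroBand (T : ℝ) : Set ℂ :=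
  {ρ | IsNontrivialZero ρ ∧ T < ρ.im ∧ ρ.im ≤ 2 * T}

/-- Number of nontrivial zeros with `T < γ ≤ 2T`, counted with multiplicity. -/
noncomputable def Ntot (T : ℝ) : ℝ :=
  ∑ᶠ ρ ∈ zeroBand T, (zetaMult ρ : ℝ)

/-- Number of simple nontrivial zeros with `T < γ ≤ 2T`. -/
noncomputable def Nsimple (T : ℝ) : ℝ :=
  ∑ᶠ ρ ∈ {ρ ∈ zeroBand T | zetaMult ρ = 1}, (1 : ℝ)

/-- Number of nontrivial zeros with `T < γ ≤ 2T` on the critical line, with multiplicity. -/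
noncomputable def Nline (T : ℝ) : ℝ :=
  ∑ᶠ ρ ∈ {ρ ∈ zeroBand T | ρ.re = 1/2}, (zetaMult ρ : ℝ)

/-- Number of simple critical-line nontrivial zeros with `T < γ ≤ 2T`. -/
noncomputable def NlineSimple (T : ℝ) : ℝ :=
  ∑ᶠ ρ ∈ {ρ ∈ zeroBand T | ρ.re = 1/2 ∧ zetaMult ρ = 1}, (1 : ℝ)

/-- The weight `W(u) = 4/(4 - u²)`. -/
noncomputable def Wweight (u : ℂ) : ℂ := 4 / (4 - u ^ 2)

/-- `𝓕(x,T) = Σ_{ρ,ρ' : T<γ,γ'≤2T} x^{ρ-ρ'} W(ρ-ρ')`, pairs of nontrivial zeros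
counted with multiplicity. -/
noncomputable def FF (x T : ℝ) : ℂ :=
  ∑ᶠ ρ ∈ zeroBand T, ∑ᶠ ρ' ∈ zeroBand T,
    (zetaMult ρ : ℂ) * (zetaMult ρ' : ℂ) * (x : ℂ) ^ (ρ - ρ') * Wweight (ρ - ρ')



open Complex in
lemma zeta_an : AnalyticOnNhd ℂ riemannZeta {1}ᶜ :=
  DifferentiableOn.analyticOnNhd
    (fun _ hs => (differentiableAt_riemannZeta hs).differentiableWithinAt) isOpen_compl_singleton

lemma zeta_order {ρ : ℂ} (h : ρ ≠ 1) : analyticOrderAt riemannZeta ρ = zetaMult ρ := by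
  have hne : analyticOrderAt riemannZeta ρ ≠ ⊤ := by
    refine zeta_an.analyticOrderAt_ne_top_of_isPreconnected (x := 2)
      (isConnected_compl_singleton_of_one_lt_rank (by simp) _).isPreconnected
      (by norm_num) h ?_
    rw [((zeta_an 2 (by norm_num)).analyticOrderAt_eq_zero).2
      (riemannZeta_ne_zero_of_one_le_re (by norm_num))]
    simp
  obtain ⟨n, hn⟩ := ENat.ne_top_iff_exists.1 hne
  have := (analyticOrderAt_eq_nat_iff_iteratedDeriv_eq_zero (zeta_an ρ h)).1 hn.symm
  rw [← hn, zetaMult]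
  norm_cast
  refine le_antisymm ?_ (Nat.sInf_le this.2)
  by_contra! hlt
  exact (Nat.sInf_mem (s := {n : ℕ | iteratedDeriv n riemannZeta ρ ≠ 0}) ⟨n, this.2⟩) (this.1 _ hlt)

lemma zetaMult_pos {ρ : ℂ} (h : ρ ≠ 1) : 0 < zetaMult ρ ↔ riemannZeta ρ = 0 := by
  rw [← (zeta_an ρ h).analyticOrderAt_ne_zero, zeta_order h]
  simp [Nat.pos_iff_ne_zero]

lemma zetaMult_conj (ρ : ℂ) : zetaMult (starRingEnd ℂ ρ) = zetaMult ρ := by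
  have : ∀ n z, iteratedDeriv n riemannZeta (starRingEnd ℂ z)
      = starRingEnd ℂ (iteratedDeriv n riemannZeta z) := by
    intro n
    induction n with
    | zero => intro z; simp [riemannZeta_conj]
    | succ n ih =>
      intro z
      rw [iteratedDeriv_succ]
      have h2 : iteratedDeriv n riemannZeta =
          starRingEnd ℂ ∘ iteratedDeriv n riemannZeta ∘ starRingEnd ℂ := by
        ext w; simp [ih]
      conv_lhs => rw [h2]
      rw [deriv_conj_conj]; simp
  simp [zetaMult, this]

lemma zetaMult_one_sub {ρ : ℂ} (h : 0 < ρ.re) (h' : ρ.re < 1) :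
    zetaMult (1 - ρ) = zetaMult ρ := by
  have h1 : ρ ≠ 1 := by rintro rfl; simp at h'
  have h2 : 1 - ρ ≠ 1 := by intro h3; rw [sub_eq_self] at h3; simp [h3] at h
  have key : analyticOrderAt (fun s => riemannZeta (1 - s)) ρ = zetaMult ρ := by
    rw [← zeta_order h1]
    have hG : AnalyticAt ℂ (fun s : ℂ => 2 * (2 * Real.pi) ^ (-s) * Complex.Gamma s *
        Complex.cos (Real.pi * s / 2)) ρ := by
      have : AnalyticAt ℂ Complex.Gamma ρ := by
        refine DifferentiableOn.analyticAt (s := {s : ℂ | 0 < s.re}) (fun s hs => ?_)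
          ((isOpen_lt continuous_const Complex.continuous_re).mem_nhds h)
        refine (Complex.differentiableAt_Gamma _ fun m hm => ?_).differentiableWithinAt
        have : 0 < s.re := hs
        rw [hm] at this; simp at this
        linarith [Nat.cast_nonneg (α := ℝ) m]
      have h3 : AnalyticAt ℂ (fun s : ℂ => (2 * Real.pi : ℂ) ^ (-s)) ρ := by
        refine AnalyticAt.cpow analyticAt_const (by fun_prop) (Or.inl ?_)
        norm_cast; positivity
      have h4 : AnalyticAt ℂ (fun s : ℂ => Complex.cos (Real.pi * s / 2)) ρ := by
        have := Complex.differentiable_cos.analyticAt (Real.pi * ρ / 2)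
        exact this.fun_comp (f := fun s : ℂ => Real.pi * s / 2) (by fun_prop)
      fun_prop
    have hG0 : 2 * (2 * Real.pi : ℂ) ^ (-ρ) * Complex.Gamma ρ *
        Complex.cos (Real.pi * ρ / 2) ≠ 0 := by
      refine mul_ne_zero (mul_ne_zero (mul_ne_zero two_ne_zero ?_)
        (Complex.Gamma_ne_zero_of_re_pos h)) ?_
      · rw [Complex.cpow_def_of_ne_zero (by norm_cast; positivity)]
        exact Complex.exp_ne_zero _
      · rw [Complex.cos_ne_zero_iff]
        intro k hk
        have := congrArg Complex.re hk
        simp at this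
        have h5 : ρ.re = 2 * k + 1 := by
          have := Real.pi_pos
          field_simp at *
          nlinarith
        rw [h5] at h h'
        norm_cast at h h'
        omega
    have := analyticOrderAt_mul hG (zeta_an ρ h1)
    rw [hG.analyticOrderAt_eq_zero.2 hG0, zero_add] at this
    rw [← this]
    refine analyticOrderAt_congr ?_
    filter_upwards [(isOpen_lt continuous_const Complex.continuous_re).mem_nhds h,
      isOpen_compl_singleton.mem_nhds h1] with s hs hs1
    have hs : 0 < s.re := hs
    rw [riemannZeta_one_sub (fun n hn => ?_) hs1]
    · rfl
    · rw [hn] at hs; simp at hs; linarith [Nat.cast_nonneg (α := ℝ) n]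
  have h6 := analyticOrderAt_comp_of_deriv_ne_zero (f := riemannZeta)
    (g := fun s : ℂ => 1 - s) (z₀ := ρ) (by fun_prop) (by simp)
  rw [zeta_order h2] at h6
  have h7 : ((zetaMult ρ : ℕ) : ℕ∞) = zetaMult (1 - ρ) := key.symm.trans h6
  exact_mod_cast h7.symm

lemma zeta_ne_one {ρ : ℂ} (h : IsNontrivialZero ρ) : ρ ≠ 1 := by
  rintro rfl; simpa using h.2.2

lemma nz_mult_pos {ρ : ℂ} (h : IsNontrivialZero ρ) : 0 < zetaMult ρ :=
  (zetaMult_pos (zeta_ne_one h)).2 h.1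

/-- reflection in the critical line -/
lemma refl_mult {ρ : ℂ} (h : IsNontrivialZero ρ) :
    zetaMult (1 - starRingEnd ℂ ρ) = zetaMult ρ := by
  rw [zetaMult_one_sub (by simpa using h.2.1) (by simpa using h.2.2), zetaMult_conj]

lemma refl_zero {ρ : ℂ} (h : IsNontrivialZero ρ) : IsNontrivialZero (1 - starRingEnd ℂ ρ) := by
  have h1 : (1 - starRingEnd ℂ ρ) ≠ 1 := by
    intro h3; rw [sub_eq_self] at h3; simp at h3; simpa [h3] using h.2.1
  refine ⟨(zetaMult_pos h1).1 (refl_mult h ▸ nz_mult_pos h), ?_, ?_⟩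
  · simpa using h.2.2
  · simpa using h.2.1

lemma fac_one {U : Set ℂ} (hU : IsOpen U) {f : ℂ → ℂ} (hf : DifferentiableOn ℂ f U) {ρ : ℂ}
    (hρ : ρ ∈ U) {n : ℕ} (hn : analyticOrderAt f ρ = n) :
    ∃ g, DifferentiableOn ℂ g U ∧ g ρ ≠ 0 ∧ ∀ z ∈ U, f z = (z - ρ) ^ n * g z := by
  obtain ⟨g1, h1, h2, h3⟩ := ((hf.analyticAt (hU.mem_nhds hρ)).analyticOrderAt_eq_natCast).1 hn
  set g : ℂ → ℂ := Function.update (fun z => f z / (z - ρ) ^ n) ρ (g1 ρ) with hg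
  have hev : g =ᶠ[𝓝 ρ] g1 := by
    filter_upwards [h3] with z hz
    by_cases hzρ : z = ρ
    · simp [hg, hzρ]
    · have : z - ρ ≠ 0 := sub_ne_zero.2 hzρ
      simp [hg, hzρ, hz, this]
  refine ⟨g, fun z hz => ?_, by simpa [hg] using h2, fun z hz => ?_⟩
  · by_cases hzρ : z = ρ
    · subst hzρ
      exact (h1.differentiableAt.congr_of_eventuallyEq hev).differentiableWithinAt
    · have hd : DifferentiableAt ℂ (fun z => f z / (z - ρ) ^ n) z :=
        (hf.differentiableAt (hU.mem_nhds hz)).div (by fun_prop)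
          (pow_ne_zero _ (sub_ne_zero.2 hzρ))
      refine (hd.congr_of_eventuallyEq ?_).differentiableWithinAt
      filter_upwards [isOpen_compl_singleton.mem_nhds hzρ] with w hw
      simp [hg, Function.update_of_ne hw]
  · by_cases hzρ : z = ρ
    · subst hzρ
      rw [hev.self_of_nhds, h3.self_of_nhds]; simp
    · have : z - ρ ≠ 0 := sub_ne_zero.2 hzρ
      simp [hg, hzρ]; field_simp

lemma fac_many {U : Set ℂ} (hU : IsOpen U) {f : ℂ → ℂ} (hf : DifferentiableOn ℂ f U) (m : ℂ → ℕ)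
    (Z : Finset ℂ) (hZ : ∀ ρ ∈ Z, ρ ∈ U ∧ analyticOrderAt f ρ = m ρ) :
    ∃ g, DifferentiableOn ℂ g U ∧ (∀ ρ ∈ Z, g ρ ≠ 0) ∧
      ∀ z ∈ U, f z = (∏ ρ ∈ Z, (z - ρ) ^ m ρ) * g z := by
  induction Z using Finset.induction_on with
  | empty => exact ⟨f, hf, by simp, by simp⟩
  | insert a Z ha ih =>
    obtain ⟨g, h1, h2, h3⟩ := ih (fun ρ h => hZ ρ (Finset.mem_insert_of_mem h))
    obtain ⟨haU, hao⟩ := hZ a (Finset.mem_insert_self _ _)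
    have hP : AnalyticAt ℂ (fun z => ∏ ρ ∈ Z, (z - ρ) ^ m ρ) a := by fun_prop
    have hP0 : ∏ ρ ∈ Z, (a - ρ) ^ m ρ ≠ 0 :=
      Finset.prod_ne_zero_iff.2 fun ρ h => pow_ne_zero _ (sub_ne_zero.2 (by rintro rfl; exact ha h))
    have ho : analyticOrderAt g a = m a := by
      have := analyticOrderAt_mul hP (h1.analyticAt (hU.mem_nhds haU))
      rw [hP.analyticOrderAt_eq_zero.2 hP0, zero_add] at this
      rw [← this, ← hao]
      refine (analyticOrderAt_congr ?_).symm
      filter_upwards [hU.mem_nhds haU] with z hz using h3 z hz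
    obtain ⟨k, k1, k2, k3⟩ := fac_one hU h1 haU ho
    refine ⟨k, k1, fun ρ h => ?_, fun z hz => ?_⟩
    · rcases Finset.mem_insert.1 h with rfl | h
      · exact k2
      · have := h2 ρ h
        rw [k3 ρ (hZ ρ (Finset.mem_insert_of_mem h)).1] at this
        exact right_ne_zero_of_mul this
    · rw [h3 z hz, k3 z hz, Finset.prod_insert ha]; ring

/-- zeta factorization relative to a compact set -/
lemma zeta_fac {K : Set ℂ} (hK : IsCompact K) (h1 : (1 : ℂ) ∉ K) :
    ∃ (Z : Finset ℂ) (g : ℂ → ℂ), (∀ ρ, ρ ∈ Z ↔ ρ ∈ K ∧ riemannZeta ρ = 0) ∧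
      DifferentiableOn ℂ g {1}ᶜ ∧ (∀ z ∈ K, g z ≠ 0) ∧
      ∀ z, z ≠ 1 → riemannZeta z = (∏ ρ ∈ Z, (z - ρ) ^ zetaMult ρ) * g z := by
  have hfin := hK.inter_riemannZetaZeros_finite
  have hmem : ∀ ρ, ρ ∈ hfin.toFinset ↔ ρ ∈ K ∧ riemannZeta ρ = 0 := by
    intro ρ
    simp only [Finite.mem_toFinset, mem_inter_iff]
    exact Iff.rfl
  have hz1 : ∀ z ∈ K, z ≠ 1 := fun z hz h => h1 (h ▸ hz)
  obtain ⟨g, hg1, hg2, hg3⟩ := fac_many isOpen_compl_singleton (zeta_an.differentiableOn) zetaMult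
    hfin.toFinset (fun ρ h => ⟨hz1 ρ ((hmem ρ).1 h).1, zeta_order (hz1 ρ ((hmem ρ).1 h).1)⟩)
  refine ⟨hfin.toFinset, g, hmem, hg1, fun z hz h0 => ?_, fun z hz => hg3 z hz⟩
  by_cases hzz : riemannZeta z = 0
  · exact hg2 z ((hmem z).2 ⟨hz, hzz⟩) h0
  · rw [hg3 z (hz1 z hz), h0, mul_zero] at hzz; exact hzz rfl

/-- logarithmic derivative of the factorization -/
lemma zeta_fac_logDeriv {Z : Finset ℂ} {g : ℂ → ℂ} (hg : DifferentiableOn ℂ g {1}ᶜ)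
    (hfac : ∀ z, z ≠ 1 → riemannZeta z = (∏ ρ ∈ Z, (z - ρ) ^ zetaMult ρ) * g z)
    {z : ℂ} (hz : z ≠ 1) (h0 : riemannZeta z ≠ 0) (hZ : z ∉ Z) :
    deriv riemannZeta z / riemannZeta z =
      ∑ ρ ∈ Z, (zetaMult ρ : ℂ) / (z - ρ) + deriv g z / g z := by
  have hev : riemannZeta =ᶠ[𝓝 z] fun z => (∏ ρ ∈ Z, (z - ρ) ^ zetaMult ρ) * g z := by
    filter_upwards [isOpen_compl_singleton.mem_nhds hz] with w hw using hfac w hw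
  have hgz : g z ≠ 0 := fun h => h0 (by rw [hfac z hz, h, mul_zero])
  have hne : ∀ ρ ∈ Z, z - ρ ≠ 0 := fun ρ h => sub_ne_zero.2 (by rintro rfl; exact hZ h)
  change logDeriv riemannZeta z = _
  rw [logDeriv, Pi.div_apply, hev.deriv_eq, hev.self_of_nhds]
  change logDeriv _ z = _
  rw [logDeriv_mul z (Finset.prod_ne_zero_iff.2 fun ρ h => pow_ne_zero _ (hne ρ h)) hgz
    (by fun_prop) (hg.differentiableAt (isOpen_compl_singleton.mem_nhds hz)),
    logDeriv_prod (f := fun ρ z => (z - ρ) ^ zetaMult ρ) (fun ρ h => pow_ne_zero _ (hne ρ h))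
      (fun ρ _ => by fun_prop)]
  congr 1
  refine Finset.sum_congr rfl fun ρ h => ?_
  rw [logDeriv_fun_pow (by fun_prop)]
  simp [logDeriv, div_eq_mul_inv]


lemma zeta_growth {s : ℂ} (hs : 1 / 8 ≤ s.re) (ht : 1 ≤ |s.im|) :
    ‖riemannZeta s‖ ≤ 2 + 8 * ‖s‖ := by
  set f : ℝ → ℂ := fun u => (Ioi (1 : ℝ)).indicator (fun u => ((Int.fract u : ℝ) : ℂ)) u with hf
  have hfle : ∀ u, ‖f u‖ ≤ 1 := by
    intro u
    simp only [hf, indicator]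
    split_ifs
    · rw [Complex.norm_real, Real.norm_eq_abs, abs_of_nonneg (Int.fract_nonneg u)]
      exact (Int.fract_lt_one u).le
    · simp
  have hfm : Measurable f := by
    refine Measurable.indicator ?_ measurableSet_Ioi
    exact Complex.measurable_ofReal.comp measurable_fract
  have hfloc : LocallyIntegrableOn f (Ioi 0) := by
    refine LocallyIntegrable.locallyIntegrableOn ?_ _
    exact (locallyIntegrable_const (1 : ℝ)).mono hfm.aestronglyMeasurable
      (.of_forall fun u => by simpa using hfle u)
  have htop : f =O[atTop] fun u => u ^ (-(0 : ℝ)) := by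
    refine Asymptotics.IsBigO.of_bound 1 (.of_forall fun u => by simpa using hfle u)
  have hbot : ∀ b : ℝ, f =O[𝓝[>] 0] fun u => u ^ (-b) := by
    intro b
    refine Asymptotics.IsBigO.of_bound 1 ?_
    filter_upwards [mem_nhdsWithin_of_mem_nhds (Iio_mem_nhds zero_lt_one)] with u hu
    have : f u = 0 := by simp only [hf]; exact indicator_of_notMem (by simpa using (le_of_lt hu)) _
    simp [this]
  have hM : ∀ s : ℂ, 0 < s.re → DifferentiableAt ℂ (fun s => mellin f (-s)) s := by
    intro s hs
    have := mellin_differentiableAt_of_isBigO_rpow hfloc htop (s := -s) (by simpa using hs)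
      (hbot (-s.re - 1)) (by simp)
    exact this.comp (f := fun s : ℂ => -s) s (by fun_prop)
  have hMint : ∀ s : ℂ, mellin f (-s) = ∫ u in Ioi (1 : ℝ), ((Int.fract u : ℝ) : ℂ) * (u : ℂ) ^ (-s - 1) := by
    intro s
    rw [mellin]
    have : (fun t : ℝ => (t : ℂ) ^ (-s - 1) • f t) =
        (Ioi (1 : ℝ)).indicator (fun u => ((Int.fract u : ℝ) : ℂ) * (u : ℂ) ^ (-s - 1)) := by
      ext u
      by_cases hu : u ∈ Ioi (1 : ℝ)
      · simp only [hf, indicator_of_mem hu, smul_eq_mul]; ring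
      · simp only [hf, indicator_of_notMem hu, smul_eq_mul, mul_zero]
    rw [this, setIntegral_indicator measurableSet_Ioi]
    congr 2
    ext u; simp
  have hEq : EqOn riemannZeta₁ (fun s => s - s * (s - 1) * mellin f (-s)) {s : ℂ | 0 < s.re} := by
    have ho : IsOpen {s : ℂ | 0 < s.re} := isOpen_lt continuous_const Complex.continuous_re
    have hc : IsPreconnected {s : ℂ | 0 < s.re} := (convex_halfSpace_re_gt 0).isPreconnected
    refine AnalyticOnNhd.eqOn_of_preconnected_of_eventuallyEq (z₀ := 2)
      (DifferentiableOn.analyticOnNhd (differentiable_riemannZeta₁.differentiableOn) ho)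
      (DifferentiableOn.analyticOnNhd (fun s hs => ?_) ho) hc (by simp) ?_
    · have := hM s hs
      exact DifferentiableAt.differentiableWithinAt (by fun_prop)
    · filter_upwards [(isOpen_lt continuous_const Complex.continuous_re).mem_nhds
        (show (1 : ℝ) < (2 : ℂ).re by simp)] with s hs
      have hs : 1 < s.re := hs
      have hs1 : s ≠ 1 := by rintro rfl; simp at hs
      have hs1' : s - 1 ≠ 0 := sub_ne_zero.2 hs1
      have h1 : riemannZeta₁ s = (s - 1) * riemannZeta s := by
        rw [riemannZeta_eq_inv_sub_mul hs1, ← mul_assoc, mul_inv_cancel₀ hs1', one_mul]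
      have h2 : riemannZeta s = s * ∫ t in Ioi (1 : ℝ), ((⌊t⌋₊ : ℝ) : ℂ) * (t : ℂ) ^ (-(s + 1)) := by
        have := LSeries_eq_mul_integral' (1 : ℕ → ℂ) zero_le_one (s := s) hs (by
          refine Asymptotics.IsBigO.of_bound 1 (.of_forall fun n => by simp))
        rw [LSeries_one_eq_riemannZeta hs] at this
        simpa using this
      have hI : IntegrableOn (fun t : ℝ => (t : ℂ) ^ (-s)) (Ioi 1) :=
        integrableOn_Ioi_cpow_of_lt (by simpa using hs) one_pos
      have hI2 : IntegrableOn (fun u : ℝ => ((Int.fract u : ℝ) : ℂ) * (u : ℂ) ^ (-s - 1)) (Ioi 1) := by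
        refine Integrable.bdd_mul (c := 1)
          (integrableOn_Ioi_cpow_of_lt (by simp; linarith) one_pos)
          (Complex.measurable_ofReal.comp measurable_fract).aestronglyMeasurable
          (.of_forall fun u => ?_)
        rw [Complex.norm_real, Real.norm_eq_abs, abs_of_nonneg (Int.fract_nonneg u)]
        exact (Int.fract_lt_one u).le
      have h3 : ∫ t in Ioi (1 : ℝ), ((⌊t⌋₊ : ℝ) : ℂ) * (t : ℂ) ^ (-(s + 1)) =
          1 / (s - 1) - mellin f (-s) := by
        rw [hMint]
        have : 1 / (s - 1) = ∫ t in Ioi (1 : ℝ), (t : ℂ) ^ (-s) := by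
          rw [integral_Ioi_cpow_of_lt (by simpa using hs) one_pos]
          have : -s + 1 ≠ 0 := by rw [neg_add_eq_sub]; exact fun h => hs1' (by linear_combination -h)
          simp; field_simp; ring
        rw [this, ← integral_sub hI hI2]
        refine setIntegral_congr_fun measurableSet_Ioi fun t ht => ?_
        have ht0 : (0 : ℝ) < t := lt_trans one_pos ht
        have e1 : (t : ℂ) ^ (-s) = t * (t : ℂ) ^ (-s - 1) := by
          have : (t : ℂ) ≠ 0 := by exact_mod_cast ht0.ne'
          rw [Complex.cpow_sub _ _ this, Complex.cpow_one]
          field_simp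
        have e2 : ((⌊t⌋₊ : ℝ) : ℂ) = t - ((Int.fract t : ℝ) : ℂ) := by
          rw [← Complex.ofReal_sub, Int.self_sub_fract, natCast_floor_eq_intCast_floor ht0.le]
        simp only [e1, e2, neg_add, ← sub_eq_add_neg]
        ring
      change _ = s - s * (s - 1) * mellin f (-s)
      rw [h1, h2, h3]
      field_simp
  have hs0 : 0 < s.re := by linarith
  have hs1 : s ≠ 1 := by rintro rfl; simp at ht; linarith
  have hn1 : 1 ≤ ‖s - 1‖ := ht.trans (by simpa using Complex.abs_im_le_norm (s - 1))
  have hs1' : s - 1 ≠ 0 := sub_ne_zero.2 hs1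
  have hb : ‖mellin f (-s)‖ ≤ 8 := by
    rw [hMint]
    calc _ ≤ ∫ u in Ioi (1 : ℝ), u ^ (-s.re - 1) := by
          refine norm_integral_le_of_norm_le (integrableOn_Ioi_rpow_of_lt (by linarith) one_pos) ?_
          filter_upwards [ae_restrict_mem measurableSet_Ioi] with u hu
          rw [norm_mul, Complex.norm_cpow_eq_rpow_re_of_pos (lt_trans one_pos hu), Complex.norm_real,
            Real.norm_eq_abs, abs_of_nonneg (Int.fract_nonneg u)]
          simpa using mul_le_of_le_one_left (Real.rpow_nonneg (lt_trans one_pos hu).le _)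
            (Int.fract_lt_one u).le
      _ = 1 / s.re := by
          rw [integral_Ioi_rpow_of_lt (by linarith) one_pos]; simp
      _ ≤ 8 := by rw [div_le_iff₀ hs0]; linarith
  have h := hEq (show s ∈ {s : ℂ | 0 < s.re} from hs0)
  have h' : riemannZeta s = 1 + (s - 1)⁻¹ - s * mellin f (-s) := by
    rw [riemannZeta_eq_inv_sub_mul hs1, h]; field_simp; ring
  rw [h']
  calc _ ≤ ‖(1 : ℂ)‖ + ‖(s - 1)⁻¹‖ + ‖s * mellin f (-s)‖ :=
        (norm_sub_le _ _).trans (by gcongr; exact norm_add_le _ _)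
    _ ≤ 1 + 1 + ‖s‖ * 8 := by
        rw [norm_mul, norm_inv, norm_one]; gcongr; exact inv_le_one_of_one_le₀ hn1
    _ = _ := by ring


lemma log_deriv_bound {h : ℂ → ℂ} {c : ℂ} {M : ℝ} (hM : 0 < M)
    (hd : DifferentiableOn ℂ h (Metric.ball c (7/4))) (h0 : ∀ z ∈ Metric.ball c (7/4), h z ≠ 0)
    (hb : ∀ z ∈ Metric.ball c (7/4), ‖h z‖ ≤ Real.exp M * ‖h c‖) {z : ℂ}
    (hz : z ∈ Metric.closedBall c (13/8)) : ‖deriv h z / h z‖ ≤ 864 * M := by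
  have hc : c ∈ Metric.ball c (7/4 : ℝ) := by simp
  have hop : IsOpen (Metric.ball c (7/4 : ℝ)) := Metric.isOpen_ball
  have hq : DifferentiableOn ℂ (fun z => deriv h z / h z) (Metric.ball c (7/4)) :=
    (hd.deriv hop).div hd h0
  obtain ⟨Ψ, hΨ0, hΨ⟩ := hq.isExactOn_ball.with_val_at c 0
  have hconst : ∀ z ∈ Metric.ball c (7/4), h z * Complex.exp (-Ψ z) = h c := by
    have hder : ∀ z ∈ Metric.ball c (7/4), HasDerivAt (fun z => h z * Complex.exp (-Ψ z)) 0 z := by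
      intro z hz
      convert! ((hd.differentiableAt (hop.mem_nhds hz)).hasDerivAt).mul (hΨ z hz).neg.cexp using 1
      have := h0 z hz
      field_simp; ring
    intro z hz
    have := hop.is_const_of_deriv_eq_zero (Metric.isPreconnected_ball)
      (fun z hz => (hder z hz).differentiableAt.differentiableWithinAt)
      (fun z hz => (hder z hz).deriv) hz hc
    simpa [hΨ0] using this
  have hre : ∀ z ∈ Metric.ball c (7/4), (Ψ z).re ≤ M := by
    intro z hz
    have h1 := hconst z hz
    have h2 : h z = h c * Complex.exp (Ψ z) := by
      rw [← h1, mul_assoc, ← Complex.exp_add]; simp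
    have h3 := hb z hz
    rw [h2, norm_mul, Complex.norm_exp, mul_comm] at h3
    exact Real.exp_le_exp.1 (le_of_mul_le_mul_right h3 (norm_pos_iff.2 (h0 c hc)))
  have hmap : ∀ w ∈ Metric.ball (0 : ℂ) (7/4), c + w ∈ Metric.ball c (7/4) := by
    intro w hw; simpa using hw
  have hBC : ∀ w, ‖w‖ ≤ 27/16 → ‖Ψ (c + w)‖ ≤ 54 * M := by
    intro w hw
    have := Complex.borelCaratheodory_zero (f := fun w => Ψ (c + w)) (R := 7/4) (z := w) hM
      (fun w hw => by
        have := (hΨ _ (hmap w hw)).differentiableAt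
        exact (this.comp w (f := fun w => c + w) (by fun_prop)).differentiableWithinAt)
      (fun w hw => hre _ (hmap w hw)) (by norm_num) (by simp; linarith) (by simpa using hΨ0)
    refine this.trans ?_
    rw [div_le_iff₀ (by linarith)]
    nlinarith
  rw [← (hΨ z (Metric.closedBall_subset_ball (by norm_num) hz)).deriv]
  have hz' : ‖z - c‖ ≤ 13/8 := by simpa [dist_eq_norm] using hz
  have hsub : ∀ w ∈ Metric.closedBall z (1/16), ‖w - c‖ ≤ 27/16 := by
    intro w hw
    have : ‖w - z‖ ≤ 1/16 := by simpa [dist_eq_norm] using hw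
    calc ‖w - c‖ = ‖(w - z) + (z - c)‖ := by congr 1; ring
      _ ≤ _ := (norm_add_le _ _).trans (by linarith)
  have := Complex.norm_deriv_le_of_forall_mem_sphere_norm_le (c := z) (R := 1/16) (C := 54 * M)
    (f := Ψ) (by norm_num) ?_ ?_
  · refine this.trans (le_of_eq (by ring))
  · refine DifferentiableOn.diffContOnCl fun w hw => ?_
    rw [closure_ball _ (by norm_num)] at hw
    have h3 := hsub w hw
    exact (hΨ w (by rw [Metric.mem_ball, dist_eq_norm]; linarith)).differentiableAt.differentiableWithinAt
  · intro w hw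
    have := hBC (w - c) (hsub w (Metric.sphere_subset_closedBall hw))
    simpa using this

lemma zeta_lower (t : ℝ) : 1/3 ≤ ‖riemannZeta (2 + t * Complex.I)‖ := by
  set s : ℂ := 2 + t * Complex.I with hs
  have hre : s.re = 2 := by simp [hs]
  have hnorm : ∀ n : ℕ, ‖1 / ((n : ℂ) + 1) ^ s‖ = 1 / ((n : ℝ) + 1) ^ 2 := by
    intro n
    have : ((n : ℂ) + 1) = ((n + 1 : ℝ) : ℂ) := by push_cast; ring
    rw [norm_div, norm_one, this, Complex.norm_cpow_eq_rpow_re_of_pos (by positivity), hre]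
    norm_num
  have hsum : HasSum (fun n : ℕ => 1 / ((n : ℝ) + 1) ^ 2) (Real.pi ^ 2 / 6) := by
    have := (hasSum_nat_add_iff' 1).2 hasSum_zeta_two
    simpa using this
  have h1 := zeta_eq_tsum_one_div_nat_add_one_cpow (s := s) (by rw [hre]; norm_num)
  have hS : Summable (fun n : ℕ => 1 / ((n : ℂ) + 1) ^ s) :=
    Summable.of_norm (by simpa only [hnorm] using hsum.summable)
  rw [hS.tsum_eq_zero_add] at h1
  have h2 : ‖∑' n : ℕ, 1 / (((n + 1 : ℕ) : ℂ) + 1) ^ s‖ ≤ Real.pi ^ 2 / 6 - 1 := by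
    have h3 := (hasSum_nat_add_iff' 1).2 hsum
    simp only [Finset.range_one, Finset.sum_singleton] at h3
    refine tsum_of_norm_bounded (g := fun n : ℕ => 1 / (((n + 1 : ℕ) : ℝ) + 1) ^ 2)
      (by simpa using h3) (fun n => (hnorm (n + 1)).le)
  rw [h1]
  have hpi : Real.pi ^ 2 / 6 - 1 ≤ 2/3 := by nlinarith [Real.pi_lt_d2, Real.pi_pos]
  have h4 := norm_sub_le_norm_add (1 : ℂ) (∑' n : ℕ, 1 / (((n + 1 : ℕ) : ℂ) + 1) ^ s)
  simp only [norm_one] at h4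
  simp only [Nat.cast_zero, zero_add, Complex.one_cpow, div_one]
  linarith

lemma sphere_factor {R : ℝ} {a z : ℂ} (hz : ‖z‖ = R) (hR : 0 < R) :
    ‖(R ^ 2 - starRingEnd ℂ a * z) / R‖ = ‖z - a‖ := by
  have h1 : (R : ℂ) ^ 2 - starRingEnd ℂ a * z = starRingEnd ℂ (z - a) * z := by
    have : (R : ℂ) ^ 2 = starRingEnd ℂ z * z := by
      rw [mul_comm, Complex.mul_conj, Complex.normSq_eq_norm_sq, hz]; push_cast; ring
    rw [this, map_sub]; ring
  rw [h1, norm_div, norm_mul, RCLike.norm_conj, hz, Complex.norm_real, Real.norm_eq_abs,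
    abs_of_pos hR, mul_div_assoc, div_self hR.ne', mul_one]

lemma landau : ∃ C : ℝ, 0 < C ∧ ∀ T : ℝ, 3 ≤ T → ∃ (Z : Finset ℂ) (G : ℂ → ℂ),
    (∀ ρ, ρ ∈ Z ↔ ‖ρ - (2 + T * Complex.I)‖ ≤ 7/4 ∧ riemannZeta ρ = 0) ∧
    ∑ ρ ∈ Z, (zetaMult ρ : ℝ) ≤ C * Real.log T ∧
    DifferentiableOn ℂ G (Metric.ball (2 + T * Complex.I) (7/4)) ∧
    (∀ z ∈ Metric.closedBall (2 + T * Complex.I) (13/8), ‖G z‖ ≤ C * Real.log T) ∧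
    (∀ z ∈ Metric.ball (2 + T * Complex.I) (7/4), riemannZeta z ≠ 0 →
      deriv riemannZeta z / riemannZeta z = ∑ ρ ∈ Z, (zetaMult ρ : ℂ) / (z - ρ) + G z) := by
  refine ⟨100000, by norm_num, fun T hT => ?_⟩
  set s0 : ℂ := 2 + T * Complex.I with hs0
  have hs0re : s0.re = 2 := by simp [hs0]
  have hs0im : s0.im = T := by simp [hs0]
  have hlog1 : 1 ≤ Real.log T := by
    rw [Real.le_log_iff_exp_le (by linarith)]; linarith [Real.exp_one_lt_d9]
  have hgeo : ∀ z : ℂ, ‖z - s0‖ ≤ 15/8 → 1/8 ≤ z.re ∧ 1 ≤ |z.im| ∧ ‖z‖ ≤ T + 4 := by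
    intro z hz
    have h1 := (Complex.abs_re_le_norm (z - s0)).trans hz
    have h2 := (Complex.abs_im_le_norm (z - s0)).trans hz
    simp only [Complex.sub_re, Complex.sub_im, hs0re, hs0im, abs_le] at h1 h2
    refine ⟨by linarith, le_abs.2 (Or.inl (by linarith)), ?_⟩
    have h3 : ‖s0‖ ≤ 2 + T := by
      refine (norm_add_le _ _).trans ?_
      simp [abs_of_nonneg (show (0:ℝ) ≤ T by linarith)]
    calc ‖z‖ = ‖(z - s0) + s0‖ := by congr 1; ring
      _ ≤ _ := (norm_add_le _ _).trans (by linarith)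
  have hne1 : ∀ z : ℂ, ‖z - s0‖ ≤ 15/8 → z ≠ 1 := by
    rintro z hz rfl
    have := (hgeo 1 hz).2.1
    simp at this; linarith
  obtain ⟨Z, g, hZ, hg, hg0, hfac⟩ := zeta_fac (K := Metric.closedBall s0 (7/4))
    (isCompact_closedBall _ _) (fun h => hne1 1 (by
      rw [Metric.mem_closedBall, dist_eq_norm] at h; linarith) rfl)
  have hZ' : ∀ ρ, ρ ∈ Z ↔ ‖ρ - s0‖ ≤ 7/4 ∧ riemannZeta ρ = 0 := by
    intro ρ; rw [hZ, Metric.mem_closedBall, dist_eq_norm]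
  set N := ∑ ρ ∈ Z, zetaMult ρ with hN
  set P : ℂ → ℂ := fun z => ∏ ρ ∈ Z,
    ((((15/8 : ℝ) : ℂ) ^ 2 - starRingEnd ℂ (ρ - s0) * (z - s0)) / (15/8 : ℝ)) ^ zetaMult ρ with hP
  have hden : ∀ ρ ∈ Z, ∀ z, ‖z - s0‖ ≤ 7/4 →
      29/64 ≤ ‖((15/8 : ℝ) : ℂ) ^ 2 - starRingEnd ℂ (ρ - s0) * (z - s0)‖ := by
    intro ρ hρ z hz
    have h1 : ‖starRingEnd ℂ (ρ - s0) * (z - s0)‖ ≤ 7/4 * (7/4) := by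
      rw [norm_mul, RCLike.norm_conj]
      exact mul_le_mul ((hZ' ρ).1 hρ).1 hz (norm_nonneg _) (by norm_num)
    have h2 := norm_sub_norm_le (((15/8 : ℝ) : ℂ) ^ 2) (starRingEnd ℂ (ρ - s0) * (z - s0))
    have h3 : ‖((15/8 : ℝ) : ℂ) ^ 2‖ = 225/64 := by
      rw [norm_pow, Complex.norm_real]; norm_num
    linarith
  have hPd : Differentiable ℂ P := by fun_prop
  set h : ℂ → ℂ := fun z => g z * P z with hh
  have hgd : ∀ z : ℂ, ‖z - s0‖ ≤ 15/8 → DifferentiableAt ℂ g z := fun z hz =>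
    hg.differentiableAt (isOpen_compl_singleton.mem_nhds (hne1 z hz))
  have hhd : ∀ z : ℂ, ‖z - s0‖ ≤ 15/8 → DifferentiableAt ℂ h z := fun z hz =>
    (hgd z hz).mul (hPd z)
  -- maximum modulus
  have hmax : ∀ z : ℂ, ‖z - s0‖ ≤ 15/8 → ‖h z‖ ≤ 2 + 8 * (T + 4) := by
    intro z hz
    refine Complex.norm_le_of_forall_mem_frontier_norm_le (U := Metric.ball s0 (15/8))
      Metric.isBounded_ball (DifferentiableOn.diffContOnCl fun w hw => ?_) (fun w hw => ?_)
      (by rw [closure_ball _ (by norm_num), Metric.mem_closedBall, dist_eq_norm]; exact hz)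
    · rw [closure_ball _ (by norm_num), Metric.mem_closedBall, dist_eq_norm] at hw
      exact (hhd w hw).differentiableWithinAt
    · rw [frontier_ball _ (by norm_num), mem_sphere_iff_norm] at hw
      have : ‖h w‖ = ‖riemannZeta w‖ := by
        rw [hfac w (hne1 w hw.le), hh, hP, norm_mul, norm_mul, mul_comm, norm_prod, norm_prod]
        congr 1
        refine Finset.prod_congr rfl fun ρ _ => ?_
        rw [norm_pow, norm_pow, sphere_factor hw (by norm_num)]
        congr 2; ring
      rw [this]
      have h3 := hgeo w hw.le
      exact (zeta_growth h3.1 h3.2.1).trans (by linarith [h3.2.2])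
  have hc : (15/14 : ℝ) ^ N * (1/3) ≤ ‖h s0‖ := by
    have h1 := zeta_lower T
    rw [← hs0, hfac s0 (hne1 s0 (by norm_num)), norm_mul, norm_prod] at h1
    have h2 : ‖h s0‖ = ‖g s0‖ * (15/8) ^ N := by
      rw [hh, hP, norm_mul, norm_prod, hN, ← Finset.prod_pow_eq_pow_sum]
      congr 1
      refine Finset.prod_congr rfl fun ρ _ => ?_
      rw [norm_pow, sub_self, mul_zero, sub_zero, norm_div, norm_pow, Complex.norm_real]; norm_num
    have h3 : ∏ ρ ∈ Z, ‖(s0 - ρ) ^ zetaMult ρ‖ ≤ (7/4) ^ N := by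
      rw [hN, ← Finset.prod_pow_eq_pow_sum]
      refine Finset.prod_le_prod (fun _ _ => norm_nonneg _) fun ρ hρ => ?_
      rw [norm_pow, norm_sub_rev]
      exact pow_le_pow_left₀ (norm_nonneg _) ((hZ' ρ).1 hρ).1 _
    rw [h2]
    calc (15/14 : ℝ) ^ N * (1/3) ≤ (15/14) ^ N * ((7/4) ^ N * ‖g s0‖) := by
          gcongr; exact h1.trans (by gcongr)
      _ = ‖g s0‖ * (15/8) ^ N := by rw [← mul_assoc, ← mul_pow]; norm_num; ring
  have hBT : 3 * (2 + 8 * (T + 4)) ≤ Real.exp (8 * Real.log T) := by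
    have : Real.exp (8 * Real.log T) = T ^ 8 := by
      rw [mul_comm, Real.exp_mul, Real.exp_log (by linarith)]; norm_cast
    rw [this]
    have h7 : (3:ℝ)^7 ≤ T^7 := by gcongr
    nlinarith
  have hN1 : (N : ℝ) ≤ 120 * Real.log T := by
    have h1 : (15/14 : ℝ) ^ N ≤ Real.exp (8 * Real.log T) := by
      have := hmax s0 (by norm_num)
      linarith
    have h2 : Real.exp (1/15) ≤ 15/14 := by
      have := Real.one_sub_le_exp_neg (1/15 : ℝ)
      rw [Real.exp_neg] at this
      rw [show (15/14:ℝ) = (14/15 : ℝ)⁻¹ by norm_num]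
      rw [le_inv_comm₀ (Real.exp_pos _) (by norm_num)]
      linarith
    have h3 : Real.exp (N * (1/15)) ≤ Real.exp (8 * Real.log T) := by
      rw [Real.exp_nat_mul]
      exact (pow_le_pow_left₀ (Real.exp_pos _).le h2 _).trans h1
    have := Real.exp_le_exp.1 h3
    linarith
  have hsub : ∀ z ∈ Metric.ball s0 (7/4), ‖z - s0‖ ≤ 7/4 := fun z hz => by
    rw [Metric.mem_ball, dist_eq_norm] at hz; exact hz.le
  have hP0 : ∀ z, ‖z - s0‖ ≤ 7/4 → P z ≠ 0 := fun z hz => by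
    refine Finset.prod_ne_zero_iff.2 fun ρ hρ => pow_ne_zero _ (div_ne_zero ?_ (by norm_num))
    exact norm_pos_iff.1 (lt_of_lt_of_le (by norm_num) (hden ρ hρ z hz))
  have hgz : ∀ z, ‖z - s0‖ ≤ 7/4 → g z ≠ 0 := fun z hz => hg0 z (by
    rw [Metric.mem_closedBall, dist_eq_norm]; exact hz)
  have hlb := fun z hz => log_deriv_bound (h := h) (c := s0) (M := 8 * Real.log T) (z := z)
    (by linarith) (fun z hz => (hhd z (by linarith [hsub z hz])).differentiableWithinAt)
    (fun z hz => mul_ne_zero (hgz z (hsub z hz)) (hP0 z (hsub z hz)))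
    (fun z hz => by
      have h1 := hmax z (by linarith [hsub z hz])
      have h2 : 1/3 ≤ ‖h s0‖ := le_trans (by
        have : (1:ℝ) ≤ (15/14 : ℝ) ^ N := one_le_pow₀ (by norm_num)
        linarith) hc
      nlinarith [Real.exp_pos (8 * Real.log T)]) hz
  refine ⟨Z, fun z => deriv g z / g z, hZ', ?_, ?_, ?_, ?_⟩
  · have : ∑ ρ ∈ Z, (zetaMult ρ : ℝ) = N := by rw [hN]; push_cast; rfl
    rw [this]; linarith
  · have hs : Metric.ball s0 (7/4) ⊆ {1}ᶜ := fun z hz => hne1 z (by linarith [hsub z hz])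
    exact ((hg.deriv isOpen_compl_singleton).mono hs).div (hg.mono hs) fun z hz => hgz z (hsub z hz)
  · intro z hz
    have hz1 : ‖z - s0‖ ≤ 13/8 := by rwa [Metric.mem_closedBall, dist_eq_norm] at hz
    have h1 := hlb z hz
    have h2 : deriv h z / h z = deriv g z / g z + logDeriv P z := by
      exact logDeriv_mul z (hgz z (by linarith)) (hP0 z (by linarith)) (hgd z (by linarith)) (hPd z)
    have h3 : ‖logDeriv P z‖ ≤ N * 4 := by
      rw [hP, logDeriv_prod (f := fun ρ z => ((((15/8 : ℝ) : ℂ) ^ 2 - starRingEnd ℂ (ρ - s0) * (z - s0)) / (15/8 : ℝ)) ^ zetaMult ρ) (fun ρ hρ => pow_ne_zero _ (div_ne_zero (norm_pos_iff.1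
        (lt_of_lt_of_le (by norm_num) (hden ρ hρ z (by linarith)))) (by norm_num)))
        (fun ρ _ => by fun_prop)]
      rw [hN, Nat.cast_sum, Finset.sum_mul]
      refine norm_sum_le_of_le _ fun ρ hρ => ?_
      rw [logDeriv_fun_pow (by fun_prop), norm_mul]
      have hd := hden ρ hρ z (by linarith)
      have : logDeriv (fun z => (((15/8 : ℝ) : ℂ) ^ 2 - starRingEnd ℂ (ρ - s0) * (z - s0)) /
          (15/8 : ℝ)) z = - starRingEnd ℂ (ρ - s0) /
          (((15/8 : ℝ) : ℂ) ^ 2 - starRingEnd ℂ (ρ - s0) * (z - s0)) := by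
        rw [logDeriv_apply, deriv_div_const, deriv_const_sub, deriv_const_mul _ (by fun_prop)]
        rw [deriv_sub_const, deriv_id'', mul_one, div_div_div_cancel_right₀ (by norm_num)]
      rw [this, norm_div, norm_neg, RCLike.norm_conj]
      gcongr
      · simp
      · rw [div_le_iff₀ (by linarith)]
        linarith [((hZ' ρ).1 hρ).1]
    have h4 : deriv g z / g z = deriv h z / h z - logDeriv P z := by rw [h2]; ring
    change ‖deriv g z / g z‖ ≤ _
    rw [h4]
    refine (norm_sub_le _ _).trans ?_
    linarith
  · intro z hz h0
    exact zeta_fac_logDeriv hg hfac (hne1 z (by linarith [hsub z hz])) h0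
      (fun hm => h0 ((hZ' z).1 hm).2)


noncomputable def gK (n : ℕ) (x : ℝ) : ℝ := Real.exp (-x) - indicator (Ioc 0 (n:ℝ)) (fun x => (1 - x / n) ^ n) x

lemma gK_nonneg (n : ℕ) (x : ℝ) : 0 ≤ gK n x := by
  unfold gK
  by_cases h : x ∈ Ioc 0 (n:ℝ)
  · rw [indicator_of_mem h]
    linarith [Real.one_sub_div_pow_le_exp_neg h.2]
  · rw [indicator_of_notMem h]; linarith [Real.exp_pos (-x)]

lemma gK_int {s : ℂ} (hs : 0 < s.re) {n : ℕ} (hn : n ≠ 0) :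
    IntegrableOn (fun x : ℝ => (gK n x : ℂ) * (x:ℂ) ^ (s-1)) (Ioi 0) ∧
    Complex.Gamma s - Complex.GammaSeq s n = ∫ x in Ioi (0:ℝ), (gK n x : ℂ) * (x:ℂ) ^ (s-1) := by
  have h1 : IntegrableOn (fun x : ℝ => ((Real.exp (-x) : ℝ) : ℂ) * (x:ℂ) ^ (s-1)) (Ioi 0) :=
    Complex.GammaIntegral_convergent hs
  have h2 : Integrable (indicator (Ioc 0 (n : ℝ)) fun x : ℝ => (((1 - x / n) ^ n : ℝ) : ℂ) * (x : ℂ) ^ (s - 1)) (volume.restrict (Ioi 0)) := by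
    rw [integrable_indicator_iff (measurableSet_Ioc : MeasurableSet (Ioc (_ : ℝ) _)), IntegrableOn,
      Measure.restrict_restrict_of_subset Ioc_subset_Ioi_self, ← IntegrableOn, ←
      intervalIntegrable_iff_integrableOn_Ioc_of_le (by positivity : (0 : ℝ) ≤ n)]
    apply IntervalIntegrable.continuousOn_mul
    · refine intervalIntegral.intervalIntegrable_cpow' ?_
      simp; linarith
    · fun_prop
  have e : (fun x : ℝ => (gK n x : ℂ) * (x:ℂ) ^ (s-1)) = fun x => ((Real.exp (-x) : ℝ) : ℂ) * (x:ℂ) ^ (s-1) - (indicator (Ioc 0 (n : ℝ)) fun x : ℝ => (((1 - x / n) ^ n : ℝ) : ℂ) * (x : ℂ) ^ (s - 1)) x := by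
    funext x
    unfold gK
    by_cases h : x ∈ Ioc 0 (n:ℝ)
    · rw [indicator_of_mem h, indicator_of_mem h]; push_cast; ring
    · rw [indicator_of_notMem h, indicator_of_notMem h]; push_cast; ring
  rw [e]
  refine ⟨h1.sub h2, ?_⟩
  rw [integral_sub h1 h2, Complex.Gamma_eq_integral hs, Complex.GammaSeq_eq_approx_Gamma_integral hs hn,
    MeasureTheory.integral_indicator (measurableSet_Ioc : MeasurableSet (Ioc (_ : ℝ) _)),
      intervalIntegral.integral_of_le (by positivity : 0 ≤ (n : ℝ)),
      Measure.restrict_restrict_of_subset Ioc_subset_Ioi_self]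
  rfl

lemma gK_real {a : ℝ} (ha : 0 < a) {n : ℕ} (hn : n ≠ 0) :
    IntegrableOn (fun x : ℝ => gK n x * x ^ (a-1)) (Ioi 0) ∧
    ∫ x in Ioi (0:ℝ), gK n x * x ^ (a-1) = ‖Complex.Gamma a - Complex.GammaSeq a n‖ := by
  obtain ⟨h1, h2⟩ := gK_int (s := (a:ℂ)) (by simpa using ha) hn
  have e : ∀ x ∈ Ioi (0:ℝ), (gK n x : ℂ) * (x:ℂ) ^ ((a:ℂ)-1) = ((gK n x * x ^ (a-1) : ℝ) : ℂ) := by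
    intro x hx
    have hx : 0 < x := hx
    rw [Complex.ofReal_mul, Complex.ofReal_cpow hx.le]; push_cast; rfl
  have h1' := (h1.congr_fun e measurableSet_Ioi)
  rw [setIntegral_congr_fun measurableSet_Ioi e] at h2
  have i1 : IntegrableOn (fun x : ℝ => gK n x * x ^ (a-1)) (Ioi 0) := by
    have := Integrable.re h1'
    simpa [IntegrableOn] using this
  refine ⟨i1, ?_⟩
  rw [h2, integral_complex_ofReal, Complex.norm_real, Real.norm_of_nonneg]
  apply setIntegral_nonneg measurableSet_Ioi
  intro x hx
  have hx : 0 < x := hx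
  have := gK_nonneg n x
  positivity

lemma gSeq_unif {a b : ℝ} (ha : 0 < a) {n : ℕ} (hn : n ≠ 0) {s : ℂ} (h1 : a ≤ s.re) (h2 : s.re ≤ b) :
    ‖Complex.Gamma s - Complex.GammaSeq s n‖ ≤ ‖Complex.Gamma a - Complex.GammaSeq a n‖ + ‖Complex.Gamma b - Complex.GammaSeq b n‖ := by
  obtain ⟨i1, e1⟩ := gK_int (s := s) (by linarith) hn
  obtain ⟨ia, ea⟩ := gK_real ha hn
  obtain ⟨ib, eb⟩ := gK_real (a := b) (by linarith) hn
  rw [e1, ← ea, ← eb, ← integral_add ia ib]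
  apply norm_integral_le_of_norm_le (ia.add ib)
  filter_upwards [ae_restrict_mem measurableSet_Ioi] with x hx
  have hx : 0 < x := hx
  have hg := gK_nonneg n x
  rw [norm_mul, Complex.norm_real, Real.norm_of_nonneg hg, Complex.norm_cpow_eq_rpow_re_of_pos hx]
  simp only [Complex.sub_re, Complex.one_re, Pi.add_apply]
  rw [← mul_add]
  gcongr
  have p1 : 0 ≤ x ^ (a-1) := by positivity
  have p2 : 0 ≤ x ^ (b-1) := by positivity
  rcases le_total x 1 with h | h
  · have := Real.rpow_le_rpow_of_exponent_ge hx h (show a - 1 ≤ s.re - 1 by linarith)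
    linarith
  · have := Real.rpow_le_rpow_of_exponent_le h (show s.re - 1 ≤ b - 1 by linarith)
    linarith

lemma digamma_lim {s : ℂ} (hs : 0 < s.re) :
    Tendsto (fun n : ℕ => (Real.log n : ℂ) - ∑ j ∈ Finset.range (n+1), 1 / (s + j)) atTop (𝓝 (logDeriv Complex.Gamma s)) := by
  set a := s.re / 2
  set b := s.re + 1
  have ha : 0 < a := by simp only [a]; linarith
  set U : Set ℂ := {z | a < z.re} ∩ {z | z.re < b}
  have hU : IsOpen U := (isOpen_lt continuous_const Complex.continuous_re).inter (isOpen_lt Complex.continuous_re continuous_const)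
  have hsU : s ∈ U := ⟨by simp only [mem_ofPred_eq, a]; linarith, by simp only [mem_ofPred_eq, b]; linarith⟩
  have hne : ∀ z ∈ U, ∀ j : ℕ, z + j ≠ 0 := by
    intro z hz j h
    have := congrArg Complex.re h
    have h3 : a < z.re := hz.1
    simp at this
    have : (0:ℝ) ≤ j := by positivity
    linarith
  have hlim : TendstoLocallyUniformlyOn (fun (n:ℕ) z => Complex.GammaSeq z n) Complex.Gamma atTop U := by
    apply TendstoUniformlyOn.tendstoLocallyUniformlyOn
    have t1 : Tendsto (fun n => ‖Complex.Gamma a - Complex.GammaSeq a n‖ + ‖Complex.Gamma b - Complex.GammaSeq b n‖) atTop (𝓝 0) := by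
      have := ((tendsto_const_nhds (x := Complex.Gamma a)).sub (Complex.GammaSeq_tendsto_Gamma a)).norm.add ((tendsto_const_nhds (x := Complex.Gamma b)).sub (Complex.GammaSeq_tendsto_Gamma b)).norm
      simpa using this
    rw [Metric.tendstoUniformlyOn_iff]
    intro ε hε
    filter_upwards [t1.eventually (gt_mem_nhds hε), eventually_ne_atTop 0] with n hn hn0 z hz
    rw [dist_eq_norm]
    exact lt_of_le_of_lt (gSeq_unif ha hn0 (le_of_lt hz.1) (le_of_lt hz.2)) hn
  have hd : ∀ n : ℕ, n ≠ 0 → ∀ z ∈ U, HasDerivAt (fun z => Complex.GammaSeq z n) (Complex.GammaSeq z n * ((Real.log n : ℂ) - ∑ j ∈ Finset.range (n+1), 1 / (z + j))) z := by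
    intro n hn z hz
    have hn' : (n:ℂ) ≠ 0 := by exact_mod_cast hn
    have hp : ∏ j ∈ Finset.range (n + 1), (z + j) ≠ 0 := Finset.prod_ne_zero_iff.mpr (fun j _ => hne z hz j)
    have d1 : HasDerivAt (fun z : ℂ => (n:ℂ)^z) ((n:ℂ)^z * Complex.log n) z := by
      simpa using (hasDerivAt_id z).const_cpow (c := (n:ℂ)) (Or.inl hn')
    have d2 : HasDerivAt (fun z : ℂ => ∏ j ∈ Finset.range (n + 1), (z + j)) ((∏ j ∈ Finset.range (n + 1), (z + j)) * ∑ j ∈ Finset.range (n+1), 1 / (z + j)) z := by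
      have := HasDerivAt.fun_finsetProd (u := Finset.range (n+1)) (f := fun (j:ℕ) (z:ℂ) => z + j) (f' := fun _ => 1) (x := z) (fun j _ => (hasDerivAt_id z).add_const (j:ℂ))
      refine this.congr_deriv ?_
      symm
      rw [Finset.mul_sum]
      refine Finset.sum_congr rfl fun j hj => ?_
      rw [← Finset.mul_prod_erase _ _ hj]
      have := hne z hz j
      field_simp
      simp
    have d3 := (d1.mul_const ((n.factorial : ℂ))).div d2 hp
    unfold Complex.GammaSeq
    refine d3.congr_deriv ?_
    have : Complex.log n = (Real.log n : ℂ) := (Complex.natCast_log).symm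
    rw [this]
    field_simp
  have key := Complex.logDeriv_tendsto hU hsU hlim (by
    filter_upwards [eventually_ne_atTop 0] with n hn z hz
    exact (hd n hn z hz).differentiableAt.differentiableWithinAt) (Complex.Gamma_ne_zero_of_re_pos hs)
  refine key.congr' ?_
  filter_upwards [eventually_ne_atTop 0] with n hn
  have hn' : (n:ℂ) ≠ 0 := by exact_mod_cast hn
  rw [logDeriv_apply, (hd n hn s hsU).deriv, mul_div_cancel_left₀]
  unfold Complex.GammaSeq
  apply div_ne_zero
  · apply mul_ne_zero
    · simp [Complex.cpow_eq_zero_iff, hn']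
    · exact_mod_cast n.factorial_ne_zero
  · exact Finset.prod_ne_zero_iff.mpr (fun j _ => hne s hsU j)

lemma log_step {z : ℂ} (h0 : 0 < z.re) (h2 : 2 ≤ z.im) :
    ‖Complex.log (z+1) - Complex.log z - 1 / z‖ ≤ 1 / ‖z‖^2 := by
  have hz : z ≠ 0 := by rintro rfl; simp at h0
  have hn : 2 ≤ ‖z‖ := h2.trans ((le_abs_self _).trans (Complex.abs_im_le_norm z))
  have hre : 0 < (1 + 1/z).re := by
    have : 0 ≤ (1/z).re := by
      rw [one_div, Complex.inv_re]; exact div_nonneg h0.le (Complex.normSq_nonneg _)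
    simp only [Complex.add_re, Complex.one_re]; linarith
  have e : Complex.log (z+1) = Complex.log z + Complex.log (1 + 1/z) := by
    have e1 : z + 1 = z * (1 + 1/z) := by field_simp
    have hne : 1 + 1/z ≠ 0 := by intro h; rw [h] at hre; simp at hre
    rw [e1]
    apply (Complex.log_mul_eq_add_log_iff hz hne).mpr
    have a1 := abs_lt.mp (Complex.abs_arg_lt_pi_div_two_iff.mpr (Or.inl h0))
    have a2 := abs_lt.mp (Complex.abs_arg_lt_pi_div_two_iff.mpr (Or.inl hre))
    constructor <;> linarith [a1.1, a1.2, a2.1, a2.2]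
  have hw : ‖1/z‖ ≤ 1/2 := by
    rw [norm_div, norm_one]; exact one_div_le_one_div_of_le (by norm_num) hn
  have := Complex.norm_log_one_add_sub_self_le (z := 1/z) (by linarith)
  rw [e, add_sub_cancel_left]
  refine this.trans ?_
  have h3 : (1 - ‖1/z‖)⁻¹ ≤ 2 := by
    rw [inv_le_comm₀ (by linarith) (by norm_num)]; linarith
  have : ‖1/z‖^2 = 1 / ‖z‖^2 := by rw [norm_div, norm_one, div_pow, one_pow]
  rw [this]
  have h4 : 0 ≤ 1/‖z‖^2 := by positivity
  nlinarith

lemma digamma_log {s : ℂ} (h0 : 0 < s.re) (h2 : 2 ≤ s.im) : ‖logDeriv Complex.Gamma s - Complex.log s‖ ≤ 7 := by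
  have hlim := (digamma_lim h0).sub_const (Complex.log s)
  refine le_of_tendsto hlim.norm ?_
  filter_upwards [eventually_ge_atTop (⌈‖s+1‖⌉₊ + 1)] with n hn
  have hn1 : ‖s+1‖ ≤ n := (Nat.le_ceil _).trans (by exact_mod_cast (by omega : ⌈‖s+1‖⌉₊ ≤ n))
  have hn0 : (1:ℝ) ≤ n := by exact_mod_cast (by omega : 1 ≤ n)
  have tel : ∀ N : ℕ, Complex.log (s+N) - Complex.log s - ∑ j ∈ Finset.range N, 1/(s+j) = ∑ j ∈ Finset.range N, (Complex.log (s+j+1) - Complex.log (s+j) - 1/(s+j)) := by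
    intro N
    induction N with
    | zero => simp
    | succ N ih =>
      rw [Finset.sum_range_succ, Finset.sum_range_succ, ← ih]; push_cast
      rw [← add_assoc]; ring
  have bd : ∀ N : ℕ, ‖∑ j ∈ Finset.range N, (Complex.log (s+j+1) - Complex.log (s+j) - 1/(s+j))‖ ≤ 2 - 2/(N+1) := by
    intro N
    induction N with
    | zero => norm_num
    | succ N ih =>
      rw [Finset.sum_range_succ]
      refine (norm_add_le _ _).trans ?_
      have h3 := log_step (z := s + N) (by simp; positivity) (by simpa using h2)
      have h4 : ((N:ℝ)+1)*(N+2)/2 ≤ ‖s + N‖^2 := by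
        rw [Complex.sq_norm, Complex.normSq_apply]
        simp only [Complex.add_re, Complex.natCast_re, Complex.add_im, Complex.natCast_im, add_zero]
        have : (0:ℝ) ≤ N := by positivity
        nlinarith [sq_nonneg ((N:ℝ) - 3/2), mul_nonneg h0.le this]
      have h5 : 1/‖s+N‖^2 ≤ 2/((N+1)*(N+2)) := by
        calc _ ≤ 1/(((N:ℝ)+1)*(N+2)/2) := one_div_le_one_div_of_le (by positivity) h4
          _ = _ := by field_simp
      have h6 : 2/(((N:ℝ)+1)*(N+2)) = 2/((N:ℝ)+1) - 2/((N:ℝ)+2) := by field_simp; ring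
      push_cast
      rw [show (N:ℝ)+1+1 = N+2 by ring]
      linarith
  have t := tel (n+1)
  have b := bd (n+1)
  have l1 : ‖(Real.log n : ℂ) - Complex.log (s + ((n+1:ℕ):ℂ))‖ ≤ 5 := by
    set z := s + ((n+1:ℕ):ℂ)
    refine (Complex.norm_le_abs_re_add_abs_im _).trans ?_
    simp only [Complex.sub_re, Complex.ofReal_re, Complex.log_re, Complex.sub_im, Complex.ofReal_im, Complex.log_im, zero_sub, abs_neg]
    have a1 := Complex.abs_arg_le_pi z
    have z1 : (n:ℝ) ≤ ‖z‖ := by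
      refine le_trans ?_ (Complex.re_le_norm z)
      simp [z]; linarith
    have z2 : ‖z‖ ≤ 2 * n := by
      have : z = (s+1) + (n:ℂ) := by simp only [z]; push_cast; ring
      rw [this]
      refine (norm_add_le _ _).trans ?_
      rw [Complex.norm_natCast]; linarith
    have q1 := Real.log_le_log (by linarith) z1
    have q2 := Real.log_le_log (by linarith) z2
    rw [Real.log_mul (by norm_num) (by linarith)] at q2
    have := Real.log_two_lt_d9
    have := Real.pi_lt_d2
    have : |Real.log n - Real.log ‖z‖| ≤ 1 := by rw [abs_le]; constructor <;> linarith
    linarith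
  have e : (Real.log n : ℂ) - ∑ j ∈ Finset.range (n+1), 1/(s+j) - Complex.log s = ((Real.log n : ℂ) - Complex.log (s + ((n+1:ℕ):ℂ))) + ∑ j ∈ Finset.range (n+1), (Complex.log (s+j+1) - Complex.log (s+j) - 1/(s+j)) := by
    rw [← t]; ring
  rw [e]
  refine (norm_add_le _ _).trans ?_
  have : 0 ≤ 2/(((n+1:ℕ):ℝ)+1) := by positivity
  linarith

lemma tan_bound {w : ℂ} (h : 1 ≤ w.im) : Complex.cos w ≠ 0 ∧ ‖Complex.sin w / Complex.cos w‖ ≤ 2 := by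
  have e1 : ‖Complex.exp (w * Complex.I)‖ = Real.exp (-w.im) := by rw [Complex.norm_exp]; simp
  have e2 : ‖Complex.exp (-w * Complex.I)‖ = Real.exp (w.im) := by rw [Complex.norm_exp]; simp
  have h1 : 2 ≤ Real.exp w.im := by linarith [Real.add_one_le_exp w.im]
  have h2 : Real.exp (-w.im) ≤ 1/2 := by
    rw [Real.exp_neg, inv_le_comm₀ (by positivity) (by norm_num)]; linarith
  have c : ‖Complex.exp (-w * Complex.I)‖ - ‖Complex.exp (w * Complex.I)‖ ≤ 2 * ‖Complex.cos w‖ := by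
    have : 2 * ‖Complex.cos w‖ = ‖Complex.exp (-w * Complex.I) - (-Complex.exp (w * Complex.I))‖ := by
      rw [Complex.cos]; rw [norm_div]; simp; rw [add_comm]; ring
    rw [this]
    have := norm_sub_norm_le (Complex.exp (-w * Complex.I)) (-Complex.exp (w * Complex.I))
    rwa [norm_neg] at this
  have s : 2 * ‖Complex.sin w‖ ≤ ‖Complex.exp (-w * Complex.I)‖ + ‖Complex.exp (w * Complex.I)‖ := by
    have : 2 * ‖Complex.sin w‖ = ‖Complex.exp (-w * Complex.I) - (Complex.exp (w * Complex.I))‖ := by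
      rw [Complex.sin]; rw [norm_div, norm_mul]; simp; ring
    rw [this]; exact norm_sub_le _ _
  rw [e1, e2] at c s
  have hc : 0 < ‖Complex.cos w‖ := by linarith
  refine ⟨norm_pos_iff.mp hc, ?_⟩
  rw [norm_div, div_le_iff₀ hc]
  linarith

lemma zeta_refl {s : ℂ} (h1 : 1/2 ≤ s.re) (h2 : s.re ≤ 5/4) (h3 : 2 ≤ s.im) (h0 : riemannZeta s ≠ 0) :
    riemannZeta (1-s) ≠ 0 ∧
    ‖deriv riemannZeta (1-s) / riemannZeta (1-s) + deriv riemannZeta s / riemannZeta s + (Real.log s.im : ℂ)‖ ≤ 20 := by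
  set U : Set ℂ := {z | 0 < z.im}
  have hU : IsOpen U := isOpen_lt continuous_const Complex.continuous_im
  have hsU : s ∈ U := by show 0 < s.im; linarith
  have nn : ∀ z ∈ U, ∀ n : ℕ, z ≠ -n := by
    rintro z hz n rfl
    have : 0 < (-(n:ℂ)).im := hz
    simp at this
  have n1 : ∀ z ∈ U, z ≠ 1 := by
    rintro z hz rfl
    have : 0 < (1:ℂ).im := hz
    simp at this
  have hs1 : s ≠ 1 := n1 s hsU
  have hs1' : 1 - s ≠ 1 := by intro h; apply nn s hsU 0; simp at h; simp [h]
  obtain ⟨hc, ht⟩ := tan_bound (w := (Real.pi:ℂ) * s / 2) (by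
    have : ((Real.pi:ℂ) * s / 2).im = Real.pi * s.im / 2 := by
      rw [show ((Real.pi:ℂ) * s / 2) = ((Real.pi / 2 : ℝ) : ℂ) * s by push_cast; ring, Complex.im_ofReal_mul]; ring
    rw [this]; nlinarith [Real.pi_gt_three])
  have hG : Complex.Gamma s ≠ 0 := Complex.Gamma_ne_zero_of_re_pos (by linarith)
  have h2pi : (2 * (Real.pi:ℂ)) ≠ 0 := by simp [Real.pi_ne_zero]
  have hP : (2 * (Real.pi:ℂ)) ^ (-s) ≠ 0 := by simp [Complex.cpow_eq_zero_iff, Real.pi_ne_zero]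
  have fe := riemannZeta_one_sub (nn s hsU) hs1
  have hne : riemannZeta (1-s) ≠ 0 := by
    rw [fe]; simp only [ne_eq, mul_eq_zero, not_or]; exact ⟨⟨⟨⟨two_ne_zero, hP⟩, hG⟩, hc⟩, h0⟩
  refine ⟨hne, ?_⟩
  have d0 : HasDerivAt (fun z => riemannZeta (1-z)) (-deriv riemannZeta (1-s)) s := by
    have := (differentiableAt_riemannZeta hs1').hasDerivAt.comp s ((hasDerivAt_id s).const_sub 1)
    simpa [Function.comp_def] using this
  have d1 : HasDerivAt (fun z : ℂ => (2 * (Real.pi:ℂ)) ^ (-z)) ((2 * (Real.pi:ℂ)) ^ (-s) * Complex.log (2 * (Real.pi:ℂ)) * (-1)) s := by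
    simpa using ((hasDerivAt_id s).neg).const_cpow (c := 2 * (Real.pi:ℂ)) (Or.inl h2pi)
  have d2 : HasDerivAt Complex.Gamma (deriv Complex.Gamma s) s := (Complex.differentiableAt_Gamma _ (nn s hsU)).hasDerivAt
  have d3 : HasDerivAt (fun z : ℂ => Complex.cos (Real.pi * z / 2)) (-Complex.sin (Real.pi * s / 2) * (Real.pi / 2)) s := by
    have := ((hasDerivAt_id s).const_mul (Real.pi:ℂ)).div_const 2
    simpa using this.ccos
  have d4 := (differentiableAt_riemannZeta hs1).hasDerivAt
  have d5 := ((((d1.const_mul 2).mul d2).mul d3).mul d4)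
  have d6 := d5.congr_of_eventuallyEq (f₁ := fun z => riemannZeta (1-z)) (by
    filter_upwards [hU.mem_nhds hsU] with z hz
    simp only [Pi.mul_apply]
    rw [riemannZeta_one_sub (nn z hz) (n1 z hz)])
  have eq := d0.unique d6
  have key : deriv riemannZeta (1-s) / riemannZeta (1-s) = Complex.log (2 * (Real.pi:ℂ)) - logDeriv Complex.Gamma s + (Real.pi/2) * (Complex.sin (Real.pi * s / 2) / Complex.cos (Real.pi * s / 2)) - deriv riemannZeta s / riemannZeta s := by
    have : deriv riemannZeta (1-s) = -(-deriv riemannZeta (1-s)) := by ring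
    rw [this, eq, fe, logDeriv_apply]
    simp only [Pi.mul_apply]
    field_simp
    ring
  rw [key]
  have hlog : ‖Complex.log (2 * (Real.pi:ℂ))‖ ≤ 2 := by
    have : Complex.log (2 * (Real.pi:ℂ)) = ((Real.log (2*Real.pi) : ℝ) : ℂ) := by
      rw [Complex.ofReal_log (by positivity)]; push_cast; rfl
    rw [this, Complex.norm_real, Real.norm_of_nonneg (Real.log_nonneg (by linarith [Real.pi_gt_three]))]
    rw [Real.log_le_iff_le_exp (by positivity)]
    have := Real.exp_one_gt_d9
    have e2 : Real.exp 2 = Real.exp 1 * Real.exp 1 := by rw [← Real.exp_add]; norm_num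
    rw [e2]; nlinarith [Real.pi_lt_d2]
  have hdl := digamma_log (s := s) (by linarith) h3
  have hls : ‖Complex.log s - (Real.log s.im : ℂ)‖ ≤ 5 := by
    refine (Complex.norm_le_abs_re_add_abs_im _).trans ?_
    simp only [Complex.sub_re, Complex.ofReal_re, Complex.log_re, Complex.sub_im, Complex.ofReal_im, Complex.log_im, sub_zero]
    have a1 := Complex.abs_arg_le_pi s
    have z1 : s.im ≤ ‖s‖ := Complex.im_le_norm s
    have z2 : ‖s‖ ≤ 2 * s.im := by
      refine (Complex.norm_le_abs_re_add_abs_im _).trans ?_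
      rw [abs_of_nonneg (by linarith), abs_of_nonneg (by linarith)]; linarith
    have q1 := Real.log_le_log (by linarith) z1
    have q2 := Real.log_le_log (by linarith) z2
    rw [Real.log_mul (by norm_num) (by linarith)] at q2
    have := Real.log_two_lt_d9
    have := Real.pi_lt_d2
    have : |Real.log ‖s‖ - Real.log s.im| ≤ 1 := by rw [abs_le]; constructor <;> linarith
    linarith
  have ht2 : ‖((Real.pi/2 : ℂ)) * (Complex.sin (Real.pi * s / 2) / Complex.cos (Real.pi * s / 2))‖ ≤ 4 := by
    rw [norm_mul]
    have : ‖(Real.pi/2 : ℂ)‖ ≤ 2 := by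
      rw [norm_div, Complex.norm_real, Real.norm_of_nonneg Real.pi_pos.le]; norm_num; linarith [Real.pi_lt_d2]
    nlinarith [norm_nonneg (Real.pi/2 : ℂ), norm_nonneg (Complex.sin (Real.pi * s / 2) / Complex.cos (Real.pi * s / 2))]
  have e : ∀ a b c d L l : ℂ, a - b + c - d + d + L = a + c - (b - l) - (l - L) := by intros; ring
  rw [e _ _ _ _ _ (Complex.log s)]
  have n1 := norm_sub_le (Complex.log (2 * (Real.pi:ℂ)) + (Real.pi/2) * (Complex.sin (Real.pi * s / 2) / Complex.cos (Real.pi * s / 2)) - (logDeriv Complex.Gamma s - Complex.log s)) (Complex.log s - (Real.log s.im : ℂ))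
  have n2 := norm_sub_le (Complex.log (2 * (Real.pi:ℂ)) + (Real.pi/2) * (Complex.sin (Real.pi * s / 2) / Complex.cos (Real.pi * s / 2))) (logDeriv Complex.Gamma s - Complex.log s)
  have n3 := norm_add_le (Complex.log (2 * (Real.pi:ℂ))) ((Real.pi/2) * (Complex.sin (Real.pi * s / 2) / Complex.cos (Real.pi * s / 2)))
  linarith


lemma landau_choice : ∃ C : ℝ, ∃ Z : ℝ → Finset ℂ, ∃ G : ℝ → ℂ → ℂ, 1 ≤ C ∧ ∀ T : ℝ, 3 ≤ T →
    (∀ ρ, ρ ∈ Z T ↔ ‖ρ - (2 + T * Complex.I)‖ ≤ 7/4 ∧ riemannZeta ρ = 0) ∧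
    ∑ ρ ∈ Z T, (zetaMult ρ : ℝ) ≤ C * Real.log T ∧
    DifferentiableOn ℂ (G T) (Metric.ball (2 + T * Complex.I) (7/4)) ∧
    (∀ z ∈ Metric.closedBall (2 + T * Complex.I) (13/8), ‖G T z‖ ≤ C * Real.log T) ∧
    (∀ z ∈ Metric.ball (2 + T * Complex.I) (7/4), riemannZeta z ≠ 0 →
      deriv riemannZeta z / riemannZeta z = ∑ ρ ∈ Z T, (zetaMult ρ : ℂ) / (z - ρ) + G T z) := by
  obtain ⟨C, hC, h⟩ := landau
  choose! Z G h using h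
  refine ⟨C + 1, Z, G, by linarith, fun T hT => ?_⟩
  obtain ⟨a, b, c, d, e⟩ := h T hT
  have hl : 0 ≤ Real.log T := Real.log_nonneg (by linarith)
  exact ⟨a, by nlinarith, c, fun z hz => (d z hz).trans (by nlinarith), e⟩

noncomputable def CL : ℝ := landau_choice.choose
noncomputable def ZL : ℝ → Finset ℂ := landau_choice.choose_spec.choose
noncomputable def GZ : ℝ → ℂ → ℂ := landau_choice.choose_spec.choose_spec.choose
lemma CL_one : 1 ≤ CL := landau_choice.choose_spec.choose_spec.choose_spec.1
lemma ZL_mem {T : ℝ} (hT : 3 ≤ T) {ρ : ℂ} : ρ ∈ ZL T ↔ ‖ρ - (2 + T * Complex.I)‖ ≤ 7/4 ∧ riemannZeta ρ = 0 := (landau_choice.choose_spec.choose_spec.choose_spec.2 _ hT).1 ρ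
lemma ZL_sum {T : ℝ} (hT : 3 ≤ T) : ∑ ρ ∈ ZL T, (zetaMult ρ : ℝ) ≤ CL * Real.log T := (landau_choice.choose_spec.choose_spec.choose_spec.2 _ hT).2.1
lemma GZ_diff {T : ℝ} (hT : 3 ≤ T) : DifferentiableOn ℂ (GZ T) (Metric.ball (2 + T * Complex.I) (7/4)) := (landau_choice.choose_spec.choose_spec.choose_spec.2 _ hT).2.2.1
lemma GZ_bd {T : ℝ} (hT : 3 ≤ T) {z : ℂ} (hz : z ∈ Metric.closedBall (2 + T * Complex.I) (13/8)) : ‖GZ T z‖ ≤ CL * Real.log T := (landau_choice.choose_spec.choose_spec.choose_spec.2 _ hT).2.2.2.1 z hz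
lemma ZL_log {T : ℝ} (hT : 3 ≤ T) {z : ℂ} (hz : z ∈ Metric.ball (2 + T * Complex.I) (7/4)) (h0 : riemannZeta z ≠ 0) :
    deriv riemannZeta z / riemannZeta z = ∑ ρ ∈ ZL T, (zetaMult ρ : ℂ) / (z - ρ) + GZ T z := (landau_choice.choose_spec.choose_spec.choose_spec.2 _ hT).2.2.2.2 z hz h0

lemma norm_lt_of_sq {z : ℂ} {r : ℝ} (hr : 0 ≤ r) (h : z.re^2 + z.im^2 < r^2) : ‖z‖ < r := by
  apply lt_of_pow_lt_pow_left₀ 2 hr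
  rw [Complex.sq_norm, Complex.normSq_apply]; linarith
lemma norm_le_of_sq {z : ℂ} {r : ℝ} (hr : 0 ≤ r) (h : z.re^2 + z.im^2 ≤ r^2) : ‖z‖ ≤ r := by
  apply le_of_sq_le_sq _ hr
  rw [Complex.sq_norm, Complex.normSq_apply]; linarith

lemma log_ge_one {T : ℝ} (hT : 3 ≤ T) : 1 ≤ Real.log T := by
  rw [Real.le_log_iff_exp_le (by linarith)]
  linarith [Real.exp_one_lt_d9]

lemma ZL_re {T : ℝ} (hT : 3 ≤ T) {ρ : ℂ} (h : ρ ∈ ZL T) : ρ.re < 1 ∧ 1/4 ≤ ρ.re ∧ |ρ.im - T| ≤ 7/4 := by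
  obtain ⟨h1, h2⟩ := (ZL_mem hT).mp h
  refine ⟨?_, ?_, ?_⟩
  · by_contra h3
    exact riemannZeta_ne_zero_of_one_le_re (not_lt.mp h3) h2
  · have := (Complex.abs_re_le_norm (ρ - (2 + T * Complex.I))).trans h1
    simp at this
    linarith [(abs_le.mp this).1]
  · have := (Complex.abs_im_le_norm (ρ - (2 + T * Complex.I))).trans h1
    simpa using this

lemma z1_ne {s : ℂ} (h : 1 ≤ s.re) : riemannZeta₁ s ≠ 0 := by
  by_cases h1 : s = 1
  · rw [h1]; simp
  · intro h0
    apply riemannZeta_ne_zero_of_one_le_re h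
    rw [riemannZeta_eq_inv_sub_mul h1, h0, mul_zero]

lemma z_logderiv {s : ℂ} (h1 : s ≠ 1) (h0 : riemannZeta s ≠ 0) :
    deriv riemannZeta s / riemannZeta s = -1/(s-1) + deriv riemannZeta₁ s / riemannZeta₁ s := by
  have hs : s - 1 ≠ 0 := sub_ne_zero.mpr h1
  have e := riemannZeta_eq_inv_sub_mul h1
  have hz : riemannZeta₁ s ≠ 0 := by intro h; rw [e, h, mul_zero] at h0; exact h0 rfl
  have d1 : HasDerivAt (fun s => (s-1)⁻¹ * riemannZeta₁ s) (-1/(s-1)^2 * riemannZeta₁ s + (s-1)⁻¹ * deriv riemannZeta₁ s) s := by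
    have := ((hasDerivAt_id s).sub_const 1).inv hs
    exact this.mul (differentiable_riemannZeta₁ s).hasDerivAt
  have d2 := d1.congr_of_eventuallyEq (f₁ := riemannZeta) (by
    filter_upwards [isOpen_ne.mem_nhds h1] with z hz
    exact riemannZeta_eq_inv_sub_mul hz)
  rw [d2.deriv, e]
  field_simp

lemma mang_sum {s : ℂ} (hs : 1 < s.re) :
    HasSum (fun n : ℕ => (ArithmeticFunction.vonMangoldt n : ℂ) * (n:ℂ)^(-s)) (-(deriv riemannZeta s / riemannZeta s)) := by
  have h := (ArithmeticFunction.LSeriesSummable_vonMangoldt hs).LSeriesHasSum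
  rw [ArithmeticFunction.LSeries_vonMangoldt_eq_deriv_riemannZeta_div hs] at h
  unfold LSeriesHasSum at h
  rw [neg_div] at h
  convert h using 1
  funext n
  rw [LSeries.term_def]
  split_ifs with h0
  · simp [h0]
  · rw [Complex.cpow_neg]; rfl

noncomputable def SL (σ : ℝ) : ℝ := ∑' n : ℕ, ArithmeticFunction.vonMangoldt n * (n:ℝ)^(-σ)

lemma SL_sum {σ : ℝ} (hs : 1 < σ) : HasSum (fun n : ℕ => ArithmeticFunction.vonMangoldt n * (n:ℝ)^(-σ)) (SL σ) ∧ ((SL σ : ℝ) : ℂ) = -(deriv riemannZeta σ / riemannZeta σ) := by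
  have h := mang_sum (s := (σ:ℂ)) (by simpa using hs)
  have e : (fun n : ℕ => (ArithmeticFunction.vonMangoldt n : ℂ) * (n:ℂ)^(-(σ:ℂ))) = fun n => ((ArithmeticFunction.vonMangoldt n * (n:ℝ)^(-σ) : ℝ) : ℂ) := by
    funext n
    rw [Complex.ofReal_mul, Complex.ofReal_cpow (by positivity)]; push_cast; rfl
  rw [e] at h
  have h2 : Summable (fun n : ℕ => ArithmeticFunction.vonMangoldt n * (n:ℝ)^(-σ)) := by
    exact_mod_cast Complex.summable_ofReal.mp h.summable
  refine ⟨h2.hasSum, ?_⟩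
  exact (Complex.hasSum_ofReal.mpr h2.hasSum).unique h

lemma vM_norm {s : ℂ} (hs : s.re ≠ 0) (n : ℕ) : ‖(ArithmeticFunction.vonMangoldt n : ℂ) * (n:ℂ)^(-s)‖ = ArithmeticFunction.vonMangoldt n * (n:ℝ)^(-s.re) := by
  rw [norm_mul, Complex.norm_real, Real.norm_of_nonneg ArithmeticFunction.vonMangoldt_nonneg,
    Complex.norm_natCast_cpow_of_re_ne_zero _ (by simpa using hs)]
  simp

lemma zlog_le_SL {s : ℂ} (hs : 1 < s.re) : ‖deriv riemannZeta s / riemannZeta s‖ ≤ SL s.re := by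
  rw [← norm_neg]
  have h1 := (SL_sum hs).1
  refine (mang_sum hs).norm_le_of_bounded h1 (fun n => ?_)
  rw [vM_norm (by linarith)]

lemma SL_le : ∃ C : ℝ, 1 ≤ C ∧ ∀ r, 0 < r → r ≤ 1 → SL (1+r) ≤ 1/r + C := by
  have hc : ContinuousOn (fun r : ℝ => ‖deriv riemannZeta₁ (1+r) / riemannZeta₁ (1+r)‖) (Icc (0:ℝ) 1) := by
    apply ContinuousOn.norm
    apply ContinuousOn.div
    · have : Continuous (deriv riemannZeta₁) := (differentiable_riemannZeta₁.contDiff (n := 1)).continuous_deriv le_rfl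
      exact (this.comp (by fun_prop)).continuousOn
    · exact (differentiable_riemannZeta₁.continuous.comp (by fun_prop)).continuousOn
    · intro r hr; exact z1_ne (by simpa using hr.1)
  obtain ⟨C, hC⟩ := (isCompact_Icc.image_of_continuousOn hc).bddAbove
  refine ⟨max C 1, le_max_right _ _, fun r h0 h1 => ?_⟩
  have e := (SL_sum (σ := 1 + r) (by linarith)).2
  have hne : (((1+r:ℝ)):ℂ) ≠ 1 := by
    intro h; have := congrArg Complex.re h; simp at this; linarith
  rw [z_logderiv hne (riemannZeta_ne_zero_of_one_le_re (by simp; linarith))] at e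
  have hb := hC (mem_image_of_mem _ (⟨h0.le, h1⟩ : r ∈ Icc (0:ℝ) 1))
  have e2 : ((SL (1+r) - 1/r : ℝ) : ℂ) = -(deriv riemannZeta₁ (1+r) / riemannZeta₁ (1+r)) := by
    push_cast
    rw [e]; push_cast
    rw [add_sub_cancel_left]
    ring
  have e3 : SL (1+r) - 1/r ≤ ‖((SL (1+r) - 1/r : ℝ) : ℂ)‖ := by rw [Complex.norm_real]; exact le_abs_self _
  rw [e2, norm_neg] at e3
  linarith [le_max_left C 1]

/-- real part of the zero sum -/
lemma re_term (ρ z : ℂ) : ((zetaMult ρ : ℂ) / (z - ρ)).re = zetaMult ρ * ((z.re - ρ.re) / ((z.re - ρ.re)^2 + (z.im - ρ.im)^2)) := by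
  rw [div_eq_mul_inv, ← Complex.ofReal_natCast, Complex.re_ofReal_mul, Complex.inv_re, Complex.normSq_apply]
  simp only [Complex.sub_re, Complex.sub_im]
  ring_nf

lemma star : ∃ C : ℝ, 1 ≤ C ∧ ∀ T, 3 ≤ T → ∀ r, 0 < r → r ≤ 1 →
    ∑ ρ ∈ ZL T, zetaMult ρ * ((1 + r - ρ.re) / ((1 + r - ρ.re)^2 + (T - ρ.im)^2)) ≤ 1/r + C * Real.log T := by
  obtain ⟨C, hC, h⟩ := SL_le
  refine ⟨C + CL, by linarith [CL_one], fun T hT r h0 h1 => ?_⟩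
  set z : ℂ := ((1 + r : ℝ) : ℂ) + T * Complex.I
  have zr : z.re = 1 + r := by simp [z]
  have zi : z.im = T := by simp [z]
  have hzd : z - (2 + T * Complex.I) = ((r - 1 : ℝ) : ℂ) := by simp only [z]; push_cast; ring
  have hn : ‖z - (2 + T * Complex.I)‖ ≤ 1 := by
    rw [hzd, Complex.norm_real, Real.norm_eq_abs, abs_le]; constructor <;> linarith
  have hb : z ∈ Metric.ball (2 + T * Complex.I) (7/4) := by
    rw [mem_ball_iff_norm]; linarith
  have hb2 : z ∈ Metric.closedBall (2 + T * Complex.I) (13/8) := by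
    rw [mem_closedBall_iff_norm]; linarith
  have h3 := ZL_log hT hb (riemannZeta_ne_zero_of_one_le_re (by rw [zr]; linarith))
  have h4 := congrArg Complex.re h3
  rw [Complex.add_re, Complex.re_sum] at h4
  simp only [re_term, zr, zi] at h4
  have h5 := zlog_le_SL (s := z) (by rw [zr]; linarith)
  have h6 := Complex.re_le_norm (deriv riemannZeta z / riemannZeta z)
  have h7 := GZ_bd hT hb2
  have h8 := (Complex.abs_re_le_norm (GZ T z)).trans h7
  have h9 := (abs_le.mp h8).1
  have h10 := h r h0 h1
  rw [zr] at h5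
  have := log_ge_one hT
  nlinarith

lemma sumdq : ∃ C : ℝ, 1 ≤ C ∧ ∀ T, 3 ≤ T →
    ∑ ρ ∈ ZL T, zetaMult ρ / (|ρ.im - T| + (1 + 1/Real.log T - ρ.re)) ≤ C * Real.log T ^ (5/4 : ℝ) := by
  obtain ⟨C, hC, hstar⟩ := star
  refine ⟨CL + 10 * (2 + 9 * C), by linarith [CL_one], fun T hT => ?_⟩
  have hL := log_ge_one hT
  set L := Real.log T with hLdef
  set J := ⌊Real.logb 2 L⌋₊ with hJ
  have hJ1 : ∀ j ∈ Finset.range (J+1), (2:ℝ)^j ≤ L := by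
    intro j hj
    have : (j:ℝ) ≤ Real.logb 2 L := by
      have h1 : j ≤ J := by simpa [Nat.lt_succ_iff] using hj
      have h2 : (J:ℝ) ≤ Real.logb 2 L := Nat.floor_le (Real.logb_nonneg (by norm_num) hL)
      have h3 : (j:ℝ) ≤ J := by exact_mod_cast h1
      linarith
    rw [Real.le_logb_iff_rpow_le (by norm_num) (by linarith)] at this
    exact_mod_cast this
  -- pointwise
  have pt : ∀ ρ ∈ ZL T, zetaMult ρ / (|ρ.im - T| + (1 + 1/L - ρ.re)) ≤ zetaMult ρ + 10 * ∑ j ∈ Finset.range (J+1), zetaMult ρ * ((1 + 2^j/L - ρ.re) / ((1 + 2^j/L - ρ.re)^2 + (T - ρ.im)^2)) := by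
    intro ρ hρ
    obtain ⟨hr1, -, -⟩ := ZL_re hT hρ
    set δ := |ρ.im - T| with hδ
    have hδ2 : (T - ρ.im)^2 = δ^2 := by rw [hδ, sq_abs]; ring
    have hδ0 : 0 ≤ δ := abs_nonneg _
    have hη : 0 < 1/L := by positivity
    have hm : (0:ℝ) ≤ zetaMult ρ := by positivity
    have tn : ∀ j ∈ Finset.range (J+1), (0:ℝ) ≤ zetaMult ρ * ((1 + 2^j/L - ρ.re) / ((1 + 2^j/L - ρ.re)^2 + (T - ρ.im)^2)) := by
      intro j _
      have : 0 < (2:ℝ)^j/L := by positivity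
      have : 0 < 1 + 2^j/L - ρ.re := by linarith
      positivity
    have sn := Finset.sum_nonneg tn
    have hden : 0 < δ + (1 + 1/L - ρ.re) := by linarith
    set M := max δ (1 + 1/L - ρ.re) with hM
    have hMδ : δ ≤ M := le_max_left _ _
    have hMq : 1 + 1/L - ρ.re ≤ M := le_max_right _ _
    have hMs : M ≤ δ + (1 + 1/L - ρ.re) := max_le (by linarith) (by linarith)
    rcases le_or_gt M 1 with hM1 | hM1
    · have hML : 1 ≤ M * L := by
        have : 1/L ≤ M := by linarith
        rwa [div_le_iff₀ (by linarith)] at this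
      obtain ⟨j, hj1, hj2⟩ := exists_nat_pow_near hML (show (1:ℝ) < 2 by norm_num)
      have hjJ : j ∈ Finset.range (J+1) := by
        rw [Finset.mem_range, Nat.lt_succ_iff, hJ]
        apply Nat.le_floor
        rw [Real.le_logb_iff_rpow_le (by norm_num) (by linarith)]
        rw [Real.rpow_natCast]; nlinarith
      set r := (2:ℝ)^j/L with hr
      have hr0 : 0 < r := by positivity
      have hrM : r ≤ M := by rw [hr, div_le_iff₀ (by linarith)]; exact hj1
      have hrM2 : M ≤ 2*r := by
        rw [hr]; rw [pow_succ] at hj2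
        rw [show 2 * ((2:ℝ)^j/L) = (2^j*2)/L by ring, le_div_iff₀ (by linarith)]; exact hj2.le
      have hMp : 0 < M := by linarith
      have h1 : 1/(10 * M) ≤ (1 + r - ρ.re) / ((1 + r - ρ.re)^2 + (T - ρ.im)^2) := by
        rw [hδ2, div_le_div_iff₀ (by positivity) (by nlinarith)]
        have b1 : M/2 ≤ 1 + r - ρ.re := by linarith
        have b2 : 1 + r - ρ.re ≤ 2*M := by linarith
        nlinarith
      have h2 := Finset.single_le_sum tn hjJ
      have h3 : zetaMult ρ / (δ + (1 + 1/L - ρ.re)) ≤ zetaMult ρ * (10 * (1/(10*M))) := by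
        rw [div_eq_mul_one_div]
        apply mul_le_mul_of_nonneg_left _ hm
        rw [show 10 * (1/(10*M)) = 1/M by field_simp]
        exact one_div_le_one_div_of_le hMp hMs
      have h4 : zetaMult ρ * (10 * (1/(10*M))) ≤ 10 * (zetaMult ρ * ((1 + r - ρ.re) / ((1 + r - ρ.re)^2 + (T - ρ.im)^2))) := by
        have := mul_le_mul_of_nonneg_left h1 hm
        linarith
      linarith
    · have : zetaMult ρ / (δ + (1 + 1/L - ρ.re)) ≤ zetaMult ρ := by
        apply div_le_self hm; linarith
      linarith
  refine (Finset.sum_le_sum pt).trans ?_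
  rw [Finset.sum_add_distrib, ← Finset.mul_sum, Finset.sum_comm]
  have h1 := ZL_sum hT
  have h2 : ∑ j ∈ Finset.range (J+1), ∑ ρ ∈ ZL T, (zetaMult ρ:ℝ) * ((1 + 2^j/L - ρ.re) / ((1 + 2^j/L - ρ.re)^2 + (T - ρ.im)^2)) ≤ ∑ j ∈ Finset.range (J+1), (L * (1/2)^j + C * L) := by
    apply Finset.sum_le_sum
    intro j hj
    have := hstar T hT (2^j/L) (by positivity) (by rw [div_le_one (by linarith)]; exact hJ1 j hj)
    refine this.trans (le_of_eq ?_)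
    rw [one_div_div, one_div, inv_pow]; ring
  rw [Finset.sum_add_distrib, ← Finset.mul_sum, Finset.sum_const, Finset.card_range, nsmul_eq_mul] at h2
  have h3 : ∑ j ∈ Finset.range (J+1), (1/2:ℝ)^j ≤ 2 := by
    rw [geom_sum_eq (by norm_num)]
    have : (0:ℝ) ≤ (1/2)^(J+1) := by positivity
    have e : ((1/2:ℝ)^(J+1)-1)/(1/2-1) = 2 - 2*(1/2)^(J+1) := by ring
    rw [e]; linarith
  have hq : 1 ≤ L ^ (1/4:ℝ) := Real.one_le_rpow hL (by norm_num)
  have h4 : ((J+1:ℕ):ℝ) ≤ 9 * L^(1/4:ℝ) := by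
    have a1 : (J:ℝ) ≤ Real.logb 2 L := Nat.floor_le (Real.logb_nonneg (by norm_num) hL)
    have a2 := Real.log_le_rpow_div (x := L) (by linarith) (show (0:ℝ) < 1/4 by norm_num)
    have a3 := Real.log_two_gt_d9
    rw [Real.logb, le_div_iff₀ (by linarith)] at a1
    push_cast
    have : (0:ℝ) ≤ J := by positivity
    nlinarith
  have h5 : L ^ (5/4:ℝ) = L * L^(1/4:ℝ) := by
    rw [show (5/4:ℝ) = 1 + 1/4 by norm_num, Real.rpow_add (by linarith), Real.rpow_one]
  rw [h5]
  have h6 : L ≤ L * L^(1/4:ℝ) := by nlinarith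
  have h7 : ((J+1:ℕ):ℝ) * (C*L) ≤ 9 * L^(1/4:ℝ) * (C * L) := by gcongr
  have h8 : L * ∑ j ∈ Finset.range (J+1), (1/2:ℝ)^j ≤ 2 * L := by nlinarith
  have h9 : CL * L ≤ CL * (L * L^(1/4:ℝ)) := mul_le_mul_of_nonneg_left h6 (by linarith [CL_one])
  nlinarith


noncomputable def Jh (u : ℝ) : ℝ := u ^ (-1/2 : ℝ) + (-u) ^ (-1/2 : ℝ)

lemma neg_rpow_half {u : ℝ} (h : u < 0) : u ^ (-1/2 : ℝ) = 0 := by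
  rw [Real.rpow_def_of_neg h, show (-1/2 : ℝ) * Real.pi = -(Real.pi/2) by ring, Real.cos_neg, Real.cos_pi_div_two, mul_zero]

lemma Jh_eq {u : ℝ} (h : u ≠ 0) : Jh u = |u| ^ (-1/2 : ℝ) := by
  unfold Jh
  rcases lt_or_gt_of_ne h with h | h
  · rw [neg_rpow_half h, zero_add, abs_of_neg h]
  · rw [neg_rpow_half (neg_lt_zero.mpr h), add_zero, abs_of_pos h]

lemma Jh_neg (u : ℝ) : Jh (-u) = Jh u := by unfold Jh; rw [neg_neg, add_comm]

lemma Jh_nonneg (u : ℝ) : 0 ≤ Jh u := by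
  by_cases h : u = 0
  · rw [h]; simp [Jh]
  · rw [Jh_eq h]; positivity

lemma rpow_half_sqrt (u : ℝ) : u ^ (1/2:ℝ) = √u := (Real.sqrt_eq_rpow u).symm

lemma Jh_II (a b : ℝ) : IntervalIntegrable Jh volume a b := by
  unfold Jh
  apply IntervalIntegrable.add
  · exact intervalIntegral.intervalIntegrable_rpow' (by norm_num)
  · have := (intervalIntegral.intervalIntegrable_rpow' (a := -a) (b := -b) (r := -1/2) (by norm_num)).comp_mul_left (c := -1)
    simpa using this

lemma Jh_int {a b : ℝ} (hab : a ≤ b) : ∫ v in a..b, Jh v ≤ 4 * √(b-a) := by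
  unfold Jh
  have h2 : IntervalIntegrable (fun u : ℝ => (-u)^(-1/2:ℝ)) volume a b := by
    have := (intervalIntegral.intervalIntegrable_rpow' (a := -a) (b := -b) (r := -1/2) (by norm_num)).comp_mul_left (c := -1)
    simpa using this
  rw [intervalIntegral.integral_add (intervalIntegral.intervalIntegrable_rpow' (by norm_num)) h2,
    intervalIntegral.integral_comp_neg (fun u : ℝ => u^(-1/2:ℝ)), integral_rpow (Or.inl (by norm_num)), integral_rpow (Or.inl (by norm_num)),
    show (-1/2+1:ℝ) = 1/2 by norm_num]
  simp only [rpow_half_sqrt]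
  have p : ∀ x y : ℝ, x ≤ y → √y - √x ≤ √(y-x) := by
    intro x y hxy
    rcases le_total x 0 with h | h
    · rw [Real.sqrt_eq_zero'.mpr h, sub_zero]; exact Real.sqrt_le_sqrt (by linarith)
    · rw [sub_le_iff_le_add]
      calc √y = √((y-x)+x) := by ring_nf
        _ ≤ _ := by
          rw [Real.sqrt_le_left (by positivity)]
          have := Real.sq_sqrt (show 0 ≤ y - x by linarith)
          have := Real.sq_sqrt h
          nlinarith [mul_nonneg (Real.sqrt_nonneg (y-x)) (Real.sqrt_nonneg x)]
  have p1 := p a b hab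
  have p2 := p (-b) (-a) (by linarith)
  rw [show -a - -b = b - a by ring] at p2
  linarith

lemma Jh_II' (q a b : ℝ) : IntervalIntegrable (fun v => Jh (v - q)) volume a b := by
  have := (Jh_II (a-q) (b-q)).comp_sub_right q
  simpa using this

lemma Jh_int' (q : ℝ) {a b : ℝ} (hab : a ≤ b) : ∫ v in a..b, Jh (v-q) ≤ 4 * √(b-a) := by
  rw [intervalIntegral.integral_comp_sub_right]
  refine (Jh_int (by linarith)).trans (le_of_eq (by ring_nf))

lemma exp_int (b c : ℝ) (hc : 0 < c) (a : ℝ) : ∫ σ in a..b, Real.exp (-(b-σ)*c) ≤ 1/c := by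
  have d : ∀ σ ∈ uIcc a b, HasDerivAt (fun σ => Real.exp (-(b-σ)*c)/c) (Real.exp (-(b-σ)*c)) σ := by
    intro σ _
    have h1 : HasDerivAt (fun σ : ℝ => -(b-σ)*c) c σ := by
      have := (((hasDerivAt_id σ).const_sub b).neg).mul_const c
      simpa using this
    have := h1.exp.div_const c
    simpa [hc.ne'] using this
  rw [intervalIntegral.integral_eq_sub_of_hasDerivAt d (Continuous.intervalIntegrable (by fun_prop) _ _)]
  have : 0 ≤ Real.exp (-(b-a)*c)/c := by positivity
  simp only [sub_self, neg_zero, zero_mul, Real.exp_zero]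
  linarith

lemma Eint {L : ℝ} (hL : 2 ≤ L) (β : ℝ) :
    IntervalIntegrable (fun σ => Real.exp (-(1+1/L-σ)*(L/2)) * ((1+2/L-σ) * Jh (σ-β))) volume (1/2) (1+1/L) ∧
    ∫ σ in (1/2)..(1+1/L), Real.exp (-(1+1/L-σ)*(L/2)) * ((1+2/L-σ) * Jh (σ-β)) ≤ 48 * L^(-3/2:ℝ) := by
  have hη : 0 < 1/L := by positivity
  have i1 : IntervalIntegrable (fun σ => Real.exp (-(1+1/L-σ)*(L/2)) * ((1+2/L-σ) * Jh (σ-β))) volume (1/2) (1+1/L) := by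
    apply IntervalIntegrable.continuousOn_mul _ (by fun_prop)
    exact (Jh_II' β _ _).continuousOn_mul (by fun_prop)
  refine ⟨i1, ?_⟩
  set K : ℝ → ℝ := indicator (Ioc (β-1/L) (β+1/L)) (fun σ => Jh (σ-β))
  have hK0 : ∀ σ, 0 ≤ K σ := fun σ => indicator_nonneg (fun σ _ => Jh_nonneg _) σ
  have hKi : Integrable K := by
    rw [integrable_indicator_iff measurableSet_Ioc, ← intervalIntegrable_iff_integrableOn_Ioc_of_le (by linarith)]
    exact Jh_II' _ _ _
  have hK : ∫ σ in (1/2)..(1+1/L), K σ ≤ 4 * √(2/L) := by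
    rw [intervalIntegral.integral_of_le (by linarith)]
    refine (setIntegral_le_integral hKi (Eventually.of_forall hK0)).trans ?_
    rw [integral_indicator measurableSet_Ioc, ← intervalIntegral.integral_of_le (by linarith)]
    refine (Jh_int' β (by linarith)).trans (le_of_eq ?_)
    congr 2; ring
  have hbd : ∀ σ ∈ Icc (1/2) (1+1/L), σ ≠ β - 1/L → Real.exp (-(1+1/L-σ)*(L/2)) * ((1+2/L-σ) * Jh (σ-β)) ≤ (4/L) * (K σ + √L * Real.exp (-(1+1/L-σ)*(L/4))) := by
    intro σ hσ hne
    have e1 : Real.exp (-(1+1/L-σ)*(L/2)) = Real.exp (-(1+1/L-σ)*(L/4)) * Real.exp (-(1+1/L-σ)*(L/4)) := by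
      rw [← Real.exp_add]; ring_nf
    have e2 : Real.exp (-(1+1/L-σ)*(L/4)) * (1+2/L-σ) ≤ 4/L := by
      have := Real.add_one_le_exp ((1+1/L-σ)*(L/4))
      rw [neg_mul, Real.exp_neg, inv_mul_le_iff₀ (Real.exp_pos _)]
      have h3 : 1 + 2/L - σ ≤ ((1+1/L-σ)*(L/4) + 1) * (4/L) := by
        have : ((1+1/L-σ)*(L/4) + 1) * (4/L) = (1+1/L-σ) + 4/L := by field_simp
        rw [this]
        have : 2/L ≤ 4/L := by gcongr; norm_num
        linarith
      refine h3.trans (by gcongr)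
    have e3 : Real.exp (-(1+1/L-σ)*(L/4)) * Jh (σ-β) ≤ K σ + √L * Real.exp (-(1+1/L-σ)*(L/4)) := by
      have hE : 0 < Real.exp (-(1+1/L-σ)*(L/4)) := Real.exp_pos _
      have hE1 : Real.exp (-(1+1/L-σ)*(L/4)) ≤ 1 := by
        rw [Real.exp_le_one_iff]; nlinarith [hσ.2]
      by_cases hm : σ ∈ Ioc (β-1/L) (β+1/L)
      · have : K σ = Jh (σ-β) := indicator_of_mem hm _
        rw [this]
        have h1 := Jh_nonneg (σ-β)
        have : 0 ≤ √L * Real.exp (-(1+1/L-σ)*(L/4)) := by positivity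
        nlinarith
      · have hK' : K σ = 0 := indicator_of_notMem hm _
        rw [hK', zero_add, mul_comm]
        gcongr
        have hab : 1/L ≤ |σ-β| := by
          simp only [mem_Ioc, not_and_or, not_lt, not_le] at hm
          rcases hm with h | h
          · rw [abs_of_nonpos (by linarith)]; linarith
          · rw [abs_of_nonneg (by linarith)]; linarith
        have hne0 : σ - β ≠ 0 := by intro h; rw [h, abs_zero] at hab; linarith
        rw [Jh_eq hne0]
        calc |σ-β|^(-1/2:ℝ) ≤ (1/L)^(-1/2:ℝ) := Real.rpow_le_rpow_of_nonpos hη hab (by norm_num)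
          _ = √L := by rw [one_div, Real.inv_rpow (by linarith), ← Real.rpow_neg (by linarith), Real.sqrt_eq_rpow]; norm_num
    have hJ := Jh_nonneg (σ-β)
    have hE : 0 < Real.exp (-(1+1/L-σ)*(L/4)) := Real.exp_pos _
    calc _ = (Real.exp (-(1+1/L-σ)*(L/4)) * (1+2/L-σ)) * (Real.exp (-(1+1/L-σ)*(L/4)) * Jh (σ-β)) := by rw [e1]; ring
      _ ≤ (4/L) * (Real.exp (-(1+1/L-σ)*(L/4)) * Jh (σ-β)) := by gcongr
      _ ≤ _ := by gcongr
  have i2 : IntervalIntegrable (fun σ => (4/L) * (K σ + √L * Real.exp (-(1+1/L-σ)*(L/4)))) volume (1/2) (1+1/L) := by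
    apply IntervalIntegrable.const_mul
    apply hKi.intervalIntegrable.add
    exact Continuous.intervalIntegrable (by fun_prop) _ _
  have h1 := intervalIntegral.integral_mono_ae_restrict (by linarith) i1 i2 (by
    have : ∀ᵐ σ ∂(volume.restrict (Icc (1/2) (1+1/L))), σ ≠ β - 1/L :=
      ae_restrict_of_ae (measure_eq_zero_iff_ae_notMem.mp (Real.volume_singleton (a := β - 1/L)) )
    filter_upwards [ae_restrict_mem measurableSet_Icc, this] with σ h1 h2 using hbd σ h1 h2)
  refine h1.trans ?_
  rw [intervalIntegral.integral_const_mul, intervalIntegral.integral_add hKi.intervalIntegrable (Continuous.intervalIntegrable (by fun_prop) _ _), intervalIntegral.integral_const_mul]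
  have h2 := exp_int (1+1/L) (L/4) (by linarith) (1/2)
  have hs : L^(-3/2:ℝ) = (1/L) * (1/√L) := by
    rw [show (-3/2:ℝ) = -1 + -(1/2) by norm_num, Real.rpow_add (by linarith), Real.rpow_neg_one, Real.rpow_neg (by linarith), ← Real.sqrt_eq_rpow, one_div, one_div]
  have hsq : √L * √L = L := Real.mul_self_sqrt (by linarith)
  have hsp : 0 < √L := Real.sqrt_pos.mpr (by linarith)
  have h3 : √(2/L) ≤ 2 * (1/√L) := by
    rw [Real.sqrt_div (by norm_num)]
    have : √2 ≤ 2 := by rw [Real.sqrt_le_left (by norm_num)]; norm_num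
    rw [mul_one_div]; gcongr
  have h4 : √L * (1/(L/4)) = 4 * (1/√L) := by
    field_simp; nlinarith
  have h5 : √L * (∫ σ in (1/2)..(1+1/L), Real.exp (-(1+1/L-σ)*(L/4))) ≤ 4 * (1/√L) := by
    rw [← h4]; gcongr
  rw [hs]
  calc _ ≤ 4/L * (4 * (2 * (1/√L)) + 4 * (1/√L)) := by gcongr; linarith
    _ = 48 * (1/L * (1/√L)) := by ring

lemma pt_bound {T U σ : ℝ} (hT : 8 ≤ T) (hU : U ∈ Icc T (T + 1/Real.log T)) (hσ : σ ∈ Icc (1/2) (1+1/Real.log T))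
    (h2 : 2 ≤ Real.log T) (hne : ∀ ρ ∈ ZL T, ρ.im ≠ U) (hne2 : ∀ ρ ∈ ZL T, ρ.re ≠ σ) :
    ‖deriv riemannZeta (σ + U * Complex.I) / riemannZeta (σ + U * Complex.I)‖ ≤ CL * Real.log T +
      ∑ ρ ∈ ZL T, zetaMult ρ / (|ρ.im - T| + (1 + 1/Real.log T - ρ.re)) * (2 + Jh (U - ρ.im) * ((1 + 2/Real.log T - σ) * Jh (σ - ρ.re))) := by
  set L := Real.log T
  have hη : 0 < 1/L := by positivity
  have hη2 : 1/L ≤ 1/2 := one_div_le_one_div_of_le (by norm_num) h2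
  set z : ℂ := σ + U * Complex.I
  have zr : z.re = σ := by simp [z]
  have zi : z.im = U := by simp [z]
  have hUT : |U - T| ≤ 1/L := by rw [abs_le]; constructor <;> linarith [hU.1, hU.2]
  have hsq : (U-T)^2 ≤ 1/4 := by rw [← sq_abs]; nlinarith [abs_nonneg (U-T)]
  have hn : ‖z - (2 + T * Complex.I)‖ ≤ 13/8 := by
    apply norm_le_of_sq (by norm_num)
    simp only [Complex.sub_re, Complex.sub_im, zr, zi]
    simp
    nlinarith [hσ.1, hσ.2]
  have hb : z ∈ Metric.ball (2 + T * Complex.I) (7/4) := by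
    rw [mem_ball_iff_norm]; linarith
  have hb2 : z ∈ Metric.closedBall (2 + T * Complex.I) (13/8) := by
    rw [mem_closedBall_iff_norm]; linarith
  have h0 : riemannZeta z ≠ 0 := by
    intro h
    exact hne z ((ZL_mem (by linarith)).mpr ⟨by linarith, h⟩) zi
  rw [ZL_log (by linarith) hb h0, add_comm]
  refine (norm_add_le _ _).trans (add_le_add (GZ_bd (by linarith) hb2) ?_)
  refine (norm_sum_le _ _).trans (Finset.sum_le_sum fun ρ hρ => ?_)
  obtain ⟨hr1, -, -⟩ := ZL_re (by linarith) hρ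
  rw [norm_div, Complex.norm_natCast]
  have ha : σ - ρ.re ≠ 0 := sub_ne_zero.mpr (hne2 ρ hρ).symm
  have hb : U - ρ.im ≠ 0 := sub_ne_zero.mpr (hne ρ hρ).symm
  rw [Jh_eq ha, Jh_eq hb]
  have r1 : |σ - ρ.re| ≤ ‖z - ρ‖ := by
    have := Complex.abs_re_le_norm (z - ρ); rwa [Complex.sub_re, zr] at this
  have r2 : |U - ρ.im| ≤ ‖z - ρ‖ := by
    have := Complex.abs_im_le_norm (z - ρ); rwa [Complex.sub_im, zi] at this
  have ap : 0 < |σ - ρ.re| := abs_pos.mpr ha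
  have bp : 0 < |U - ρ.im| := abs_pos.mpr hb
  set N := ‖z - ρ‖
  have hN : 0 < N := lt_of_lt_of_le ap r1
  have inv : 1/N ≤ |U - ρ.im|^(-1/2:ℝ) * |σ - ρ.re|^(-1/2:ℝ) := by
    have i1 : N^(-1/2:ℝ) ≤ |U - ρ.im|^(-1/2:ℝ) := Real.rpow_le_rpow_of_nonpos bp r2 (by norm_num)
    have i2 : N^(-1/2:ℝ) ≤ |σ - ρ.re|^(-1/2:ℝ) := Real.rpow_le_rpow_of_nonpos ap r1 (by norm_num)
    calc 1/N = N^(-1/2:ℝ) * N^(-1/2:ℝ) := by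
          rw [← Real.rpow_add hN]; norm_num [Real.rpow_neg_one]
      _ ≤ _ := by gcongr
  set D := |ρ.im - T| + (1 + 1/L - ρ.re)
  have hD : 0 < D := by have := abs_nonneg (ρ.im - T); simp only [D]; linarith
  have hV : 0 ≤ 1 + 2/L - σ := by
    have : 2/L = 1/L+1/L := by ring
    linarith [hσ.2]
  have hDle : D ≤ 2 * N + (1 + 2/L - σ) := by
    have t1 : |ρ.im - T| ≤ |U - ρ.im| + |U - T| := by
      calc |ρ.im - T| = |(U - T) - (U - ρ.im)| := by ring_nf
        _ ≤ |U - T| + |U - ρ.im| := abs_sub _ _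
        _ = _ := add_comm _ _
    have t2 := le_abs_self (σ - ρ.re)
    have : 2/L = 1/L+1/L := by ring
    simp only [D]; linarith
  have key : 1/N ≤ 1/D * (2 + |U - ρ.im|^(-1/2:ℝ) * ((1 + 2/L - σ) * |σ - ρ.re|^(-1/2:ℝ))) := by
    have k1 : D * (1/N) ≤ 2 + (1 + 2/L - σ) * (1/N) := by
      calc D * (1/N) ≤ (2 * N + (1 + 2/L - σ)) * (1/N) := by gcongr
        _ = _ := by field_simp
    have k2 := mul_le_mul_of_nonneg_left inv hV
    rw [one_div_mul_eq_div, le_div_iff₀ hD]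
    linarith
  have hm : (0:ℝ) ≤ zetaMult ρ := by positivity
  have := mul_le_mul_of_nonneg_left key hm
  calc _ = zetaMult ρ * (1/N) := by ring
    _ ≤ _ := this
    _ = _ := by ring


lemma II_sum {ι : Type*} (S : Finset ι) {f : ι → ℝ → ℝ} {a b : ℝ} (h : ∀ i ∈ S, IntervalIntegrable (f i) volume a b) :
    IntervalIntegrable (fun v => ∑ i ∈ S, f i v) volume a b :=
  ⟨integrable_finsetSum S (fun i hi => (h i hi).1), integrable_finsetSum S (fun i hi => (h i hi).2)⟩

noncomputable def aw (T : ℝ) (ρ : ℂ) : ℝ := zetaMult ρ / (|ρ.im - T| + (1 + 1/Real.log T - ρ.re))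

noncomputable def Zf (U σ : ℝ) : ℝ := ‖deriv riemannZeta (σ + U * Complex.I) / riemannZeta (σ + U * Complex.I)‖

lemma aw_nonneg {T : ℝ} (hT : 8 ≤ T) {ρ : ℂ} (hρ : ρ ∈ ZL T) : 0 ≤ aw T ρ := by
  obtain ⟨h1, -, -⟩ := ZL_re (by linarith) hρ
  have := log_ge_one (show 3 ≤ T by linarith)
  have : 0 < 1/Real.log T := by positivity
  unfold aw
  have := abs_nonneg (ρ.im - T)
  apply div_nonneg (by positivity); linarith

lemma goodU {T : ℝ} (hT : 8 ≤ T) : ∃ U ∈ Icc T (T + 1/Real.log T), (∀ ρ ∈ ZL T, ρ.im ≠ U) ∧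
    ∑ ρ ∈ ZL T, aw T ρ * Jh (U - ρ.im) ≤ 4 * √(Real.log T) * ∑ ρ ∈ ZL T, aw T ρ := by
  set L := Real.log T with hL
  have hL1 : 1 ≤ L := log_ge_one (by linarith)
  have hη : 0 < 1/L := by positivity
  have ii : ∀ ρ ∈ ZL T, IntervalIntegrable (fun v => aw T ρ * Jh (v - ρ.im)) volume T (T+1/L) :=
    fun ρ _ => (Jh_II' _ _ _).const_mul _
  have hint : IntervalIntegrable (fun v => ∑ ρ ∈ ZL T, aw T ρ * Jh (v - ρ.im)) volume T (T+1/L) := by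
    exact II_sum _ ii
  have hval : ∫ v in T..(T+1/L), ∑ ρ ∈ ZL T, aw T ρ * Jh (v - ρ.im) ≤ (4 * √(1/L)) * ∑ ρ ∈ ZL T, aw T ρ := by
    rw [intervalIntegral.integral_finsetSum ii, Finset.mul_sum]
    apply Finset.sum_le_sum
    intro ρ hρ
    rw [intervalIntegral.integral_const_mul, mul_comm]
    have h1 := Jh_int' ρ.im (show T ≤ T + 1/L by linarith)
    rw [add_sub_cancel_left] at h1
    exact mul_le_mul_of_nonneg_right h1 (aw_nonneg hT hρ)
  rw [intervalIntegrable_iff_integrableOn_Ioc_of_le (by linarith)] at hint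
  have hvol : volume (Ioc T (T+1/L)) = ENNReal.ofReal (1/L) := by rw [Real.volume_Ioc, add_sub_cancel_left]
  obtain ⟨U, hU, hle⟩ := exists_notMem_null_le_average (μ := volume.restrict (Ioc T (T+1/L)))
    (N := (Ioc T (T+1/L))ᶜ ∪ ((ZL T).image Complex.im : Set ℝ)) (by
      rw [Ne, Measure.restrict_eq_zero, hvol]; simpa using by positivity) hint (by
      apply measure_union_null
      · rw [Measure.restrict_apply measurableSet_Ioc.compl]; simp
      · exact (Finset.finite_toSet _).measure_zero _)
  simp only [mem_union, not_or, mem_compl_iff, not_not] at hU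
  refine ⟨U, ⟨hU.1.1.le, hU.1.2⟩, ?_, ?_⟩
  · intro ρ hρ h
    apply hU.2
    rw [← h]
    exact_mod_cast Finset.mem_image_of_mem _ hρ
  · rw [setAverage_eq, ← intervalIntegral.integral_of_le (by linarith), Measure.real, hvol, ENNReal.toReal_ofReal hη.le, smul_eq_mul] at hle
    refine hle.trans ?_
    rw [show (1/L)⁻¹ = L by simp]
    calc _ ≤ L * ((4 * √(1/L)) * ∑ ρ ∈ ZL T, aw T ρ) := by gcongr
      _ = _ := by
        have : L * √(1/L) = √L := by
          rw [Real.sqrt_div zero_le_one, Real.sqrt_one]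
          have := Real.mul_self_sqrt (show 0 ≤ L by linarith)
          have h0 : 0 < √L := Real.sqrt_pos.mpr (by linarith)
          field_simp; nlinarith
        rw [← this]; ring

lemma edge_wt {T U : ℝ} (hT : 8 ≤ T) (h2 : 2 ≤ Real.log T) (hU : U ∈ Icc T (T + 1/Real.log T))
    (hne : ∀ ρ ∈ ZL T, ρ.im ≠ U)
    (hs : ∑ ρ ∈ ZL T, aw T ρ * Jh (U - ρ.im) ≤ 4 * √(Real.log T) * ∑ ρ ∈ ZL T, aw T ρ)
    {E : ℝ → ℝ} (hE : Continuous E) (hE0 : ∀ σ, 0 ≤ E σ) {A B : ℝ} (hA : ∫ σ in (1/2)..(1+1/Real.log T), E σ ≤ A)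
    (hB0 : 0 ≤ B)
    (hB : ∀ β, ∫ σ in (1/2)..(1+1/Real.log T), E σ * ((1+2/Real.log T-σ) * Jh (σ-β)) ≤ B) :
    ∫ σ in (1/2)..(1+1/Real.log T), E σ * Zf U σ ≤ CL * Real.log T * A + (2 * A + 4 * √(Real.log T) * B) * ∑ ρ ∈ ZL T, aw T ρ := by
  set L := Real.log T with hL
  have hη : 0 < 1/L := by positivity
  have hC := CL_one
  have i1 : ∀ ρ ∈ ZL T, IntervalIntegrable (fun σ => aw T ρ * (2 * E σ + Jh (U - ρ.im) * (E σ * ((1 + 2/L - σ) * Jh (σ - ρ.re))))) volume (1/2) (1+1/L) := by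
    intro ρ _
    apply IntervalIntegrable.const_mul
    apply IntervalIntegrable.add (Continuous.intervalIntegrable (by fun_prop) _ _)
    apply IntervalIntegrable.const_mul
    apply IntervalIntegrable.continuousOn_mul _ hE.continuousOn
    exact (Jh_II' _ _ _).continuousOn_mul (by fun_prop)
  have i2 : IntervalIntegrable (fun σ => ∑ ρ ∈ ZL T, aw T ρ * (2 * E σ + Jh (U - ρ.im) * (E σ * ((1 + 2/L - σ) * Jh (σ - ρ.re))))) volume (1/2) (1+1/L) := by
    exact II_sum _ i1
  have i3 : IntervalIntegrable (fun σ => CL * L * E σ) volume (1/2) (1+1/L) := Continuous.intervalIntegrable (by fun_prop) _ _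
  have h1 := intervalIntegral.norm_integral_le_of_norm_le (μ := volume) (f := fun σ => E σ * Zf U σ) (show (1/2:ℝ) ≤ 1 + 1/L by linarith) (by
    have hfin : volume (((ZL T).image Complex.re : Finset ℝ) : Set ℝ) = 0 := (Finset.finite_toSet _).measure_zero _
    filter_upwards [measure_eq_zero_iff_ae_notMem.mp hfin] with σ h1 h2'
    have hp := pt_bound hT hU ⟨h2'.1.le, h2'.2⟩ h2 hne (fun ρ hρ h => h1 (by rw [← h]; exact_mod_cast Finset.mem_image_of_mem _ hρ))
    show ‖E σ * Zf U σ‖ ≤ CL * L * E σ + ∑ ρ ∈ ZL T, aw T ρ * (2 * E σ + Jh (U - ρ.im) * (E σ * ((1 + 2/L - σ) * Jh (σ - ρ.re))))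
    have hz : 0 ≤ Zf U σ := norm_nonneg _
    rw [Real.norm_of_nonneg (mul_nonneg (hE0 σ) hz)]
    refine (mul_le_mul_of_nonneg_left hp (hE0 σ)).trans (le_of_eq ?_)
    rw [mul_add, Finset.mul_sum]
    congr 1
    · ring
    · apply Finset.sum_congr rfl
      intro ρ _
      simp only [aw, ← hL]; ring) (i3.add i2)
  refine (le_abs_self _).trans (h1.trans ?_)
  rw [intervalIntegral.integral_add i3 i2, intervalIntegral.integral_const_mul, intervalIntegral.integral_finsetSum i1]
  apply add_le_add (by gcongr)
  calc _ ≤ ∑ ρ ∈ ZL T, (2 * A * aw T ρ + B * (aw T ρ * Jh (U - ρ.im))) := by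
        apply Finset.sum_le_sum
        intro ρ hρ
        have ha := aw_nonneg hT hρ
        rw [intervalIntegral.integral_const_mul, intervalIntegral.integral_add (Continuous.intervalIntegrable (by fun_prop) _ _) (by
          apply IntervalIntegrable.const_mul
          apply IntervalIntegrable.continuousOn_mul _ hE.continuousOn
          exact (Jh_II' _ _ _).continuousOn_mul (by fun_prop)), intervalIntegral.integral_const_mul, intervalIntegral.integral_const_mul]
        have := mul_le_mul_of_nonneg_left (hB ρ.re) (Jh_nonneg (U - ρ.im))
        have : aw T ρ * (2 * (∫ σ in (1/2)..(1+1/L), E σ) + Jh (U - ρ.im) * ∫ σ in (1/2)..(1+1/L), E σ * ((1+2/L-σ) * Jh (σ-ρ.re))) ≤ aw T ρ * (2 * A + Jh (U - ρ.im) * B) := by gcongr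
        refine this.trans (le_of_eq (by ring))
    _ = 2 * A * (∑ ρ ∈ ZL T, aw T ρ) + B * ∑ ρ ∈ ZL T, aw T ρ * Jh (U - ρ.im) := by
        rw [Finset.sum_add_distrib, ← Finset.mul_sum, ← Finset.mul_sum]
    _ ≤ 2 * A * (∑ ρ ∈ ZL T, aw T ρ) + B * (4 * √L * ∑ ρ ∈ ZL T, aw T ρ) := by gcongr
    _ = _ := by ring

lemma conj_logderiv (s : ℂ) : deriv riemannZeta (starRingEnd ℂ s) / riemannZeta (starRingEnd ℂ s) = starRingEnd ℂ (deriv riemannZeta s / riemannZeta s) := by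
  have h : (starRingEnd ℂ ∘ riemannZeta ∘ starRingEnd ℂ) = riemannZeta := by
    ext z; simp [riemannZeta_conj]
  have h2 := congrFun (deriv_conj_conj (f := riemannZeta)) (starRingEnd ℂ s)
  rw [h] at h2
  rw [h2, riemannZeta_conj, map_div₀]; simp

lemma Zf_refl {U σ : ℝ} (hU : 2 ≤ U) (h1 : σ ∈ Icc (-1/4) (1/2)) (h0 : riemannZeta ((1-σ:ℝ) + U * Complex.I) ≠ 0) :
    riemannZeta (σ + U * Complex.I) ≠ 0 ∧ Zf U σ ≤ Zf U (1-σ) + (Real.log U + 20) := by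
  set s : ℂ := (1-σ:ℝ) + U * Complex.I
  have sr : s.re = 1 - σ := by simp [s]
  have si : s.im = U := by simp [s]
  obtain ⟨a, b⟩ := zeta_refl (s := s) (by rw [sr]; linarith [h1.2]) (by rw [sr]; linarith [h1.1]) (by rw [si]; exact hU) h0
  have e : (σ + U * Complex.I : ℂ) = starRingEnd ℂ (1 - s) := by
    apply Complex.ext <;> simp [s]
  constructor
  · rw [e, riemannZeta_conj]; simpa using a
  · unfold Zf
    rw [e, conj_logderiv, RCLike.norm_conj]
    rw [si] at b
    have : deriv riemannZeta (1-s) / riemannZeta (1-s) = (deriv riemannZeta (1-s) / riemannZeta (1-s) + deriv riemannZeta s / riemannZeta s + (Real.log U : ℂ)) - deriv riemannZeta s / riemannZeta s - (Real.log U : ℂ) := by ring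
    rw [this]
    refine (norm_sub_le _ _).trans ?_
    rw [Complex.norm_real, Real.norm_of_nonneg (Real.log_nonneg (by linarith))]
    have := norm_sub_le (deriv riemannZeta (1-s) / riemannZeta (1-s) + deriv riemannZeta s / riemannZeta s + (Real.log U : ℂ)) (deriv riemannZeta s / riemannZeta s)
    linarith

lemma log_pow_bd {T : ℝ} (hT : 8 ≤ T) : Real.log T ^ 2 * T^(1/4:ℝ) ≤ 64 * √T := by
  have h := Real.log_le_rpow_div (show 0 ≤ T by linarith) (show (0:ℝ) < 1/8 by norm_num)
  have h0 : 0 ≤ Real.log T := Real.log_nonneg (by linarith)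
  have h1 : Real.log T ^ 2 ≤ (T^(1/8:ℝ)/(1/8))^2 := pow_le_pow_left₀ h0 h 2
  have e1 : (T^(1/8:ℝ)/(1/8))^2 = 64 * T^(1/4:ℝ) := by
    rw [div_pow, ← Real.rpow_natCast, ← Real.rpow_mul (by linarith)]; norm_num; ring
  have e2 : T^(1/4:ℝ) * T^(1/4:ℝ) = √T := by
    rw [← Real.rpow_add (by linarith), Real.sqrt_eq_rpow]; norm_num
  rw [e1] at h1
  calc _ ≤ 64 * T^(1/4:ℝ) * T^(1/4:ℝ) := by gcongr
    _ = _ := by rw [mul_assoc, e2]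

lemma edge_core : ∃ C : ℝ, 1 ≤ C ∧ ∀ T, 8 ≤ T → 8 ≤ Real.log T → ∃ U ∈ Icc T (T + 1/Real.log T),
    (∀ ρ ∈ ZL T, ρ.im ≠ U) ∧
    ∫ σ in (1/2)..(1+1/Real.log T), Zf U σ ≤ C * Real.log T ^ 2 ∧
    ∫ σ in (1/2)..(1+1/Real.log T), Real.exp (-(1+1/Real.log T-σ)*(Real.log T/2)) * Zf U σ ≤ C * Real.log T ^ (1/4:ℝ) := by
  obtain ⟨C, hC, hsum⟩ := sumdq
  have hCL := CL_one
  refine ⟨2 * CL + 200 * C, by linarith, fun T hT hL8 => ?_⟩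
  obtain ⟨U, hU, hne, hs⟩ := goodU hT
  refine ⟨U, hU, hne, ?_⟩
  have hS : ∑ ρ ∈ ZL T, aw T ρ ≤ C * Real.log T ^ (5/4 : ℝ) := hsum T (by linarith)
  have hS0 : 0 ≤ ∑ ρ ∈ ZL T, aw T ρ := Finset.sum_nonneg (fun ρ h => aw_nonneg hT h)
  set L := Real.log T with hLd
  have hL0 : 0 < L := by linarith
  have hη : 0 < 1/L := by positivity
  have hη2 : 1/L ≤ 1/8 := one_div_le_one_div_of_le (by norm_num) hL8
  have h2η : 2/L = 1/L + 1/L := by ring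
  have hsL : √L = L^(1/2:ℝ) := Real.sqrt_eq_rpow L
  constructor
  · have := edge_wt hT (by linarith) hU hne hs (E := fun _ => 1) continuous_const (fun _ => zero_le_one) (A := 1) (B := 8)
      (by rw [intervalIntegral.integral_const, smul_eq_mul]; linarith) (by norm_num) (by
        intro β
        have : ∫ σ in (1/2)..(1+1/L), 1 * ((1+2/L-σ) * Jh (σ-β)) ≤ ∫ σ in (1/2)..(1+1/L), 1 * Jh (σ-β) := by
          apply intervalIntegral.integral_mono_on (by linarith)
          · apply IntervalIntegrable.const_mul
            exact (Jh_II' _ _ _).continuousOn_mul (by fun_prop)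
          · exact (Jh_II' _ _ _).const_mul _
          · intro σ hσ
            have := Jh_nonneg (σ-β)
            have h1 : 1+2/L-σ ≤ 1 := by linarith [hσ.1]
            nlinarith
        refine this.trans ?_
        simp only [one_mul]
        refine (Jh_int' β (by linarith)).trans ?_
        have : √(1+1/L-1/2) ≤ 1 := by rw [Real.sqrt_le_left (by norm_num)]; linarith
        linarith)
    simp only [one_mul] at this
    refine this.trans ?_
    have p1 : L^(5/4:ℝ) ≤ L^(3/2:ℝ) := Real.rpow_le_rpow_of_exponent_le (by linarith) (by norm_num)
    have p2 : L^(3/2:ℝ) * L^(1/2:ℝ) = L^2 := by rw [← Real.rpow_add hL0, ← Real.rpow_natCast]; norm_num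
    have p3 : (1:ℝ) ≤ L^(1/2:ℝ) := Real.one_le_rpow (by linarith) (by norm_num)
    have p4 : L ≤ L^2 := by nlinarith
    rw [hsL]
    calc _ ≤ CL * L^2 + (2 * L^(1/2:ℝ) + 32 * L^(1/2:ℝ)) * (C * L^(3/2:ℝ)) := by
          have : 2 * 1 + 4 * L^(1/2:ℝ) * 8 ≤ 2 * L^(1/2:ℝ) + 32 * L^(1/2:ℝ) := by linarith
          apply add_le_add (by rw [mul_one]; gcongr)
          apply mul_le_mul this (hS.trans (by gcongr)) hS0 (by positivity)
      _ = (CL + 34 * C) * L^2 := by rw [← p2]; ring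
      _ ≤ _ := by gcongr <;> linarith
  · have := edge_wt hT (by linarith) hU hne hs (E := fun σ => Real.exp (-(1+1/L-σ)*(L/2))) (by fun_prop) (fun _ => (Real.exp_pos _).le) (A := 1/(L/2)) (B := 48 * L^(-3/2:ℝ))
      (exp_int _ _ (by linarith) _) (by positivity) (fun β => (Eint (by linarith) β).2)
    refine this.trans ?_
    have p1 : L^(1/2:ℝ) * L^(-3/2:ℝ) = 1/L := by rw [← Real.rpow_add hL0, show ((1/2:ℝ) + -3/2) = -1 by norm_num, Real.rpow_neg_one, one_div]
    have p2 : L^(5/4:ℝ) * (1/L) = L^(1/4:ℝ) := by rw [one_div, ← Real.rpow_neg_one, ← Real.rpow_add hL0]; norm_num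
    have p3 : (1:ℝ) ≤ L^(1/4:ℝ) := Real.one_le_rpow (by linarith) (by norm_num)
    rw [hsL]
    calc _ = CL * 2 + (4 * (1/L) + 192 * (L^(1/2:ℝ) * L^(-3/2:ℝ))) * ∑ ρ ∈ ZL T, aw T ρ := by field_simp; ring
      _ ≤ CL * 2 + (4 * (1/L) + 192 * (L^(1/2:ℝ) * L^(-3/2:ℝ))) * (C * L^(5/4:ℝ)) := by gcongr
      _ = 2 * CL + 196 * C * L^(1/4:ℝ) := by rw [p1, ← p2]; ring
      _ ≤ 2 * CL * L^(1/4:ℝ) + 200 * C * L^(1/4:ℝ) := by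
          have : 196 * C * L^(1/4:ℝ) ≤ 200 * C * L^(1/4:ℝ) := by gcongr; norm_num
          nlinarith
      _ = _ := by ring

set_option maxHeartbeats 1000000 in
lemma edge : ∃ C : ℝ, 1 ≤ C ∧ ∀ T, 8 ≤ T → 8 ≤ Real.log T → ∃ U ∈ Icc T (T + 1/Real.log T),
    (∀ σ ∈ Icc (-1/4 : ℝ) (5/4), riemannZeta (σ + U * Complex.I) ≠ 0) ∧
    ∀ x ∈ Icc 1 T, ∫ σ in (-1/4)..(1+2/Real.log T), Zf U σ * x^(σ-1/2) ≤ C * √T * Real.log T ^ (1/4:ℝ) := by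
  obtain ⟨C, hC, hcore⟩ := edge_core
  obtain ⟨C2, hC2, hSL⟩ := SL_le
  refine ⟨2000 * C + 2000 * C2, by linarith, fun T hT hL8 => ?_⟩
  obtain ⟨U, hU, hne, hi1, hi2⟩ := hcore T hT hL8
  have hlp := log_pow_bd hT
  set L := Real.log T with hLd
  have hL0 : 0 < L := by linarith
  have hη : 0 < 1/L := by positivity
  have hη2 : 1/L ≤ 1/8 := one_div_le_one_div_of_le (by norm_num) hL8
  have h2η : 2/L = 1/L + 1/L := by ring
  have hnz1 : ∀ σ ∈ Icc (1/2 : ℝ) (5/4), riemannZeta (σ + U * Complex.I) ≠ 0 := by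
    intro σ hσ h
    refine hne (σ + U * Complex.I) ((ZL_mem (by linarith)).mpr ⟨?_, h⟩) (by simp)
    apply norm_le_of_sq (by norm_num)
    have : (U-T)^2 ≤ 1/4 := by nlinarith [hU.1, hU.2]
    simp; nlinarith [hσ.1, hσ.2]
  have hnz : ∀ σ ∈ Icc (-1/4 : ℝ) (5/4), riemannZeta (σ + U * Complex.I) ≠ 0 := by
    intro σ hσ
    rcases le_total (1/2) σ with h | h
    · exact hnz1 σ ⟨h, hσ.2⟩
    · exact (Zf_refl (by linarith [hU.1]) ⟨hσ.1, h⟩ (hnz1 _ ⟨by linarith, by linarith [hσ.1]⟩)).1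
  refine ⟨U, hU, hnz, ?_⟩
  have hcont : ContinuousOn (Zf U) (Icc (-1/4) (5/4)) := by
    have hmap : ∀ σ : ℝ, (σ + U * Complex.I : ℂ) ≠ 1 := by
      intro σ h
      have := congrArg Complex.im h
      simp at this; linarith [hU.1]
    have hc : Continuous (fun σ : ℝ => (σ + U * Complex.I : ℂ)) := by fun_prop
    unfold Zf
    apply ContinuousOn.norm
    apply ContinuousOn.div
    · exact (zeta_an.deriv.continuousOn).comp hc.continuousOn (fun σ _ => hmap σ)
    · exact (zeta_an.continuousOn).comp hc.continuousOn (fun σ _ => hmap σ)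
    · exact hnz
  have hZ0 : ∀ σ, 0 ≤ Zf U σ := fun σ => norm_nonneg _
  have hII : ∀ a b, -1/4 ≤ a → a ≤ b → b ≤ 5/4 → IntervalIntegrable (Zf U) volume a b := by
    intro a b h1 h2 h3
    apply ContinuousOn.intervalIntegrable
    rw [uIcc_of_le h2]
    exact hcont.mono (Icc_subset_Icc h1 h3)
  have hbd : ∀ σ ∈ Icc (1+1/L) (5/4), Zf U σ ≤ L + C2 := by
    intro σ hσ
    have h1 : 1 < (σ + U * Complex.I : ℂ).re := by simp; linarith [hσ.1]
    refine (zlog_le_SL h1).trans ?_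
    have e : (σ + U * Complex.I : ℂ).re = 1 + (σ - 1) := by simp
    rw [e]
    refine (hSL _ (by linarith [hσ.1]) (by linarith [hσ.2])).trans ?_
    have : 1/(σ-1) ≤ L := by
      rw [div_le_iff₀ (by linarith [hσ.1])]
      have := mul_le_mul_of_nonneg_left (show 1/L ≤ σ - 1 by linarith [hσ.1]) hL0.le
      rwa [mul_one_div_cancel hL0.ne'] at this
    linarith
  have hIright : ∫ σ in (1+1/L)..(5/4), Zf U σ ≤ L + C2 := by
    have := intervalIntegral.integral_mono_on (show 1+1/L ≤ 5/4 by linarith) (hII _ _ (by linarith) (by linarith) le_rfl) (intervalIntegrable_const (c := L + C2)) hbd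
    rw [intervalIntegral.integral_const, smul_eq_mul] at this
    nlinarith
  have hT1 : (1:ℝ) ≤ T^(1/4:ℝ) := Real.one_le_rpow (by linarith) (by norm_num)
  have hL14 : (1:ℝ) ≤ L^(1/4:ℝ) := Real.one_le_rpow (by linarith) (by norm_num)
  have hLsq : L ^ 2 ≤ 64 * √T := by nlinarith [sq_nonneg L]
  have hsT : 1 ≤ √T := by rw [Real.one_le_sqrt]; linarith
  have hIhalf : ∫ σ in (1/2)..(5/4), Zf U σ ≤ C * L^2 + (L + C2) := by
    rw [← intervalIntegral.integral_add_adjacent_intervals (hII (1/2) (1+1/L) (by norm_num) (by linarith) (by linarith)) (hII (1+1/L) (5/4) (by linarith) (by linarith) le_rfl)]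
    linarith
  intro x hx
  have hx0 : 0 < x := by linarith [hx.1]
  have hxc : ∀ a b, ContinuousOn (fun σ : ℝ => x^(σ-1/2)) (uIcc a b) := fun a b =>
    Continuous.continuousOn (Continuous.rpow continuous_const (by fun_prop) (fun _ => Or.inl hx0.ne'))
  have hIIx : ∀ a b, -1/4 ≤ a → a ≤ b → b ≤ 5/4 → IntervalIntegrable (fun σ => Zf U σ * x^(σ-1/2)) volume a b :=
    fun a b h1 h2 h3 => (hII a b h1 h2 h3).mul_continuousOn (hxc a b)
  have hlogx : Real.log x ≤ L := Real.log_le_log hx0 hx.2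
  have hlogx0 : 0 ≤ Real.log x := Real.log_nonneg hx.1
  have hxη : x^(1/L) ≤ 3 := by
    rw [Real.rpow_def_of_pos hx0]
    have : Real.log x * (1/L) ≤ 1 := by rw [mul_one_div, div_le_one hL0]; exact hlogx
    linarith [Real.exp_le_exp.mpr this, Real.exp_one_lt_d9]
  -- left part
  have hleft : ∫ σ in (-1/4)..(1/2), Zf U σ * x^(σ-1/2) ≤ C * L^2 + (L + C2) + (L + 21) := by
    have hlogU : Real.log U ≤ L + 1 := by
      have h1 : U ≤ T * Real.exp 1 := by nlinarith [hU.2, Real.add_one_le_exp (1:ℝ)]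
      calc Real.log U ≤ Real.log (T * Real.exp 1) := Real.log_le_log (by linarith [hU.1]) h1
        _ = L + 1 := by rw [Real.log_mul (by linarith) (Real.exp_pos _).ne', Real.log_exp]
    have iref : IntervalIntegrable (fun σ => Zf U (1-σ)) volume (-1/4) (1/2) := by
      have := (hII (1/2) (5/4) (by norm_num) (by norm_num) le_rfl).comp_sub_left 1
      convert this.symm using 1 <;> norm_num
    have h1 : ∫ σ in (-1/4)..(1/2), Zf U σ * x^(σ-1/2) ≤ ∫ σ in (-1/4)..(1/2), (Zf U (1-σ) + (L + 21)) := by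
      apply intervalIntegral.integral_mono_on (by norm_num) (hIIx _ _ le_rfl (by norm_num) (by norm_num)) (iref.add intervalIntegrable_const)
      intro σ hσ
      have h2 := (Zf_refl (by linarith [hU.1]) hσ (hnz1 _ ⟨by linarith [hσ.2], by linarith [hσ.1]⟩)).2
      have h3 : x^(σ-1/2) ≤ 1 := Real.rpow_le_one_of_one_le_of_nonpos hx.1 (by linarith [hσ.2])
      have := mul_le_of_le_one_right (hZ0 σ) h3
      linarith
    refine h1.trans ?_
    rw [intervalIntegral.integral_add iref intervalIntegrable_const, intervalIntegral.integral_comp_sub_left (Zf U) 1, intervalIntegral.integral_const, smul_eq_mul]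
    norm_num at hIhalf ⊢
    nlinarith
  have hright : ∫ σ in (1+1/L)..(1+2/L), Zf U σ * x^(σ-1/2) ≤ 9 * √T * (1 + C2) := by
    have h1 : ∫ σ in (1+1/L)..(1+2/L), Zf U σ * x^(σ-1/2) ≤ ∫ σ in (1+1/L)..(1+2/L), (L + C2) * (9 * √T) := by
      apply intervalIntegral.integral_mono_on (by linarith) (hIIx _ _ (by linarith) (by linarith) (by linarith)) intervalIntegrable_const
      intro σ hσ
      apply mul_le_mul (hbd σ ⟨hσ.1, by linarith [hσ.2]⟩) _ (by positivity) (by linarith)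
      calc x^(σ-1/2) ≤ x^(1/2+1/L+1/L) := Real.rpow_le_rpow_of_exponent_le hx.1 (by linarith [hσ.2])
        _ = √x * x^(1/L) * x^(1/L) := by rw [Real.rpow_add hx0, Real.rpow_add hx0, Real.sqrt_eq_rpow]
        _ ≤ √T * 3 * 3 := by gcongr; exact hx.2
        _ = _ := by ring
    refine h1.trans ?_
    rw [intervalIntegral.integral_const, smul_eq_mul]
    have : (1+2/L-(1+1/L)) * (L + C2) ≤ 1 + C2 := by
      have e : (1+2/L-(1+1/L)) * (L + C2) = 1 + (1/L)*C2 := by field_simp; ring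
      rw [e]; nlinarith
    calc _ = ((1+2/L-(1+1/L)) * (L + C2)) * (9 * √T) := by ring
      _ ≤ (1 + C2) * (9 * √T) := by gcongr
      _ = _ := by ring
  have hmid : ∫ σ in (1/2)..(1+1/L), Zf U σ * x^(σ-1/2) ≤ 200 * C * √T * L^(1/4:ℝ) := by
    rcases le_total (Real.log x) (L/2) with hs | hs
    · have h1 : ∫ σ in (1/2)..(1+1/L), Zf U σ * x^(σ-1/2) ≤ ∫ σ in (1/2)..(1+1/L), Zf U σ * (3 * T^(1/4:ℝ)) := by
        apply intervalIntegral.integral_mono_on (by linarith) (hIIx _ _ (by linarith) (by linarith) (by linarith)) ((hII _ _ (by norm_num) (by linarith) (by linarith)).mul_const _)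
        intro σ hσ
        apply mul_le_mul_of_nonneg_left _ (hZ0 σ)
        calc x^(σ-1/2) ≤ x^(1/L+1/2) := Real.rpow_le_rpow_of_exponent_le hx.1 (by linarith [hσ.2])
          _ = x^(1/L) * x^(1/2:ℝ) := by rw [Real.rpow_add hx0]
          _ ≤ 3 * T^(1/4:ℝ) := by
            gcongr
            rw [Real.rpow_def_of_pos hx0, Real.rpow_def_of_pos (by linarith : 0 < T)]
            apply Real.exp_le_exp.mpr; rw [← hLd]; linarith
      refine h1.trans ?_
      rw [intervalIntegral.integral_mul_const]
      calc _ ≤ C * L^2 * (3 * T^(1/4:ℝ)) := by gcongr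
        _ = 3 * C * (L^2 * T^(1/4:ℝ)) := by ring
        _ ≤ 3 * C * (64 * √T) := by gcongr
        _ ≤ 200 * C * √T * 1 := by nlinarith [mul_nonneg (by linarith : 0 ≤ C) (Real.sqrt_nonneg T)]
        _ ≤ _ := by gcongr
    · have h1 : ∫ σ in (1/2)..(1+1/L), Zf U σ * x^(σ-1/2) ≤ ∫ σ in (1/2)..(1+1/L), (3 * √T) * (Real.exp (-(1+1/L-σ)*(L/2)) * Zf U σ) := by
        apply intervalIntegral.integral_mono_on (by linarith) (hIIx _ _ (by linarith) (by linarith) (by linarith))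
        · apply IntervalIntegrable.const_mul
          exact (hII _ _ (by norm_num) (by linarith) (by linarith)).continuousOn_mul (by fun_prop)
        intro σ hσ
        have : x^(σ-1/2) ≤ 3 * √T * Real.exp (-(1+1/L-σ)*(L/2)) := by
          calc x^(σ-1/2) = x^(1/L) * x^(1/2:ℝ) * x^(-(1+1/L-σ)) := by rw [← Real.rpow_add hx0, ← Real.rpow_add hx0]; congr 1; ring
            _ ≤ 3 * √T * Real.exp (-(1+1/L-σ)*(L/2)) := by
              rw [← Real.sqrt_eq_rpow, Real.rpow_def_of_pos hx0 (-(1+1/L-σ))]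
              have h5 : Real.exp (Real.log x * -(1+1/L-σ)) ≤ Real.exp (-(1+1/L-σ)*(L/2)) := by
                apply Real.exp_le_exp.mpr
                have h6 : 0 ≤ 1+1/L-σ := by linarith [hσ.2]
                have h7 := mul_le_mul_of_nonneg_left hs h6
                linarith
              have h8 : √x ≤ √T := Real.sqrt_le_sqrt hx.2
              gcongr
        calc _ ≤ Zf U σ * (3 * √T * Real.exp (-(1+1/L-σ)*(L/2))) := mul_le_mul_of_nonneg_left this (hZ0 σ)
          _ = _ := by ring
      refine h1.trans ?_
      rw [intervalIntegral.integral_const_mul]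
      calc _ ≤ 3 * √T * (C * L^(1/4:ℝ)) := by gcongr
        _ = 3 * C * √T * L^(1/4:ℝ) := by ring
        _ ≤ _ := by gcongr; norm_num
  rw [← intervalIntegral.integral_add_adjacent_intervals (hIIx (-1/4) (1/2) le_rfl (by norm_num) (by norm_num)) (hIIx (1/2) (1+2/L) (by norm_num) (by linarith) (by linarith)),
    ← intervalIntegral.integral_add_adjacent_intervals (hIIx (1/2) (1+1/L) (by norm_num) (by linarith) (by linarith)) (hIIx (1+1/L) (1+2/L) (by linarith) (by linarith) (by linarith))]
  have f1 : √T ≤ √T * L^(1/4:ℝ) := le_mul_of_one_le_right (by linarith) hL14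
  have f2 : L ≤ L^2 := by nlinarith
  have f3 : C * L^2 ≤ C * (64 * √T) := by gcongr
  set S := √T * L^(1/4:ℝ)
  have g1 : C * √T ≤ C * S := by gcongr
  have g2 : C2 * √T ≤ C2 * S := by gcongr
  have g3 : √T ≤ C * √T := le_mul_of_one_le_left (by linarith) hC
  have g4 : C2 ≤ C2 * √T := le_mul_of_one_le_right (by linarith) hsT
  have e1 : 200 * C * √T * L^(1/4:ℝ) = 200 * (C * S) := by simp only [S]; ring
  have e2 : (2000 * C + 2000 * C2) * √T * L^(1/4:ℝ) = 2000 * (C*S) + 2000 * (C2*S) := by simp only [S]; ring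
  rw [e2]; rw [e1] at hmid
  have e3 : 9 * √T * (1 + C2) = 9 * √T + 9 * (C2 * √T) := by ring
  rw [e3] at hright
  linarith


lemma ZL_of {T : ℝ} (hT : 8 ≤ T) (hL8 : 8 ≤ Real.log T) {ρ : ℂ} (h : IsNontrivialZero ρ) (h1 : T ≤ ρ.im) (h2 : ρ.im ≤ T + 1/Real.log T)
    (h3 : 1/2 ≤ ρ.re) : ρ ∈ ZL T := by
  refine (ZL_mem (by linarith)).mpr ⟨?_, h.1⟩
  have hη2 : 1/Real.log T ≤ 1/8 := one_div_le_one_div_of_le (by norm_num) hL8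
  apply norm_le_of_sq (by norm_num)
  have : (ρ.im-T)^2 ≤ 1/4 := by nlinarith
  simp; nlinarith [h.2.2]

lemma zshift : ∃ C : ℝ, 1 ≤ C ∧ ∀ T, 8 ≤ T → 8 ≤ Real.log T → ∀ S : Finset ℂ,
    (∀ ρ ∈ S, IsNontrivialZero ρ ∧ T ≤ ρ.im ∧ ρ.im ≤ T + 1/Real.log T) → ∀ x ∈ Icc 1 T,
    ∑ ρ ∈ S, zetaMult ρ * x^(ρ.re-1/2) ≤ C * √T * Real.log T ^ (1/4:ℝ) := by
  obtain ⟨C, hC, hsum⟩ := sumdq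
  have hCL := CL_one
  refine ⟨100 * CL + 12 * C, by linarith, fun T hT hL8 S hS x hx => ?_⟩
  have hlp := log_pow_bd hT
  have hsumT : ∑ ρ ∈ ZL T, aw T ρ ≤ C * Real.log T ^ (5/4 : ℝ) := hsum T (by linarith)
  have hZs := ZL_sum (show 3 ≤ T by linarith)
  classical
  set S1 := S.filter (fun ρ => 1/2 ≤ ρ.re)
  set S2 := S.filter (fun ρ => ¬ 1/2 ≤ ρ.re)
  have h1Z : S1 ⊆ ZL T := by
    intro ρ hρ
    rw [Finset.mem_filter] at hρ
    obtain ⟨a, b, c⟩ := hS ρ hρ.1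
    exact ZL_of hT hL8 a b c hρ.2
  have h2Z : S2.image (fun ρ => 1 - starRingEnd ℂ ρ) ⊆ ZL T := by
    intro ρ hρ
    rw [Finset.mem_image] at hρ
    obtain ⟨w, hw, rfl⟩ := hρ
    rw [Finset.mem_filter] at hw
    obtain ⟨a, b, c⟩ := hS w hw.1
    exact ZL_of hT hL8 (refl_zero a) (by simpa using b) (by simpa using c) (by simp; linarith [hw.2])
  set L := Real.log T with hLd
  have hL0 : 0 < L := by linarith
  have hη : 0 < 1/L := by positivity
  have hx0 : 0 < x := by linarith [hx.1]
  have hT0 : 0 < T := by linarith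
  have hlogx : Real.log x ≤ L := Real.log_le_log hx0 hx.2
  have hT1 : (1:ℝ) ≤ T^(1/4:ℝ) := Real.one_le_rpow (by linarith) (by norm_num)
  have hL14 : (1:ℝ) ≤ L^(1/4:ℝ) := Real.one_le_rpow (by linarith) (by norm_num)
  have hLT : L * T^(1/4:ℝ) ≤ 8 * √T := by
    have : 0 ≤ (L - 8) * (L * T^(1/4:ℝ)) := by apply mul_nonneg <;> [linarith; positivity]
    nlinarith
  have hL8T : L ≤ 8 * √T := by nlinarith
  have b2 : ∑ ρ ∈ S2, zetaMult ρ * x^(ρ.re-1/2) ≤ CL * L := by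
    calc _ ≤ ∑ ρ ∈ S2, (zetaMult (1 - starRingEnd ℂ ρ) : ℝ) := by
          apply Finset.sum_le_sum
          intro ρ hρ
          rw [Finset.mem_filter] at hρ
          rw [refl_mult (hS ρ hρ.1).1]
          apply mul_le_of_le_one_right (by positivity)
          exact Real.rpow_le_one_of_one_le_of_nonpos hx.1 (by linarith [hρ.2])
      _ = ∑ ρ ∈ S2.image (fun ρ => 1 - starRingEnd ℂ ρ), (zetaMult ρ : ℝ) := by
          rw [Finset.sum_image]
          intro a _ b _ hab
          exact star_injective (by simpa using hab)
      _ ≤ ∑ ρ ∈ ZL T, (zetaMult ρ : ℝ) := Finset.sum_le_sum_of_subset_of_nonneg h2Z (fun _ _ _ => by positivity)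
      _ ≤ _ := hZs
  have b1 : ∑ ρ ∈ S1, zetaMult ρ * x^(ρ.re-1/2) ≤ (8 * CL + 12 * C) * √T * L^(1/4:ℝ) := by
    rcases le_total (Real.log x) (L/2) with hs | hs
    · calc _ ≤ ∑ ρ ∈ S1, (zetaMult ρ : ℝ) * T^(1/4:ℝ) := by
            apply Finset.sum_le_sum
            intro ρ hρ
            rw [Finset.mem_filter] at hρ
            gcongr
            rw [Real.rpow_def_of_pos hx0, Real.rpow_def_of_pos hT0]
            apply Real.exp_le_exp.mpr; rw [← hLd]
            have : ρ.re - 1/2 ≤ 1/2 := by linarith [(hS ρ hρ.1).1.2.2]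
            nlinarith [hρ.2, Real.log_nonneg hx.1]
        _ ≤ ∑ ρ ∈ ZL T, (zetaMult ρ : ℝ) * T^(1/4:ℝ) := Finset.sum_le_sum_of_subset_of_nonneg h1Z (fun _ _ _ => by positivity)
        _ = (∑ ρ ∈ ZL T, (zetaMult ρ : ℝ)) * T^(1/4:ℝ) := by rw [Finset.sum_mul]
        _ ≤ CL * L * T^(1/4:ℝ) := by gcongr
        _ = CL * (L * T^(1/4:ℝ)) := by ring
        _ ≤ CL * (8 * √T) := by gcongr
        _ ≤ (8 * CL + 12 * C) * √T * 1 := by nlinarith [mul_nonneg (by linarith : 0 ≤ C) (Real.sqrt_nonneg T)]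
        _ ≤ _ := by gcongr
    · have hxη : x^(1/L) ≤ 3 := by
        rw [Real.rpow_def_of_pos hx0]
        have : Real.log x * (1/L) ≤ 1 := by rw [mul_one_div, div_le_one hL0]; exact hlogx
        linarith [Real.exp_le_exp.mpr this, Real.exp_one_lt_d9]
      calc _ ≤ ∑ ρ ∈ S1, (12 * √T / L) * aw T ρ := by
            apply Finset.sum_le_sum
            intro ρ hρ
            rw [Finset.mem_filter] at hρ
            obtain ⟨a, b, c⟩ := hS ρ hρ.1
            set q := 1 + 1/L - ρ.re with hq
            have hqp : 1/L < q := by simp only [q]; linarith [a.2.2]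
            have hq0 : 0 < q := by linarith
            have e1 : x^(ρ.re-1/2) ≤ 3 * √T * (2/(q*L)) := by
              calc x^(ρ.re-1/2) = x^(1/L) * x^(1/2:ℝ) * x^(-q) := by rw [← Real.rpow_add hx0, ← Real.rpow_add hx0]; congr 1; simp only [q]; ring
                _ ≤ 3 * √T * (2/(q*L)) := by
                  rw [← Real.sqrt_eq_rpow, Real.rpow_def_of_pos hx0 (-q)]
                  have h5 : Real.exp (Real.log x * -q) ≤ 2/(q*L) := by
                    rw [mul_neg, Real.exp_neg, inv_eq_one_div, div_le_div_iff₀ (Real.exp_pos _) (by positivity)]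
                    have := Real.add_one_le_exp (Real.log x * q)
                    nlinarith
                  have h8 : √x ≤ √T := Real.sqrt_le_sqrt hx.2
                  gcongr
            have e2 : (zetaMult ρ : ℝ) / (2*q) ≤ aw T ρ := by
              unfold aw
              rw [← hLd, ← hq, abs_of_nonneg (by linarith)]
              gcongr
              linarith
            calc _ ≤ (zetaMult ρ : ℝ) * (3 * √T * (2/(q*L))) := by gcongr
              _ = (12 * √T / L) * (zetaMult ρ / (2*q)) := by field_simp; ring
              _ ≤ _ := by gcongr
        _ ≤ ∑ ρ ∈ ZL T, (12 * √T / L) * aw T ρ := Finset.sum_le_sum_of_subset_of_nonneg h1Z (fun ρ h _ => by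
            have := aw_nonneg hT h; positivity)
        _ = (12 * √T / L) * ∑ ρ ∈ ZL T, aw T ρ := by rw [Finset.mul_sum]
        _ ≤ (12 * √T / L) * (C * L^(5/4:ℝ)) := by gcongr
        _ = 12 * C * √T * L^(1/4:ℝ) := by
            have p2 : L^(5/4:ℝ) = L^(1/4:ℝ) * L := by rw [← Real.rpow_add_one hL0.ne']; norm_num
            rw [p2]; field_simp
        _ ≤ _ := by gcongr; linarith
  rw [← Finset.sum_filter_add_sum_filter_not S (fun ρ => 1/2 ≤ ρ.re)]
  have f1 : √T ≤ √T * L^(1/4:ℝ) := le_mul_of_one_le_right (Real.sqrt_nonneg T) hL14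
  have : CL * L ≤ CL * (8 * (√T * L^(1/4:ℝ))) := by gcongr; linarith
  have : 0 ≤ CL * (√T * L^(1/4:ℝ)) := by positivity
  change _ + _ ≤ _
  have e : (100 * CL + 12 * C) * √T * L^(1/4:ℝ) = (8 * CL + 12 * C) * √T * L^(1/4:ℝ) + 92 * (CL * (√T * L^(1/4:ℝ))) := by ring
  rw [e]
  linarith


noncomputable def kk (p : ℝ) (w : ℂ) : ℂ := 2 * p / ((p:ℂ)^2 - w^2)

lemma kk_den {p : ℝ} {w : ℂ} (h : |w.re| < p) : ((p:ℂ) - w) ≠ 0 ∧ ((p:ℂ) + w) ≠ 0 := by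
  rw [abs_lt] at h
  constructor <;> intro h0 <;> have := congrArg Complex.re h0 <;> simp at this <;> linarith

lemma kk_norm {p : ℝ} {w : ℂ} (h : |w.re| < p) : ‖kk p w‖ ≤ 2 * p / ((p - |w.re|)^2 + w.im^2) := by
  have hp : 0 < p := lt_of_le_of_lt (abs_nonneg _) h
  have h1 : (p - |w.re|)^2 + w.im^2 ≤ ‖(p:ℂ)^2 - w^2‖ := by
    rw [show (p:ℂ)^2 - w^2 = (p - w) * (p + w) by ring, norm_mul]
    have key : ∀ z : ℂ, (p - |w.re|)^2 + w.im^2 ≤ z.re^2+z.im^2 → √((p - |w.re|)^2 + w.im^2) ≤ ‖z‖ := by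
      intro z hz
      rw [Complex.norm_eq_sqrt_sq_add_sq]
      exact Real.sqrt_le_sqrt hz
    have a1 := abs_nonneg w.re
    have a2 := le_abs_self w.re
    have a3 := neg_abs_le w.re
    have k1 := key (p - w) (by simp; nlinarith)
    have k2 := key (p + w) (by simp; nlinarith)
    calc _ = √((p - |w.re|)^2 + w.im^2) * √((p - |w.re|)^2 + w.im^2) := (Real.mul_self_sqrt (by positivity)).symm
      _ ≤ _ := by gcongr
  unfold kk
  rw [norm_div]
  have : ‖(2:ℂ) * p‖ = 2 * p := by rw [norm_mul, Complex.norm_real, Real.norm_of_nonneg hp.le]; norm_num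
  rw [this]
  have : 0 < p - |w.re| := by linarith
  gcongr

lemma kk_neg (p : ℝ) (w : ℂ) : kk p (-w) = kk p w := by unfold kk; rw [neg_sq]

lemma lap {p : ℝ} {w : ℂ} (h : |w.re| < p) :
    Integrable (fun y : ℝ => Complex.exp (-(p*|y| : ℝ) + w * y)) ∧ ∫ y : ℝ, Complex.exp (-(p*|y| : ℝ) + w * y) = kk p w := by
  have hd := kk_den h
  rw [abs_lt] at h
  have e1 : EqOn (fun y : ℝ => Complex.exp ((p + w) * y)) (fun y : ℝ => Complex.exp (-(p*|y| : ℝ) + w * y)) (Iic 0) := by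
    intro y hy
    simp only [abs_of_nonpos (mem_Iic.mp hy)]
    congr 1; push_cast; ring
  have e2 : EqOn (fun y : ℝ => Complex.exp ((w - p) * y)) (fun y : ℝ => Complex.exp (-(p*|y| : ℝ) + w * y)) (Ioi 0) := by
    intro y hy
    simp only [abs_of_pos (mem_Ioi.mp hy)]
    congr 1; push_cast; ring
  have i1 : IntegrableOn (fun y : ℝ => Complex.exp (-(p*|y| : ℝ) + w * y)) (Iic 0) :=
    (integrableOn_exp_mul_complex_Iic (a := p + w) (by simp; linarith) 0).congr_fun e1 measurableSet_Iic
  have i2 : IntegrableOn (fun y : ℝ => Complex.exp (-(p*|y| : ℝ) + w * y)) (Ioi 0) :=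
    (integrableOn_exp_mul_complex_Ioi (a := w - p) (by simp; linarith) 0).congr_fun e2 measurableSet_Ioi
  refine ⟨by rw [← integrableOn_univ, ← Iic_union_Ioi (a := (0:ℝ))]; exact i1.union i2, ?_⟩
  rw [← intervalIntegral.integral_Iic_add_Ioi i1 i2, ← setIntegral_congr_fun measurableSet_Iic e1, ← setIntegral_congr_fun measurableSet_Ioi e2,
    integral_exp_mul_complex_Iic (a := p + w) (by simp; linarith), integral_exp_mul_complex_Ioi (a := w - p) (by simp; linarith)]
  unfold kk
  have h3 : w - p ≠ 0 := by rw [← neg_sub]; exact neg_ne_zero.mpr hd.1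
  have h4 : (p:ℂ)^2 - w^2 ≠ 0 := by
    rw [show (p:ℂ)^2 - w^2 = (p - w) * (p + w) by ring]; exact mul_ne_zero hd.1 hd.2
  have h5 := hd.2
  simp only [Complex.ofReal_zero, mul_zero, Complex.exp_zero]
  field_simp
  ring

lemma kk_cont {p : ℝ} {a : ℂ} (h : |a.re| < p) : Continuous (fun u : ℝ => kk p (a + u * Complex.I)) := by
  unfold kk
  apply Continuous.div continuous_const (by fun_prop)
  intro u
  have hd := kk_den (w := a + u * Complex.I) (p := p) (by simpa using h)
  rw [show (p:ℂ)^2 - (a + u * Complex.I)^2 = (p - (a + u * Complex.I)) * (p + (a + u * Complex.I)) by ring]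
  exact mul_ne_zero hd.1 hd.2

lemma int_quad {d : ℝ} (hd : 0 < d) : Integrable (fun u : ℝ => (d^2 + u^2)⁻¹) := by
  have := (integrable_inv_one_add_sq.comp_mul_left' (g := fun x : ℝ => (1 + x^2)⁻¹) (inv_ne_zero hd.ne')).const_mul ((d^2)⁻¹)
  refine this.congr (Eventually.of_forall fun u => ?_)
  simp only
  rw [← mul_inv]; congr 1; field_simp

lemma kk_int {p : ℝ} {a : ℂ} (h : |a.re| < p) : Integrable (fun u : ℝ => kk p (a + u * Complex.I)) := by
  have h1 : Integrable (fun u : ℝ => kk p (a.re + u * Complex.I)) := by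
    refine Integrable.mono' ((int_quad (sub_pos.mpr h)).const_mul (2*p)) (kk_cont (a := a.re) (by simpa using h)).aestronglyMeasurable (Eventually.of_forall fun u => ?_)
    refine (kk_norm (by simpa using h)).trans (le_of_eq ?_)
    simp [div_eq_mul_inv]
  have := h1.comp_add_right a.im
  refine this.congr (Eventually.of_forall fun u => ?_)
  simp only
  congr 1
  apply Complex.ext <;> simp; ring

lemma kk_inv0 {p c : ℝ} (h : |c| < p) (y : ℝ) :
    ∫ u : ℝ, kk p (c + u * Complex.I) * Complex.exp ((c + u * Complex.I) * y) = 2 * Real.pi * Real.exp (-(p*|y|)) := by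
  set f : ℝ → ℂ := fun y => Complex.exp (-(p*|y| : ℝ) + (c:ℂ) * y) with hf
  have hfi : Integrable f := (lap (w := c) (by simpa using h)).1
  have hF : ∀ ξ, FourierTransform.fourier f ξ = kk p (c + (-(2*Real.pi) * ξ : ℝ) * Complex.I) := by
    intro ξ
    rw [Real.fourier_eq', ← (lap (w := c + (-(2*Real.pi) * ξ : ℝ) * Complex.I) (by simpa using h)).2]
    congr 1
    ext v
    rw [smul_eq_mul, hf, ← Complex.exp_add]
    congr 1
    simp; ring
  have hFi : Integrable (FourierTransform.fourier f) := by
    rw [show FourierTransform.fourier f = _ from funext hF]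
    have := (kk_int (a := c) (by simpa using h)).comp_mul_left' (R := -(2*Real.pi)) (by simp [Real.pi_ne_zero])
    exact this
  have hfc : Continuous f := by simp only [hf]; fun_prop
  have inv := Continuous.fourierInv_fourier_eq hfc hfi hFi
  have := congrFun inv (-y)
  rw [Real.fourierInv_eq'] at this
  simp only [hF, smul_eq_mul] at this
  have sub := Measure.integral_comp_mul_left (fun u : ℝ => kk p (c + u * Complex.I) * Complex.exp ((c + u * Complex.I) * y)) (-(2*Real.pi))
  have e : (∫ ξ : ℝ, kk p (c + (-(2*Real.pi) * ξ : ℝ) * Complex.I) * Complex.exp ((c + (-(2*Real.pi) * ξ : ℝ) * Complex.I) * y)) = Complex.exp (c*y) * f (-y) := by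
    rw [← this, ← integral_const_mul]
    congr 1
    ext ξ
    rw [show ∀ A B D : ℂ, A * (B * D) = D * (A * B) by intros; ring, ← Complex.exp_add]
    congr 2
    simp; ring
  rw [e] at sub
  have hpi : |(-(2*Real.pi))⁻¹| = (2*Real.pi)⁻¹ := by
    rw [abs_inv, abs_neg, abs_of_pos (by positivity)]
  rw [hpi, hf, ← Complex.exp_add] at sub
  have e2 : (c:ℂ) * y + (-(p*|(-y)| : ℝ) + (c:ℂ) * (-y : ℝ)) = ((-(p*|y|) : ℝ) : ℂ) := by
    rw [abs_neg]; push_cast; ring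
  rw [e2, Complex.real_smul] at sub
  have hp : (Real.pi : ℂ) ≠ 0 := by exact_mod_cast Real.pi_ne_zero
  rw [Complex.ofReal_exp, sub, ← mul_assoc]
  rw [show (2 * (Real.pi:ℂ)) * ((2 * Real.pi)⁻¹ : ℝ) = 1 by push_cast; field_simp, one_mul]

lemma kk_inv {p : ℝ} {a : ℂ} (h : |a.re| < p) (y : ℝ) :
    ∫ u : ℝ, kk p (a + u * Complex.I) * Complex.exp ((a + u * Complex.I) * y) = 2 * Real.pi * Real.exp (-(p*|y|)) := by
  rw [← kk_inv0 (c := a.re) h y, ← integral_add_right_eq_self (fun u : ℝ => kk p (a.re + u * Complex.I) * Complex.exp ((a.re + u * Complex.I) * y)) a.im]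
  congr 1; ext u
  have : a + u * Complex.I = a.re + (u + a.im : ℝ) * Complex.I := by apply Complex.ext <;> simp; ring
  rw [this]

lemma kk1 {w : ℂ} (h : |w.re| ≤ 3/4) : ‖kk 1 w‖ ≤ 32 / (1 + w.im^2) := by
  refine (kk_norm (by linarith)).trans ?_
  have : 0 < 1 - |w.re| := by linarith
  rw [div_le_div_iff₀ (by positivity) (by positivity)]
  nlinarith [sq_nonneg w.im]

noncomputable def Fk (c l u : ℝ) : ℂ := kk 1 (c + u * Complex.I) * Complex.exp ((c + u * Complex.I) * l)

lemma Fk_split (c l u : ℝ) : Fk c l u = Real.exp (c*l) * (kk 1 (c + u * Complex.I) * Complex.exp (u * l * Complex.I)) := by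
  unfold Fk
  rw [show ((c:ℂ) + u * Complex.I) * l = ((c*l : ℝ) : ℂ) + u * l * Complex.I by push_cast; ring, Complex.exp_add, Complex.ofReal_exp]; ring

lemma exp_im_norm (u l : ℝ) : ‖Complex.exp (u * l * Complex.I)‖ = 1 := by
  rw [show (u:ℂ) * l * Complex.I = ((u*l : ℝ):ℂ) * Complex.I by push_cast; ring, Complex.norm_exp_ofReal_mul_I]

lemma Fk_norm {c : ℝ} (hc : |c| ≤ 3/4) (l u : ℝ) : ‖Fk c l u‖ ≤ Real.exp (c*l) * (32 / (1 + u^2)) := by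
  rw [Fk_split, norm_mul, norm_mul, exp_im_norm, mul_one, Complex.norm_real, Real.norm_of_nonneg (Real.exp_pos _).le]
  gcongr
  have := kk1 (w := c + u * Complex.I) (by simpa using hc)
  simpa using this

lemma Fk_cont {c : ℝ} (hc : |c| ≤ 3/4) (l : ℝ) : Continuous (Fk c l) := by
  unfold Fk
  exact (kk_cont (a := c) (p := 1) (by simp; linarith)).mul (by fun_prop)

lemma Fk_int {c : ℝ} (hc : |c| ≤ 3/4) (l : ℝ) : Integrable (Fk c l) := by
  refine Integrable.mono' ((integrable_inv_one_add_sq.const_mul (32 * Real.exp (c*l)))) (Fk_cont hc l).aestronglyMeasurable (Eventually.of_forall fun u => ?_)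
  refine (Fk_norm hc l u).trans (le_of_eq ?_)
  rw [div_eq_mul_inv]; ring

lemma Fk_full {c : ℝ} (hc : |c| ≤ 3/4) (l : ℝ) : ∫ u, Fk c l u = 2 * Real.pi * Real.exp (-|l|) := by
  have := kk_inv0 (p := 1) (c := c) (by linarith) l
  rw [one_mul] at this; exact_mod_cast this

lemma pow_int {a b : ℝ} (ha : 0 ≤ a) (hab : a ≤ b) : (∫ u in a..b, 64 / (1+u)^2 ≤ 64/(1+a)) ∧ (∫ u in a..b, 4096 / (1+u)^3 ≤ 2048/(1+a^2)) := by
  have pos : ∀ u ∈ uIcc a b, 0 < 1 + u := by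
    intro u hu; rw [uIcc_of_le hab] at hu; linarith [hu.1]
  constructor
  · have d : ∀ u ∈ uIcc a b, HasDerivAt (fun u : ℝ => -64/(1+u)) (64/(1+u)^2) u := by
      intro u hu
      have := ((hasDerivAt_const u (-64:ℝ)).div ((hasDerivAt_id u).const_add 1) (pos u hu).ne')
      refine this.congr_deriv ?_
      simp
    rw [intervalIntegral.integral_eq_sub_of_hasDerivAt d (ContinuousOn.intervalIntegrable (by
      apply ContinuousOn.div (by fun_prop) (by fun_prop); intro u hu; have := pos u hu; positivity))]
    have : 0 ≤ 64/(1+b) := by have := pos b right_mem_uIcc; positivity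
    simp only [neg_div]; linarith
  · have d : ∀ u ∈ uIcc a b, HasDerivAt (fun u : ℝ => -2048/(1+u)^2) (4096/(1+u)^3) u := by
      intro u hu
      have hp := pos u hu
      have := ((hasDerivAt_const u (-2048:ℝ)).div (((hasDerivAt_id u).const_add 1).pow 2) (pow_ne_zero 2 hp.ne'))
      refine this.congr_deriv ?_
      simp; field_simp; ring
    rw [intervalIntegral.integral_eq_sub_of_hasDerivAt d (ContinuousOn.intervalIntegrable (by
      apply ContinuousOn.div (by fun_prop) (by fun_prop); intro u hu; have := pos u hu; positivity))]
    have : 0 ≤ 2048/(1+b)^2 := by have := pos b right_mem_uIcc; positivity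
    have : 2048/(1+a)^2 ≤ 2048/(1+a^2) := by gcongr; nlinarith
    simp only [neg_div]; linarith

lemma tail_raw {c l a b : ℝ} (hc : |c| ≤ 3/4) (ha : 0 ≤ a) (hab : a ≤ b) :
    ‖∫ u in a..b, kk 1 (c + u * Complex.I) * Complex.exp (u * l * Complex.I)‖ ≤ 64/(1+a) ∧
    (l ≠ 0 → ‖∫ u in a..b, kk 1 (c + u * Complex.I) * Complex.exp (u * l * Complex.I)‖ ≤ 2112/(|l| * (1+a^2))) := by
  have pos : ∀ u ∈ uIcc a b, 0 ≤ u := by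
    intro u hu; rw [uIcc_of_le hab] at hu; linarith [hu.1]
  have hkb : ∀ u : ℝ, ‖kk 1 (c + u * Complex.I)‖ ≤ 32/(1+u^2) := by
    intro u
    have := kk1 (w := c + u * Complex.I) (by simpa using hc)
    simpa using this
  have hsq : ∀ u : ℝ, 0 ≤ u → 1/(1+u^2) ≤ 2/(1+u)^2 := by
    intro u hu
    rw [div_le_div_iff₀ (by positivity) (by positivity)]; nlinarith [sq_nonneg (1-u)]
  obtain ⟨p1, p2⟩ := pow_int ha hab
  constructor
  · refine (intervalIntegral.norm_integral_le_of_norm_le hab (g := fun u => 64/(1+u)^2) ?_ (ContinuousOn.intervalIntegrable (by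
      apply ContinuousOn.div (by fun_prop) (by fun_prop); intro u hu; have := pos u hu; positivity))).trans p1
    refine Eventually.of_forall fun u hu => ?_
    rw [norm_mul, exp_im_norm, mul_one]
    have h1 := hsq u (by linarith [hu.1])
    calc _ ≤ 32/(1+u^2) := hkb u
      _ = 32 * (1/(1+u^2)) := by ring
      _ ≤ 32 * (2/(1+u)^2) := by gcongr
      _ = _ := by ring
  · intro hl
    have hlI : (l * Complex.I : ℂ) ≠ 0 := by simp [hl]
    have dk : ∀ u ∈ uIcc a b, HasDerivAt (fun u : ℝ => kk 1 (c + u * Complex.I)) (Complex.I * ((c + u * Complex.I) * kk 1 (c + u * Complex.I)^2)) u := by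
      intro u _
      have hd := kk_den (w := c + u * Complex.I) (p := 1) (by simp; linarith)
      have hne : ((1:ℝ):ℂ)^2 - (c + u * Complex.I)^2 ≠ 0 := by
        rw [show ((1:ℝ):ℂ)^2 - (c + u * Complex.I)^2 = ((1:ℝ) - (c + u * Complex.I)) * ((1:ℝ) + (c + u * Complex.I)) by ring]
        exact mul_ne_zero hd.1 hd.2
      have h1 : HasDerivAt (fun u : ℝ => (c + u * Complex.I : ℂ)) Complex.I u := by
        have := ((Complex.ofRealCLM.hasDerivAt (x := u)).mul_const Complex.I).const_add (c:ℂ)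
        simpa using this
      unfold kk
      have := (hasDerivAt_const u (2 * ((1:ℝ):ℂ))).div ((h1.pow 2).const_sub (((1:ℝ):ℂ)^2)) hne
      refine this.congr_deriv ?_
      simp only [Nat.cast_ofNat, Complex.ofReal_one, Pi.pow_apply] at hne ⊢
      field_simp
      ring
    have dv : ∀ u ∈ uIcc a b, HasDerivAt (fun u : ℝ => Complex.exp (u * l * Complex.I) / (l * Complex.I)) (Complex.exp (u * l * Complex.I)) u := by
      intro u _
      have h1 : HasDerivAt (fun u : ℝ => (u * l * Complex.I : ℂ)) (l * Complex.I) u := by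
        have := (((Complex.ofRealCLM.hasDerivAt (x := u)).mul_const (l:ℂ))).mul_const Complex.I
        simpa using this
      refine (h1.cexp.div_const _).congr_deriv ?_
      rw [mul_div_assoc, div_self hlI, mul_one]
    have kc := kk_cont (a := c) (p := 1) (by simp; linarith)
    rw [intervalIntegral.integral_mul_deriv_eq_deriv_mul dk dv (Continuous.intervalIntegrable (by fun_prop) _ _) (Continuous.intervalIntegrable (by fun_prop) _ _)]
    have nv : ∀ u : ℝ, ‖Complex.exp (u * l * Complex.I) / (l * Complex.I)‖ = 1/|l| := by
      intro u
      rw [norm_div, exp_im_norm, norm_mul, Complex.norm_I, mul_one, Complex.norm_real, Real.norm_eq_abs]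
    have lp : 0 < |l| := abs_pos.mpr hl
    have b1 : ‖∫ u in a..b, Complex.I * ((c + u * Complex.I) * kk 1 (c + u * Complex.I)^2) * (Complex.exp (u * l * Complex.I) / (l * Complex.I))‖ ≤ (1/|l|) * (2048/(1+a^2)) := by
      refine (intervalIntegral.norm_integral_le_of_norm_le hab (g := fun u => (1/|l|) * (4096/(1+u)^3)) ?_ (ContinuousOn.intervalIntegrable (by
        apply ContinuousOn.mul (by fun_prop)
        apply ContinuousOn.div (by fun_prop) (by fun_prop); intro u hu; have := pos u hu; positivity))).trans (by
          rw [intervalIntegral.integral_const_mul]; gcongr)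
      refine Eventually.of_forall fun u hu => ?_
      have hu0 : 0 ≤ u := by linarith [hu.1]
      rw [norm_mul, nv, mul_comm, norm_mul, Complex.norm_I, one_mul, norm_mul, norm_pow]
      gcongr
      have h2 : ‖(c + u * Complex.I : ℂ)‖ ≤ 1 + u := by
        refine (norm_add_le _ _).trans ?_
        rw [norm_mul, Complex.norm_I, mul_one, Complex.norm_real, Complex.norm_real, Real.norm_eq_abs, Real.norm_of_nonneg hu0]; linarith
      have h3 : ‖kk 1 (c + u * Complex.I)‖ ≤ 64/(1+u)^2 := by
        refine (hkb u).trans ?_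
        have h1 := hsq u hu0
        calc _ = 32 * (1/(1+u^2)) := by ring
          _ ≤ 32 * (2/(1+u)^2) := by gcongr
          _ = _ := by ring
      calc _ ≤ (1+u) * (64/(1+u)^2)^2 := by gcongr
        _ = _ := by field_simp; norm_num
    refine (norm_sub_le _ _).trans ?_
    refine (add_le_add (norm_sub_le _ _) b1).trans ?_
    rw [norm_mul, norm_mul, nv, nv]
    have h1 := hkb a
    have h2 : ‖kk 1 (c + b * Complex.I)‖ ≤ 32/(1+a^2) := (hkb b).trans (by gcongr)
    have e : 2112/(|l| * (1+a^2)) = 32/(1+a^2)*(1/|l|) + 32/(1+a^2)*(1/|l|) + (1/|l|) * (2048/(1+a^2)) := by field_simp; norm_num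
    rw [e]
    gcongr

lemma tailIoi {c l a : ℝ} (hc : |c| ≤ 3/4) (ha : 0 ≤ a) :
    ‖∫ u in Ioi a, Fk c l u‖ ≤ Real.exp (c*l) * (64 / (1 + |a|)) ∧
    (l ≠ 0 → ‖∫ u in Ioi a, Fk c l u‖ ≤ Real.exp (c*l) * (2112/(|l| * (1+a^2)))) := by
  have ht := (intervalIntegral_tendsto_integral_Ioi a (Fk_int hc l).integrableOn tendsto_id).norm
  have e : ∀ b, ∫ u in a..b, Fk c l u = Real.exp (c*l) * ∫ u in a..b, kk 1 (c + u * Complex.I) * Complex.exp (u * l * Complex.I) := by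
    intro b; rw [← intervalIntegral.integral_const_mul]; congr 1; ext u; rw [Fk_split]
  have n : ‖((Real.exp (c*l) : ℝ) : ℂ)‖ = Real.exp (c*l) := by rw [Complex.norm_real, Real.norm_of_nonneg (Real.exp_pos _).le]
  rw [abs_of_nonneg ha]
  constructor
  · refine le_of_tendsto ht ?_
    filter_upwards [eventually_ge_atTop a] with b hb
    simp only [id]
    rw [e, norm_mul, n]
    gcongr
    exact (tail_raw hc ha hb).1
  · intro hl
    refine le_of_tendsto ht ?_
    filter_upwards [eventually_ge_atTop a] with b hb
    simp only [id]
    rw [e, norm_mul, n]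
    gcongr
    exact (tail_raw hc ha hb).2 hl

lemma Fk_neg (c l u : ℝ) : Fk c l (-u) = Fk (-c) (-l) u := by
  unfold Fk
  rw [← kk_neg]
  push_cast
  congr 2 <;> ring

lemma tailIic {c l a : ℝ} (hc : |c| ≤ 3/4) (ha : a ≤ 0) :
    ‖∫ u in Iic a, Fk c l u‖ ≤ Real.exp (c*l) * (64 / (1 + |a|)) ∧
    (l ≠ 0 → ‖∫ u in Iic a, Fk c l u‖ ≤ Real.exp (c*l) * (2112/(|l| * (1+a^2)))) := by
  have e : ∫ u in Iic a, Fk c l u = ∫ u in Ioi (-a), Fk (-c) (-l) u := by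
    simp only [← Fk_neg]
    rw [integral_comp_neg_Ioi (-a) (Fk c l), neg_neg]
  rw [e]
  have := tailIoi (c := -c) (l := -l) (a := -a) (by simpa using hc) (by linarith)
  simpa using this

lemma trunc {c l a b : ℝ} (hc : |c| ≤ 3/4) (hab : a ≤ b) (ha : a ≠ 0) (hb : b ≠ 0) {B : ℝ → ℝ}
    (h1 : ∀ a, 0 ≤ a → ‖∫ u in Ioi a, Fk c l u‖ ≤ B a) (h2 : ∀ a, a ≤ 0 → ‖∫ u in Iic a, Fk c l u‖ ≤ B a) :
    ‖(∫ u in a..b, Fk c l u) - (if a < 0 ∧ 0 < b then ((2 * Real.pi * Real.exp (-|l|) : ℝ) : ℂ) else 0)‖ ≤ B a + B b := by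
  have hi := Fk_int hc l
  rcases lt_or_gt_of_ne ha with ha | ha
  · rcases lt_or_gt_of_ne hb with hb | hb
    · rw [if_neg (by rintro ⟨-, h⟩; linarith), sub_zero, intervalIntegral.integral_Iic_sub_Iic hi.integrableOn hi.integrableOn |>.symm]
      refine (norm_sub_le _ _).trans ?_
      linarith [h2 a ha.le, h2 b hb.le]
    · rw [if_pos ⟨ha, hb⟩]
      have e1 := intervalIntegral.integral_Iic_add_Ioi (b := b) hi.integrableOn hi.integrableOn
      have e2 := intervalIntegral.integral_Iic_sub_Iic (a := a) (b := b) hi.integrableOn hi.integrableOn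
      rw [Fk_full hc] at e1
      have : (∫ u in a..b, Fk c l u) - ((2 * Real.pi * Real.exp (-|l|) : ℝ) : ℂ) = -(∫ u in Iic a, Fk c l u) - ∫ u in Ioi b, Fk c l u := by
        rw [← e2]; push_cast at e1 ⊢; rw [← e1]; ring
      rw [this]
      refine (norm_sub_le _ _).trans ?_
      rw [norm_neg]
      linarith [h2 a ha.le, h1 b hb.le]
  · have hb : 0 < b := by linarith
    rw [if_neg (by rintro ⟨h, -⟩; linarith), sub_zero]
    have e1 := intervalIntegral.integral_Iic_add_Ioi (b := b) hi.integrableOn hi.integrableOn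
    have e1' := intervalIntegral.integral_Iic_add_Ioi (b := a) hi.integrableOn hi.integrableOn
    have e2 := intervalIntegral.integral_Iic_sub_Iic (a := a) (b := b) hi.integrableOn hi.integrableOn
    have : (∫ u in a..b, Fk c l u) = (∫ u in Ioi a, Fk c l u) - ∫ u in Ioi b, Fk c l u := by
      rw [← e2, sub_eq_sub_iff_add_eq_add, e1, add_comm, e1']
    rw [this]
    refine (norm_sub_le _ _).trans ?_
    linarith [h1 a ha.le, h1 b hb.le]


noncomputable def RB (f : ℂ → ℂ) (a b c d : ℝ) : ℂ :=
  (∫ x : ℝ in a..b, f (x + c * Complex.I)) - (∫ x : ℝ in a..b, f (x + d * Complex.I)) +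
    Complex.I * (∫ y : ℝ in c..d, f (b + y * Complex.I)) - Complex.I * ∫ y : ℝ in c..d, f (a + y * Complex.I)

def Bd (a b c d : ℝ) : Set ℂ := {z | z.re ∈ Icc a b ∧ z.im ∈ Icc c d ∧ ¬ (z.re ∈ Ioo a b ∧ z.im ∈ Ioo c d)}

lemma Bd_mem {a b c d : ℝ} (hab : a < b) (hcd : c < d) :
    (∀ x ∈ uIcc a b, (x + c * Complex.I : ℂ) ∈ Bd a b c d ∧ (x + d * Complex.I : ℂ) ∈ Bd a b c d) ∧
    (∀ y ∈ uIcc c d, (b + y * Complex.I : ℂ) ∈ Bd a b c d ∧ (a + y * Complex.I : ℂ) ∈ Bd a b c d) := by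
  rw [uIcc_of_le hab.le, uIcc_of_le hcd.le]
  constructor
  · intro x hx; constructor <;> simp [Bd, hx.1, hx.2, hcd.le]
  · intro x hx; constructor <;> simp [Bd, hx.1, hx.2, hab.le]

lemma RB_congr {a b c d : ℝ} (hab : a < b) (hcd : c < d) {f g : ℂ → ℂ} (h : ∀ z ∈ Bd a b c d, f z = g z) :
    RB f a b c d = RB g a b c d := by
  obtain ⟨h1, h2⟩ := Bd_mem hab hcd
  unfold RB
  rw [intervalIntegral.integral_congr fun x hx => h _ (h1 x hx).1, intervalIntegral.integral_congr fun x hx => h _ (h1 x hx).2,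
    intervalIntegral.integral_congr fun x hx => h _ (h2 x hx).1, intervalIntegral.integral_congr fun x hx => h _ (h2 x hx).2]

lemma Bd_int {a b c d : ℝ} (hab : a < b) (hcd : c < d) {f : ℂ → ℂ} (h : ContinuousOn f (Bd a b c d)) :
    (IntervalIntegrable (fun x : ℝ => f (x + c * Complex.I)) volume a b ∧ IntervalIntegrable (fun x : ℝ => f (x + d * Complex.I)) volume a b) ∧
    (IntervalIntegrable (fun y : ℝ => f (b + y * Complex.I)) volume c d ∧ IntervalIntegrable (fun y : ℝ => f (a + y * Complex.I)) volume c d) := by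
  obtain ⟨h1, h2⟩ := Bd_mem hab hcd
  refine ⟨⟨?_, ?_⟩, ⟨?_, ?_⟩⟩ <;> apply ContinuousOn.intervalIntegrable
  · exact h.comp (by fun_prop) fun x hx => (h1 x hx).1
  · exact h.comp (by fun_prop) fun x hx => (h1 x hx).2
  · exact h.comp (by fun_prop) fun x hx => (h2 x hx).1
  · exact h.comp (by fun_prop) fun x hx => (h2 x hx).2

lemma RB_add {a b c d : ℝ} (hab : a < b) (hcd : c < d) {f g : ℂ → ℂ} (hf : ContinuousOn f (Bd a b c d))
    (hg : ContinuousOn g (Bd a b c d)) : RB (fun z => f z + g z) a b c d = RB f a b c d + RB g a b c d := by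
  obtain ⟨⟨f1, f2⟩, ⟨f3, f4⟩⟩ := Bd_int hab hcd hf
  obtain ⟨⟨g1, g2⟩, ⟨g3, g4⟩⟩ := Bd_int hab hcd hg
  unfold RB
  rw [intervalIntegral.integral_add f1 g1, intervalIntegral.integral_add f2 g2, intervalIntegral.integral_add f3 g3,
    intervalIntegral.integral_add f4 g4]
  ring

lemma RB_mul {a b c d : ℝ} (f : ℂ → ℂ) (k : ℂ) : RB (fun z => k * f z) a b c d = k * RB f a b c d := by
  unfold RB
  simp only [intervalIntegral.integral_const_mul]; ring

lemma RB_inv {a b c d : ℝ} {ρ : ℂ} (h1 : ρ.re ∈ Ioo a b) (h2 : ρ.im ∈ Ioo c d) :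
    RB (fun z => 1/(z-ρ)) a b c d = 2 * Real.pi * Complex.I := by
  obtain ⟨h1, h1'⟩ := h1
  obtain ⟨h2, h2'⟩ := h2
  have hh : ∀ e : ℝ, e ≠ ρ.im → ∫ x : ℝ in a..b, 1/((x + e * Complex.I : ℂ)-ρ) = Complex.log ((b + e * Complex.I : ℂ)-ρ) - Complex.log ((a + e * Complex.I : ℂ)-ρ) := by
    intro e he
    have hs : ∀ x : ℝ, ((x + e * Complex.I : ℂ)-ρ) ∈ Complex.slitPlane := by
      intro x; right; simp [sub_eq_zero, he]
    refine intervalIntegral.integral_eq_sub_of_hasDerivAt (f := fun x : ℝ => Complex.log ((x + e * Complex.I : ℂ)-ρ)) ?_ (ContinuousOn.intervalIntegrable ?_)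
    · intro x _
      have : HasDerivAt (fun x : ℝ => ((x + e * Complex.I : ℂ)-ρ)) 1 x := by
        simpa using ((Complex.ofRealCLM.hasDerivAt (x := x)).add_const (e * Complex.I)).sub_const ρ
      exact this.clog_real (hs x)
    · exact ContinuousOn.div (by fun_prop) (by fun_prop) fun x _ => Complex.slitPlane_ne_zero (hs x)
  have hv : ∀ (e : ℝ) (σ : ℂ), σ ≠ 0 → (∀ y : ℝ, σ * ((e + y * Complex.I : ℂ)-ρ) ∈ Complex.slitPlane) →
      Complex.I * ∫ y : ℝ in c..d, 1/((e + y * Complex.I : ℂ)-ρ) = Complex.log (σ * ((e + d * Complex.I : ℂ)-ρ)) - Complex.log (σ * ((e + c * Complex.I : ℂ)-ρ)) := by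
    intro e σ hσ hs
    rw [← intervalIntegral.integral_const_mul]
    refine intervalIntegral.integral_eq_sub_of_hasDerivAt (f := fun y : ℝ => Complex.log (σ * ((e + y * Complex.I : ℂ)-ρ))) ?_ (ContinuousOn.intervalIntegrable ?_)
    · intro x _
      have : HasDerivAt (fun x : ℝ => σ * ((e + x * Complex.I : ℂ)-ρ)) (σ * Complex.I) x := by
        simpa using ((((Complex.ofRealCLM.hasDerivAt (x := x)).mul_const Complex.I).const_add (e:ℂ)).sub_const ρ).const_mul σ
      refine (this.clog_real (hs x)).congr_deriv ?_
      have := Complex.slitPlane_ne_zero (hs x)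
      have h3 : ((e + x * Complex.I : ℂ)-ρ) ≠ 0 := right_ne_zero_of_mul this
      field_simp
    · refine ContinuousOn.mul (by fun_prop) (ContinuousOn.div (by fun_prop) (by fun_prop) fun x _ => ?_)
      exact right_ne_zero_of_mul (Complex.slitPlane_ne_zero (hs x))
  unfold RB
  rw [hh c h2.ne, hh d h2'.ne', hv b 1 one_ne_zero (by intro y; left; simp; linarith), hv a (-1) (by norm_num) (by intro y; left; simp; linarith)]
  have hp : ∀ z : ℂ, 0 < z.im → Complex.log z - Complex.log (-z) = Real.pi * Complex.I := by
    intro z hz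
    apply Complex.ext
    · simp [Complex.log_re]
    · simp [Complex.log_im, Complex.arg_neg_eq_arg_sub_pi_of_im_pos hz]
  have p1 := hp ((a + d * Complex.I : ℂ)-ρ) (by simp; linarith)
  have p2 := hp (-((a + c * Complex.I : ℂ)-ρ)) (by simp; linarith)
  rw [neg_neg] at p2
  rw [one_mul, one_mul, neg_one_mul, neg_one_mul]
  linear_combination p1 + p2

lemma RB_zero {a b c d : ℝ} (hab : a ≤ b) (hcd : c ≤ d) {f : ℂ → ℂ} (h : DifferentiableOn ℂ f (Icc a b ×ℂ Icc c d)) : RB f a b c d = 0 := by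
  have := Complex.integral_boundary_rect_eq_zero_of_differentiableOn f (a + c * Complex.I) (b + d * Complex.I)
    (by simpa [uIcc_of_le hab, uIcc_of_le hcd] using h)
  unfold RB
  simpa using this

lemma RB_sum {a b c d : ℝ} (hab : a < b) (hcd : c < d) {g : ℂ → ℂ} (hg : ContinuousOn g (Bd a b c d)) (Z : Finset ℂ) (k : ℂ → ℂ)
    (hZ : ∀ ρ ∈ Z, ρ.re ∈ Ioo a b ∧ ρ.im ∈ Ioo c d) :
    RB (fun z => (∑ ρ ∈ Z, k ρ * (1/(z-ρ))) + g z) a b c d = 2 * Real.pi * Complex.I * (∑ ρ ∈ Z, k ρ) + RB g a b c d := by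
  classical
  have hc : ∀ ρ ∈ Z, ContinuousOn (fun z => k ρ * (1/(z-ρ))) (Bd a b c d) := by
    intro ρ hρ
    refine ContinuousOn.mul (by fun_prop) (ContinuousOn.div (by fun_prop) (by fun_prop) fun z hz h0 => ?_)
    rw [sub_eq_zero] at h0; subst h0
    exact hz.2.2 (hZ _ hρ)
  induction Z using Finset.induction_on with
  | empty => simp
  | insert ρ Z hρ ih =>
    simp only [Finset.sum_insert hρ, add_assoc]
    rw [RB_add hab hcd (hc ρ (Finset.mem_insert_self _ _)), RB_mul, RB_inv (hZ ρ (Finset.mem_insert_self _ _)).1 (hZ ρ (Finset.mem_insert_self _ _)).2,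
      ih (fun ρ h => hZ ρ (Finset.mem_insert_of_mem h)) (fun ρ h => hc ρ (Finset.mem_insert_of_mem h))]
    · ring
    · exact (continuousOn_finsetSum _ fun ρ h => hc ρ (Finset.mem_insert_of_mem h)).add hg

lemma zero_strip {ρ : ℂ} (h0 : riemannZeta ρ = 0) (h1 : -1/4 ≤ ρ.re) (h2 : 2 ≤ ρ.im) : IsNontrivialZero ρ := by
  refine ⟨h0, ?_, ?_⟩
  · by_contra h
    push Not at h
    have h3 : riemannZeta (1 - starRingEnd ℂ ρ) ≠ 0 := riemannZeta_ne_zero_of_one_le_re (by simp; linarith)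
    have := (zeta_refl (s := 1 - starRingEnd ℂ ρ) (by simp; linarith) (by simp; linarith) (by simpa using h2) h3).1
    rw [sub_sub_cancel, riemannZeta_conj, h0] at this
    simp at this
  · by_contra h
    push Not at h
    exact riemannZeta_ne_zero_of_one_le_re h h0

lemma residue {b U1 U2 : ℝ} (hb : 1 < b) (hb' : b ≤ 5/4) (hU : 2 ≤ U1) (hU' : U1 < U2)
    (e1 : ∀ σ ∈ Icc (-1/4:ℝ) (5/4), riemannZeta (σ + U1 * Complex.I) ≠ 0)
    (e2 : ∀ σ ∈ Icc (-1/4:ℝ) (5/4), riemannZeta (σ + U2 * Complex.I) ≠ 0) :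
    ∃ Z : Finset ℂ, (∀ ρ, ρ ∈ Z ↔ IsNontrivialZero ρ ∧ U1 < ρ.im ∧ ρ.im < U2) ∧
      ∀ h : ℂ → ℂ, DifferentiableOn ℂ h {z | -1/2 < z.re ∧ z.re < 3/2} →
        RB (fun z => deriv riemannZeta z / riemannZeta z * h z) (-1/4) b U1 U2 = 2 * Real.pi * Complex.I * ∑ ρ ∈ Z, zetaMult ρ * h ρ := by
  have hK : IsCompact (Icc (-1/4:ℝ) b ×ℂ Icc U1 U2) := isCompact_Icc.reProdIm isCompact_Icc
  have h1K : (1:ℂ) ∉ Icc (-1/4:ℝ) b ×ℂ Icc U1 U2 := by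
    intro h; rw [Complex.mem_reProdIm] at h; have := h.2.1; simp at this; linarith
  obtain ⟨Z, g, hZ, hg, hg0, hfac⟩ := zeta_fac hK h1K
  have him : ∀ ρ, riemannZeta ρ = 0 → ρ.re ∈ Icc (-1/4) (5/4:ℝ) → ρ.im ≠ U1 ∧ ρ.im ≠ U2 := by
    intro ρ h0 hr
    constructor <;> rintro rfl
    · exact e1 _ hr (by rw [Complex.re_add_im, h0])
    · exact e2 _ hr (by rw [Complex.re_add_im, h0])
  have hZ' : ∀ ρ, ρ ∈ Z ↔ IsNontrivialZero ρ ∧ U1 < ρ.im ∧ ρ.im < U2 := by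
    intro ρ
    rw [hZ, Complex.mem_reProdIm]
    constructor
    · rintro ⟨⟨h1, h2⟩, h0⟩
      have hn := him ρ h0 ⟨h1.1, h1.2.trans hb'⟩
      exact ⟨zero_strip h0 h1.1 (hU.trans h2.1), lt_of_le_of_ne h2.1 hn.1.symm, lt_of_le_of_ne h2.2 hn.2⟩
    · rintro ⟨h1, h2, h3⟩
      exact ⟨⟨⟨by linarith [h1.2.1], by linarith [h1.2.2]⟩, h2.le, h3.le⟩, h1.1⟩
  refine ⟨Z, hZ', fun h hh => ?_⟩
  have hO : IsOpen {z : ℂ | -1/2 < z.re ∧ z.re < 3/2} :=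
    (isOpen_lt continuous_const Complex.continuous_re).inter (isOpen_lt Complex.continuous_re continuous_const)
  have hKO : Icc (-1/4:ℝ) b ×ℂ Icc U1 U2 ⊆ {z : ℂ | -1/2 < z.re ∧ z.re < 3/2} := by
    intro z hz; rw [Complex.mem_reProdIm] at hz; constructor <;> linarith [hz.1.1, hz.1.2]
  have hBK : Bd (-1/4) b U1 U2 ⊆ Icc (-1/4:ℝ) b ×ℂ Icc U1 U2 := fun z hz => by rw [Complex.mem_reProdIm]; exact ⟨hz.1, hz.2.1⟩
  have hin : ∀ ρ ∈ Z, ρ.re ∈ Ioo (-1/4) b ∧ ρ.im ∈ Ioo U1 U2 := by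
    intro ρ hρ
    obtain ⟨h1, h2, h3⟩ := (hZ' ρ).1 hρ
    exact ⟨⟨by linarith [h1.2.1], by linarith [h1.2.2]⟩, h2, h3⟩
  set G : ℂ → ℂ := fun z => (∑ ρ ∈ Z, (zetaMult ρ : ℂ) * dslope h ρ z) + deriv g z / g z * h z with hG
  have hGd : DifferentiableOn ℂ G (Icc (-1/4:ℝ) b ×ℂ Icc U1 U2) := by
    refine DifferentiableOn.add (DifferentiableOn.fun_sum fun ρ hρ => ?_) (DifferentiableOn.mul (DifferentiableOn.div ?_ ?_ hg0) (hh.mono hKO))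
    · refine DifferentiableOn.const_mul ?_ _
      exact ((Complex.differentiableOn_dslope (hO.mem_nhds (hKO ((hZ ρ).1 hρ).1))).2 hh).mono hKO
    · exact (hg.deriv isOpen_compl_singleton).mono fun z hz h => h1K (by rw [← show z = 1 from h]; exact hz)
    · exact hg.mono fun z hz h => h1K (by rw [← show z = 1 from h]; exact hz)
  rw [← add_zero (2 * Real.pi * Complex.I * _), ← RB_zero (by linarith) hU'.le hGd, ← RB_sum (by linarith) hU' (hGd.continuousOn.mono hBK) Z (fun ρ => zetaMult ρ * h ρ) hin]
  refine RB_congr (by linarith) hU' fun z hz => ?_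
  have hzZ : z ∉ Z := fun hm => hz.2.2 (hin z hm)
  have hz0 : riemannZeta z ≠ 0 := fun h => hzZ ((hZ z).2 ⟨hBK hz, h⟩)
  have hz1 : z ≠ 1 := by rintro rfl; exact h1K (hBK hz)
  rw [zeta_fac_logDeriv hg hfac hz1 hz0 hzZ, add_mul, Finset.sum_mul, hG]
  simp only
  rw [← add_assoc, ← Finset.sum_add_distrib]
  congr 1
  refine Finset.sum_congr rfl fun ρ hρ => ?_
  have hne : z ≠ ρ := by rintro rfl; exact hzZ hρ
  rw [dslope_of_ne _ hne, slope_def_field]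
  have := sub_ne_zero.2 hne
  field_simp
  ring


lemma blk {X : ℝ} (hX : 0 < X) (S : Finset ℕ) (hS : ∀ n ∈ S, X ≤ n ∧ (n:ℝ) ≤ Real.exp 1 * X) : ∑ n ∈ S, Λ n / n ≤ 18 := by
  have h1 : ∑ n ∈ S, Λ n / n ≤ ∑ n ∈ S, Λ n / X := by
    refine Finset.sum_le_sum fun n hn => ?_
    have := (hS n hn).1
    have := ArithmeticFunction.vonMangoldt_nonneg (n := n)
    gcongr
  have h2 : ∑ n ∈ S, Λ n ≤ Chebyshev.psi (Real.exp 1 * X) := by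
    unfold Chebyshev.psi
    refine Finset.sum_le_sum_of_subset_of_nonneg (fun n hn => ?_) (fun n _ _ => ArithmeticFunction.vonMangoldt_nonneg)
    rw [Finset.mem_Ioc]
    exact ⟨by have := (hS n hn).1; exact_mod_cast hX.trans_le this, Nat.le_floor (hS n hn).2⟩
  have h3 := Chebyshev.psi_le_const_mul_self (x := Real.exp 1 * X) (by positivity)
  have h4 : Real.log 4 ≤ 1.4 := by
    rw [show (4:ℝ) = 2^2 by norm_num, Real.log_pow]; have := Real.log_two_lt_d9; norm_num; linarith
  refine h1.trans ?_
  rw [← Finset.sum_div, div_le_iff₀ hX]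
  refine (h2.trans h3).trans ?_
  have h5 := Real.exp_one_lt_d9
  have : (Real.log 4 + 4) * Real.exp 1 ≤ 5.4 * 2.8 := by gcongr <;> linarith
  nlinarith

lemma BL : ∃ C : ℝ, 1 ≤ C ∧ ∀ x : ℝ, 1 ≤ x → ∀ S : Finset ℕ, ∑ n ∈ S, Λ n / n * (1 + |Real.log x - Real.log n|) ^ (-(5/4):ℝ) ≤ C := by
  have hs : Summable fun j : ℕ => 36 * ((1 + j : ℕ) : ℝ) ^ (-(5/4):ℝ) := by
    refine Summable.mul_left _ ?_
    have := (Real.summable_nat_rpow (p := -(5/4))).2 (by norm_num)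
    simpa [add_comm] using (summable_nat_add_iff 1).2 this
  refine ⟨max 1 (∑' j : ℕ, 36 * ((1 + j : ℕ) : ℝ) ^ (-(5/4):ℝ)), le_max_left _ _, fun x hx S => le_trans ?_ (le_max_right _ _)⟩
  set y : ℕ → ℝ := fun n => |Real.log x - Real.log n| with hy
  rw [← Finset.sum_fiberwise_of_maps_to (t := S.image fun n => ⌊y n⌋₊) (g := fun n => ⌊y n⌋₊) (fun n hn => Finset.mem_image_of_mem _ hn)]
  refine le_trans (Finset.sum_le_sum fun j _ => ?_) (hs.sum_le_tsum _ (fun j _ => by positivity))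
  have h1 : ∀ n ∈ S.filter (fun n => ⌊y n⌋₊ = j), Λ n / n * (1 + |Real.log x - Real.log n|) ^ (-(5/4):ℝ) ≤ (Λ n / n) * ((1 + j : ℕ) : ℝ) ^ (-(5/4):ℝ) := by
    intro n hn
    have h2 : (j:ℝ) ≤ y n := by
      have := (Finset.mem_filter.1 hn).2
      rw [← this]; exact Nat.floor_le (abs_nonneg _)
    have h3 := ArithmeticFunction.vonMangoldt_nonneg (n := n)
    refine mul_le_mul_of_nonneg_left ?_ (by positivity)
    refine Real.rpow_le_rpow_of_nonpos (by positivity) ?_ (by norm_num)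
    push_cast; linarith
  refine (Finset.sum_le_sum h1).trans ?_
  rw [← Finset.sum_mul]
  refine mul_le_mul_of_nonneg_right ?_ (by positivity)
  have hx0 : 0 < x := by linarith
  classical
  set F := S.filter (fun n => ⌊y n⌋₊ = j) with hF
  have hF1 : ∀ n ∈ F, (j:ℝ) ≤ y n ∧ y n < j + 1 := by
    intro n hn
    have := (Finset.mem_filter.1 hn).2
    rw [← this]; exact ⟨Nat.floor_le (abs_nonneg _), Nat.lt_floor_add_one _⟩
  set F' := F.filter (fun n => n ≠ 0) with hF'
  have e0 : ∑ n ∈ F, Λ n / n = ∑ n ∈ F', Λ n / n := by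
    symm; apply Finset.sum_filter_of_ne; rintro n _ hn rfl; simp at hn
  rw [e0, ← Finset.sum_filter_add_sum_filter_not F' (fun n : ℕ => Real.log n ≤ Real.log x)]
  have b1 := blk (X := x * Real.exp (-(j+1))) (by positivity) (F'.filter (fun n : ℕ => Real.log n ≤ Real.log x)) (by
    intro n hn
    simp only [hF', Finset.mem_filter] at hn
    obtain ⟨⟨hn1, hn0⟩, hn2⟩ := hn
    have hn3 := hF1 n hn1
    have hnp : (0:ℝ) < n := by positivity
    simp only [hy, abs_of_nonneg (sub_nonneg.2 hn2)] at hn3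
    constructor
    · rw [← Real.log_le_log_iff (by positivity) hnp, Real.log_mul (by positivity) (by positivity), Real.log_exp]; linarith
    · rw [← Real.log_le_log_iff hnp (by positivity), Real.log_mul (by positivity) (by positivity), Real.log_mul (by positivity) (by positivity), Real.log_exp, Real.log_exp]; linarith)
  have b2 := blk (X := x * Real.exp j) (by positivity) (F'.filter (fun n : ℕ => ¬ Real.log n ≤ Real.log x)) (by
    intro n hn
    simp only [hF', Finset.mem_filter, not_le] at hn
    obtain ⟨⟨hn1, hn0⟩, hn2⟩ := hn
    have hn3 := hF1 n hn1
    have hnp : (0:ℝ) < n := by positivity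
    simp only [hy, abs_of_nonpos (sub_nonpos.2 hn2.le)] at hn3
    constructor
    · rw [← Real.log_le_log_iff (by positivity) hnp, Real.log_mul (by positivity) (by positivity), Real.log_exp]; linarith
    · rw [← Real.log_le_log_iff hnp (by positivity), Real.log_mul (by positivity) (by positivity), Real.log_mul (by positivity) (by positivity), Real.log_exp, Real.log_exp]; linarith)
  linarith

lemma BL' : ∃ C : ℝ, 1 ≤ C ∧ ∀ x : ℝ, 1 ≤ x → ∃ S : ℝ, S ≤ C ∧ 0 ≤ S ∧ HasSum (fun n : ℕ => Λ n / n * (1 + |Real.log x - Real.log n|) ^ (-(5/4):ℝ)) S := by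
  obtain ⟨C, hC, h⟩ := BL
  refine ⟨C, hC, fun x hx => ?_⟩
  have nn : ∀ n : ℕ, 0 ≤ Λ n / n * (1 + |Real.log x - Real.log n|) ^ (-(5/4):ℝ) := fun n => by
    have := ArithmeticFunction.vonMangoldt_nonneg (n := n); positivity
  have hs := summable_of_sum_le nn (h x hx)
  exact ⟨_, hs.tsum_le_of_sum_le (h x hx), tsum_nonneg nn, hs.hasSum⟩

/-- coefficients -/
noncomputable def an (x : ℝ) (n : ℕ) : ℝ := Λ n * Real.exp (-(Real.log n/2)) * Real.exp (-|Real.log x - Real.log n|)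

lemma an_nonneg (x : ℝ) (n : ℕ) : 0 ≤ an x n := by
  have := ArithmeticFunction.vonMangoldt_nonneg (n := n); unfold an; positivity

lemma exp_abs_le (y : ℝ) : Real.exp (-|y|/2) ≤ 16 * (1 + |y|) ^ (-(5/4):ℝ) := by
  have h0 : 0 < 1 + |y| := by positivity
  rw [Real.rpow_neg h0.le, ← div_eq_mul_inv, le_div_iff₀ (by positivity)]
  have h1 : (1+|y|) ^ (5/4:ℝ) ≤ (1+|y|)^(2:ℝ) := Real.rpow_le_rpow_of_exponent_le (by linarith [abs_nonneg y]) (by norm_num)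
  have h2 := Real.add_one_le_exp (|y|/4)
  have h3 : (1 + |y|/4)^2 ≤ Real.exp (|y|/2) := by
    rw [show |y|/2 = |y|/4 + |y|/4 by ring, Real.exp_add, ← sq]
    have := abs_nonneg y
    gcongr; linarith
  rw [Real.rpow_two] at h1
  rw [neg_div, Real.exp_neg, inv_mul_le_iff₀ (Real.exp_pos _)]
  refine h1.trans ?_
  nlinarith [sq_nonneg (|y| - 4), abs_nonneg y, Real.exp_pos (|y|/2), Real.add_one_le_exp (|y|/2)]


noncomputable def hk (x t : ℝ) (z : ℂ) : ℂ := kk 1 (z - (1/2 + t * Complex.I)) * Complex.exp ((z - (1/2 + t * Complex.I)) * Real.log x)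

lemma hk_line (x t σ v : ℝ) : hk x t (σ + v * Complex.I) = Fk (σ - 1/2) (Real.log x) (v - t) := by
  unfold hk Fk
  congr 2 <;> push_cast <;> ring

noncomputable def Q1 (a b : ℝ) : ℝ := 1/(1+|a|) + 1/(1+|b|)
noncomputable def Q2 (a b : ℝ) : ℝ := 1/(1+a^2) + 1/(1+b^2)

lemma Q1_nn (a b : ℝ) : 0 ≤ Q1 a b := by unfold Q1; positivity
lemma Q2_nn (a b : ℝ) : 0 ≤ Q2 a b := by unfold Q2; positivity

lemma far_wt {L x : ℝ} {n : ℕ} (hL : 1 ≤ L) (hx : 1 ≤ x) (hxL : Real.log x ≤ L) (hl : 1 ≤ |Real.log x - Real.log n|) :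
    Real.exp (-(Real.log n/L)) / |Real.log x - Real.log n| ≤ 4 * L ^ (1/4:ℝ) * (1 + |Real.log x - Real.log n|) ^ (-(5/4):ℝ) := by
  set l := |Real.log x - Real.log n| with hld
  set v := Real.log n / L with hv
  have hL0 : 0 < L := by linarith
  have hn1 : 0 ≤ Real.log n := Real.log_natCast_nonneg n
  have hv0 : 0 ≤ v := by positivity
  have hlx := Real.log_nonneg hx
  have h1 : 1 + l ≤ L * (2 + v) := by
    have : l ≤ L + Real.log n := by rw [hld, abs_le]; constructor <;> linarith
    rw [hv]; field_simp; nlinarith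
  have h2 : (1+l)^(1/4:ℝ) ≤ L^(1/4:ℝ) * (2 * Real.exp v) := by
    refine (Real.rpow_le_rpow (by linarith) h1 (by norm_num)).trans ?_
    rw [Real.mul_rpow (by linarith) (by linarith)]
    refine mul_le_mul_of_nonneg_left ?_ (by positivity)
    calc (2+v)^(1/4:ℝ) ≤ (2+v)^(1:ℝ) := Real.rpow_le_rpow_of_exponent_le (by linarith) (by norm_num)
      _ ≤ _ := by rw [Real.rpow_one]; have := Real.add_one_le_exp v; linarith
  rw [show (-(5/4):ℝ) = -(1+1/4) by norm_num, Real.rpow_neg (by linarith), Real.rpow_add (by linarith), Real.rpow_one,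
    div_le_iff₀ (by linarith), Real.exp_neg]
  have h3 : 0 < (1+l)^(1/4:ℝ) := Real.rpow_pos_of_pos (by linarith) _
  rw [inv_le_iff_one_le_mul₀' (Real.exp_pos _)]
  have : Real.exp v * (4 * L ^ (1 / 4:ℝ) * ((1 + l) * (1 + l) ^ (1 / 4:ℝ))⁻¹ * l) = (L^(1/4:ℝ) * (2 * Real.exp v)) / (1+l)^(1/4:ℝ) * (2 * l/(1+l)) := by
    field_simp; ring
  rw [this]
  have h4 : 1 ≤ (L^(1/4:ℝ) * (2 * Real.exp v)) / (1+l)^(1/4:ℝ) := by rw [le_div_iff₀ h3]; linarith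
  have h5 : 1 ≤ 2 * l/(1+l) := by rw [le_div_iff₀ (by linarith)]; linarith
  nlinarith

/-- `n^{-1/2-it}` -/
noncomputable def ez (t : ℝ) (n : ℕ) : ℂ := Complex.exp (-((1/2 + t * Complex.I) * Real.log n))

lemma ez_norm (t : ℝ) (n : ℕ) : ‖ez t n‖ = Real.exp (-(Real.log n/2)) := by
  unfold ez; rw [Complex.norm_exp]; congr 1; simp [← Complex.natCast_log]; ring

lemma ez_an (x t : ℝ) (n : ℕ) : (Λ n : ℂ) * ez t n * ((Real.exp (-|Real.log x - Real.log n|) : ℝ) : ℂ) = an x n * Complex.exp (-(t * Real.log n) * Complex.I) := by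
  unfold ez an
  rw [show (-((1/2 + t * Complex.I) * Real.log n) : ℂ) = ((-(Real.log n/2) : ℝ) : ℂ) + -(t * Real.log n) * Complex.I by push_cast; ring,
    Complex.exp_add, ← Complex.ofReal_exp]
  push_cast; ring

lemma right_sum {η x U1 U2 t : ℝ} (h0 : 0 < η) (h1 : η ≤ 1/4) :
    HasSum (fun n : ℕ => -((Λ n : ℂ) * ez t n) * ∫ u in (U1-t)..(U2-t), Fk (1/2+η) (Real.log x - Real.log n) u)
      (∫ v in U1..U2, deriv riemannZeta ((1+η:ℝ) + v * Complex.I) / riemannZeta ((1+η:ℝ) + v * Complex.I) * hk x t ((1+η:ℝ) + v * Complex.I)) := by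
  have hc : |1/2+η| ≤ 3/4 := by rw [abs_of_pos (by linarith)]; linarith
  have hpt : ∀ v : ℝ, ∀ n : ℕ, (Λ n : ℂ) * (n:ℂ)^(-((1+η:ℝ) + v * Complex.I)) * hk x t ((1+η:ℝ) + v * Complex.I) =
      (Λ n : ℂ) * ez t n * Fk (1/2+η) (Real.log x - Real.log n) (v-t) := by
    intro v n
    rcases eq_or_ne n 0 with rfl | hn
    · simp
    rw [hk_line, Complex.cpow_def_of_ne_zero (by exact_mod_cast hn), ← Complex.natCast_log]
    unfold Fk ez
    rw [show (1:ℝ) + η - 1/2 = 1/2 + η by ring, mul_assoc, mul_assoc]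
    congr 1
    rw [mul_left_comm, mul_left_comm (Complex.exp _)]
    congr 1
    rw [← Complex.exp_add, ← Complex.exp_add]
    congr 1; push_cast; ring
  have e1 : ∀ n : ℕ, -((Λ n : ℂ) * ez t n) * ∫ u in (U1-t)..(U2-t), Fk (1/2+η) (Real.log x - Real.log n) u =
      ∫ v in U1..U2, -((Λ n : ℂ) * (n:ℂ)^(-((1+η:ℝ) + v * Complex.I)) * hk x t ((1+η:ℝ) + v * Complex.I)) := by
    intro n
    simp only [hpt]
    rw [intervalIntegral.integral_neg, intervalIntegral.integral_const_mul, intervalIntegral.integral_comp_sub_right (fun u => Fk (1/2+η) (Real.log x - Real.log n) u), neg_mul]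
  simp only [e1]
  have hs := SL_sum (σ := 1+η) (by linarith)
  refine intervalIntegral.hasSum_integral_of_dominated_convergence
    (fun n v => (Λ n * (n:ℝ)^(-(1+η))) * (Real.exp ((1/2+η) * Real.log x) * 32)) ?_ ?_ ?_ ?_ ?_
  · intro n
    simp only [hpt]
    refine Continuous.aestronglyMeasurable ?_
    have := Fk_cont hc (Real.log x - Real.log n)
    fun_prop
  · intro n
    refine Eventually.of_forall fun v _ => ?_
    rw [norm_neg, norm_mul, vM_norm (by simp; linarith)]
    have hh : (((1+η:ℝ):ℂ) + v * Complex.I).re = 1 + η := by simp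
    rw [hh]
    have := ArithmeticFunction.vonMangoldt_nonneg (n := n)
    gcongr
    rw [hk_line, show (1:ℝ) + η - 1/2 = 1/2 + η by ring]
    refine (Fk_norm hc _ _).trans ?_
    gcongr
    exact div_le_self (by norm_num) (by nlinarith)
  · exact Eventually.of_forall fun v _ => hs.1.summable.mul_right _
  · simp
  · refine Eventually.of_forall fun v _ => ?_
    have := (mang_sum (s := ((1+η:ℝ):ℂ) + v * Complex.I) (by simp; linarith)).mul_right (hk x t ((1+η:ℝ) + v * Complex.I))
    simpa using this.neg

noncomputable def ind (U1 U2 t : ℝ) : ℝ := if U1 < t ∧ t < U2 then 1 else 0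

lemma trunc_ind {c l U1 U2 t : ℝ} (hc : |c| ≤ 3/4) (hab : U1 ≤ U2) (ha : t ≠ U1) (hb : t ≠ U2) :
    (‖(∫ u in (U1-t)..(U2-t), Fk c l u) - ind U1 U2 t * (2 * Real.pi * Real.exp (-|l|) : ℝ)‖ ≤ Real.exp (c*l) * (64 * Q1 (U1-t) (U2-t))) ∧
    (l ≠ 0 → ‖(∫ u in (U1-t)..(U2-t), Fk c l u) - ind U1 U2 t * (2 * Real.pi * Real.exp (-|l|) : ℝ)‖ ≤ Real.exp (c*l) * (2112 / |l| * Q2 (U1-t) (U2-t))) := by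
  have e : (ind U1 U2 t * (2 * Real.pi * Real.exp (-|l|) : ℝ) : ℂ) = if U1 - t < 0 ∧ 0 < U2 - t then ((2 * Real.pi * Real.exp (-|l|) : ℝ) : ℂ) else 0 := by
    unfold ind
    simp only [sub_neg, sub_pos]
    split_ifs <;> simp
  rw [e]
  constructor
  · refine (trunc hc (by linarith) (sub_ne_zero.2 ha.symm) (sub_ne_zero.2 hb.symm) (fun a ha => (tailIoi hc ha).1) (fun a ha => (tailIic hc ha).1)).trans (le_of_eq ?_)
    unfold Q1; ring
  · intro hl
    refine (trunc hc (by linarith) (sub_ne_zero.2 ha.symm) (sub_ne_zero.2 hb.symm) (fun a ha => (tailIoi hc ha).2 hl) (fun a ha => (tailIic hc ha).2 hl)).trans (le_of_eq ?_)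
    unfold Q2; have := abs_pos.2 hl; field_simp

lemma ind_le (U1 U2 t : ℝ) : 0 ≤ ind U1 U2 t ∧ ind U1 U2 t ≤ 1 := by unfold ind; split_ifs <;> norm_num


lemma right_wt {L x : ℝ} (n : ℕ) (hL : 1 ≤ L) (hx : 1 ≤ x) (hxL : Real.log x ≤ L) :
    Λ n * Real.exp (-(Real.log n/2)) * Real.exp ((1/2+1/L) * (Real.log x - Real.log n)) ≤ 3 * √x * (Λ n / n * Real.exp (-(Real.log n/L))) := by
  rcases eq_or_ne n 0 with rfl | hn
  · simp
  have hnp : (0:ℝ) < n := by positivity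
  have hL0 : 0 < L := by linarith
  have e1 : √x = Real.exp (Real.log x/2) := by
    rw [Real.sqrt_eq_rpow, Real.rpow_def_of_pos (by linarith)]; congr 1; ring
  have e2 : (1:ℝ)/n = Real.exp (-Real.log n) := by rw [Real.exp_neg, Real.exp_log hnp, one_div]
  have e3 : Real.exp (Real.log x / L) ≤ 3 := by
    have : Real.log x / L ≤ 1 := by rw [div_le_one hL0]; exact hxL
    exact (Real.exp_le_exp.2 this).trans (by linarith [Real.exp_one_lt_d9])
  have h0 := ArithmeticFunction.vonMangoldt_nonneg (n := n)
  have e4 : Λ n * Real.exp (-(Real.log n/2)) * Real.exp ((1/2+1/L) * (Real.log x - Real.log n)) =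
      Real.exp (Real.log x / L) * (√x * (Λ n / n * Real.exp (-(Real.log n/L)))) := by
    rw [div_eq_mul_one_div (Λ n), e1, e2]
    have : Real.exp (-(Real.log n/2)) * Real.exp ((1/2+1/L) * (Real.log x - Real.log n)) =
      Real.exp (Real.log x / L) * Real.exp (Real.log x/2) * Real.exp (-Real.log n) * Real.exp (-(Real.log n/L)) := by
      rw [← Real.exp_add, ← Real.exp_add, ← Real.exp_add, ← Real.exp_add]; congr 1; ring
    rw [mul_assoc, this]; ring
  rw [e4, mul_assoc 3]
  exact mul_le_mul_of_nonneg_right e3 (by positivity)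

lemma right_bound : ∃ C : ℝ, 1 ≤ C ∧ ∀ T x U1 U2 t : ℝ, 8 ≤ T → 8 ≤ Real.log T → x ∈ Icc 1 T → U1 ≤ U2 → t ≠ U1 → t ≠ U2 →
    ‖(∫ v in U1..U2, deriv riemannZeta ((1+1/Real.log T:ℝ) + v * Complex.I) / riemannZeta ((1+1/Real.log T:ℝ) + v * Complex.I) * hk x t ((1+1/Real.log T:ℝ) + v * Complex.I)) +
      ind U1 U2 t * (2 * Real.pi) * ∑ n ∈ Finset.range (⌊T^4⌋₊+1), an x n * Complex.exp (-(t * Real.log n) * Complex.I)‖ ≤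
      C * (ind U1 U2 t + √T * Q1 (U1-t) (U2-t) + √T * Real.log T ^ (1/4:ℝ) * Q2 (U1-t) (U2-t)) := by
  obtain ⟨C0, hC0, hBL⟩ := BL'
  have hS54 := SL_sum (σ := 5/4) (by norm_num)
  have hSnn : 0 ≤ SL (5/4) := hS54.1.nonneg fun n => by have := ArithmeticFunction.vonMangoldt_nonneg (n := n); positivity
  refine ⟨C0 * 30000 + 2 * Real.pi * SL (5/4), by nlinarith [Real.pi_pos, mul_nonneg Real.pi_pos.le hSnn], fun T x U1 U2 t hT hL8 hx hU ht1 ht2 => ?_⟩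
  set L := Real.log T with hL
  obtain ⟨hx1, hxT⟩ := hx
  have hx0 : 0 < x := by linarith
  have hxL : Real.log x ≤ L := Real.log_le_log hx0 hxT
  obtain ⟨S, hSC, hS0, hS⟩ := hBL x hx1
  have hη : 1/L ≤ 1/4 := by rw [div_le_div_iff₀ (by linarith) (by norm_num)]; linarith
  have hη0 : 0 < 1/L := by have : 0 < L := by linarith
                           positivity
  have hc : |1/2+1/L| ≤ 3/4 := by rw [abs_of_pos (by linarith)]; linarith
  have hR := right_sum (x := x) (U1 := U1) (U2 := U2) (t := t) hη0 hη
  set q1 := Q1 (U1-t) (U2-t) with hq1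
  set q2 := Q2 (U1-t) (U2-t) with hq2
  have q1n : 0 ≤ q1 := Q1_nn _ _
  have q2n : 0 ≤ q2 := Q2_nn _ _
  have i1 := ind_le U1 U2 t
  set δ := ind U1 U2 t with hδ
  set N := ⌊T^4⌋₊ with hN
  set F : ℕ → ℂ := fun n : ℕ => -((Λ n : ℂ) * ez t n) * ∫ u in (U1-t)..(U2-t), Fk (1/2+1/L) (Real.log x - Real.log n) u with hF
  set G : ℕ → ℂ := fun n => if n ∈ Finset.range (N+1) then -(δ * (2 * Real.pi)) * (an x n * Complex.exp (-(t * Real.log n) * Complex.I)) else 0 with hG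
  have hGs : HasSum G (-(δ * (2 * Real.pi) * ∑ n ∈ Finset.range (N+1), an x n * Complex.exp (-(t * Real.log n) * Complex.I))) := by
    have : HasSum G (∑ n ∈ Finset.range (N+1), G n) := hasSum_sum_of_ne_finset_zero (fun n hn => by simp only [hG]; rw [if_neg hn])
    have e : ∑ n ∈ Finset.range (N+1), G n = -(δ * (2 * Real.pi) * ∑ n ∈ Finset.range (N+1), an x n * Complex.exp (-(t * Real.log n) * Complex.I)) := by
      rw [Finset.mul_sum, ← Finset.sum_neg_distrib]
      refine Finset.sum_congr rfl fun n hn => ?_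
      simp only [hG]; rw [if_pos hn]; ring
    rwa [e] at this
  have hFG := hR.sub hGs
  rw [sub_neg_eq_add] at hFG
  set A := 3 * √x * (256 * q1 + 8448 * L^(1/4:ℝ) * q2) with hA
  have hA0 : 0 ≤ A := by positivity
  have hE := (hS.mul_left A).add (hS54.1.mul_left (δ * (2 * Real.pi)))
  have hb := hFG.norm_le_of_bounded hE (fun n => ?_)
  · refine hb.trans ?_
    have hxs : √x ≤ √T := Real.sqrt_le_sqrt hxT
    have h1 : A * S ≤ 3 * √T * (256 * q1 + 8448 * L^(1/4:ℝ) * q2) * C0 := by rw [hA]; gcongr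
    have p1 : 0 ≤ √T * q1 := by positivity
    have p2 : 0 ≤ √T * L^(1/4:ℝ) * q2 := by positivity
    have hps : 0 ≤ 2 * Real.pi * SL (5/4) := by positivity
    nlinarith [mul_nonneg p1 (by linarith : 0 ≤ C0), mul_nonneg p2 (by linarith : 0 ≤ C0), mul_nonneg hps p1, mul_nonneg hps p2, mul_nonneg i1.1 (by linarith : 0 ≤ C0)]
  · have h0 := ArithmeticFunction.vonMangoldt_nonneg (n := n)
    set l := Real.log x - Real.log n with hl
    have hmain : ‖F n + δ * (2 * Real.pi) * (an x n * Complex.exp (-(t * Real.log n) * Complex.I))‖ ≤ A * (Λ n / n * (1 + |l|) ^ (-(5/4):ℝ)) := by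
      have e1 : F n + δ * (2 * Real.pi) * (an x n * Complex.exp (-(t * Real.log n) * Complex.I)) =
          -((Λ n : ℂ) * ez t n) * ((∫ u in (U1-t)..(U2-t), Fk (1/2+1/L) l u) - δ * (2 * Real.pi * Real.exp (-|l|) : ℝ)) := by
        rw [← ez_an]; simp only [hF]; push_cast; ring
      rw [e1, norm_mul, norm_neg, norm_mul, ez_norm, Complex.norm_real, Real.norm_of_nonneg h0]
      have ht := trunc_ind (c := 1/2+1/L) (l := l) hc hU ht1 ht2
      have hw := right_wt n (by linarith) hx1 hxL
      rw [← hl] at hw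
      have hle : 0 ≤ Λ n * Real.exp (-(Real.log n/2)) := by positivity
      rcases lt_or_ge |l| 1 with h | h
      · refine (mul_le_mul_of_nonneg_left ht.1 hle).trans ?_
        rw [← mul_assoc]
        refine (mul_le_mul_of_nonneg_right hw (by positivity)).trans ?_
        have h5 : 1 ≤ 4 * (1+|l|)^(-(5/4):ℝ) := by
          have : (2:ℝ)^(-(2:ℝ)) ≤ (1+|l|)^(-(5/4):ℝ) := by
            calc (2:ℝ)^(-(2:ℝ)) ≤ (2:ℝ)^(-(5/4):ℝ) := Real.rpow_le_rpow_of_exponent_le (by norm_num) (by norm_num)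
              _ ≤ _ := Real.rpow_le_rpow_of_nonpos (by positivity) (by linarith) (by norm_num)
          have e : (2:ℝ)^(-(2:ℝ)) = 1/4 := by rw [Real.rpow_neg (by norm_num)]; norm_num
          linarith
        have h6 : Real.exp (-(Real.log n/L)) ≤ 1 := by
          rw [Real.exp_le_one_iff]; have := Real.log_natCast_nonneg n; have : 0 < L := by linarith
          have := div_nonneg ‹0 ≤ Real.log n› this.le; linarith
        calc 3 * √x * (Λ n / n * Real.exp (-(Real.log n/L))) * (64 * q1) ≤ 3 * √x * (Λ n / n * (4 * (1+|l|)^(-(5/4):ℝ))) * (64 * q1) := by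
              gcongr; linarith
          _ = 3 * √x * (256 * q1 + 0) * (Λ n / n * (1+|l|)^(-(5/4):ℝ)) := by ring
          _ ≤ _ := by rw [hA]; gcongr; positivity
      · have hlp : 0 < |l| := by linarith
        refine (mul_le_mul_of_nonneg_left (ht.2 (abs_pos.1 hlp)) hle).trans ?_
        rw [← mul_assoc]
        refine (mul_le_mul_of_nonneg_right hw (by positivity)).trans ?_
        have hf := far_wt (n := n) (by linarith) hx1 hxL h
        rw [← hl] at hf
        calc 3 * √x * (Λ n / n * Real.exp (-(Real.log n/L))) * (2112 / |l| * q2) = 3 * √x * (Λ n / n) * (2112 * q2) * (Real.exp (-(Real.log n/L)) / |l|) := by field_simp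
          _ ≤ 3 * √x * (Λ n / n) * (2112 * q2) * (4 * L ^ (1/4:ℝ) * (1 + |l|) ^ (-(5/4):ℝ)) := by gcongr
          _ = 3 * √x * (0 + 8448 * L^(1/4:ℝ) * q2) * (Λ n / n * (1+|l|)^(-(5/4):ℝ)) := by ring
          _ ≤ _ := by rw [hA]; gcongr; positivity
    have htl0 : 0 ≤ δ * (2 * Real.pi) * (Λ n * (n:ℝ)^(-(5/4):ℝ)) := by
      have := i1.1; have := Real.pi_pos; positivity
    by_cases hn : n ∈ Finset.range (N+1)
    · simp only [hG]
      rw [if_pos hn]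
      rw [← sub_neg_eq_add, ← neg_mul] at hmain
      refine hmain.trans ?_
      linarith
    · simp only [hG]
      rw [if_neg hn, sub_zero]
      have htl : an x n ≤ Λ n * (n:ℝ)^(-(5/4):ℝ) := by
        rw [Finset.mem_range, not_lt] at hn
        have hnT : T^4 < n := by
          have := Nat.lt_floor_add_one (T^4)
          rw [← hN] at this
          exact this.trans_le (by exact_mod_cast hn)
        have hnp : (0:ℝ) < n := lt_trans (by positivity) hnT
        unfold an
        rw [mul_assoc, Real.rpow_def_of_pos hnp, ← Real.exp_add]
        refine mul_le_mul_of_nonneg_left (Real.exp_le_exp.2 ?_) h0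
        have h7 : 4 * L < Real.log n := by
          have := Real.log_lt_log (by positivity) hnT
          rw [Real.log_pow] at this; push_cast at this; exact this
        have := neg_abs_le l
        rw [← hl]
        rw [abs_of_nonpos (by rw [hl]; linarith)]
        linarith
      have e2 : F n = (F n + δ * (2 * Real.pi) * (an x n * Complex.exp (-(t * Real.log n) * Complex.I))) - δ * (2 * Real.pi) * (an x n * Complex.exp (-(t * Real.log n) * Complex.I)) := by ring
      rw [e2]
      refine (norm_sub_le _ _).trans (add_le_add hmain ?_)
      rw [norm_mul, norm_mul, norm_mul, norm_mul]
      have e3 : ‖Complex.exp (-(t * Real.log n) * Complex.I)‖ = 1 := by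
        rw [show (-(t * Real.log n) * Complex.I : ℂ) = ((-(t * Real.log n) : ℝ) : ℂ) * Complex.I by push_cast; ring, Complex.norm_exp_ofReal_mul_I]
      rw [e3, mul_one, Complex.norm_real, Complex.norm_real, Complex.norm_real, Real.norm_of_nonneg i1.1, Real.norm_of_nonneg (an_nonneg _ _), Real.norm_of_nonneg Real.pi_pos.le, Complex.norm_ofNat]
      have := i1.1; have := Real.pi_pos
      gcongr


lemma left_pt {v L : ℝ} (hv : 2 ≤ v) (h1 : |Real.log v - L| ≤ 2) :
    riemannZeta ((-1/4:ℝ) + v * Complex.I) ≠ 0 ∧ ‖deriv riemannZeta ((-1/4:ℝ) + v * Complex.I) / riemannZeta ((-1/4:ℝ) + v * Complex.I) + (L:ℂ)‖ ≤ 22 + SL (5/4) := by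
  set s : ℂ := (5/4:ℝ) + v * Complex.I with hs
  have sr : s.re = 5/4 := by simp [hs]
  have si : s.im = v := by simp [hs]
  have h0 : riemannZeta s ≠ 0 := riemannZeta_ne_zero_of_one_le_re (by rw [sr]; norm_num)
  obtain ⟨h2, h3⟩ := zeta_refl (s := s) (by rw [sr]; norm_num) sr.le (by rw [si]; exact hv) h0
  have e : 1 - s = starRingEnd ℂ ((-1/4:ℝ) + v * Complex.I) := by
    rw [map_add, map_mul, Complex.conj_ofReal, Complex.conj_ofReal, Complex.conj_I, hs]; push_cast; ring
  rw [e, riemannZeta_conj] at h2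
  rw [e, conj_logderiv, si] at h3
  refine ⟨fun h => h2 (by rw [h]; simp), ?_⟩
  have h4 := zlog_le_SL (s := s) (by rw [sr]; norm_num)
  rw [sr] at h4
  rw [← Complex.norm_conj, map_add, Complex.conj_ofReal]
  set w := starRingEnd ℂ (deriv riemannZeta ((-1/4:ℝ) + v * Complex.I) / riemannZeta ((-1/4:ℝ) + v * Complex.I))
  have e2 : w + (L:ℂ) = (w + deriv riemannZeta s / riemannZeta s + (Real.log v : ℂ)) - deriv riemannZeta s / riemannZeta s - ((Real.log v - L : ℝ) : ℂ) := by push_cast; ring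
  rw [e2]
  refine (norm_sub_le _ _).trans ?_
  have := norm_sub_le (w + deriv riemannZeta s / riemannZeta s + (Real.log v : ℂ)) (deriv riemannZeta s / riemannZeta s)
  rw [Complex.norm_real, Real.norm_eq_abs]
  linarith

lemma zl_cont {f : ℝ → ℂ} (hf : Continuous f) {S : Set ℝ} (h1 : ∀ v ∈ S, f v ≠ 1) (h0 : ∀ v ∈ S, riemannZeta (f v) ≠ 0) :
    ContinuousOn (fun v => deriv riemannZeta (f v) / riemannZeta (f v)) S := by
  have h2 : ContinuousOn (deriv riemannZeta) {1}ᶜ := zeta_an.deriv.continuousOn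
  exact ContinuousOn.div (h2.comp hf.continuousOn fun v hv => h1 v hv) (zeta_an.continuousOn.comp hf.continuousOn fun v hv => h1 v hv) h0

lemma left_bound : ∃ C : ℝ, 1 ≤ C ∧ ∀ x U1 U2 t L : ℝ, 2 ≤ U1 → 1 ≤ x → U1 ≤ U2 → t ≠ U1 → t ≠ U2 → 0 ≤ L → (∀ v ∈ Icc U1 U2, |Real.log v - L| ≤ 2) →
    ‖(∫ v in U1..U2, deriv riemannZeta ((-1/4:ℝ) + v * Complex.I) / riemannZeta ((-1/4:ℝ) + v * Complex.I) * hk x t ((-1/4:ℝ) + v * Complex.I)) +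
      ind U1 U2 t * (2 * Real.pi) * (L / x : ℝ)‖ ≤ C * (ind U1 U2 t + (1 + L) * Q1 (U1-t) (U2-t)) := by
  have hSnn : 0 ≤ SL (5/4) := (SL_sum (σ := 5/4) (by norm_num)).1.nonneg fun n => by have := ArithmeticFunction.vonMangoldt_nonneg (n := n); positivity
  set D := 22 + SL (5/4) with hD
  have hD0 : 22 ≤ D := by linarith
  refine ⟨D * 1100, by linarith, fun x U1 U2 t L hU1 hx hU ht1 ht2 hL hlog => ?_⟩
  have hx0 : 0 < x := by linarith
  have i1 := ind_le U1 U2 t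
  set δ := ind U1 U2 t with hδ
  set q1 := Q1 (U1-t) (U2-t) with hq1
  have q1n : 0 ≤ q1 := Q1_nn _ _
  have hc : |(-1/4:ℝ) - 1/2| ≤ 3/4 := by rw [abs_of_neg] <;> norm_num
  have hpt : ∀ v ∈ Icc U1 U2, _ := fun v hv => left_pt (v := v) (L := L) (hU1.trans hv.1) (hlog v hv)
  simp only [hk_line]
  set Z : ℝ → ℂ := fun v => deriv riemannZeta ((-1/4:ℝ) + v * Complex.I) / riemannZeta ((-1/4:ℝ) + v * Complex.I) with hZ
  have hFc : Continuous fun v : ℝ => Fk ((-1/4:ℝ) - 1/2) (Real.log x) (v - t) := (Fk_cont hc _).comp (by fun_prop)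
  have hZc : ContinuousOn Z (uIcc U1 U2) := by
    rw [uIcc_of_le hU]
    refine zl_cont (f := fun v : ℝ => ((-1/4:ℝ) + v * Complex.I : ℂ)) (by fun_prop) (fun v hv h => ?_) (fun v hv => (hpt v hv).1)
    have := congrArg Complex.re h; simp at this; norm_num at this
  have e1 : ∫ v in U1..U2, Z v * Fk ((-1/4:ℝ) - 1/2) (Real.log x) (v - t) =
      (∫ v in U1..U2, (Z v + L) * Fk ((-1/4:ℝ) - 1/2) (Real.log x) (v - t)) - L * ∫ u in (U1-t)..(U2-t), Fk ((-1/4:ℝ) - 1/2) (Real.log x) u := by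
    rw [← intervalIntegral.integral_comp_sub_right (fun u => Fk ((-1/4:ℝ) - 1/2) (Real.log x) u), ← intervalIntegral.integral_const_mul, ← intervalIntegral.integral_sub]
    · refine intervalIntegral.integral_congr fun v _ => ?_
      ring
    · exact ((hZc.add continuousOn_const).mul hFc.continuousOn).intervalIntegrable
    · exact (hFc.const_mul _).intervalIntegrable _ _
  have e2 : Real.exp (-|Real.log x|) = 1/x := by
    rw [abs_of_nonneg (Real.log_nonneg hx), Real.exp_neg, Real.exp_log hx0, one_div]
  have t1 := (trunc_ind (c := (-1/4:ℝ) - 1/2) (l := Real.log x) hc hU ht1 ht2).1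
  rw [e2] at t1
  have ex1 : Real.exp (((-1/4:ℝ) - 1/2) * Real.log x) ≤ 1 := by
    rw [Real.exp_le_one_iff]; nlinarith [Real.log_nonneg hx]
  have t1' : ‖(∫ u in (U1-t)..(U2-t), Fk ((-1/4:ℝ) - 1/2) (Real.log x) u) - δ * (2 * Real.pi * (1/x) : ℝ)‖ ≤ 64 * q1 :=
    t1.trans (mul_le_of_le_one_left (by positivity) ex1)
  have t2 := (trunc_ind (c := 0) (l := 0) (by norm_num) hU ht1 ht2).1
  have F00 : ∀ u : ℝ, Fk 0 0 u = ((2/(1+u^2) : ℝ) : ℂ) := by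
    intro u
    unfold Fk kk
    have : ((1:ℝ):ℂ)^2 - (((0:ℝ):ℂ) + u * Complex.I)^2 = 1 + (u:ℂ)^2 := by
      push_cast; ring_nf; rw [Complex.I_sq]; ring
    rw [this]; push_cast; simp
  simp only [F00] at t2
  rw [intervalIntegral.integral_ofReal] at t2
  have t3 : ∫ u in (U1-t)..(U2-t), 2/(1+u^2) ≤ δ * (2 * Real.pi) + 64 * q1 := by
    have : (((∫ u in (U1-t)..(U2-t), 2/(1+u^2) : ℝ)):ℂ) - δ * (2 * Real.pi * Real.exp (-|0|) : ℝ) = (((∫ u in (U1-t)..(U2-t), 2/(1+u^2)) - δ * (2 * Real.pi) : ℝ) : ℂ) := by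
      push_cast; simp
    rw [this, Complex.norm_real, Real.norm_eq_abs] at t2
    have := le_abs_self ((∫ u in (U1-t)..(U2-t), 2/(1+u^2)) - δ * (2 * Real.pi))
    simp only [zero_mul, Real.exp_zero, one_mul] at t2
    linarith
  have b1 : ‖∫ v in U1..U2, (Z v + L) * Fk ((-1/4:ℝ) - 1/2) (Real.log x) (v - t)‖ ≤ 16 * D * (δ * (2 * Real.pi) + 64 * q1) := by
    refine (intervalIntegral.norm_integral_le_of_norm_le hU (g := fun v => 16 * D * (2/(1+(v-t)^2))) (Eventually.of_forall fun v hv => ?_) ?_).trans ?_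
    · rw [norm_mul]
      have h1 := (hpt v ⟨hv.1.le, hv.2⟩).2
      have h2 := Fk_norm hc (Real.log x) (v-t)
      calc _ ≤ D * (1 * (32/(1+(v-t)^2))) := by
            refine mul_le_mul h1 (h2.trans ?_) (norm_nonneg _) (by linarith)
            exact mul_le_mul_of_nonneg_right ex1 (by positivity)
        _ = _ := by ring
    · refine Continuous.intervalIntegrable (Continuous.mul continuous_const (Continuous.div (by fun_prop) (by fun_prop) fun v => by positivity)) _ _
    · rw [intervalIntegral.integral_const_mul, intervalIntegral.integral_comp_sub_right (fun u => 2/(1+u^2))]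
      exact mul_le_mul_of_nonneg_left t3 (by linarith)
  rw [e1]
  have e3 : ∀ A B : ℂ, A - L * B + δ * (2 * Real.pi) * (L / x : ℝ) = A - L * (B - δ * (2 * Real.pi * (1/x) : ℝ)) := by
    intro A B; push_cast; ring
  rw [e3]
  refine (norm_sub_le _ _).trans ((add_le_add b1 (show _ ≤ L * (64 * q1) by rw [norm_mul, Complex.norm_real, Real.norm_of_nonneg hL]; exact mul_le_mul_of_nonneg_left t1' hL)).trans ?_)
  have := Real.pi_lt_d2
  have p1 : 0 ≤ δ * (4 - Real.pi) := mul_nonneg i1.1 (by linarith)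
  nlinarith [mul_nonneg p1 (by linarith : 0 ≤ D), mul_nonneg q1n (by linarith : 0 ≤ D), mul_nonneg (mul_nonneg q1n hL) (by linarith : 0 ≤ D - 22), mul_nonneg i1.1 (by linarith : 0 ≤ D), mul_nonneg q1n hL]

lemma hor {U x t b c E : ℝ} (hb : -1/4 ≤ b) (hbc : b ≤ c) (hc : c ≤ 5/4) (hU : 2 ≤ U) (hx : 1 ≤ x)
    (hz : ∀ σ ∈ Icc (-1/4 : ℝ) (5/4), riemannZeta (σ + U * Complex.I) ≠ 0)
    (hE : ∫ σ in (-1/4)..c, Zf U σ * x^(σ-1/2) ≤ E) :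
    ‖∫ σ in (-1/4:ℝ)..b, deriv riemannZeta (σ + U * Complex.I) / riemannZeta (σ + U * Complex.I) * hk x t (σ + U * Complex.I)‖ ≤ 32 * E * (1/(1+(U-t)^2)) := by
  have hx0 : 0 < x := by linarith
  have hcont : ContinuousOn (fun σ => Zf U σ * x^(σ-1/2)) (Icc (-1/4) (5/4)) := by
    refine ContinuousOn.mul (ContinuousOn.norm (zl_cont (f := fun σ : ℝ => (σ + U * Complex.I : ℂ)) (by fun_prop) (fun v hv h => ?_) hz)) ?_
    · have := congrArg Complex.im h; simp at this; linarith
    · exact (Continuous.rpow continuous_const (by fun_prop) fun _ => Or.inl hx0.ne').continuousOn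
  have hi : ∀ d, -1/4 ≤ d → d ≤ 5/4 → IntervalIntegrable (fun σ => Zf U σ * x^(σ-1/2)) volume (-1/4) d := fun d h1 h2 =>
    ContinuousOn.intervalIntegrable (hcont.mono (by rw [uIcc_of_le h1]; exact Icc_subset_Icc_right h2))
  refine (intervalIntegral.norm_integral_le_of_norm_le hb (g := fun σ => (32/(1+(U-t)^2)) * (Zf U σ * x^(σ-1/2))) (Eventually.of_forall fun σ hσ => ?_) ((hi b hb (by linarith)).const_mul _)).trans ?_
  · rw [norm_mul, hk_line]
    have := Fk_norm (c := σ - 1/2) (by rw [abs_le]; constructor <;> linarith [hσ.1, hσ.2]) (Real.log x) (U-t)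
    rw [show (σ-1/2) * Real.log x = Real.log x * (σ-1/2) by ring, ← Real.rpow_def_of_pos hx0] at this
    calc _ ≤ Zf U σ * (x^(σ-1/2) * (32/(1+(U-t)^2))) := mul_le_mul_of_nonneg_left this (norm_nonneg _)
      _ = _ := by ring
  · rw [intervalIntegral.integral_const_mul]
    have : ∫ σ in (-1/4)..b, Zf U σ * x^(σ-1/2) ≤ ∫ σ in (-1/4)..c, Zf U σ * x^(σ-1/2) := by
      refine intervalIntegral.integral_mono_interval le_rfl hb hbc (Eventually.of_forall fun σ => ?_) (hi c (by linarith) hc)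
      exact mul_nonneg (norm_nonneg _) (Real.rpow_nonneg hx0.le _)
    calc _ ≤ 32/(1+(U-t)^2) * E := by gcongr; linarith
      _ = _ := by ring

lemma shift {C x U t : ℝ} (hx : 1 ≤ x) (S : Finset ℂ) (hS : ∀ ρ ∈ S, IsNontrivialZero ρ ∧ |ρ.im - U| ≤ 1)
    (h : ∑ ρ ∈ S, zetaMult ρ * x^(ρ.re-1/2) ≤ C) : ‖∑ ρ ∈ S, (zetaMult ρ : ℂ) * hk x t ρ‖ ≤ 96 * C * (1/(1+(U-t)^2)) := by
  have hx0 : 0 < x := by linarith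
  have : ∀ ρ ∈ S, ‖(zetaMult ρ : ℂ) * hk x t ρ‖ ≤ (96/(1+(U-t)^2)) * (zetaMult ρ * x^(ρ.re-1/2)) := by
    intro ρ hρ
    obtain ⟨⟨-, h1, h2⟩, h3⟩ := hS ρ hρ
    have e : hk x t ρ = Fk (ρ.re - 1/2) (Real.log x) (ρ.im - t) := by rw [← hk_line, Complex.re_add_im]
    rw [norm_mul, e, Complex.norm_natCast]
    have := Fk_norm (c := ρ.re - 1/2) (by rw [abs_le]; constructor <;> linarith) (Real.log x) (ρ.im-t)
    rw [show (ρ.re-1/2) * Real.log x = Real.log x * (ρ.re-1/2) by ring, ← Real.rpow_def_of_pos hx0] at this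
    have h5 : 32/(1+(ρ.im-t)^2) ≤ 96/(1+(U-t)^2) := by
      rw [div_le_div_iff₀ (by positivity) (by positivity)]
      rw [abs_le] at h3
      nlinarith [sq_nonneg (ρ.im - t + (ρ.im - U)), h3.1, h3.2]
    calc _ ≤ zetaMult ρ * (x^(ρ.re-1/2) * (96/(1+(U-t)^2))) := by
          refine mul_le_mul_of_nonneg_left (this.trans ?_) (by positivity)
          gcongr
      _ = _ := by ring
  refine (norm_sum_le_of_le _ this).trans ?_
  rw [← Finset.mul_sum]
  calc _ ≤ 96/(1+(U-t)^2) * C := by gcongr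
    _ = _ := by ring


noncomputable def PP (x T t : ℝ) : ℂ := (Real.log T / x : ℝ) - ∑ n ∈ Finset.range (⌊T^4⌋₊+1), an x n * Complex.exp (-(t * Real.log n) * Complex.I)

lemma log_two_mul_le {T : ℝ} (hT : 8 ≤ T) : Real.log (2*T) ≤ 2 * Real.log T ∧ Real.log T ≤ Real.log (2*T) := by
  constructor
  · rw [Real.log_mul (by norm_num) (by linarith)]
    have := Real.log_le_log (by norm_num) (show (2:ℝ) ≤ T by linarith); linarith
  · exact Real.log_le_log (by linarith) (by linarith)

lemma dbl {T C : ℝ} (hT : 8 ≤ T) (hL : 8 ≤ Real.log T) (hC : 0 ≤ C) : C * √(2*T) * Real.log (2*T)^(1/4:ℝ) ≤ 4 * C * (√T * Real.log T^(1/4:ℝ)) := by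
  have h1 := (log_two_mul_le hT).1
  have h2 : Real.log (2*T)^(1/4:ℝ) ≤ 2 * Real.log T^(1/4:ℝ) := by
    refine (Real.rpow_le_rpow (Real.log_nonneg (by linarith)) h1 (by norm_num)).trans ?_
    rw [Real.mul_rpow (by norm_num) (by linarith)]
    gcongr
    calc (2:ℝ)^(1/4:ℝ) ≤ 2^(1:ℝ) := Real.rpow_le_rpow_of_exponent_le (by norm_num) (by norm_num)
      _ = 2 := by norm_num
  have h3 : √(2*T) ≤ 2 * √T := by
    rw [Real.sqrt_mul (by norm_num)]; gcongr
    rw [Real.sqrt_le_left (by norm_num)]; norm_num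
  have h4 : 0 ≤ Real.log (2*T)^(1/4:ℝ) := Real.rpow_nonneg (Real.log_nonneg (by linarith)) _
  calc _ ≤ C * (2 * √T) * (2 * Real.log T^(1/4:ℝ)) := by gcongr
    _ = _ := by ring

set_option maxHeartbeats 1000000 in
lemma contour : ∃ C : ℝ, 1 ≤ C ∧ ∀ T, 8 ≤ T → 8 ≤ Real.log T → ∃ U1 ∈ Icc T (T + 1), ∃ U2 ∈ Icc (2*T) (2*T+1),
    ∀ x ∈ Icc 1 T, ∀ B : Finset ℂ, (∀ ρ, ρ ∈ B ↔ ρ ∈ zeroBand T) → ∀ t, t ≠ U1 → t ≠ U2 →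
      ‖(∑ ρ ∈ B, (zetaMult ρ : ℂ) * hk x t ρ) - ind U1 U2 t * PP x T t‖ ≤
        C * (ind U1 U2 t + √T * Q1 (U1-t) (U2-t) + √T * Real.log T ^ (1/4:ℝ) * Q2 (U1-t) (U2-t)) := by
  classical
  obtain ⟨C1, hC1, hedge⟩ := edge
  obtain ⟨C2, hC2, hzs⟩ := zshift
  obtain ⟨C3, hC3, hright⟩ := right_bound
  obtain ⟨C4, hC4, hleft⟩ := left_bound
  refine ⟨C3 + 9 * C4 + 128 * C1 + 384 * C2, by linarith, fun T hT hL => ?_⟩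
  obtain ⟨U1, hU1, z1, E1⟩ := hedge T hT hL
  have hl2 := log_two_mul_le hT
  obtain ⟨U2, hU2, z2, E2⟩ := hedge (2*T) (by linarith) (by linarith)
  set L := Real.log T with hLd
  have hL0 : 0 < L := by linarith
  have hinv : 1/L ≤ 1/8 := by rw [div_le_div_iff₀ hL0 (by norm_num)]; linarith
  have hinv0 : 0 < 1/L := by positivity
  have hinv2 : 1/Real.log (2*T) ≤ 1/8 := by rw [div_le_div_iff₀ (by linarith) (by norm_num)]; linarith
  refine ⟨U1, ⟨hU1.1, by linarith [hU1.2]⟩, U2, ⟨hU2.1, by linarith [hU2.2]⟩, fun x hx B hB t ht1 ht2 => ?_⟩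
  have hU12 : U1 < U2 := by linarith [hU1.2, hU2.1]
  obtain ⟨Z, hZ, hres⟩ := residue (b := 1+1/L) (by linarith) (by linarith) (by linarith [hU1.1]) hU12 z1 z2
  have hx1 := hx.1
  have hx0 : 0 < x := by linarith
  have hkd : DifferentiableOn ℂ (hk x t) {z | -1/2 < z.re ∧ z.re < 3/2} := by
    intro z hz
    refine DifferentiableAt.differentiableWithinAt ?_
    unfold hk kk
    refine DifferentiableAt.mul (DifferentiableAt.div (by fun_prop) (by fun_prop) ?_) (by fun_prop)
    have hd := kk_den (w := z - (1/2 + t * Complex.I)) (p := 1) (by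
      rw [abs_lt]; simp; constructor <;> linarith [hz.1, hz.2])
    rw [show ((1:ℝ):ℂ)^2 - (z - (1/2 + t * Complex.I))^2 = ((1:ℝ) - (z - (1/2 + t * Complex.I))) * ((1:ℝ) + (z - (1/2 + t * Complex.I))) by ring]
    exact mul_ne_zero hd.1 hd.2
  have hR := hres (hk x t) hkd
  have bR := hright T x U1 U2 t hT hL hx hU12.le ht1 ht2
  have bL := hleft x U1 U2 t L (by linarith [hU1.1]) hx1 hU12.le ht1 ht2 hL0.le (by
    intro v hv
    have hT0 : 0 < T := by linarith
    have h1 : L ≤ Real.log v := Real.log_le_log hT0 (by linarith [hv.1, hU1.1])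
    have h2 : Real.log v ≤ Real.log (4 * T) := Real.log_le_log (by linarith [hv.1, hU1.1]) (by linarith [hv.2, hU2.2])
    rw [Real.log_mul (by norm_num) hT0.ne', show (4:ℝ) = 2^2 by norm_num, Real.log_pow] at h2
    have := Real.log_two_lt_d9
    push_cast at h2
    rw [abs_of_nonneg (by linarith)]; linarith)
  have b1 := hor (t := t) (b := 1+1/L) (c := 1+2/L) (by linarith) (by gcongr; norm_num) (by rw [show 2/L = 2*(1/L) by ring]; linarith) (by linarith [hU1.1]) hx1 z1 (E1 x hx)
  have b2 := hor (t := t) (b := 1+1/L) (c := 1+2/Real.log (2*T)) (by linarith) (by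
    gcongr 1 + ?_
    rw [div_le_div_iff₀ hL0 (by linarith)]; linarith) (by rw [show 2/Real.log (2*T) = 2*(1/Real.log (2*T)) by ring]; linarith) (by linarith [hU2.1]) hx1 z2 ((E2 x ⟨hx1, by linarith [hx.2]⟩).trans (dbl hT hL (by linarith)))
  have s1 := shift (U := U1) (t := t) hx1 (B \ Z) (by
    intro ρ hρ
    rw [Finset.mem_sdiff, hB, hZ] at hρ
    obtain ⟨⟨h1, h2, h3⟩, h4⟩ := hρ
    have : ρ.im ≤ U1 := by
      by_contra h; push Not at h; exact h4 ⟨h1, h, by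
        by_contra h'; push Not at h'
        have h5 : ρ.im = U2 := by linarith [hU2.1]
        exact z2 ρ.re ⟨by linarith [h1.2.1], by linarith [h1.2.2]⟩ (by rw [← h5, Complex.re_add_im]; exact h1.1)⟩
    exact ⟨h1, by rw [abs_le]; constructor <;> linarith [hU1.2]⟩) (hzs T hT hL (B \ Z) (by
    intro ρ hρ
    rw [Finset.mem_sdiff, hB, hZ] at hρ
    obtain ⟨⟨h1, h2, h3⟩, h4⟩ := hρ
    refine ⟨h1, h2.le, ?_⟩
    by_contra h; push Not at h; exact h4 ⟨h1, by linarith [hU1.2], by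
        by_contra h'; push Not at h'
        have h5 : ρ.im = U2 := by linarith [hU2.1]
        exact z2 ρ.re ⟨by linarith [h1.2.1], by linarith [h1.2.2]⟩ (by rw [← h5, Complex.re_add_im]; exact h1.1)⟩) x hx)
  have hZB : ∀ ρ ∈ Z \ B, IsNontrivialZero ρ ∧ 2*T < ρ.im ∧ ρ.im < U2 := by
    intro ρ hρ
    rw [Finset.mem_sdiff, hB, hZ] at hρ
    obtain ⟨⟨h1, h2, h3⟩, h4⟩ := hρ
    refine ⟨h1, ?_, h3⟩
    by_contra h; push Not at h
    exact h4 ⟨h1, by linarith [hU1.1], h⟩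
  have s2 := shift (U := U2) (t := t) hx1 (Z \ B) (by
    intro ρ hρ
    obtain ⟨h1, h2, h3⟩ := hZB ρ hρ
    exact ⟨h1, by rw [abs_le]; constructor <;> linarith [hU2.2]⟩) ((hzs (2*T) (by linarith) (by linarith) (Z \ B) (by
    intro ρ hρ
    obtain ⟨h1, h2, h3⟩ := hZB ρ hρ
    exact ⟨h1, h2.le, by linarith [hU2.2]⟩) x ⟨hx1, by linarith [hx.2]⟩).trans (dbl hT hL (by linarith)))
  have eBZ : ∑ ρ ∈ B, (zetaMult ρ : ℂ) * hk x t ρ = (∑ ρ ∈ Z, (zetaMult ρ : ℂ) * hk x t ρ) + (∑ ρ ∈ B \ Z, (zetaMult ρ : ℂ) * hk x t ρ) - ∑ ρ ∈ Z \ B, (zetaMult ρ : ℂ) * hk x t ρ := by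
    have h1 := Finset.sum_inter_add_sum_sdiff B Z (fun ρ => (zetaMult ρ : ℂ) * hk x t ρ)
    have h2 := Finset.sum_inter_add_sum_sdiff Z B (fun ρ => (zetaMult ρ : ℂ) * hk x t ρ)
    rw [← h1, ← h2, Finset.inter_comm]; ring
  rw [eBZ]
  unfold RB at hR
  unfold PP
  set SZ := ∑ ρ ∈ Z, (zetaMult ρ : ℂ) * hk x t ρ
  set SB := ∑ ρ ∈ B \ Z, (zetaMult ρ : ℂ) * hk x t ρ
  set SC := ∑ ρ ∈ Z \ B, (zetaMult ρ : ℂ) * hk x t ρ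
  rw [show (((-1/4:ℝ)):ℂ) = ((-1/4:ℝ):ℂ) from rfl] at hR
  set I1 := ∫ σ in (-1/4:ℝ)..(1+1/L), deriv riemannZeta (σ + U1 * Complex.I) / riemannZeta (σ + U1 * Complex.I) * hk x t (σ + U1 * Complex.I)
  set I2 := ∫ σ in (-1/4:ℝ)..(1+1/L), deriv riemannZeta (σ + U2 * Complex.I) / riemannZeta (σ + U2 * Complex.I) * hk x t (σ + U2 * Complex.I)
  set I3 := (∫ v in U1..U2, deriv riemannZeta ((1+1/L:ℝ) + v * Complex.I) / riemannZeta ((1+1/L:ℝ) + v * Complex.I) * hk x t ((1+1/L:ℝ) + v * Complex.I))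
  set I4 := (∫ v in U1..U2, deriv riemannZeta ((-1/4:ℝ) + v * Complex.I) / riemannZeta ((-1/4:ℝ) + v * Complex.I) * hk x t ((-1/4:ℝ) + v * Complex.I))
  set P := ∑ n ∈ Finset.range (⌊T^4⌋₊+1), (an x n : ℂ) * Complex.exp (-(t * Real.log n) * Complex.I)
  set δ := ind U1 U2 t
  have hI2 : Complex.I * Complex.I = -1 := Complex.I_mul_I
  have hpi : (Real.pi : ℂ) ≠ 0 := by exact_mod_cast Real.pi_ne_zero
  have key : SZ - δ * ((L/x : ℝ) - P) = (1/(2 * Real.pi)) * (-Complex.I * I1 + Complex.I * I2 + (I3 + δ * (2 * Real.pi) * P) - (I4 + δ * (2 * Real.pi) * (L / x : ℝ))) := by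
    have : 2 * (Real.pi:ℂ) * (SZ - δ * ((L/x : ℝ) - P)) = (-Complex.I * I1 + Complex.I * I2 + (I3 + δ * (2 * Real.pi) * P) - (I4 + δ * (2 * Real.pi) * (L / x : ℝ))) := by
      linear_combination Complex.I * hR + (2 * Real.pi * SZ - (I3 - I4)) * hI2
    rw [← this, ← mul_assoc, one_div, inv_mul_cancel₀ (by simp), one_mul]
  have e5 : SZ + SB - SC - δ * ((L/x : ℝ) - P) = (SZ - δ * ((L/x : ℝ) - P)) + SB - SC := by ring
  rw [e5, key]
  have hn2 : ‖(1/(2 * Real.pi) : ℂ)‖ ≤ 1 := by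
    rw [norm_div, norm_mul, Complex.norm_real, Real.norm_of_nonneg Real.pi_pos.le]
    simp only [norm_one, Complex.norm_ofNat]
    rw [div_le_one (by positivity)]; linarith [Real.pi_gt_three]
  have n1 : ‖-Complex.I * I1 + Complex.I * I2 + (I3 + δ * (2 * Real.pi) * P) - (I4 + δ * (2 * Real.pi) * (L / x : ℝ))‖ ≤ ‖I1‖ + ‖I2‖ + ‖I3 + δ * (2 * Real.pi) * P‖ + ‖I4 + δ * (2 * Real.pi) * (L / x : ℝ)‖ := by
    refine (norm_sub_le _ _).trans (add_le_add_left ((norm_add_le _ _).trans (add_le_add_left ((norm_add_le _ _).trans ?_) _)) _)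
    simp
  have n2 : ‖(1/(2 * Real.pi)) * (-Complex.I * I1 + Complex.I * I2 + (I3 + δ * (2 * Real.pi) * P) - (I4 + δ * (2 * Real.pi) * (L / x : ℝ)))‖ ≤ ‖I1‖ + ‖I2‖ + ‖I3 + δ * (2 * Real.pi) * P‖ + ‖I4 + δ * (2 * Real.pi) * (L / x : ℝ)‖ := by
    rw [norm_mul]
    exact (mul_le_of_le_one_left (norm_nonneg _) hn2).trans n1
  have n3 := (norm_sub_le ((1/(2 * Real.pi)) * (-Complex.I * I1 + Complex.I * I2 + (I3 + δ * (2 * Real.pi) * P) - (I4 + δ * (2 * Real.pi) * (L / x : ℝ))) + SB) SC).trans (add_le_add_left (norm_add_le _ _) _)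
  have hLT : 1 + L ≤ 9 * √T := by
    have h1 : L ≤ 2 * √T := by
      have := Real.log_le_sub_one_of_pos (Real.sqrt_pos.2 (show 0 < T by linarith))
      rw [Real.log_sqrt (by linarith)] at this; linarith
    have : 1 ≤ √T := Real.one_le_sqrt.2 (by linarith)
    linarith
  have q1n := Q1_nn (U1-t) (U2-t)
  have hQ2 : Q2 (U1-t) (U2-t) = 1/(1+(U1-t)^2) + 1/(1+(U2-t)^2) := rfl
  have i0 := (ind_le U1 U2 t).1
  set A := √T * L^(1/4:ℝ) with hA
  have hA0 : 0 ≤ A := by positivity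
  set q := Q1 (U1-t) (U2-t)
  set r1 := 1/(1+(U1-t)^2)
  set r2 := 1/(1+(U2-t)^2)
  have r1n : 0 ≤ r1 := by positivity
  have r2n : 0 ≤ r2 := by positivity
  rw [hQ2] at bR ⊢
  have m1 : C4 * (δ + (1+L)*q) ≤ 9 * C4 * (δ + √T * q) := by
    have : (1+L)*q ≤ 9 * √T * q := mul_le_mul_of_nonneg_right hLT q1n
    nlinarith [mul_nonneg (by linarith : 0 ≤ C4) i0]
  have hsT : 0 ≤ √T * q := by positivity
  have hAr1 : 0 ≤ A * r1 := by positivity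
  have hAr2 : 0 ≤ A * r2 := by positivity
  rw [mul_assoc C1, ← hA] at b1
  rw [mul_assoc C2, ← hA] at s1
  have hd0 : 0 ≤ δ + √T * q := by positivity
  have c1 : 0 ≤ C1 := by linarith
  have c2 : 0 ≤ C2 := by linarith
  have c4 : 0 ≤ C4 := by linarith
  nlinarith [mul_nonneg c1 hd0, mul_nonneg c2 hd0, mul_nonneg c1 hAr1, mul_nonneg c1 hAr2, mul_nonneg c2 hAr1, mul_nonneg c2 hAr2, mul_nonneg c4 hAr1, mul_nonneg c4 hAr2]


lemma kk_conv {a b : ℂ} (ha : |a.re| < 1/2) (hb : |b.re| < 1/2) :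
    Integrable (fun t : ℝ => kk 1 (a - t * Complex.I) * kk 1 (b - t * Complex.I)) ∧
    ∫ t : ℝ, kk 1 (a - t * Complex.I) * kk 1 (b - t * Complex.I) = 2 * Real.pi * kk 2 (b - a) := by
  have ha1 : |a.re| < 1 := by linarith
  have hb1 : |b.re| < 1 := by linarith
  have ia : Integrable (fun t : ℝ => kk 1 (a - t * Complex.I)) := by
    have := (kk_int (p := 1) ha1).comp_neg
    refine this.congr (ae_of_all _ fun t => ?_)
    simp [sub_eq_add_neg]
  have lb := fun t : ℝ => lap (p := 1) (w := b - t * Complex.I) (by simpa using hb1)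
  set F : ℝ → ℝ → ℂ := fun t y => kk 1 (a - t * Complex.I) * Complex.exp (-((1:ℝ) * |y| : ℝ) + (b - t * Complex.I) * y) with hF
  have lb0 := (lap (p := 1) (w := b) hb1).1
  have iF : Integrable (Function.uncurry F) (volume.prod volume) := by
    have h1 := ia.mul_prod lb0
    have h2 : Function.uncurry F = fun z : ℝ × ℝ => (kk 1 (a - z.1 * Complex.I) * Complex.exp (-((1:ℝ) * |z.2| : ℝ) + b * z.2)) * Complex.exp (-(z.1 * Complex.I) * z.2) := by
      ext z; simp only [Function.uncurry, hF]; rw [mul_assoc, ← Complex.exp_add]; congr 2; ring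
    rw [h2]
    refine h1.mul_bdd (c := 1) (by fun_prop) (ae_of_all _ fun z => ?_)
    simp [Complex.norm_exp]
  have e1 : ∀ t : ℝ, ∫ y, F t y = kk 1 (a - t * Complex.I) * kk 1 (b - t * Complex.I) := by
    intro t; simp only [hF]; rw [integral_const_mul, (lb t).2]
  have e2 : ∀ y : ℝ, ∫ t, F t y = 2 * Real.pi * Complex.exp (-((2:ℝ) * |y| : ℝ) + (b - a) * y) := by
    intro y
    have h3 : ∀ t : ℝ, F t y = Complex.exp (-((1:ℝ) * |y| : ℝ) + (b - a) * y) * (fun u : ℝ => kk 1 (a + u * Complex.I) * Complex.exp ((a + u * Complex.I) * y)) (-t) := by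
      intro t; simp only [hF]; push_cast
      rw [mul_left_comm, ← Complex.exp_add]; congr 2 <;> ring_nf
    simp_rw [h3]
    rw [integral_const_mul, integral_neg_eq_self (fun u : ℝ => kk 1 (a + u * Complex.I) * Complex.exp ((a + u * Complex.I) * y)), kk_inv (p := 1) ha1 y, Complex.ofReal_exp, mul_left_comm, ← Complex.exp_add]
    congr 2; push_cast; ring
  refine ⟨(iF.integral_prod_left).congr (ae_of_all _ fun t => e1 t), ?_⟩
  have l2 := (lap (p := 2) (w := b - a) (by rw [Complex.sub_re]; have := abs_sub a.re b.re; rw [abs_lt] at *; constructor <;> linarith [ha.1, ha.2, hb.1, hb.2])).2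
  rw [← integral_congr_ae (ae_of_all _ e1), integral_integral_swap iF, integral_congr_ae (ae_of_all _ e2), integral_const_mul, ← l2]

noncomputable def A1 (x : ℝ) (B : Finset ℂ) (t : ℝ) : ℂ := ∑ ρ ∈ B, (zetaMult ρ : ℂ) * hk x t ρ

lemma FFid {x T : ℝ} (hx : 1 ≤ x) {B : Finset ℂ} (hB : ∀ ρ, ρ ∈ B ↔ ρ ∈ zeroBand T) :
    Integrable (fun t => ‖A1 x B t‖^2) ∧ 2 * Real.pi * FF x T = ((∫ t, ‖A1 x B t‖^2 : ℝ) : ℂ) := by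
  classical
  have hre : ∀ ρ ∈ B, |(ρ - 1/2).re| < 1/2 := by
    intro ρ h; have := ((hB ρ).1 h).1
    rw [abs_lt]; simp; constructor <;> linarith [this.2.1, this.2.2]
  have hx0 : (x:ℂ) ≠ 0 := by exact_mod_cast (by linarith : x ≠ 0)
  set G : ℂ → ℂ → ℝ → ℂ := fun ρ ρ' t => ((zetaMult ρ : ℂ) * zetaMult ρ' * (x:ℂ)^(ρ-ρ')) * (kk 1 ((ρ - 1/2) - t * Complex.I) * kk 1 ((ρ' - 1/2) - t * Complex.I)) with hG
  have hrefl : ∀ ρ ∈ B, 1 - starRingEnd ℂ ρ ∈ B := by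
    intro ρ h
    have := (hB ρ).1 h
    exact (hB _).2 ⟨refl_zero this.1, by simpa using this.2.1, by simpa using this.2.2⟩
  have hpt : ∀ t : ℝ, ((‖A1 x B t‖^2 : ℝ) : ℂ) = ∑ ρ ∈ B, ∑ ρ' ∈ B, G ρ ρ' t := by
    intro t
    rw [Complex.ofReal_pow, ← Complex.mul_conj', A1, map_sum, Finset.sum_mul]
    refine Finset.sum_congr rfl fun ρ hρ => ?_
    rw [Finset.mul_sum]
    refine Finset.sum_bij' (fun ρ _ => 1 - starRingEnd ℂ ρ) (fun ρ _ => 1 - starRingEnd ℂ ρ) hrefl hrefl (by simp) (by simp) fun ρ' hρ' => ?_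
    simp only [hG]
    rw [refl_mult ((hB ρ').1 hρ').1, map_mul, Complex.conj_natCast]
    have e : starRingEnd ℂ (hk x t ρ') = kk 1 ((1 - starRingEnd ℂ ρ' - 1/2) - t * Complex.I) * Complex.exp ((starRingEnd ℂ ρ' - 1/2 + t * Complex.I) * Real.log x) := by
      unfold hk kk
      rw [map_mul, ← Complex.exp_conj]
      simp only [map_div₀, map_mul, map_sub, map_add, map_pow, Complex.conj_ofReal, Complex.conj_I, map_one, map_ofNat]
      congr 2 <;> ring
    rw [e, hk, Complex.cpow_def_of_ne_zero hx0, ← Complex.ofReal_log (by linarith)]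
    have e3 : Complex.exp (Real.log x * (ρ - (1 - starRingEnd ℂ ρ'))) = Complex.exp ((ρ - (1/2 + t * Complex.I)) * Real.log x) * Complex.exp ((starRingEnd ℂ ρ' - 1/2 + t * Complex.I) * Real.log x) := by
      rw [← Complex.exp_add]; congr 1; ring
    rw [e3, show ρ - (1/2 + t * Complex.I) = ρ - 1/2 - t * Complex.I by ring]; ring
  have hint : ∀ ρ ∈ B, ∀ ρ' ∈ B, Integrable (G ρ ρ') := fun ρ h ρ' h' => (kk_conv (hre ρ h) (hre ρ' h')).1.const_mul _
  have hI : Integrable (fun t => ((‖A1 x B t‖^2 : ℝ) : ℂ)) := by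
    refine (integrable_finsetSum B fun ρ h => integrable_finsetSum B fun ρ' h' => hint ρ h ρ' h').congr (ae_of_all _ fun t => ?_)
    simp only [hpt]
  refine ⟨hI.re.congr (ae_of_all _ fun t => Complex.ofReal_re _), ?_⟩
  rw [← integral_complex_ofReal]
  simp_rw [hpt]
  rw [integral_finsetSum B fun ρ h => integrable_finsetSum B fun ρ' h' => hint ρ h ρ' h']
  have hBs : zeroBand T = (B : Set ℂ) := by ext ρ; exact (hB ρ).symm
  unfold FF
  rw [hBs, finsum_mem_coe_finset, Finset.mul_sum]
  refine Finset.sum_congr rfl fun ρ h => ?_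
  rw [finsum_mem_coe_finset, Finset.mul_sum, integral_finsetSum B fun ρ' h' => hint ρ h ρ' h']
  refine Finset.sum_congr rfl fun ρ' h' => ?_
  simp only [hG]
  rw [integral_const_mul, (kk_conv (hre ρ h) (hre ρ' h')).2, Wweight, kk]
  push_cast
  rw [show ρ' - 1/2 - (ρ - 1/2) = -(ρ - ρ') by ring, neg_sq]
  norm_num; ring


lemma tfo {σ : ℝ} (hs : 1 < σ) (t : ℝ) : 0 ≤ 3 * SL σ + 4 * (-(deriv riemannZeta (σ + t * Complex.I) / riemannZeta (σ + t * Complex.I))).re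
    + (-(deriv riemannZeta (σ + (2*t:ℝ) * Complex.I) / riemannZeta (σ + (2*t:ℝ) * Complex.I))).re := by
  have h : ∀ u : ℝ, HasSum (fun n : ℕ => Λ n * (n:ℝ)^(-σ) * Real.cos (u * Real.log n)) (-(deriv riemannZeta (σ + u * Complex.I) / riemannZeta (σ + u * Complex.I))).re := by
    intro u
    refine (Complex.hasSum_re (mang_sum (s := σ + u * Complex.I) (by simpa using hs))).congr_fun fun n => ?_
    rcases Nat.eq_zero_or_pos n with rfl | hn
    · simp
    rw [Complex.re_ofReal_mul, Complex.cpow_def_of_ne_zero (by exact_mod_cast hn.ne'), Complex.exp_re, ← Complex.natCast_log, Real.rpow_def_of_pos (by exact_mod_cast hn), mul_assoc]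
    simp [mul_comm, -Complex.natCast_log]
  refine HasSum.nonneg (fun n => ?_) ((((SL_sum hs).1.mul_left 3).add ((h t).mul_left 4)).add (h (2*t)))
  have h1 : 0 ≤ Λ n * (n:ℝ)^(-σ) := mul_nonneg ArithmeticFunction.vonMangoldt_nonneg (by positivity)
  rw [mul_assoc 2, Real.cos_two_mul]
  nlinarith [mul_nonneg h1 (sq_nonneg (Real.cos (t * Real.log n) + 1))]

lemma re_low {T r : ℝ} (hT : 3 ≤ T) (h0 : 0 < r) (h1 : r ≤ 1) :
    -(CL * Real.log T) ≤ (deriv riemannZeta ((1+r:ℝ) + T * Complex.I) / riemannZeta ((1+r:ℝ) + T * Complex.I)).re ∧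
    ∀ β : ℝ, 1/4 ≤ β → β ≤ 1 → riemannZeta (β + T * Complex.I) = 0 → 1/(1+r-β) - CL * Real.log T ≤ (deriv riemannZeta ((1+r:ℝ) + T * Complex.I) / riemannZeta ((1+r:ℝ) + T * Complex.I)).re := by
  set z : ℂ := ((1 + r : ℝ) : ℂ) + T * Complex.I
  have zr : z.re = 1 + r := by simp [z]
  have zi : z.im = T := by simp [z]
  have hzd : z - (2 + T * Complex.I) = ((r - 1 : ℝ) : ℂ) := by simp only [z]; push_cast; ring
  have hn : ‖z - (2 + T * Complex.I)‖ ≤ 1 := by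
    rw [hzd, Complex.norm_real, Real.norm_eq_abs, abs_le]; constructor <;> linarith
  have h4 := congrArg Complex.re (ZL_log hT (by rw [mem_ball_iff_norm]; linarith) (riemannZeta_ne_zero_of_one_le_re (s := z) (by rw [zr]; linarith)))
  rw [Complex.add_re, Complex.re_sum] at h4
  simp only [re_term, zr, zi] at h4
  have h9 := (abs_le.mp ((Complex.abs_re_le_norm (GZ T z)).trans (GZ_bd hT (by rw [mem_closedBall_iff_norm]; linarith)))).1
  have hp : ∀ ρ ∈ ZL T, 0 ≤ (zetaMult ρ:ℝ) * ((1 + r - ρ.re) / ((1 + r - ρ.re)^2 + (T - ρ.im)^2)) := by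
    intro ρ hρ
    have : 0 ≤ 1 + r - ρ.re := by linarith [(ZL_re hT hρ).1]
    positivity
  refine ⟨by linarith [Finset.sum_nonneg hp], fun β hb hb1 hz => ?_⟩
  set ρ : ℂ := β + T * Complex.I
  have hm : ρ ∈ ZL T := (ZL_mem hT).2 ⟨by
    rw [show ρ - (2 + T * Complex.I) = ((β - 2 : ℝ) : ℂ) by simp only [ρ]; push_cast; ring, Complex.norm_real, Real.norm_eq_abs, abs_le]; constructor <;> linarith, hz⟩
  have h5 := Finset.single_le_sum hp hm
  have hm1 : (1:ℝ) ≤ zetaMult ρ := by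
    exact_mod_cast (zetaMult_pos (by intro h; have := congrArg Complex.im h; simp [ρ] at this; linarith)).2 hz
  have rr : ρ.re = β := by simp [ρ]
  have ri : ρ.im = T := by simp [ρ]
  rw [rr, ri, sub_self, zero_pow (by norm_num), add_zero] at h5
  have hd : 0 < 1 + r - β := by linarith
  have h6 : (1 + r - β) / (1 + r - β)^2 = 1/(1+r-β) := by field_simp
  rw [h6] at h5
  have : 0 ≤ 1/(1+r-β) := by positivity
  nlinarith

lemma zfr : ∃ c : ℝ, 0 < c ∧ c ≤ 1/8 ∧ ∀ ρ : ℂ, riemannZeta ρ = 0 → 3 ≤ ρ.im → ρ.re ≤ 1 - c / Real.log ρ.im := by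
  obtain ⟨C, hC, h⟩ := SL_le
  have h1 := CL_one
  set K := 3 * C + 6 * CL with hK
  have hK9 : 9 ≤ K := by linarith
  refine ⟨1/(14*K), by positivity, by rw [div_le_div_iff₀ (by positivity) (by norm_num)]; linarith, fun ρ hz hT => ?_⟩
  set l := Real.log ρ.im with hl
  have hl1 : 1 ≤ l := log_ge_one hT
  have hKl : 9 ≤ K * l := by nlinarith
  have e1 : 1/(14*K)/l = 1/(14*(K*l)) := by field_simp
  rw [e1]
  have hs : 1/(14*(K*l)) ≤ 1/2 := by rw [div_le_div_iff₀ (by positivity) (by norm_num)]; linarith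
  by_cases hb : 1/4 ≤ ρ.re
  swap
  · linarith
  have hlt : ρ.re < 1 := by
    by_contra h2; push Not at h2; exact riemannZeta_ne_zero_of_one_le_re h2 hz
  set r := 1/(2*(K*l)) with hr
  have hr0 : 0 < r := by positivity
  have hr1 : r ≤ 1 := by rw [hr, div_le_one (by positivity)]; linarith
  have a1 := tfo (σ := 1 + r) (by linarith) ρ.im
  have a2 := h r hr0 hr1
  have a3 := (re_low (T := 2*ρ.im) (by linarith) hr0 hr1).1
  have a4 := (re_low hT hr0 hr1).2 ρ.re hb hlt.le (by rw [Complex.re_add_im]; exact hz)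
  have a5 : Real.log (2*ρ.im) ≤ 2 * l := by
    rw [Real.log_mul (by norm_num) (by linarith)]
    have := Real.log_le_log (by norm_num) (show (2:ℝ) ≤ ρ.im by linarith); linarith
  rw [Complex.neg_re, Complex.neg_re] at a1
  have a6 : CL * Real.log (2*ρ.im) ≤ CL * (2*l) := by gcongr
  have e2 : 1/r = 2*(K*l) := by rw [hr]; field_simp
  have a7 : 4 * (1/(1+r-ρ.re)) ≤ 7 * (K*l) := by
    rw [e2] at a2
    have : K * l = 3 * C * l + 6 * CL * l := by rw [hK]; ring
    nlinarith
  have hd : 0 < 1 + r - ρ.re := by linarith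
  rw [mul_one_div, div_le_iff₀ hd] at a7
  by_contra hc; push Not at hc
  have e3 : (K*l) * r = 1/2 := by rw [hr]; field_simp
  have e4 : (K*l) * (1/(14*(K*l))) = 1/14 := by field_simp
  have : (K*l) * (1 - ρ.re) < (K*l) * (1/(14*(K*l))) := by
    apply mul_lt_mul_of_pos_left _ (by positivity); linarith
  nlinarith


lemma zl_bd : ∃ c C : ℝ, 0 < c ∧ c ≤ 1/8 ∧ 1 ≤ C ∧ ∀ s : ℂ, 5 ≤ |s.im| → 1 - c / Real.log |s.im| ≤ s.re → s.re ≤ 3 →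
    riemannZeta s ≠ 0 ∧ ‖deriv riemannZeta s / riemannZeta s‖ ≤ C * Real.log |s.im|^2 := by
  obtain ⟨c0, h0, h8, hz⟩ := zfr
  have hCL := CL_one
  have main : ∀ s : ℂ, 5 ≤ s.im → 1 - (c0/4) / Real.log s.im ≤ s.re → s.re ≤ 3 →
    riemannZeta s ≠ 0 ∧ ‖deriv riemannZeta s / riemannZeta s‖ ≤ (CL * 4 / c0 + CL) * Real.log s.im^2 := by
    intro s h5 hre h3
    have hT : 3 ≤ s.im := by linarith
    set l := Real.log s.im with hl
    have hl1 : 1 ≤ l := log_ge_one hT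
    have hc : 0 < c0 / l := by positivity
    have e4 : c0/4/l = (c0/l)/4 := by ring
    rw [e4] at hre
    have hcl : c0 / l ≤ 1/8 := by rw [div_le_iff₀ (by linarith)]; nlinarith
    have n0 : riemannZeta s ≠ 0 := fun h => by have := hz s h hT; rw [← hl] at this; linarith
    refine ⟨n0, ?_⟩
    have hn : ‖s - (2 + s.im * Complex.I)‖ ≤ 13/8 := by
      rw [show s - (2 + s.im * Complex.I) = ((s.re - 2 : ℝ) : ℂ) by nth_rw 1 [← Complex.re_add_im s]; push_cast; ring, Complex.norm_real, Real.norm_eq_abs, abs_le]; constructor <;> linarith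
    rw [ZL_log hT (by rw [mem_ball_iff_norm]; linarith) n0]
    have g := GZ_bd hT (mem_closedBall_iff_norm.2 hn)
    have hs : ‖∑ ρ ∈ ZL s.im, (zetaMult ρ : ℂ) / (s - ρ)‖ ≤ ∑ ρ ∈ ZL s.im, (zetaMult ρ : ℝ) * (4 * l / c0) := by
      refine norm_sum_le_of_le _ fun ρ hρ => ?_
      obtain ⟨b1, b2, b3⟩ := ZL_re hT hρ
      rw [abs_le] at b3
      have hi : 3 ≤ ρ.im := by linarith [b3.1]
      have k := hz ρ ((ZL_mem hT).1 hρ).2 hi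
      have k2 : Real.log ρ.im ≤ 2 * l := by
        rw [hl, ← Real.log_rpow (by linarith)]
        refine Real.log_le_log (by linarith) ?_
        rw [show (2:ℝ) = (2:ℕ) by norm_num, Real.rpow_natCast]; nlinarith [b3.2]
      have k3 : c0/l/2 ≤ c0 / Real.log ρ.im := by
        rw [div_div]; exact div_le_div_of_nonneg_left h0.le (by linarith [log_ge_one hi]) (by linarith)
      have k4 : c0/l/4 ≤ ‖s - ρ‖ := by
        have := (le_abs_self _).trans (Complex.abs_re_le_norm (s - ρ))
        rw [Complex.sub_re] at this; linarith
      rw [norm_div, Complex.norm_natCast, div_eq_mul_inv]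
      refine mul_le_mul_of_nonneg_left ?_ (by positivity)
      calc ‖s-ρ‖⁻¹ ≤ (c0/l/4)⁻¹ := inv_anti₀ (by positivity) k4
        _ = _ := by field_simp
    rw [← Finset.sum_mul] at hs
    have h6 := mul_le_mul_of_nonneg_right (ZL_sum hT) (show 0 ≤ 4 * l / c0 by positivity)
    have h7 : CL * l ≤ CL * l^2 := mul_le_mul_of_nonneg_left (by nlinarith) (by linarith)
    refine (norm_add_le _ _).trans ((add_le_add (hs.trans h6) g).trans ?_)
    rw [show CL * Real.log s.im * (4*l/c0) = CL*4/c0*l^2 by rw [← hl]; ring]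
    rw [← hl]; linarith
  refine ⟨c0/4, CL*4/c0 + CL, by positivity, by linarith, by have : 0 ≤ CL*4/c0 := (by positivity); linarith, fun s h5 h1 h3 => ?_⟩
  rcases le_total 0 s.im with h | h
  · rw [abs_of_nonneg h] at *; exact main s h5 h1 h3
  · rw [abs_of_nonpos h] at *
    have := main (starRingEnd ℂ s) (by simpa using h5) (by simpa using h1) (by simpa using h3)
    rw [conj_logderiv, riemannZeta_conj, Complex.norm_conj] at this
    simpa using this

noncomputable def Wf (s : ℂ) : ℂ := deriv riemannZeta₁ s / riemannZeta₁ s * kk 2 (s - 1)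

lemma Wf_diff {s : ℂ} (h0 : riemannZeta₁ s ≠ 0) (h : |s.re - 1| < 2) : DifferentiableAt ℂ Wf s := by
  unfold Wf
  refine DifferentiableAt.mul (DifferentiableAt.div ?_ (differentiable_riemannZeta₁ s) h0) ?_
  · exact (differentiable_riemannZeta₁.contDiff (n := 2)).differentiable_deriv_two s
  · unfold kk
    refine DifferentiableAt.div (by fun_prop) (by fun_prop) ?_
    have hd := kk_den (w := s - 1) (p := 2) (by simpa using h)
    rw [show ((2:ℝ):ℂ)^2 - (s-1)^2 = ((2:ℝ) - (s-1)) * ((2:ℝ) + (s-1)) by ring]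
    exact mul_ne_zero hd.1 hd.2

set_option maxHeartbeats 1000000 in
lemma Wf_bd : ∃ C : ℝ, 1 ≤ C ∧ ∀ σ ∈ Icc (1:ℝ) (3/2), ∀ v : ℝ, DifferentiableAt ℂ Wf (σ + v * Complex.I) ∧
    ‖Wf (σ + v * Complex.I)‖ ≤ C * (1+v^2)^(-(3/4):ℝ) ∧ ‖deriv Wf (σ + v * Complex.I)‖ ≤ C * (1+v^2)^(-(3/4):ℝ) := by
  obtain ⟨c, C, hc, hc8, hC, hb⟩ := zl_bd
  set U : Set ℂ := {s | riemannZeta₁ s ≠ 0} ∩ {s | |s.re - 1| < 2}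
  have hU : IsOpen U := (isOpen_ne_fun differentiable_riemannZeta₁.continuous continuous_const).inter (isOpen_lt (by fun_prop) continuous_const)
  have hW : DifferentiableOn ℂ Wf U := fun s hs => (Wf_diff hs.1 hs.2).differentiableWithinAt
  set K : Set ℂ := Icc (1:ℝ) (3/2) ×ℂ Icc (-6:ℝ) 6
  have hK : IsCompact K := isCompact_Icc.reProdIm isCompact_Icc
  have hKU : K ⊆ U := by
    intro s hs
    obtain ⟨h1, h2⟩ := Complex.mem_reProdIm.1 hs
    exact ⟨z1_ne h1.1, by show |s.re - 1| < 2; rw [abs_lt]; constructor <;> linarith [h1.1, h1.2]⟩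
  obtain ⟨M1, hM1⟩ := hK.exists_bound_of_continuousOn (hW.continuousOn.mono hKU)
  obtain ⟨M2, hM2⟩ := hK.exists_bound_of_continuousOn ((hW.analyticOnNhd hU).deriv.continuousOn.mono hKU)
  set A := (4 * C + 1) * 16 * (2 / c) * 1728 with hA
  have hA0 : 0 < A := by positivity
  refine ⟨37 * (|M1| + |M2|) + A + 1, by linarith [abs_nonneg M1, abs_nonneg M2], fun σ hσ v => ?_⟩
  set s : ℂ := σ + v * Complex.I
  have sr : s.re = σ := by simp [s]
  have si : s.im = v := by simp [s]
  refine ⟨Wf_diff (z1_ne (by rw [sr]; exact hσ.1)) (by rw [sr, abs_lt]; constructor <;> linarith [hσ.1, hσ.2]), ?_⟩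
  set q := (1+v^2)^(-(3/4):ℝ) with hq
  have q0 : 0 < q := by positivity
  rcases le_or_gt |v| 6 with hv | hv
  · rw [abs_le] at hv
    have hs : s ∈ K := Complex.mem_reProdIm.2 ⟨by rw [sr]; exact hσ, by rw [si]; exact hv⟩
    have h1 := (hM1 s hs).trans (le_abs_self _)
    have h2 := (hM2 s hs).trans (le_abs_self _)
    have h3 : 1 ≤ 37 * q := by
      have : (37:ℝ)^(-1:ℝ) ≤ q := by
        refine le_trans ?_ (Real.rpow_le_rpow_of_nonpos (by positivity) (show 1 + v^2 ≤ 37 by nlinarith) (by norm_num))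
        exact Real.rpow_le_rpow_of_exponent_le (by norm_num) (by norm_num)
      rw [Real.rpow_neg_one] at this; linarith
    have m1 := abs_nonneg M1
    have m2 := abs_nonneg M2
    have aq : 0 ≤ A * q := by positivity
    constructor
    · nlinarith [mul_nonneg m2 q0.le]
    · nlinarith [mul_nonneg m1 q0.le]
  · set l := Real.log |v| with hl
    have hl1 : 1 ≤ l := log_ge_one (by linarith)
    set r := c / (2*l) with hr
    have r0 : 0 < r := by positivity
    have r8 : r ≤ 1/8 := by rw [hr, div_le_iff₀ (by positivity)]; nlinarith
    have hz : ∀ z ∈ Metric.closedBall s r, z ∈ U ∧ ‖Wf z‖ ≤ (4*C+1) * 16 * l^2 / (1+v^2) := by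
      intro z hz
      rw [mem_closedBall_iff_norm] at hz
      have a1 := abs_le.1 ((Complex.abs_re_le_norm (z - s)).trans hz)
      have a2 := (Complex.abs_im_le_norm (z - s)).trans hz
      rw [Complex.sub_re, sr] at a1
      rw [Complex.sub_im, si] at a2
      have a3 := (abs_sub_abs_le_abs_sub v z.im).trans ((abs_sub_comm _ _).le.trans a2)
      have a4 := (abs_sub_abs_le_abs_sub z.im v).trans a2
      have a5 : 5 ≤ |z.im| := by linarith
      have a6 : Real.log |z.im| ≤ 2 * l := by
        rw [hl, ← Real.log_rpow (by linarith)]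
        refine Real.log_le_log (by linarith) ?_
        rw [show (2:ℝ) = (2:ℕ) by norm_num, Real.rpow_natCast]; nlinarith
      have a7 : 1 ≤ Real.log |z.im| := log_ge_one (by linarith)
      have a8 : r ≤ c / Real.log |z.im| := div_le_div_of_nonneg_left hc.le (by linarith) a6
      obtain ⟨b1, b2⟩ := hb z a5 (by linarith [a1.1, hσ.1]) (by linarith [a1.2, hσ.2])
      have z1 : z ≠ 1 := by rintro rfl; norm_num at a5
      have b3 := z_logderiv z1 b1
      have hz0 : riemannZeta₁ z ≠ 0 := by intro h; rw [riemannZeta_eq_inv_sub_mul z1, h, mul_zero] at b1; exact b1 rfl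
      have hre : |z.re - 1| ≤ 1 := by rw [abs_le]; constructor <;> linarith [hσ.1, hσ.2, a1.1, a1.2]
      refine ⟨⟨hz0, by show |z.re - 1| < 2; linarith⟩, ?_⟩
      have b4 : ‖deriv riemannZeta₁ z / riemannZeta₁ z‖ ≤ (4*C+1) * l^2 := by
        have e : deriv riemannZeta₁ z / riemannZeta₁ z = deriv riemannZeta z / riemannZeta z + 1/(z-1) := by rw [b3]; ring
        have n1 : ‖1/(z-1)‖ ≤ 1 := by
          have := Complex.abs_im_le_norm (z-1)
          simp only [Complex.sub_im, Complex.one_im, sub_zero] at this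
          rw [norm_div, norm_one, div_le_one (by linarith)]; linarith
        rw [e]
        have : C * Real.log |z.im|^2 ≤ C * (2*l)^2 := by gcongr
        refine (norm_add_le _ _).trans ((add_le_add (b2.trans this) n1).trans ?_)
        nlinarith
      have b5 : ‖kk 2 (z-1)‖ ≤ 16/(1+v^2) := by
        refine (kk_norm (by simp only [Complex.sub_re, Complex.one_re]; linarith)).trans ?_
        simp only [Complex.sub_re, Complex.one_re, Complex.sub_im, Complex.one_im, sub_zero]
        have : v^2 ≤ 4 * z.im^2 := by rw [← sq_abs v, ← sq_abs z.im]; nlinarith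
        rw [div_le_div_iff₀ (by nlinarith) (by positivity)]
        nlinarith
      rw [Wf, norm_mul]
      refine (mul_le_mul b4 b5 (norm_nonneg _) (by positivity)).trans (le_of_eq (by ring))
    have hd := Complex.norm_deriv_le_of_forall_mem_sphere_norm_le r0 (f := Wf) (c := s) ((DifferentiableOn.mono hW (by
        rw [closure_ball _ r0.ne']; exact fun z h => (hz z h).1)).diffContOnCl) (fun z h => (hz z (Metric.sphere_subset_closedBall h)).2)
    have hs := (hz s (Metric.mem_closedBall_self r0.le)).2
    have hlb : l ^ 3 ≤ 1728 * (1+v^2)^(1/4:ℝ) := by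
      have h1 : l ≤ (1+v^2)^(1/12:ℝ)/(1/12) := (Real.log_le_log (by linarith) (by rw [← sq_abs v]; nlinarith)).trans (Real.log_le_rpow_div (by positivity) (by norm_num))
      refine (pow_le_pow_left₀ (by linarith) h1 3).trans (le_of_eq ?_)
      rw [div_pow, ← Real.rpow_natCast, ← Real.rpow_mul (by positivity)]; norm_num; ring
    have e1 : (1+v^2)^(1/4:ℝ) / (1+v^2) = q := by
      rw [hq, show (-(3/4):ℝ) = 1/4 - 1 by norm_num, Real.rpow_sub_one (by positivity)]
    have hB : (4*C+1) * 16 * l^2 / (1+v^2) / r ≤ A * q := by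
      rw [← e1, hA, hr]
      rw [show (4*C+1) * 16 * l^2 / (1+v^2) / (c/(2*l)) = (4*C+1)*16*(2/c) * (l^3) / (1+v^2) by field_simp]
      calc _ ≤ (4*C+1)*16*(2/c) * (1728 * (1+v^2)^(1/4:ℝ)) / (1+v^2) := by gcongr
        _ = _ := by ring
    have hB0 : 0 ≤ (4*C+1) * 16 * l^2 / (1+v^2) := by positivity
    have hr1 : (4*C+1) * 16 * l^2 / (1+v^2) ≤ (4*C+1) * 16 * l^2 / (1+v^2) / r := by
      rw [le_div_iff₀ r0]; nlinarith
    have mq : 0 ≤ (37 * (|M1| + |M2|) + 1) * q := by positivity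
    constructor <;> nlinarith


lemma polar {ε l : ℝ} (h0 : 0 < ε) (h1 : ε ≤ 1) (hl : 0 ≤ l) :
    Integrable (fun u : ℝ => 1/(ε + u * Complex.I) * kk 2 (ε + u * Complex.I) * Complex.exp ((ε + u * Complex.I) * l)) ∧
    ∫ u : ℝ, 1/(ε + u * Complex.I) * kk 2 (ε + u * Complex.I) * Complex.exp ((ε + u * Complex.I) * l) = 2 * Real.pi * ((1 - Real.exp (-(2*l))/2 : ℝ) : ℂ) := by
  have he : |(ε:ℂ).re| < 2 := by rw [Complex.ofReal_re, abs_of_pos h0]; linarith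
  set F : ℝ → ℝ → ℂ := fun u r => kk 2 (ε + u * Complex.I) * Complex.exp ((ε + u * Complex.I) * (l - r : ℝ)) with hF
  have i1 : IntegrableOn (fun r : ℝ => Complex.exp ((-ε:ℂ) * r)) (Ioi 0) := integrableOn_exp_mul_complex_Ioi (by simpa using h0) 0
  have iF : Integrable (Function.uncurry F) (volume.prod (volume.restrict (Ioi 0))) := by
    have h2 : Function.uncurry F = fun z : ℝ × ℝ => (kk 2 (ε + z.1 * Complex.I) * Complex.exp ((-ε:ℂ) * z.2)) * Complex.exp (ε * l + z.1 * (l - z.2) * Complex.I) := by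
      ext z; simp only [Function.uncurry, hF]; rw [mul_assoc, ← Complex.exp_add]; congr 2; push_cast; ring
    rw [h2]
    refine ((kk_int he).mul_prod i1).mul_bdd (c := Real.exp (ε*l)) (by fun_prop) (ae_of_all _ fun z => ?_)
    simp [Complex.norm_exp]
  have e1 : ∀ u : ℝ, ∫ r in Ioi (0:ℝ), F u r = 1/(ε + u * Complex.I) * kk 2 (ε + u * Complex.I) * Complex.exp ((ε + u * Complex.I) * l) := by
    intro u
    have h3 : ∀ r : ℝ, F u r = (kk 2 (ε + u * Complex.I) * Complex.exp ((ε + u * Complex.I) * l)) * Complex.exp (-(ε + u * Complex.I) * r) := by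
      intro r; simp only [hF]; rw [mul_assoc, ← Complex.exp_add]; congr 2; push_cast; ring
    simp_rw [h3]
    rw [integral_const_mul, integral_exp_mul_complex_Ioi (by simpa using h0)]
    rw [Complex.ofReal_zero, mul_zero, Complex.exp_zero, neg_div_neg_eq]; ring
  have e2 : ∀ r : ℝ, ∫ u, F u r = 2 * Real.pi * ((Real.exp (-(2*|l - r|)) : ℝ) : ℂ) := fun r => kk_inv he (l - r)
  refine ⟨iF.integral_prod_left.congr (ae_of_all _ e1), ?_⟩
  rw [← integral_congr_ae (ae_of_all _ e1), integral_integral_swap iF]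
  simp_rw [e2]
  rw [integral_const_mul, integral_complex_ofReal]
  congr 2
  have lp := lap (p := 2) (w := 0) (by norm_num)
  have l1 : Integrable (fun y : ℝ => Real.exp (-(2*|y|))) := by
    refine lp.1.re.congr (ae_of_all _ fun y => ?_)
    simp only [zero_mul, add_zero]; rw [← Complex.ofReal_neg, ← Complex.ofReal_exp]; exact Complex.ofReal_re _
  have l2 : ∫ y : ℝ, Real.exp (-(2*|y|)) = 1 := by
    have := lp.2
    simp only [zero_mul, add_zero, kk] at this
    simp_rw [← Complex.ofReal_neg, ← Complex.ofReal_exp] at this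
    rw [integral_complex_ofReal] at this
    norm_num at this; exact_mod_cast this
  have l3 : Integrable (fun r : ℝ => Real.exp (-(2*|l - r|))) := l1.comp_sub_left l
  have l4 := integral_add_compl (measurableSet_Ioi (a := (0:ℝ))) l3
  rw [integral_sub_left_eq_self (fun y : ℝ => Real.exp (-(2*|y|))) volume l, l2, compl_Ioi] at l4
  have l5 : ∫ r in Iic (0:ℝ), Real.exp (-(2*|l - r|)) = Real.exp (-(2*l))/2 := by
    have : ∀ r ∈ Iic (0:ℝ), Real.exp (-(2*|l - r|)) = Real.exp (-(2*l)) * Real.exp (2 * r) := by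
      intro r hr
      rw [abs_of_nonneg (by linarith [mem_Iic.1 hr]), ← Real.exp_add]; congr 1; ring
    rw [setIntegral_congr_fun measurableSet_Iic this, integral_const_mul, integral_exp_mul_Iic (by norm_num)]
    simp; ring
  linarith

lemma Wint : ∃ C : ℝ, 1 ≤ C ∧ ∀ l, 2 ≤ l → Integrable (fun u : ℝ => Wf ((1+1/l:ℝ) + u * Complex.I) * Complex.exp (((1/l:ℝ) + u * Complex.I) * l)) ∧
    ‖∫ u : ℝ, Wf ((1+1/l:ℝ) + u * Complex.I) * Complex.exp (((1/l:ℝ) + u * Complex.I) * l)‖ ≤ C / l := by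
  obtain ⟨C, hC, hW⟩ := Wf_bd
  have iq : Integrable (fun v : ℝ => (1+v^2)^(-(3/4):ℝ)) := by
    have := integrable_rpow_neg_one_add_norm_sq (E := ℝ) (μ := volume) (r := 3/2) (by norm_num)
    refine this.congr (ae_of_all _ fun v => ?_)
    simp only [Real.norm_eq_abs, sq_abs]; norm_num
  set J := ∫ v : ℝ, (1+v^2)^(-(3/4):ℝ) with hJ
  have hJ0 : 0 ≤ J := integral_nonneg fun v => by positivity
  refine ⟨C * Real.exp 1 * J + 1, by have : 0 ≤ C * Real.exp 1 * J := (by positivity); linarith, fun l hl => ?_⟩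
  have hσ : (1+1/l:ℝ) ∈ Icc (1:ℝ) (3/2) := by
    have h1 : 1/l ≤ 1/2 := one_div_le_one_div_of_le (by norm_num) hl
    have h2 : 0 < 1/l := by positivity
    constructor <;> linarith
  have hd := hW _ hσ
  set G : ℝ → ℂ := fun u => Wf ((1+1/l:ℝ) + u * Complex.I)
  set G' : ℝ → ℂ := fun u => deriv Wf ((1+1/l:ℝ) + u * Complex.I) * Complex.I
  set E : ℝ → ℂ := fun u => Complex.exp (((1/l:ℝ) + u * Complex.I) * l)
  have hE : ∀ u, ‖E u‖ = Real.exp 1 := by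
    intro u; simp only [E, Complex.norm_exp]; congr 1; simp; field_simp
  have dG : ∀ u, HasDerivAt G (G' u) u := fun u => by
    have h1 : HasDerivAt (fun u : ℝ => (((1+1/l:ℝ):ℂ) + u * Complex.I)) Complex.I u := by
      simpa using ((Complex.ofRealCLM.hasDerivAt (x := u)).mul_const Complex.I).const_add (((1+1/l:ℝ):ℂ))
    exact (hd u).1.hasDerivAt.comp u h1
  have dE : ∀ u, HasDerivAt E (E u * (Complex.I * l)) u := fun u => by
    have h1 : HasDerivAt (fun u : ℝ => (((1/l:ℝ):ℂ) + u * Complex.I) * l) (Complex.I * l) u := by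
      simpa using (((Complex.ofRealCLM.hasDerivAt (x := u)).mul_const Complex.I).const_add (((1/l:ℝ):ℂ))).mul_const (l:ℂ)
    exact h1.cexp
  have cG : Continuous G := continuous_iff_continuousAt.2 fun u => (dG u).continuousAt
  have cE : Continuous E := continuous_iff_continuousAt.2 fun u => (dE u).continuousAt
  have mG' : AEStronglyMeasurable G' := by
    have : G' = deriv G := funext fun u => (dG u).deriv.symm
    rw [this]; exact (measurable_deriv G).aestronglyMeasurable
  have iG : Integrable (fun u => G u * E u) := by
    refine (iq.const_mul (C * Real.exp 1)).mono' (cG.mul cE).aestronglyMeasurable (ae_of_all _ fun u => ?_)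
    rw [norm_mul, hE]; nlinarith [(hd u).2.1, Real.exp_pos 1]
  have bG' : ∀ u, ‖G' u * E u‖ ≤ C * Real.exp 1 * (1+u^2)^(-(3/4):ℝ) := fun u => by
    rw [norm_mul, hE, norm_mul, Complex.norm_I, mul_one]; nlinarith [(hd u).2.2, Real.exp_pos 1]
  have iG' : Integrable (fun u => G' u * E u) := (iq.const_mul (C * Real.exp 1)).mono' (mG'.mul cE.aestronglyMeasurable) (ae_of_all _ bG')
  refine ⟨iG, ?_⟩
  have iG2 : Integrable (fun u => G u * (E u * (Complex.I * l))) := (iG.mul_const (Complex.I * l)).congr (ae_of_all _ fun u => by ring)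
  have ib := integral_mul_deriv_eq_deriv_mul_of_integrable (u := G) (v := E) (u' := G') (v' := fun u => E u * (Complex.I * l)) (fun x _ => dG x) (fun x _ => dE x) iG2 iG' iG
  have e : ∫ u, G u * (E u * (Complex.I * l)) = (∫ u, G u * E u) * (Complex.I * l) := by
    rw [← integral_mul_const]; congr 1; ext u; ring
  rw [e] at ib
  have nb : ‖∫ u, G' u * E u‖ ≤ C * Real.exp 1 * J := by
    refine (norm_integral_le_of_norm_le (iq.const_mul (C * Real.exp 1)) (ae_of_all _ bG')).trans (le_of_eq ?_)
    rw [integral_const_mul]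
  have := congrArg norm ib
  rw [norm_neg, norm_mul, norm_mul, Complex.norm_I, one_mul, Complex.norm_real, Real.norm_of_nonneg (by linarith)] at this
  rw [le_div_iff₀ (by linarith)]
  linarith

lemma DD : ∃ C : ℝ, 1 ≤ C ∧ ∀ x : ℝ, 1 ≤ x → 2 ≤ Real.log x → ∃ S : ℝ, HasSum (fun n : ℕ => Λ n / n * Real.exp (-(2*|Real.log x - Real.log n|))) S ∧ |S - 1| ≤ C / Real.log x := by
  obtain ⟨C, hC, hW⟩ := Wint
  refine ⟨C + 1, by linarith, fun x hx hl => ?_⟩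
  set l := Real.log x
  set ε := 1/l with hε
  have h0 : 0 < ε := by positivity
  have h1 : ε ≤ 1 := by rw [hε, div_le_one (by linarith)]; linarith
  have he : |(ε:ℂ).re| < 2 := by rw [Complex.ofReal_re, abs_of_pos h0]; linarith
  set F : ℕ → ℝ → ℂ := fun n u => ((Λ n / n : ℝ) : ℂ) * (kk 2 (ε + u * Complex.I) * Complex.exp ((ε + u * Complex.I) * (l - Real.log n : ℝ))) with hF
  have iF : ∀ n, Integrable (F n) := fun n => by
    refine ((kk_int he).mul_bdd (c := Real.exp (ε * (l - Real.log n))) (by fun_prop) (ae_of_all _ fun z => ?_)).const_mul _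
    simp [Complex.norm_exp, -Complex.natCast_log]
  have hn : ∀ n u, ‖F n u‖ = Λ n * (n:ℝ)^(-(1+ε)) * Real.exp (ε*l) * ‖kk 2 (ε + u * Complex.I)‖ := by
    intro n u
    rcases Nat.eq_zero_or_pos n with rfl | hn
    · simp [hF]
    have hn' : (0:ℝ) < n := by exact_mod_cast hn
    simp only [hF, norm_mul, Complex.norm_exp, Complex.norm_real]
    rw [Real.norm_of_nonneg (div_nonneg ArithmeticFunction.vonMangoldt_nonneg hn'.le), neg_add, Real.rpow_add hn', Real.rpow_neg_one, Real.rpow_def_of_pos hn', mul_assoc _ _ (Real.exp (ε*l)), mul_assoc _ _ (Real.exp (ε*l)), ← Real.exp_add]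
    rw [show ((ε + u * Complex.I) * ((l - Real.log n : ℝ):ℂ)).re = Real.log n * -ε + ε * l by rw [Complex.re_mul_ofReal]; simp; ring]
    ring
  have sF : Summable fun n => ∫ u, ‖F n u‖ := by
    simp_rw [hn, integral_const_mul]
    exact (((SL_sum (σ := 1+ε) (by linarith)).1.summable).mul_right _).mul_right _
  have hs := hasSum_integral_of_summable_integral_norm iF sF
  have e1 : ∀ n, ∫ u, F n u = ((2 * Real.pi * (Λ n / n * Real.exp (-(2*|l - Real.log n|))) : ℝ) : ℂ) := fun n => by
    simp only [hF]; rw [integral_const_mul, kk_inv he]; push_cast; ring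
  have e2 : ∀ u : ℝ, ∑' n, F n u = 1/(ε + u * Complex.I) * kk 2 (ε + u * Complex.I) * Complex.exp ((ε + u * Complex.I) * l) - Wf ((1+ε:ℝ) + u * Complex.I) * Complex.exp ((ε + u * Complex.I) * l) := by
    intro u
    set s : ℂ := ((1+ε:ℝ):ℂ) + u * Complex.I
    have sr : s.re = 1 + ε := by simp [s]
    have s1 : s - 1 = ε + u * Complex.I := by simp only [s]; push_cast; ring
    have h3 := (mang_sum (s := s) (by rw [sr]; linarith)).mul_right (kk 2 (ε + u * Complex.I) * Complex.exp ((ε + u * Complex.I) * l))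
    have h4 : ∀ n, F n u = (Λ n : ℂ) * (n:ℂ)^(-s) * (kk 2 (ε + u * Complex.I) * Complex.exp ((ε + u * Complex.I) * l)) := by
      intro n
      rcases Nat.eq_zero_or_pos n with rfl | hn
      · simp [hF]
      have hn' : (n:ℂ) ≠ 0 := by exact_mod_cast hn.ne'
      simp only [hF]
      rw [show -s = -1 + -(ε + u * Complex.I) by rw [← s1]; ring, Complex.cpow_add _ _ hn', Complex.cpow_neg_one, Complex.cpow_def_of_ne_zero hn', ← Complex.natCast_log]
      rw [show ((ε + u * Complex.I) * ((l - Real.log n : ℝ):ℂ)) = Real.log n * -(ε + u * Complex.I) + (ε + u * Complex.I) * l by push_cast; ring, Complex.exp_add]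
      push_cast; ring
    simp_rw [h4]
    rw [h3.tsum_eq, z_logderiv (by intro h; rw [h] at sr; simp at sr; linarith) (riemannZeta_ne_zero_of_one_le_re (by rw [sr]; linarith)), Wf, s1]
    ring
  simp_rw [e1, e2] at hs
  obtain ⟨iW, bW⟩ := hW l hl
  obtain ⟨iP, eP⟩ := polar h0 h1 (show 0 ≤ l by linarith)
  rw [integral_sub iP iW, eP] at hs
  have h5 := (Complex.hasSum_re hs).mul_left (1/(2*Real.pi))
  have hpi := Real.pi_pos
  refine ⟨_, h5.congr_fun fun n => ?_, ?_⟩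
  · rw [Complex.ofReal_re]; field_simp
  · set V := ∫ u : ℝ, Wf ((1+ε:ℝ) + u * Complex.I) * Complex.exp ((ε + u * Complex.I) * l)
    have hV := (Complex.abs_re_le_norm V).trans bW
    rw [Complex.sub_re, show (2 * (Real.pi:ℂ) * ((1 - Real.exp (-(2*l))/2 : ℝ) : ℂ)) = ((2 * Real.pi * (1 - Real.exp (-(2*l))/2) : ℝ) : ℂ) by push_cast; ring, Complex.ofReal_re]
    have e3 : 1/(2*Real.pi) * (2 * Real.pi * (1 - Real.exp (-(2*l))/2) - V.re) - 1 = - (Real.exp (-(2*l))/2) - V.re / (2*Real.pi) := by field_simp; ring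
    rw [e3]
    have h6 : Real.exp (-(2*l)) ≤ 1/l := by
      rw [Real.exp_neg, ← one_div]
      exact one_div_le_one_div_of_le (by linarith) (by linarith [Real.add_one_le_exp (2*l)])
    have h7 : |V.re / (2*Real.pi)| ≤ C / l := by
      rw [abs_div, abs_of_pos (show 0 < 2 * Real.pi by positivity), div_le_iff₀ (by positivity)]
      have : 0 ≤ C/l := by positivity
      nlinarith [Real.pi_gt_three]
    have h8 := Real.exp_pos (-(2*l))
    rw [add_div]
    rw [abs_le] at h7 ⊢
    constructor <;> linarith [h7.1, h7.2]


lemma vM_nn (n : ℕ) : 0 ≤ Λ n := ArithmeticFunction.vonMangoldt_nonneg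

lemma BLe : ∃ C : ℝ, 1 ≤ C ∧ ∀ x : ℝ, 1 ≤ x → ∀ S : Finset ℕ, ∑ n ∈ S, Λ n / n * Real.exp (-|Real.log x - Real.log n|/2) ≤ C := by
  obtain ⟨C, hC, h⟩ := BL
  refine ⟨16 * C, by linarith, fun x hx S => ?_⟩
  refine le_trans ?_ (mul_le_mul_of_nonneg_left (h x hx S) (by norm_num : (0:ℝ) ≤ 16))
  rw [Finset.mul_sum]
  refine Finset.sum_le_sum fun n _ => ?_
  have := mul_le_mul_of_nonneg_left (exp_abs_le (Real.log x - Real.log n)) (div_nonneg (vM_nn n) n.cast_nonneg)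
  linarith

lemma an_sq (x : ℝ) (n : ℕ) : an x n ^ 2 = Λ n * (Λ n / n * Real.exp (-(2*|Real.log x - Real.log n|))) := by
  rcases Nat.eq_zero_or_pos n with rfl | hn
  · simp [an]
  have hn' : (0:ℝ) < n := by exact_mod_cast hn
  have e : Real.exp (-(Real.log n/2)) * Real.exp (-(Real.log n/2)) = (n:ℝ)⁻¹ := by
    rw [← Real.exp_add, ← neg_add, add_halves, Real.exp_neg, Real.exp_log hn']
  have e2 : Real.exp (-(2*|Real.log x - Real.log n|)) = Real.exp (-|Real.log x - Real.log n|) * Real.exp (-|Real.log x - Real.log n|) := by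
    rw [← Real.exp_add]; congr 1; ring
  rw [an, e2, div_eq_mul_inv (Λ n), ← e]; ring

lemma an_sum : ∃ C : ℝ, 1 ≤ C ∧ ∀ x : ℝ, 1 ≤ x → ∀ S : Finset ℕ, ∑ n ∈ S, an x n ≤ C * √x := by
  obtain ⟨C, hC, h⟩ := BLe
  refine ⟨C, hC, fun x hx S => ?_⟩
  refine le_trans ?_ (mul_le_mul_of_nonneg_right (h x hx S) (Real.sqrt_nonneg x))
  rw [Finset.sum_mul]
  refine Finset.sum_le_sum fun n _ => ?_
  rcases Nat.eq_zero_or_pos n with rfl | hn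
  · simp [an]
  have hn' : (0:ℝ) < n := by exact_mod_cast hn
  have e : √x = Real.exp (Real.log x / 2) := by rw [Real.exp_half, Real.exp_log (by linarith)]
  have e1 : Λ n / n = Λ n * Real.exp (-Real.log n) := by rw [Real.exp_neg, Real.exp_log hn']; rfl
  rw [an, e, e1, mul_assoc, mul_assoc, mul_assoc, ← Real.exp_add, ← Real.exp_add, ← Real.exp_add]
  refine mul_le_mul_of_nonneg_left (Real.exp_le_exp.2 ?_) (vM_nn n)
  linarith [neg_abs_le (Real.log x - Real.log n)]

lemma vM_le_log (n : ℕ) : Λ n ≤ Real.log n := ArithmeticFunction.vonMangoldt_le_log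

lemma pp_sum : ∃ C : ℝ, 1 ≤ C ∧ ∀ S : Finset ℕ, ∑ n ∈ S, Λ n / n * (Real.log n - Λ n) ≤ C := by
  set F : ℕ × ℕ → ℝ := fun z => (z.1:ℝ)^(-(3/2):ℝ) * (z.2:ℝ)^(-(9/4):ℝ)
  have sF : Summable F := (Real.summable_nat_rpow.2 (by norm_num)).mul_of_nonneg (Real.summable_nat_rpow.2 (by norm_num)) (fun n => by positivity) (fun n => by positivity)
  have nF : ∀ z, 0 ≤ F z := fun z => by positivity
  refine ⟨64 * (∑' z, F z) + 1, by have : 0 ≤ ∑' z, F z := (tsum_nonneg nF); linarith, fun S => ?_⟩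
  have key : ∀ n : ℕ, ¬ Λ n * (Real.log n - Λ n) = 0 → ∃ z : ℕ × ℕ, z.1^2*z.2^3 = n := by
    intro n hn
    have h1 : Λ n ≠ 0 := fun h => hn (by simp [h])
    obtain ⟨p, k, hp, hk, rfl⟩ := (isPrimePow_nat_iff n).1 (ArithmeticFunction.vonMangoldt_ne_zero_iff.1 h1)
    have hk1 : k ≠ 1 := by
      rintro rfl
      apply hn
      rw [pow_one, ArithmeticFunction.vonMangoldt_apply_prime hp]; simp
    obtain ⟨j, rfl⟩ | ⟨j, rfl⟩ := k.even_or_odd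
    · exact ⟨(p^j, 1), by simp; ring⟩
    · obtain ⟨i, rfl⟩ : ∃ i, j = i + 1 := ⟨j - 1, by omega⟩
      exact ⟨(p^i, p), by simp; ring⟩
  choose! g hg using key
  set S' := S.filter fun n => ¬ Λ n * (Real.log n - Λ n) = 0
  have e1 : ∑ n ∈ S, Λ n / n * (Real.log n - Λ n) = ∑ n ∈ S', Λ n / n * (Real.log n - Λ n) := by
    rw [Finset.sum_filter_of_ne]
    intro n _ h h0; apply h; rw [div_mul_eq_mul_div, h0, zero_div]
  have gS : ∀ n ∈ S', (g n).1^2*(g n).2^3 = n := fun n hn => hg n (Finset.mem_filter.1 hn).2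
  have e2 : ∑ n ∈ S', F (g n) = ∑ z ∈ S'.image g, F z := by
    rw [Finset.sum_image]
    intro a ha b hb hab
    rw [← gS a ha, ← gS b hb, hab]
  have h3 : ∑ z ∈ S'.image g, F z ≤ ∑' z, F z := sF.sum_le_tsum _ fun z _ => nF z
  have h4 : ∑ n ∈ S', Λ n / n * (Real.log n - Λ n) ≤ ∑ n ∈ S', 64 * F (g n) := by
    refine Finset.sum_le_sum fun n hn => ?_
    have hz := gS n hn
    have hn0 : 0 < n := by
      rcases Nat.eq_zero_or_pos n with rfl | h
      · exact absurd (by simp) (Finset.mem_filter.1 hn).2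
      · exact h
    have hn' : (0:ℝ) < n := by exact_mod_cast hn0
    have hF : F (g n) = (n:ℝ)^(-(3/4):ℝ) := by
      have hz' : (n:ℝ) = ((g n).1:ℝ)^2*((g n).2:ℝ)^3 := by exact_mod_cast hz.symm
      rw [hz']
      rw [Real.mul_rpow (by positivity) (by positivity), ← Real.rpow_natCast_mul (by positivity), ← Real.rpow_natCast_mul (by positivity)]
      norm_num [F]
    have hl0 : 0 ≤ Real.log n := Real.log_natCast_nonneg n
    have hl : Real.log n ≤ 8 * (n:ℝ)^(1/8:ℝ) := by
      have := Real.log_le_rpow_div hn'.le (show (0:ℝ) < 1/8 by norm_num); linarith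
    have h5 : Λ n * (Real.log n - Λ n) ≤ 64 * (n:ℝ)^(1/4:ℝ) := by
      have : (n:ℝ)^(1/4:ℝ) = (n:ℝ)^(1/8:ℝ) * (n:ℝ)^(1/8:ℝ) := by rw [← Real.rpow_add hn']; norm_num
      nlinarith [vM_nn n, vM_le_log n]
    rw [hF, div_mul_eq_mul_div, div_le_iff₀ hn', mul_assoc, show (n:ℝ)^(-(3/4):ℝ) * n = (n:ℝ)^(1/4:ℝ) by
      nth_rw 2 [← Real.rpow_one (n:ℝ)]; rw [← Real.rpow_add hn']; norm_num]
    exact h5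
  rw [← Finset.mul_sum, e2] at h4
  rw [e1]; linarith

lemma S2 : ∃ C : ℝ, 1 ≤ C ∧ ∀ x T : ℝ, 3 ≤ T → 1 ≤ x → x ≤ T → |∑ n ∈ Finset.range (⌊T^4⌋₊+1), an x n ^ 2 - Real.log x| ≤ C := by
  obtain ⟨C1, hC1, b1⟩ := BLe
  obtain ⟨C2, hC2, b2⟩ := pp_sum
  obtain ⟨C3, hC3, b3⟩ := DD
  refine ⟨3 * C1 + C2 + C3 + 2, by linarith, fun x T hT hx hxT => ?_⟩
  set R := Finset.range (⌊T^4⌋₊+1)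
  set l := Real.log x
  have hl : 0 ≤ l := Real.log_nonneg hx
  set a : ℕ → ℝ := fun n => Λ n / n * Real.exp (-(2*|l - Real.log n|))
  have q0 : ∀ n : ℕ, 0 ≤ Λ n / (n:ℝ) := fun n => div_nonneg (vM_nn n) n.cast_nonneg
  have a0 : ∀ n, 0 ≤ a n := fun n => mul_nonneg (q0 n) (Real.exp_pos _).le
  have ale : ∀ n, a n ≤ Λ n / n * Real.exp (-|l - Real.log n|/2) := fun n =>
    mul_le_mul_of_nonneg_left (Real.exp_le_exp.2 (by linarith [abs_nonneg (l - Real.log n)])) (q0 n)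
  have s0 : ∀ S : Finset ℕ, ∑ n ∈ S, a n ≤ C1 := fun S => (Finset.sum_le_sum fun n _ => ale n).trans (b1 x hx S)
  have e1 : ∑ n ∈ R, an x n ^ 2 = ∑ n ∈ R, (Λ n - l) * a n + l * ∑ n ∈ R, a n := by
    rw [Finset.mul_sum, ← Finset.sum_add_distrib]
    exact Finset.sum_congr rfl fun n _ => by rw [an_sq]; ring
  have h1 : |∑ n ∈ R, (Λ n - l) * a n| ≤ C1 + C2 := by
    refine (Finset.abs_sum_le_sum_abs _ _).trans (le_trans ?_ (add_le_add (b1 x hx R) (b2 R)))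
    rw [← Finset.sum_add_distrib]
    refine Finset.sum_le_sum fun n _ => ?_
    rw [abs_mul, abs_of_nonneg (a0 n)]
    have t1 : |Λ n - l| ≤ |l - Real.log n| + (Real.log n - Λ n) := by
      have := vM_le_log n
      rw [abs_le]; constructor <;> cases abs_cases (l - Real.log n) <;> linarith
    have t2 : a n * |l - Real.log n| ≤ Λ n / n * Real.exp (-|l - Real.log n|/2) := by
      simp only [a]
      rw [mul_assoc]
      refine mul_le_mul_of_nonneg_left ?_ (q0 n)
      rw [show -|l - Real.log n|/2 = -(2*|l - Real.log n|) + 3/2*|l - Real.log n| by ring, Real.exp_add]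
      refine mul_le_mul_of_nonneg_left ?_ (Real.exp_pos _).le
      linarith [Real.add_one_le_exp (3/2*|l - Real.log n|), abs_nonneg (l - Real.log n)]
    have t3 : a n * (Real.log n - Λ n) ≤ Λ n / n * (Real.log n - Λ n) := by
      refine mul_le_mul_of_nonneg_right ?_ (by linarith [vM_le_log n])
      refine mul_le_of_le_one_right (q0 n) (Real.exp_le_one_iff.2 (by linarith [abs_nonneg (l - Real.log n)]))
    nlinarith [mul_le_mul_of_nonneg_right t1 (a0 n)]
  have h2 : |l * ∑ n ∈ R, a n - l| ≤ 2 * C1 + C3 + 2 := by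
    have n0 : 0 ≤ ∑ n ∈ R, a n := Finset.sum_nonneg fun n _ => a0 n
    rcases le_total l 2 with h | h
    · have := s0 R
      have t : l * ∑ n ∈ R, a n ≤ 2 * C1 := mul_le_mul h this n0 (by norm_num)
      have t' : 0 ≤ l * ∑ n ∈ R, a n := mul_nonneg hl n0
      rw [abs_le]; constructor <;> linarith
    · obtain ⟨S, hS, hS1⟩ := b3 x hx h
      have lo : ∑ n ∈ R, a n ≤ S := sum_le_hasSum R (fun n _ => a0 n) hS
      have hi : S ≤ ∑ n ∈ R, a n + C1 / l := by
        refine hasSum_le_of_sum_le hS fun s => ?_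
        have t : ∑ n ∈ s \ R, a n ≤ C1 / l := by
          rw [le_div_iff₀ (by linarith), Finset.sum_mul]
          refine le_trans (Finset.sum_le_sum fun n hn => ?_) (b1 x hx (s \ R))
          simp only [a]
          rw [mul_assoc]
          refine mul_le_mul_of_nonneg_left ?_ (q0 n)
          have hn1 : T^4 < n := by
            have := (Finset.mem_sdiff.1 hn).2
            simp only [R, Finset.mem_range, not_lt] at this
            exact (Nat.lt_floor_add_one _).trans_le (by exact_mod_cast this)
          have hn2 : 4 * Real.log T ≤ Real.log n := by
            have := Real.log_le_log (by positivity) hn1.le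
            rw [Real.log_pow] at this; exact_mod_cast this
          have hn3 : l ≤ Real.log T := Real.log_le_log (by linarith) hxT
          rw [show -|l - Real.log n|/2 = -(2*|l - Real.log n|) + 3/2*|l - Real.log n| by ring, Real.exp_add]
          refine mul_le_mul_of_nonneg_left ?_ (Real.exp_pos _).le
          linarith [Real.add_one_le_exp (3/2*|l - Real.log n|), neg_abs_le (l - Real.log n)]
        calc ∑ n ∈ s, a n ≤ ∑ n ∈ R ∪ s, a n := Finset.sum_le_sum_of_subset_of_nonneg Finset.subset_union_right fun n _ _ => a0 n
          _ = ∑ n ∈ R, a n + ∑ n ∈ s \ R, a n := by rw [← Finset.union_sdiff_self_eq_union, Finset.sum_union Finset.disjoint_sdiff]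
          _ ≤ _ := by linarith
      have k1 : C1 / l * l = C1 := by field_simp
      have k2 : C3 / l * l = C3 := by field_simp
      rw [abs_le] at hS1 ⊢
      constructor <;> nlinarith [hS1.1, hS1.2]
  rw [e1, abs_le]
  rw [abs_le] at h1 h2
  constructor <;> linarith [h1.1, h1.2, h2.1, h2.2]


lemma crt_count {a b : ℕ} (ha : 0 < a) (hb : 0 < b) (co : a.Coprime b) (h N : ℕ) :
    |(((Finset.Ioc 0 N).filter fun n => a ∣ n ∧ b ∣ n + h).card : ℝ) - N / (a * b)| ≤ 1 := by
  obtain ⟨v, hv1, hv2⟩ := Nat.chineseRemainder co 0 (b*h - h)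
  have hv3 : b ∣ v + h := by
    have : v + h ≡ b * h - h + h [MOD b] := hv2.add_right h
    rw [Nat.sub_add_cancel (Nat.le_mul_of_pos_left h hb)] at this
    exact (this.dvd_iff dvd_rfl).2 (dvd_mul_right _ _)
  have e : ((Finset.Ioc 0 N).filter fun n => a ∣ n ∧ b ∣ n + h) = (Finset.Ioc 0 N).filter fun n => n ≡ v [MOD a*b] := by
    refine Finset.filter_congr fun n _ => ?_
    rw [← Nat.modEq_and_modEq_iff_modEq_mul co]
    refine and_congr ⟨fun hn => ((Nat.modEq_zero_iff_dvd.2 hn).trans hv1.symm), fun hn => Nat.modEq_zero_iff_dvd.1 (hn.trans hv1)⟩ ⟨fun hn => ?_, fun hn => ((hn.add_right h).dvd_iff dvd_rfl).2 hv3⟩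
    exact Nat.ModEq.add_right_cancel' h ((Nat.modEq_zero_iff_dvd.2 hn).trans (Nat.modEq_zero_iff_dvd.2 hv3).symm)
  rw [e]
  have hr : 0 < a * b := Nat.mul_pos ha hb
  have c := Nat.Ioc_filter_modEq_card 0 N hr v
  have hrq : (0:ℚ) < (a*b : ℕ) := by exact_mod_cast hr
  set f1 := ⌊((N:ℚ) - v) / (a*b : ℕ)⌋
  set f2 := ⌊(((0:ℕ):ℚ) - v) / (a*b : ℕ)⌋
  have q1 : (f1:ℚ) ≤ _ := Int.floor_le (((N:ℚ) - v) / (a*b : ℕ))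
  have q2 : _ < (f1:ℚ) + 1 := Int.lt_floor_add_one (((N:ℚ) - v) / (a*b : ℕ))
  have q3 : (f2:ℚ) ≤ _ := Int.floor_le ((((0:ℕ):ℚ) - v) / (a*b : ℕ))
  have q4 : _ < (f2:ℚ) + 1 := Int.lt_floor_add_one ((((0:ℕ):ℚ) - v) / (a*b : ℕ))
  have q5 : ((N:ℚ) - v) / (a*b : ℕ) = (((0:ℕ):ℚ) - v) / (a*b : ℕ) + N / (a*b:ℕ) := by rw [← add_div]; congr 1; push_cast; ring
  have q6 : (0:ℚ) ≤ N / (a*b:ℕ) := by positivity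
  have hm : f2 ≤ f1 := Int.floor_le_floor (by rw [q5]; linarith)
  rw [max_eq_left (by linarith)] at c
  have c' : (((Finset.Ioc 0 N).filter fun n => n ≡ v [MOD a*b]).card : ℚ) = f1 - f2 := by exact_mod_cast c
  have fin : |(((Finset.Ioc 0 N).filter fun n => n ≡ v [MOD a*b]).card : ℚ) - N / (a*b:ℕ)| ≤ 1 := by
    rw [c', abs_le]; constructor <;> linarith
  have : |(((((Finset.Ioc 0 N).filter fun n => n ≡ v [MOD a*b]).card : ℚ) - N / (a*b:ℕ) : ℚ) : ℝ)| ≤ 1 := by exact_mod_cast fin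
  push_cast at this; exact this

lemma bonf (S : Finset ℕ) (k : ℕ) : (if S = ∅ then (1:ℝ) else 0) ≤ ∑ D ∈ S.powerset.filter (fun D => D.card ≤ 2*k), (-1:ℝ)^D.card := by
  have e : ∑ D ∈ S.powerset.filter (fun D => D.card ≤ 2*k), (-1:ℝ)^D.card = ∑ j ∈ Finset.range (2*k+1), (-1:ℝ)^j * S.card.choose j := by
    rw [← Finset.sum_fiberwise_of_maps_to (t := Finset.range (2*k+1)) (g := Finset.card) (fun D hD => by
      have := (Finset.mem_filter.1 hD).2; simp; omega)]
    refine Finset.sum_congr rfl fun j hj => ?_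
    have : (S.powerset.filter (fun D => D.card ≤ 2*k)).filter (fun D => D.card = j) = S.powersetCard j := by
      ext D; simp only [Finset.mem_filter, Finset.mem_powerset, Finset.mem_powersetCard]
      have := Finset.mem_range.1 hj
      constructor
      · rintro ⟨⟨h1, _⟩, h2⟩; exact ⟨h1, h2⟩
      · rintro ⟨h1, h2⟩; exact ⟨⟨h1, by omega⟩, h2⟩
    rw [this, Finset.sum_congr rfl (g := fun _ => (-1:ℝ)^j) (fun D hD => by rw [(Finset.mem_powersetCard.1 hD).2]), Finset.sum_const, Finset.card_powersetCard, nsmul_eq_mul, mul_comm]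
  rw [e]
  rcases Finset.eq_empty_or_nonempty S with rfl | hS
  · rw [if_pos rfl, Finset.sum_eq_single 0] <;> simp +contextual [Nat.choose_eq_zero_of_lt, Nat.pos_iff_ne_zero]
  · rw [if_neg hS.ne_empty]
    obtain ⟨m, hm⟩ : ∃ m, S.card = m + 1 := ⟨S.card - 1, by have := hS.card_pos; omega⟩
    have := @Int.alternating_sum_range_choose_eq_choose m (2*k)
    rw [hm]
    have h2 : ∑ j ∈ Finset.range (2*k+1), (-1:ℝ)^j * ((m+1).choose j : ℝ) = (m.choose (2*k) : ℝ) := by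
      have h3 := congrArg (Int.cast : ℤ → ℝ) this
      push_cast at h3; simpa using h3
    rw [h2]; positivity

lemma brun (P : Finset ℕ) (hP : ∀ p ∈ P, p.Prime) (h : ℕ) (hh : ∀ p ∈ P, ¬ p ∣ h) (z : ℝ) (hz : 1 ≤ z) (hPz : ∀ p ∈ P, (p:ℝ) ≤ z) (k N : ℕ) :
    (((Finset.Ioc 0 N).filter fun n => ∀ p ∈ P, ¬ p ∣ n ∧ ¬ p ∣ n + h).card : ℝ) ≤
     N * (∏ p ∈ P, (1 - 2/(p:ℝ)) + (1/2)^(2*k) * ∏ p ∈ P, (1 + 4/(p:ℝ))) + z^(2*k) * ∏ p ∈ P, (1 + 2/(p:ℝ)) := by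
  set B := P.powerset.filter (fun D => D.card ≤ 2*k) with hB
  have hBP : ∀ D ∈ B, D ⊆ P := fun D hD => Finset.mem_powerset.1 (Finset.mem_filter.1 hD).1
  have pp : ∀ D ⊆ P, ∀ p ∈ D, (0:ℝ) < p := fun D hD p hp => by exact_mod_cast (hP p (hD hp)).pos
  let M : Finset ℕ → ℝ := fun D => ∑ n ∈ Finset.Ioc 0 N, ∏ p ∈ D, ((if p ∣ n then (1:ℝ) else 0) + (if p ∣ n + h then 1 else 0))
  have s1 : (((Finset.Ioc 0 N).filter fun n => ∀ p ∈ P, ¬ p ∣ n ∧ ¬ p ∣ n + h).card : ℝ) ≤ ∑ D ∈ B, (-1:ℝ)^D.card * M D := by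
    simp only [M, Finset.mul_sum]
    rw [Finset.sum_comm, Finset.card_filter, Nat.cast_sum]
    refine Finset.sum_le_sum fun n _ => ?_
    set S := P.filter fun p => p ∣ n ∨ p ∣ n + h with hS
    have t1 : ∀ D ∈ B, ∏ p ∈ D, ((if p ∣ n then (1:ℝ) else 0) + (if p ∣ n + h then 1 else 0)) = if D ⊆ S then 1 else 0 := by
      intro D hD
      have : ∀ p ∈ D, ((if p ∣ n then (1:ℝ) else 0) + (if p ∣ n + h then 1 else 0)) = if p ∈ S then 1 else 0 := by
        intro p hp
        have hpP := hBP D hD hp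
        have := hh p hpP
        have h2 : p ∣ n → ¬ p ∣ n + h := fun h1 h3 => this ((Nat.dvd_add_right h1).1 h3)
        by_cases h1 : p ∣ n <;> by_cases h3 : p ∣ n + h <;> simp_all
      rw [Finset.prod_congr rfl this, Finset.prod_ite_zero]; simp [Finset.subset_iff]
    have t2 : ∑ D ∈ B, (-1:ℝ)^D.card * ∏ p ∈ D, ((if p ∣ n then (1:ℝ) else 0) + (if p ∣ n + h then 1 else 0)) = ∑ D ∈ S.powerset.filter (fun D => D.card ≤ 2*k), (-1:ℝ)^D.card := by
      rw [Finset.sum_congr rfl (fun D hD => by rw [t1 D hD, mul_ite, mul_one, mul_zero]), ← Finset.sum_filter]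
      refine Finset.sum_congr ?_ fun _ _ => rfl
      ext D; simp only [hB, Finset.mem_filter, Finset.mem_powerset]
      exact ⟨fun h => ⟨h.2, h.1.2⟩, fun h => ⟨⟨h.1.trans (Finset.filter_subset _ _), h.2⟩, h.1⟩⟩
    rw [t2]
    refine le_trans (le_of_eq ?_) (bonf S k)
    push_cast
    refine if_congr ?_ rfl rfl
    simp only [hS, Finset.filter_eq_empty_iff, not_or]
  have s2 : ∀ D ∈ B, |M D - N * ∏ p ∈ D, (2/(p:ℝ))| ≤ 2^D.card := by
    intro D hD
    have hDP := hBP D hD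
    have m1 : M D = ∑ E ∈ D.powerset, (((Finset.Ioc 0 N).filter fun n => (∏ p ∈ E, p) ∣ n ∧ (∏ p ∈ D \ E, p) ∣ n + h).card : ℝ) := by
      simp only [M, Finset.prod_add]
      rw [Finset.sum_comm]
      refine Finset.sum_congr rfl fun E hE => ?_
      rw [Finset.card_filter, Nat.cast_sum]
      refine Finset.sum_congr rfl fun n _ => ?_
      rw [Finset.prod_ite_zero, Finset.prod_ite_zero, Finset.prod_const_one, Finset.prod_const_one, ite_zero_mul_ite_zero, one_mul]
      push_cast
      have dv : ∀ F ⊆ D, ∀ m, (∀ i ∈ F, i ∣ m) ↔ (∏ p ∈ F, p) ∣ m := fun F hF m =>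
        ⟨fun hm => Finset.prod_primes_dvd m (fun p hp => (hP p (hDP (hF hp))).prime) hm, fun hm i hi => (Finset.dvd_prod_of_mem _ hi).trans hm⟩
      exact if_congr (and_congr (dv E (Finset.mem_powerset.1 hE) n) (dv (D \ E) Finset.sdiff_subset _)) rfl rfl
    have m2 : (N:ℝ) * ∏ p ∈ D, (2/(p:ℝ)) = ∑ E ∈ D.powerset, (N:ℝ) / ((∏ p ∈ E, p : ℕ) * (∏ p ∈ D \ E, p : ℕ)) := by
      have : ∀ E ∈ D.powerset, (N:ℝ) / ((∏ p ∈ E, p : ℕ) * (∏ p ∈ D \ E, p : ℕ)) = N / ∏ p ∈ D, (p:ℝ) := fun E hE => by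
        rw [← Nat.cast_mul, mul_comm, Finset.prod_sdiff (Finset.mem_powerset.1 hE)]; push_cast; rfl
      rw [Finset.sum_congr rfl this, Finset.sum_const, Finset.card_powerset, Finset.prod_div_distrib, Finset.prod_const, nsmul_eq_mul]; push_cast; ring
    rw [m1, m2, ← Finset.sum_sub_distrib]
    refine (Finset.abs_sum_le_sum_abs _ _).trans ((Finset.sum_le_card_nsmul _ _ 1 fun E hE => ?_).trans (by simp [Finset.card_powerset]))
    refine crt_count (Finset.prod_pos fun p hp => (hP p (hDP (Finset.mem_powerset.1 hE hp))).pos) (Finset.prod_pos fun p hp => (hP p (hDP (Finset.sdiff_subset hp))).pos) ?_ h N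
    refine Nat.Coprime.prod_left fun p hp => Nat.Coprime.prod_right fun q hq => ?_
    refine (Nat.coprime_primes (hP p (hDP (Finset.mem_powerset.1 hE hp))) (hP q (hDP (Finset.sdiff_subset hq)))).2 ?_
    rintro rfl; exact (Finset.mem_sdiff.1 hq).2 hp
  have s3 : ∑ D ∈ B, (-1:ℝ)^D.card * M D ≤ N * ∑ D ∈ B, (-1:ℝ)^D.card * ∏ p ∈ D, (2/(p:ℝ)) + ∑ D ∈ B, (2:ℝ)^D.card := by
    rw [Finset.mul_sum, ← Finset.sum_add_distrib]
    refine Finset.sum_le_sum fun D hD => ?_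
    have h1 := abs_le.1 (s2 D hD)
    rcases neg_one_pow_eq_or ℝ D.card with h | h <;> rw [h] <;> linarith [h1.1, h1.2]
  have s4 : ∑ D ∈ B, (2:ℝ)^D.card ≤ z^(2*k) * ∏ p ∈ P, (1 + 2/(p:ℝ)) := by
    rw [Finset.prod_one_add, Finset.mul_sum]
    refine (Finset.sum_le_sum fun D hD => ?_).trans (Finset.sum_le_sum_of_subset_of_nonneg (Finset.filter_subset _ _) fun D hD _ =>
      mul_nonneg (by positivity) (Finset.prod_nonneg fun p _ => by positivity))
    have hpos : 0 < ∏ p ∈ D, (p:ℝ) := Finset.prod_pos (pp D (hBP D hD))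
    have h1 : ∏ p ∈ D, (p:ℝ) ≤ z^(2*k) :=
      (Finset.prod_le_prod (fun p _ => p.cast_nonneg) fun p hp => hPz p (hBP D hD hp)).trans (by
        rw [Finset.prod_const]; exact pow_le_pow_right₀ hz (Finset.mem_filter.1 hD).2)
    rw [Finset.prod_div_distrib, Finset.prod_const, mul_div_assoc', le_div_iff₀ hpos, mul_comm]
    exact mul_le_mul_of_nonneg_right h1 (by positivity)
  have s5 : ∑ D ∈ B, (-1:ℝ)^D.card * ∏ p ∈ D, (2/(p:ℝ)) ≤ ∏ p ∈ P, (1 - 2/(p:ℝ)) + (1/2)^(2*k) * ∏ p ∈ P, (1 + 4/(p:ℝ)) := by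
    have e1 : ∏ p ∈ P, (1 - 2/(p:ℝ)) = ∑ D ∈ P.powerset, (-1:ℝ)^D.card * ∏ p ∈ D, (2/(p:ℝ)) := by
      simp_rw [sub_eq_add_neg]
      rw [Finset.prod_one_add]
      exact Finset.sum_congr rfl fun D _ => by rw [Finset.prod_neg]
    rw [e1, ← Finset.sum_filter_add_sum_filter_not P.powerset (fun D => D.card ≤ 2*k), add_assoc]
    refine le_add_of_nonneg_right ?_
    rw [Finset.prod_one_add, Finset.mul_sum]
    have : ∑ D ∈ P.powerset.filter (fun D => ¬ D.card ≤ 2*k), -((-1:ℝ)^D.card * ∏ p ∈ D, (2/(p:ℝ))) ≤ ∑ D ∈ P.powerset, (1/2)^(2*k) * ∏ p ∈ D, (4/(p:ℝ)) := by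
      refine (Finset.sum_le_sum fun D hD => ?_).trans (Finset.sum_le_sum_of_subset_of_nonneg (Finset.filter_subset _ _) fun D hD _ =>
        mul_nonneg (by positivity) (Finset.prod_nonneg fun p _ => by positivity))
      have h4 : ∏ p ∈ D, (4/(p:ℝ)) = 2^D.card * ∏ p ∈ D, (2/(p:ℝ)) := by
        rw [← Finset.prod_const, ← Finset.prod_mul_distrib]; exact Finset.prod_congr rfl fun p _ => by ring
      have h0 : 0 ≤ ∏ p ∈ D, (2/(p:ℝ)) := Finset.prod_nonneg fun p _ => by positivity
      have h2 : (1:ℝ) ≤ (1/2)^(2*k) * 2^D.card := by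
        have : D.card = 2*k + (D.card - 2*k) := by have := (Finset.mem_filter.1 hD).2; omega
        rw [this, pow_add, ← mul_assoc, ← mul_pow]; norm_num
        exact one_le_pow₀ (by norm_num)
      rw [h4, ← mul_assoc]
      rcases neg_one_pow_eq_or ℝ D.card with h | h <;> rw [h] <;> nlinarith
    rw [Finset.sum_neg_distrib] at this
    linarith
  calc _ ≤ _ := s1
    _ ≤ _ := s3
    _ ≤ _ := add_le_add (mul_le_mul_of_nonneg_left s5 (by positivity)) s4


lemma recip_le (Z : ℕ) : ∑ p ∈ Nat.primesBelow (Z+1), 1/(p:ℝ) ≤ 36 * (1 + Real.log (1 + Real.log Z)) := by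
  have mt : ∀ p ∈ Nat.primesBelow (Z+1), ⌊Real.log p⌋₊ ∈ Finset.range (⌊Real.log Z⌋₊ + 1) := by
    intro p hp
    rw [Nat.mem_primesBelow] at hp
    have : Real.log p ≤ Real.log Z := Real.log_le_log (by exact_mod_cast hp.2.pos) (by exact_mod_cast Nat.lt_succ_iff.1 hp.1)
    exact Finset.mem_range.2 (Nat.lt_succ_iff.2 (Nat.floor_le_floor this))
  rw [← Finset.sum_fiberwise_of_maps_to mt]
  have hl : 0 ≤ Real.log Z := Real.log_natCast_nonneg Z
  have b : ∀ j ∈ Finset.range (⌊Real.log Z⌋₊ + 1), ∑ p ∈ (Nat.primesBelow (Z+1)).filter (fun p : ℕ => ⌊Real.log p⌋₊ = j), 1/(p:ℝ) ≤ 36 * ((j:ℝ)+1)⁻¹ := by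
    intro j _
    have key : ∀ p ∈ (Nat.primesBelow (Z+1)).filter (fun p : ℕ => ⌊Real.log p⌋₊ = j), p.Prime ∧ (j:ℝ) ≤ Real.log p ∧ Real.log p < j + 1 := by
      intro p hp
      obtain ⟨h1, h2⟩ := Finset.mem_filter.1 hp
      rw [Nat.mem_primesBelow] at h1
      have := Real.log_natCast_nonneg p
      refine ⟨h1.2, ?_, ?_⟩
      · rw [← h2]; exact Nat.floor_le this
      · rw [← h2]; exact Nat.lt_floor_add_one _
    have h1 := blk (Real.exp_pos j) ((Nat.primesBelow (Z+1)).filter (fun p : ℕ => ⌊Real.log p⌋₊ = j)) (fun p hp => by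
      obtain ⟨hp1, h1, h2⟩ := key p hp
      have hp0 : (0:ℝ) < p := by exact_mod_cast hp1.pos
      rw [← Real.exp_add]
      exact ⟨(Real.le_log_iff_exp_le hp0).1 h1, (Real.log_le_iff_le_exp hp0).1 (by linarith)⟩)
    have h2 : ∑ p ∈ (Nat.primesBelow (Z+1)).filter (fun p : ℕ => ⌊Real.log p⌋₊ = j), 1/(p:ℝ) ≤ ∑ p ∈ (Nat.primesBelow (Z+1)).filter (fun p : ℕ => ⌊Real.log p⌋₊ = j), 2 * ((j:ℝ)+1)⁻¹ * (Λ p / p) := by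
      refine Finset.sum_le_sum fun p hp => ?_
      obtain ⟨hp1, h1, h2⟩ := key p hp
      have hp0 : (0:ℝ) < p := by exact_mod_cast hp1.pos
      rw [ArithmeticFunction.vonMangoldt_apply_prime hp1, mul_div_assoc']
      refine div_le_div_of_nonneg_right ?_ hp0.le
      have hj : ((j:ℝ)+1)/2 ≤ Real.log p := by
        rcases Nat.eq_zero_or_pos j with rfl | hj
        · have : Real.log 2 ≤ Real.log p := Real.log_le_log (by norm_num) (by exact_mod_cast hp1.two_le)
          have := Real.log_two_gt_d9; norm_num; linarith
        · have : (1:ℝ) ≤ j := by exact_mod_cast hj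
          linarith
      have hj0 : (0:ℝ) < (j:ℝ)+1 := by positivity
      rw [mul_assoc, mul_comm, mul_assoc, inv_mul_eq_div, le_div_iff₀ hj0]; linarith
    rw [← Finset.mul_sum] at h2
    refine h2.trans ?_
    have := mul_le_mul_of_nonneg_left h1 (show (0:ℝ) ≤ 2 * ((j:ℝ)+1)⁻¹ by positivity)
    linarith
  refine (Finset.sum_le_sum b).trans ?_
  rw [← Finset.mul_sum]
  have h3 := harmonic_le_one_add_log (⌊Real.log Z⌋₊ + 1)
  rw [harmonic] at h3
  push_cast at h3
  have h4 : Real.log ((⌊Real.log Z⌋₊:ℝ) + 1) ≤ Real.log (1 + Real.log Z) := Real.log_le_log (by positivity) (by linarith [Nat.floor_le hl])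
  linarith

lemma expX_le (Z : ℕ) (c : ℕ) (P : Finset ℕ) (hP : P ⊆ Nat.primesBelow (Z+1)) : Real.exp (c * ∑ p ∈ P, 1/(p:ℝ)) ≤ (Real.exp 1 * (1 + Real.log Z)) ^ (36*c) := by
  have hl : 0 ≤ Real.log Z := Real.log_natCast_nonneg Z
  have h1 : ∑ p ∈ P, 1/(p:ℝ) ≤ 36 * (1 + Real.log (1 + Real.log Z)) :=
    (Finset.sum_le_sum_of_subset_of_nonneg hP fun p _ _ => by positivity).trans (recip_le Z)
  have : Real.exp 1 * (1 + Real.log Z) = Real.exp (1 + Real.log (1 + Real.log Z)) := by rw [Real.exp_add, Real.exp_log (by linarith)]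
  rw [this, ← Real.exp_nat_mul]
  refine Real.exp_le_exp.2 ?_
  push_cast
  have := mul_le_mul_of_nonneg_left h1 (Nat.cast_nonneg (α := ℝ) c)
  linarith

lemma prod_le (N : ℕ) (hN : 2 ≤ N) : ∏ p ∈ Nat.primesBelow N, (1 - 1/(p:ℝ)) ≤ 1 / Real.log N := by
  let f : ℕ →* ℝ := ⟨⟨fun n => (n:ℝ)⁻¹, by simp⟩, fun a b => by simp [mul_comm]⟩
  have h := (EulerProduct.summable_and_hasSum_smoothNumbers_prod_primesBelow_geometric (f := f) (fun {p} hp => by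
    change ‖(p:ℝ)⁻¹‖ < 1
    rw [Real.norm_of_nonneg (by positivity)]
    exact inv_lt_one_of_one_lt₀ (by exact_mod_cast hp.one_lt)) N).2
  have h' := (hasSum_subtype_iff_indicator (f := fun n => f n)).1 h
  have h2 := sum_le_hasSum (Finset.Icc 1 (N-1)) (fun n _ => Set.indicator_nonneg (fun n _ => by change (0:ℝ) ≤ (n:ℝ)⁻¹; positivity) n) h'
  have h3 : ∑ n ∈ Finset.Icc 1 (N-1), (Nat.smoothNumbers N).indicator (fun n => f n) n = ((harmonic (N-1) : ℚ) : ℝ) := by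
    rw [harmonic_eq_sum_Icc]; push_cast
    refine Finset.sum_congr rfl fun n hn => ?_
    have := Finset.mem_Icc.1 hn
    rw [Set.indicator_of_mem (Nat.mem_smoothNumbers_of_lt (by omega) (by omega))]; rfl
  have h4 := log_add_one_le_harmonic (N-1)
  rw [Nat.sub_add_cancel (by omega)] at h4
  rw [h3] at h2
  have hl : 0 < Real.log N := Real.log_pos (by exact_mod_cast hN)
  rw [le_div_iff₀ hl]
  have e : (∏ p ∈ Nat.primesBelow N, (1 - 1/(p:ℝ))) * ∏ p ∈ Nat.primesBelow N, (1 - f p)⁻¹ = 1 := by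
    rw [← Finset.prod_mul_distrib]
    refine Finset.prod_eq_one fun p hp => ?_
    have : (1:ℝ) < p := by exact_mod_cast (Nat.mem_primesBelow.1 hp).2.one_lt
    change (1 - 1/(p:ℝ)) * (1 - (p:ℝ)⁻¹)⁻¹ = 1
    rw [one_div]
    refine mul_inv_cancel₀ ?_
    have := inv_lt_one_of_one_lt₀ this
    linarith
  have n0 : 0 ≤ ∏ p ∈ Nat.primesBelow N, (1 - 1/(p:ℝ)) := Finset.prod_nonneg fun p hp => by
    have : (1:ℝ) < p := by exact_mod_cast (Nat.mem_primesBelow.1 hp).2.one_lt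
    rw [sub_nonneg, div_le_one (by linarith)]; linarith
  calc _ ≤ (∏ p ∈ Nat.primesBelow N, (1 - 1/(p:ℝ))) * ∏ p ∈ Nat.primesBelow N, (1 - f p)⁻¹ := mul_le_mul_of_nonneg_left (h4.trans h2) n0
    _ = 1 := e

lemma one_sub_exp {u : ℝ} (u0 : 0 ≤ u) (u1 : u ≤ 1/2) : 1 ≤ (1 - u) * Real.exp (2*u) := by
  nlinarith [Real.add_one_le_exp (2*u)]

lemma good_count {w Z h N k : ℕ} (hw : 1 ≤ w) (hwZ : w ≤ Z) (h1 : 1 ≤ h) (hh : h ≤ w) :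
    (((Finset.Ioc 0 N).filter fun n => ∀ p ∈ Nat.primesBelow (Z+1) \ Nat.primesBelow (w+1), ¬ p ∣ n ∧ ¬ p ∣ n + h).card : ℝ) ≤
     N * ((Real.exp 1 * (1 + Real.log w))^144 / Real.log (Z+1)^2 + (1/2)^(2*k) * (Real.exp 1 * (1 + Real.log Z))^144) + (Z:ℝ)^(2*k) * (Real.exp 1 * (1 + Real.log Z))^72 := by
  set P := Nat.primesBelow (Z+1) \ Nat.primesBelow (w+1)
  have hPm : ∀ p ∈ P, p.Prime ∧ w < p ∧ p ≤ Z := by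
    intro p hp
    simp only [P, Finset.mem_sdiff, Nat.mem_primesBelow] at hp
    exact ⟨hp.1.2, by by_contra hc; exact hp.2 ⟨by omega, hp.1.2⟩, by omega⟩
  have hPs : P ⊆ Nat.primesBelow (Z+1) := Finset.sdiff_subset
  have b := brun P (fun p hp => (hPm p hp).1) h (fun p hp hd => by have := Nat.le_of_dvd (by omega) hd; have := (hPm p hp).2.1; omega) Z (by exact_mod_cast hw.trans hwZ) (fun p hp => by exact_mod_cast (hPm p hp).2.2) k N
  have ex : ∀ c : ℕ, ∏ p ∈ P, (1 + c/(p:ℝ)) ≤ (Real.exp 1 * (1 + Real.log Z))^(36*c) := fun c => by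
    refine le_trans ?_ (expX_le Z c P hPs)
    rw [Finset.mul_sum, Real.exp_sum]
    refine Finset.prod_le_prod (fun p _ => by positivity) fun p _ => ?_
    have := Real.add_one_le_exp (c * (1/(p:ℝ)))
    rw [mul_one_div] at *; linarith
  have e4 := ex 4
  have e2 := ex 2
  norm_num only at e4 e2
  have m : ∏ p ∈ P, (1 - 2/(p:ℝ)) ≤ (Real.exp 1 * (1 + Real.log w))^144 / Real.log (Z+1)^2 := by
    have half : ∀ p : ℕ, p.Prime → (1:ℝ)/p ≤ 1/2 ∧ (0:ℝ) ≤ 1/p := fun p hp => ⟨one_div_le_one_div_of_le (by norm_num) (by exact_mod_cast hp.two_le), by positivity⟩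
    have t1 : ∏ p ∈ P, (1 - 2/(p:ℝ)) ≤ (∏ p ∈ P, (1 - 1/(p:ℝ)))^2 := by
      rw [← Finset.prod_pow]
      refine Finset.prod_le_prod (fun p hp => ?_) fun p hp => ?_
      · have := half p (hPm p hp).1; rw [show (2:ℝ)/p = 2 * (1/p) by ring]; linarith
      · rw [show (2:ℝ)/p = 2 * (1/p) by ring]; have := sq_nonneg ((1:ℝ)/p); rw [sub_sq]; linarith
    have t2 : 1 ≤ (∏ p ∈ Nat.primesBelow (w+1), (1 - 1/(p:ℝ))) * (Real.exp 1 * (1 + Real.log w))^72 := by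
      have := expX_le w 2 (Nat.primesBelow (w+1)) subset_rfl
      norm_num only at this
      rw [Finset.mul_sum, Real.exp_sum] at this
      have t3 : ∏ p ∈ Nat.primesBelow (w+1), Real.exp (-(2 * (1/(p:ℝ)))) ≤ ∏ p ∈ Nat.primesBelow (w+1), (1 - 1/(p:ℝ)) := by
        refine Finset.prod_le_prod (fun p hp => (Real.exp_pos _).le) fun p hp => ?_
        obtain ⟨u1, u0⟩ := half p (Nat.mem_primesBelow.1 hp).2
        set u := (1:ℝ)/p
        rw [Real.exp_neg, inv_le_iff_one_le_mul₀ (Real.exp_pos _)]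
        exact one_sub_exp u0 u1
      have t4 : 1 = (∏ p ∈ Nat.primesBelow (w+1), Real.exp (-(2 * (1/(p:ℝ))))) * ∏ p ∈ Nat.primesBelow (w+1), Real.exp (2 * (1/(p:ℝ))) := by
        rw [← Real.exp_sum, ← Real.exp_sum, ← Real.exp_add, Finset.sum_neg_distrib]; simp
      refine t4.le.trans ?_
      exact mul_le_mul t3 this (Finset.prod_nonneg fun p _ => (Real.exp_pos _).le) ((Finset.prod_nonneg fun p _ => (Real.exp_pos _).le).trans t3)
    have t5 : (∏ p ∈ P, (1 - 1/(p:ℝ))) * ∏ p ∈ Nat.primesBelow (w+1), (1 - 1/(p:ℝ)) ≤ 1 / Real.log (Z+1) := by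
      rw [Finset.prod_sdiff (fun p hp => by rw [Nat.mem_primesBelow] at hp ⊢; exact ⟨by omega, hp.2⟩)]
      have := prod_le (Z+1) (by omega)
      push_cast at this; exact this
    have n1 : 0 ≤ ∏ p ∈ P, (1 - 1/(p:ℝ)) := Finset.prod_nonneg fun p hp => by linarith [(half p (hPm p hp).1).1]
    have hlw : 0 ≤ Real.log w := Real.log_natCast_nonneg w
    have t6 : ∏ p ∈ P, (1 - 1/(p:ℝ)) ≤ 1 / Real.log (Z+1) * (Real.exp 1 * (1 + Real.log w))^72 := by
      calc _ ≤ (∏ p ∈ P, (1 - 1/(p:ℝ))) * ((∏ p ∈ Nat.primesBelow (w+1), (1 - 1/(p:ℝ))) * (Real.exp 1 * (1 + Real.log w))^72) := le_mul_of_one_le_right n1 t2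
        _ ≤ _ := by rw [← mul_assoc]; exact mul_le_mul_of_nonneg_right t5 (by positivity)
    refine t1.trans ((pow_le_pow_left₀ n1 t6 2).trans (le_of_eq ?_))
    rw [mul_pow, ← pow_mul, div_pow]; ring
  refine b.trans ?_
  gcongr


noncomputable def svA (y : ℝ) : ℝ := (Real.exp 1 * (1 + 10 * Real.log y))^144 / y^8 + Real.exp (1 - y/4) * (Real.exp 1 * (1 + y^4))^144
noncomputable def svB (y : ℝ) : ℝ := Real.exp (y^5/2) * (Real.exp 1 * (1 + y^4))^72

lemma sv_asym : ∀ᶠ y : ℝ in atTop, 100 ≤ y ∧ y^10 ≤ Real.exp (y^4) ∧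
    (1 + 10 * Real.log y) * (30 * y^10) * svA y ≤ y^(5/2:ℝ) ∧
    (1 + 10 * Real.log y) * (30 * y^10) * (svB y + 2 * ((Real.exp (y^4) + 1) * (12 * y^5 + 1))) ≤ Real.exp (9/10 * y^5) := by
  have a1 : ∀ᶠ y : ℝ in atTop, Real.log y ≤ 1/100 * y^(1/1000:ℝ) := by
    filter_upwards [(isLittleO_log_rpow_atTop (show (0:ℝ) < 1/1000 by norm_num)).def (show (0:ℝ) < 1/100 by norm_num), eventually_ge_atTop 1] with y hy h1
    rw [Real.norm_of_nonneg (Real.log_nonneg h1), Real.norm_of_nonneg (by positivity)] at hy; exact hy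
  have a2 : ∀ᶠ y : ℝ in atTop, (100:ℝ) ≤ y^(1/1000:ℝ) := (tendsto_rpow_atTop (by norm_num)).eventually_ge_atTop _
  have a3 : ∀ᶠ y : ℝ in atTop, (60:ℝ) ≤ y^(355/1000:ℝ) := (tendsto_rpow_atTop (by norm_num)).eventually_ge_atTop _
  have a4 : ∀ᶠ y : ℝ in atTop, y^800 ≤ Real.exp (1/4*y) := by
    filter_upwards [(isLittleO_pow_exp_pos_mul_atTop 800 (show (0:ℝ) < 1/4 by norm_num)).def one_pos, eventually_ge_atTop 1] with y hy h1
    rw [Real.norm_of_nonneg (by positivity), Real.norm_of_nonneg (by positivity), one_mul] at hy; exact hy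
  filter_upwards [a1, a2, a3, a4, eventually_ge_atTop 1000] with y a1 a2 a3 a4 hy
  have h1 : 1 ≤ y := by linarith
  have he := Real.exp_one_lt_d9
  have hl0 := Real.log_nonneg h1
  set q := y^(1/1000:ℝ)
  have pw : ∀ {i j : ℕ}, i ≤ j → y^i ≤ y^j := fun h => pow_le_pow_right₀ h1 h
  have m4 : y ≤ y^4 := by simpa using pw (show 1 ≤ 4 by norm_num)
  have m5 : y ≤ y^5 := by simpa using pw (show 1 ≤ 5 by norm_num)
  have hlq : 1 + 10 * Real.log y ≤ q := by linarith
  have hlq2 : Real.exp 1 * (1 + 10 * Real.log y) ≤ q := by nlinarith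
  have hqy : q ≤ y := by
    calc q ≤ y^(1:ℝ) := Real.rpow_le_rpow_of_exponent_le h1 (by norm_num)
      _ = y := Real.rpow_one y
  have h45 : Real.exp 1 * (1 + y^4) ≤ y^5 := by
    have : y^5 = y * y^4 := by ring
    have : 1 ≤ y^4 := one_le_pow₀ h1
    nlinarith
  have hy0 : 0 < y := by linarith
  have h30 : 30 * Real.exp 1 ≤ y := by linarith
  have hh : ∀ a : ℝ, 1/2*a+1/2*a ≤ a := fun a => by linarith
  have hly : 1 + 10 * Real.log y ≤ y := hlq.trans hqy
  have hy2 : 1 ≤ 1/2 * (y^2 * 1) := by nlinarith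
  refine ⟨by linarith, ?_, ?_, ?_⟩
  · exact (pw (by norm_num)).trans (a4.trans (Real.exp_le_exp.2 (by linarith)))
  · have e52 : y^(5/2:ℝ) = y^2 * y^(1/2:ℝ) := by
      rw [← Real.rpow_natCast, ← Real.rpow_add hy0]; norm_num
    have q145 : q^145 * 60 ≤ y^(1/2:ℝ) := by
      have : y^(1/2:ℝ) = q^145 * y^(355/1000:ℝ) := by
        simp only [q]; rw [← Real.rpow_natCast, ← Real.rpow_mul hy0.le, ← Real.rpow_add hy0]; norm_num
      rw [this]; gcongr
    have p1 : (1 + 10 * Real.log y) * (30 * y^10) * ((Real.exp 1 * (1 + 10 * Real.log y))^144 / y^8) ≤ 1/2 * (y^2 * y^(1/2:ℝ)) := by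
      calc _ ≤ q * (30 * y^10) * (q^144 / y^8) := by gcongr
        _ = 1/2 * (y^2 * (q^145*60)) := by
          rw [pow_succ q 144]; generalize q^144 = Q
          field_simp; ring
        _ ≤ _ := by gcongr
    have p2 : (1 + 10 * Real.log y) * (30 * y^10) * (Real.exp (1 - y/4) * (Real.exp 1 * (1 + y^4))^144) ≤ 1/2 * (y^2 * y^(1/2:ℝ)) := by
      calc _ ≤ y * (30 * y^10) * (Real.exp (1 - y/4) * (y^5)^144) := by gcongr
        _ = 30 * Real.exp 1 * (y^11*y^720) * Real.exp (-(1/4*y)) := by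
          rw [show 1 - y/4 = 1 + -(1/4*y) by ring, Real.exp_add, ← pow_mul]; norm_num only; generalize y^720 = Q; ring
        _ ≤ y * (y^11*y^720) * Real.exp (-(1/4*y)) := by gcongr
        _ ≤ y^800 * Real.exp (-(1/4*y)) := by gcongr; rw [← pow_add, ← pow_succ']; exact pw (by norm_num)
        _ ≤ Real.exp (1/4*y) * Real.exp (-(1/4*y)) := by gcongr
        _ = 1 := by rw [← Real.exp_add]; simp
        _ ≤ 1/2 * (y^2 * 1) := hy2
        _ ≤ _ := by gcongr; exact Real.one_le_rpow h1 (by norm_num)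
    rw [e52, svA, mul_add]; exact (add_le_add p1 p2).trans (hh _)
  · rw [svB]
    have b1 : Real.exp (y^4) + 1 ≤ Real.exp (y^5/2) * 2 := by
      have : Real.exp (y^4) ≤ Real.exp (y^5/2) := Real.exp_le_exp.2 (by
        have : y^5 = y * y^4 := by ring
        nlinarith)
      have : 1 ≤ Real.exp (y^5/2) := Real.one_le_exp (by positivity)
      linarith
    have b2 : 12 * y^5 + 1 ≤ y^6 := by
      have : y^6 = y * y^5 := by ring
      nlinarith
    calc _ ≤ y * (30 * y^10) * (Real.exp (y^5/2) * (y^5)^72 + 2 * (Real.exp (y^5/2) * 2 * y^6)) := by gcongr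
      _ = Real.exp (y^5/2) * (30 * (y^11*y^360) + 120 * y^17) := by
        rw [← pow_mul]; norm_num only; generalize y^360 = Q; ring
      _ ≤ Real.exp (y^5/2) * y^800 := by
        gcongr
        rw [← pow_add]; norm_num only
        have k1 := pw (show 17 ≤ 371 by norm_num)
        have k2 := pw (show 372 ≤ 800 by norm_num)
        have k3 : 1000 * y^371 ≤ y^372 := by rw [pow_succ' y 371]; gcongr
        have k4 : 0 < y^371 := by positivity
        linarith
      _ ≤ Real.exp (y^5/2) * Real.exp (1/4*y) := by gcongr
      _ ≤ _ := by rw [← Real.exp_add]; gcongr; linarith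

lemma pp_card {J Z : ℕ} {m : ℕ} (hm : (m:ℝ) < 2^(J+1)) (hL : Λ m ≠ 0) {p : ℕ} (hp : p.Prime) (hpZ : p ≤ Z) (hd : p ∣ m) :
    m ∈ (Finset.range (Z+1) ×ˢ Finset.range (J+1)).image (fun z : ℕ × ℕ => z.1^z.2) := by
  obtain ⟨r, k, hr, hk, rfl⟩ := (isPrimePow_nat_iff m).1 (ArithmeticFunction.vonMangoldt_ne_zero_iff.1 hL)
  have : p = r := (Nat.prime_dvd_prime_iff_eq hp hr).1 (hp.dvd_of_dvd_pow hd)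
  subst this
  refine Finset.mem_image.2 ⟨(p, k), Finset.mem_product.2 ⟨Finset.mem_range.2 (by omega), Finset.mem_range.2 ?_⟩, rfl⟩
  have h1 : p^k < 2^(J+1) := by exact_mod_cast hm
  exact (Nat.pow_lt_pow_iff_right (by norm_num : 1 < 2)).1 ((Nat.pow_le_pow_left hp.two_le k).trans_lt h1)

lemma sv_gc {Z k : ℕ} {y g M lw lZ lZ1 : ℝ} (hy : 100 ≤ y) (a0 : 0 ≤ M) (lw0 : 0 ≤ lw) (hlw : lw ≤ 10 * Real.log y) (lZ0 : 0 ≤ lZ) (hlZ : lZ ≤ y^4) (hlZ1 : y^4 ≤ lZ1)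
    (Zle : (Z:ℝ) ≤ Real.exp (y^4)) (kle : (k:ℝ) ≤ y/4) (kge : y/4 < k + 1) (Z1 : (1:ℝ) ≤ Z)
    (gc : g ≤ M * ((Real.exp 1 * (1 + lw))^144 / lZ1^2 + (1/2)^(2*k) * (Real.exp 1 * (1 + lZ))^144) + (Z:ℝ)^(2*k) * (Real.exp 1 * (1 + lZ))^72) :
    g ≤ M * svA y + svB y := by
    have hy0 : 0 < y := by linarith
    have e8 : y^8 = (y^4)^2 := by ring
    have c1 : ((1:ℝ)/2)^(2*k) ≤ Real.exp (1 - y/4) := by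
      rw [pow_mul]
      calc (((1:ℝ)/2)^2)^k ≤ (Real.exp (-1))^k := by
            refine pow_le_pow_left₀ (by positivity) ?_ k
            rw [Real.exp_neg, show ((1:ℝ)/2)^2 = (4:ℝ)⁻¹ by norm_num]
            exact inv_anti₀ (Real.exp_pos _) (by linarith [Real.exp_one_lt_d9])
        _ = Real.exp (-k) := by rw [← Real.exp_nat_mul]; simp
        _ ≤ _ := Real.exp_le_exp.2 (by linarith)
    have c2 : (Z:ℝ)^(2*k) ≤ Real.exp (y^5/2) := by
      calc (Z:ℝ)^(2*k) ≤ (Real.exp (y^4))^(2*k) := by gcongr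
        _ = Real.exp ((2*k) * y^4) := by rw [← Real.exp_nat_mul]; push_cast; ring_nf
        _ ≤ _ := Real.exp_le_exp.2 (by rw [show y^5/2 = (2*(y/4))*y^4 by ring]; gcongr)
    refine gc.trans ?_
    rw [svA, svB, e8]
    gcongr

lemma sv_tot {T : ℝ} {h N Z J : ℕ} {P G Bd : Finset ℕ} (hT : 3 ≤ T) (hh : (h:ℝ) ≤ Real.log T ^ 2) (hN : (N:ℝ) ≤ T^5)
    (hJ : 12 * Real.log T < J + 1) (hP : ∀ p ∈ P, p.Prime ∧ p ≤ Z)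
    (hG : ∀ n ∈ Finset.Ioc 0 N, (∀ p ∈ P, ¬ p ∣ n ∧ ¬ p ∣ n + h) → n ∈ G)
    (hB : ∀ m p : ℕ, (m:ℝ) < 2^(J+1) → Λ m ≠ 0 → p.Prime → p ≤ Z → p ∣ m → m ∈ Bd) :
    ∑ n ∈ Finset.Ioc 0 N, Λ n * Λ (n+h) ≤ 30 * Real.log T^2 * (G.card + 2 * Bd.card) := by
  obtain ⟨L, hLd⟩ : ∃ L, L = Real.log T := ⟨_, rfl⟩
  rw [← hLd] at hh hJ ⊢
  have T0 : 0 < T := by linarith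
  have hL0 : 0 < L := by rw [hLd]; exact Real.log_pos (by linarith)
  have lT : ∀ m : ℕ, (m:ℝ) ≤ T^6 → Real.log m ≤ 6 * L := by
    intro m hm
    rcases Nat.eq_zero_or_pos m with rfl | h0
    · simp; positivity
    have := Real.log_le_log (by exact_mod_cast h0) hm
    rw [Real.log_pow, ← hLd] at this; exact_mod_cast this
  have hLT : L^2 ≤ T^2 := by have := Real.log_le_self T0.le; rw [← hLd] at this; gcongr
  have hnh : ∀ n ∈ Finset.Ioc 0 N, (n:ℝ) ≤ T^5 ∧ ((n+h:ℕ):ℝ) ≤ T^6 := by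
    intro n hn
    have : (n:ℝ) ≤ N := by exact_mod_cast (Finset.mem_Ioc.1 hn).2
    refine ⟨this.trans hN, ?_⟩
    push_cast
    have : T^2 ≤ T^5 := pow_le_pow_right₀ (by linarith) (by norm_num)
    have : T^6 = T * T^5 := by ring
    have : 0 < T^5 := by positivity
    nlinarith
  have lt2 : T^6 < 2^(J+1) := by
    rw [← Real.log_lt_log_iff (by positivity) (by positivity), Real.log_pow, Real.log_pow, ← hLd]
    push_cast
    have h2 := Real.log_two_gt_d9
    nlinarith
  have pt : ∀ n ∈ Finset.Ioc 0 N, Λ n * Λ (n+h) ≤ 30 * L^2 * ((if n ∈ G then 1 else 0) + (if n ∈ Bd then 1 else 0) + (if n + h ∈ Bd then 1 else 0)) := by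
    intro n hn
    obtain ⟨q1, q2⟩ := hnh n hn
    have i0 : ∀ (q : Prop) [Decidable q], (0:ℝ) ≤ if q then 1 else 0 := fun q _ => by split_ifs <;> norm_num
    by_cases hz : Λ n * Λ (n+h) = 0
    · rw [hz]; have := i0 (n ∈ G); have := i0 (n ∈ Bd); have := i0 (n+h ∈ Bd); positivity
    have b1 : Λ n ≤ 5 * L := by
      refine (vM_le_log n).trans ?_
      have := Real.log_le_log (by exact_mod_cast (Finset.mem_Ioc.1 hn).1) q1
      rw [Real.log_pow, ← hLd] at this; exact_mod_cast this
    have b2 : Λ (n+h) ≤ 6 * L := (vM_le_log _).trans (lT _ q2)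
    have b3 : Λ n * Λ (n+h) ≤ 30 * L^2 * 1 := by
      have := mul_le_mul b1 b2 (vM_nn _) (by positivity); nlinarith
    refine b3.trans (mul_le_mul_of_nonneg_left ?_ (by positivity))
    have q0 : (n:ℝ) ≤ T^6 := q1.trans (pow_le_pow_right₀ (by linarith) (by norm_num))
    by_cases hg : n ∈ G
    · rw [if_pos hg]; have := i0 (n ∈ Bd); have := i0 (n+h ∈ Bd); linarith
    · have : ∃ p ∈ P, p ∣ n ∨ p ∣ n + h := by
        by_contra hc
        push Not at hc
        exact hg (hG n hn hc)
      obtain ⟨p, hp, hd⟩ := this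
      have hp1 := hP p hp
      rcases hd with hd | hd
      · rw [if_pos (hB n p (q0.trans_lt lt2) (left_ne_zero_of_mul hz) hp1.1 hp1.2 hd)]
        have := i0 (n ∈ G); have := i0 (n+h ∈ Bd); linarith
      · rw [if_pos (hB _ p (q2.trans_lt lt2) (right_ne_zero_of_mul hz) hp1.1 hp1.2 hd)]
        have := i0 (n ∈ G); have := i0 (n ∈ Bd); linarith
  refine (Finset.sum_le_sum pt).trans ?_
  rw [← Finset.mul_sum, Finset.sum_add_distrib, Finset.sum_add_distrib, Finset.sum_boole, Finset.sum_boole, Finset.sum_boole]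
  refine mul_le_mul_of_nonneg_left ?_ (by positivity)
  have c1 : ((Finset.Ioc 0 N).filter (· ∈ G)).card ≤ G.card := Finset.card_le_card fun n hn => (Finset.mem_filter.1 hn).2
  have c2 : ((Finset.Ioc 0 N).filter (· ∈ Bd)).card ≤ Bd.card := Finset.card_le_card fun n hn => (Finset.mem_filter.1 hn).2
  have c3 : ((Finset.Ioc 0 N).filter (· + h ∈ Bd)).card ≤ Bd.card := Finset.card_le_card_of_injOn (· + h) (fun n hn => (Finset.mem_filter.1 hn).2) fun a _ b _ hab => by simpa using hab
  have c : ((Finset.Ioc 0 N).filter (· ∈ G)).card + ((Finset.Ioc 0 N).filter (· ∈ Bd)).card + ((Finset.Ioc 0 N).filter (· + h ∈ Bd)).card ≤ G.card + 2 * Bd.card := by omega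
  exact_mod_cast c

lemma sv_fin {l y A1 A2 B g b S N R1 R2 : ℝ} (hl : 0 ≤ l) (hy : 0 < y) (N0 : 0 ≤ N) (yA : (1+10*l)*(30*y^10)*A1 ≤ R1) (yB : (1+10*l)*(30*y^10)*(A2 + 2 * B) ≤ R2)
    (hg : g ≤ N * A1 + A2) (hb : b ≤ B) (hS : S ≤ 30 * y^10 * (g + 2*b)) : (1 + 2 * (5 * l)) * S ≤ R1 * N + R2 := by
  calc _ ≤ (1 + 2 * (5 * l)) * (30 * y^10 * (g + 2 * b)) := mul_le_mul_of_nonneg_left hS (by linarith)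
    _ = (1 + 10 * l) * (30 * y^10) * (g + 2 * b) := by ring
    _ ≤ (1 + 10 * l) * (30 * y^10) * ((N * A1 + A2) + 2 * B) := by gcongr
    _ = (1 + 10 * l) * (30 * y^10) * A1 * N + (1 + 10 * l) * (30 * y^10) * (A2 + 2 * B) := by ring
    _ ≤ _ := by gcongr

lemma sieve : ∀ᶠ T : ℝ in atTop, ∀ h N : ℕ, 1 ≤ h → (h:ℝ) ≤ Real.log T ^ 2 → (N:ℝ) ≤ T^5 →
    (1 + 2 * Real.log (Real.log T)) * ∑ n ∈ Finset.Ioc 0 N, Λ n * Λ (n+h) ≤ √(Real.log T) * N + T^(9/10:ℝ) := by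
  have ty : Tendsto (fun T : ℝ => (Real.log T)^(1/5:ℝ)) atTop atTop := (tendsto_rpow_atTop (by norm_num)).comp Real.tendsto_log_atTop
  filter_upwards [ty.eventually sv_asym, eventually_ge_atTop 3] with T ⟨hy, y1, yA, yB⟩ hT h N hh0 hh hN
  set L := Real.log T with hLd
  set y := L^(1/5:ℝ)
  have hL0 : 0 < L := Real.log_pos (by linarith)
  have yL : y^5 = L := by simp only [y]; rw [← Real.rpow_natCast, ← Real.rpow_mul hL0.le]; norm_num
  have hy0 : 0 < y := by linarith
  have lL : Real.log L = 5 * Real.log y := by rw [← yL, Real.log_pow]; norm_num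
  have sL : √L = y^(5/2:ℝ) := by rw [← yL, Real.sqrt_eq_rpow, ← Real.rpow_natCast, ← Real.rpow_mul hy0.le]; norm_num
  have T0 : 0 < T := by linarith
  have tL : T^(9/10:ℝ) = Real.exp (9/10 * y^5) := by rw [yL, Real.rpow_def_of_pos T0, ← hLd, mul_comm]
  have ly : 0 ≤ Real.log y := Real.log_nonneg (by linarith)
  obtain ⟨Z, dZ⟩ : ∃ a, a = ⌊Real.exp (y^4)⌋₊ := ⟨_, rfl⟩
  obtain ⟨w, dw⟩ : ∃ a, a = ⌊y^10⌋₊ := ⟨_, rfl⟩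
  obtain ⟨k, dk⟩ : ∃ a, a = ⌊y/4⌋₊ := ⟨_, rfl⟩
  obtain ⟨J, dJ⟩ : ∃ a, a = ⌊12*L⌋₊ := ⟨_, rfl⟩
  have y10 : L^2 = y^10 := by rw [← yL]; ring
  have hw : 1 ≤ w := by rw [dw]; exact Nat.le_floor (by push_cast; exact one_le_pow₀ (by linarith))
  have hwZ : w ≤ Z := by rw [dw, dZ]; exact Nat.floor_le_floor y1
  have hhw : h ≤ w := by rw [dw]; exact Nat.le_floor (by rw [← y10]; exact hh)
  have Zle : (Z:ℝ) ≤ Real.exp (y^4) := by rw [dZ]; exact Nat.floor_le (Real.exp_pos _).le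
  have Z1 : (1:ℝ) ≤ Z := by exact_mod_cast hw.trans hwZ
  have lZ : Real.log Z ≤ y^4 := (Real.log_le_iff_le_exp (by linarith)).2 Zle
  have lZ0 : 0 ≤ Real.log Z := Real.log_nonneg Z1
  have lZ1 : y^4 ≤ Real.log (Z+1) := (Real.le_log_iff_exp_le (by linarith)).2 (by rw [dZ]; exact (Nat.lt_floor_add_one _).le)
  have w1 : (1:ℝ) ≤ w := by exact_mod_cast hw
  have lw0 : 0 ≤ Real.log w := Real.log_nonneg w1
  have lw : Real.log w ≤ 10 * Real.log y := by
    have := Real.log_le_log (by linarith) (show (w:ℝ) ≤ y^10 by rw [dw]; exact Nat.floor_le (by positivity)); rw [Real.log_pow] at this; exact_mod_cast this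
  have kle : (k:ℝ) ≤ y/4 := by rw [dk]; exact Nat.floor_le (by positivity)
  have kge : y/4 < k + 1 := by rw [dk]; exact Nat.lt_floor_add_one _
  have hJ : (J:ℝ) ≤ 12 * y^5 := by rw [yL, dJ]; exact Nat.floor_le (by positivity)
  have tot := sv_tot (T := T) (h := h) (N := N) (Z := Z) (J := J) (P := Nat.primesBelow (Z+1) \ Nat.primesBelow (w+1))
    (G := (Finset.Ioc 0 N).filter fun n => ∀ p ∈ Nat.primesBelow (Z+1) \ Nat.primesBelow (w+1), ¬ p ∣ n ∧ ¬ p ∣ n + h)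
    (Bd := (Finset.range (Z+1) ×ˢ Finset.range (J+1)).image (fun z : ℕ × ℕ => z.1^z.2)) hT hh hN
    (by rw [dJ]; exact Nat.lt_floor_add_one _)
    (fun p hp => by have := Nat.mem_primesBelow.1 (Finset.mem_sdiff.1 hp).1; exact ⟨this.2, by omega⟩)
    (fun n hn hc => Finset.mem_filter.2 ⟨hn, hc⟩) (fun m p h1 h2 h3 h4 h5 => pp_card h1 h2 h3 h4 h5)
  have bc : (((Finset.range (Z+1) ×ˢ Finset.range (J+1)).image (fun z : ℕ × ℕ => z.1^z.2)).card : ℝ) ≤ (Real.exp (y^4) + 1) * (12*y^5+1) := by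
    have : ((Finset.range (Z+1) ×ˢ Finset.range (J+1)).image (fun z : ℕ × ℕ => z.1^z.2)).card ≤ (Z+1)*(J+1) := Finset.card_image_le.trans (by simp [Finset.card_product])
    calc _ ≤ ((Z:ℝ)+1)*((J:ℝ)+1) := by exact_mod_cast this
      _ ≤ _ := by gcongr
  have gc2 := sv_gc hy (by positivity) lw0 lw lZ0 lZ lZ1 Zle kle kge Z1 (good_count (N := N) (k := k) hw hwZ hh0 hhw)
  generalize Finset.card _ = g at gc2 tot
  generalize Finset.card _ = b at bc tot
  rw [← hLd] at tot
  rw [lL, sL, tL]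
  rw [y10] at tot
  exact sv_fin ly hy0 (Nat.cast_nonneg N) yA yB gc2 bc tot


lemma mv_sq (S : Finset ℕ) (c ω : ℕ → ℝ) (t : ℝ) :
    ‖∑ n ∈ S, (c n : ℂ) * Complex.exp (-((t:ℂ) * (ω n : ℂ)) * Complex.I)‖^2 = ∑ n ∈ S, ∑ m ∈ S, c n * c m * Real.cos (t * (ω n - ω m)) := by
  have h : ∀ n, (c n : ℂ) * Complex.exp (-((t:ℂ) * (ω n : ℂ)) * Complex.I) = ((c n * Real.cos (t * ω n) : ℝ) : ℂ) + ((-(c n * Real.sin (t * ω n)) : ℝ) : ℂ) * Complex.I := by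
    intro n
    rw [Complex.exp_mul_I, Complex.cos_neg, Complex.sin_neg]; push_cast; ring
  rw [Finset.sum_congr rfl fun n _ => h n, Finset.sum_add_distrib, ← Finset.sum_mul, ← Complex.ofReal_sum, ← Complex.ofReal_sum, Complex.sq_norm, Complex.normSq_add_mul_I, Finset.sum_neg_distrib, neg_sq, sq, sq, Finset.sum_mul_sum, Finset.sum_mul_sum, ← Finset.sum_add_distrib]
  refine Finset.sum_congr rfl fun n _ => ?_
  rw [← Finset.sum_add_distrib]
  refine Finset.sum_congr rfl fun m _ => ?_
  rw [mul_sub, Real.cos_sub]; ring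

lemma kern0 (a b ξ : ℝ) (h : ξ ≠ 0) : ∫ t in a..b, Real.cos (t*ξ) = (Real.sin (b*ξ) - Real.sin (a*ξ))/ξ := by
  rw [intervalIntegral.integral_comp_mul_right _ h, integral_cos, smul_eq_mul]; field_simp

lemma kern (U V p q ξ : ℝ) (h : ξ ≠ 0) (hpq : p ≤ q) :
    |∫ s in p..q, ∫ t in (U-s)..(V+s), Real.cos (t*ξ)| ≤ min (2*(q-p)/|ξ|) (4/ξ^2) := by
  have h0 : 0 < |ξ| := abs_pos.2 h
  simp only [kern0 _ _ _ h]
  refine le_min ?_ ?_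
  · rw [← Real.norm_eq_abs]
    refine (intervalIntegral.norm_integral_le_of_norm_le_const (C := 2/|ξ|) fun s _ => ?_).trans (le_of_eq ?_)
    · rw [Real.norm_eq_abs, abs_div]; gcongr
      have := abs_sub (Real.sin ((V+s)*ξ)) (Real.sin ((U-s)*ξ))
      linarith [Real.abs_sin_le_one ((V+s)*ξ), Real.abs_sin_le_one ((U-s)*ξ)]
    · rw [abs_of_nonneg (show 0 ≤ q - p by linarith)]; ring
  · have hd : ∀ s ∈ uIcc p q, HasDerivAt (fun s => (-Real.cos ((V+s)*ξ) - Real.cos ((U-s)*ξ))/ξ^2) ((Real.sin ((V+s)*ξ) - Real.sin ((U-s)*ξ))/ξ) s := by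
      intro s _
      have d1 : HasDerivAt (fun s : ℝ => (V+s)*ξ) ξ s := by simpa using ((hasDerivAt_id s).const_add V).mul_const ξ
      have d2 : HasDerivAt (fun s : ℝ => (U-s)*ξ) (-ξ) s := by simpa using ((hasDerivAt_id s).const_sub U).mul_const ξ
      refine ((d1.cos.neg.sub d2.cos).div_const (ξ^2)).congr_deriv ?_
      field_simp
    rw [intervalIntegral.integral_eq_sub_of_hasDerivAt hd ((by fun_prop : Continuous _).intervalIntegrable _ _), ← sub_div, abs_div, abs_of_pos (show 0 < ξ^2 by positivity)]
    gcongr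
    have := Real.abs_cos_le_one
    rw [abs_le]
    constructor <;> linarith [abs_le.1 (this ((V+q)*ξ)), abs_le.1 (this ((V+p)*ξ)), abs_le.1 (this ((U-q)*ξ)), abs_le.1 (this ((U-p)*ξ))]

lemma mv (S : Finset ℕ) (c ω : ℕ → ℝ) (hω : ∀ n ∈ S, ∀ m ∈ S, n ≠ m → ω n ≠ ω m) {U V Δ : ℝ} (hΔ : 0 < Δ) :
    |(∫ t in U..V, ‖∑ n ∈ S, (c n : ℂ) * Complex.exp (-((t:ℂ) * (ω n : ℂ)) * Complex.I)‖^2) - (V - U) * ∑ n ∈ S, c n^2| ≤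
      Δ * ∑ n ∈ S, c n^2 + ∑ n ∈ S, ∑ m ∈ S, if n = m then 0 else |c n * c m| * min (2/|ω n - ω m|) (4/(Δ*(ω n - ω m)^2)) := by
  set F : ℝ → ℝ := fun t => ‖∑ n ∈ S, (c n : ℂ) * Complex.exp (-((t:ℂ) * (ω n : ℂ)) * Complex.I)‖^2
  have Fc : Continuous F := by fun_prop
  have F0 : ∀ t, 0 ≤ F t := fun t => by positivity
  have ii : ∀ a b, IntervalIntegrable F volume a b := fun a b => Fc.intervalIntegrable a b
  set J : ℝ → ℝ := fun s => ∫ t in (U-s)..(V+s), F t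
  have Jm : Monotone J := by
    intro s s' hs
    have e1 := intervalIntegral.integral_add_adjacent_intervals (ii (U-s') (U-s)) (ii (U-s) (V+s))
    have e2 := intervalIntegral.integral_add_adjacent_intervals (ii (U-s') (V+s)) (ii (V+s) (V+s'))
    have p1 : 0 ≤ ∫ t in (U-s')..(U-s), F t := intervalIntegral.integral_nonneg (by linarith) fun t _ => F0 t
    have p2 : 0 ≤ ∫ t in (V+s)..(V+s'), F t := intervalIntegral.integral_nonneg (by linarith) fun t _ => F0 t
    show (∫ t in (U-s)..(V+s), F t) ≤ ∫ t in (U-s')..(V+s'), F t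
    linarith
  have cK : ∀ ξ : ℝ, Continuous fun s => ∫ t in (U-s)..(V+s), Real.cos (t*ξ) := by
    intro ξ
    by_cases h : ξ = 0
    · simp only [h, mul_zero, Real.cos_zero, intervalIntegral.integral_const, smul_eq_mul]; fun_prop
    · simp only [kern0 _ _ _ h]; fun_prop
  have Je : ∀ s, J s = ∑ n ∈ S, ∑ m ∈ S, c n * c m * ∫ t in (U-s)..(V+s), Real.cos (t * (ω n - ω m)) := by
    intro s
    simp only [J, F, mv_sq]
    rw [intervalIntegral.integral_finsetSum fun n _ => (by fun_prop : Continuous _).intervalIntegrable _ _]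
    refine Finset.sum_congr rfl fun n _ => ?_
    rw [intervalIntegral.integral_finsetSum fun n _ => (by fun_prop : Continuous _).intervalIntegrable _ _]
    exact Finset.sum_congr rfl fun m _ => intervalIntegral.integral_const_mul _ _
  have Jc : Continuous J := by
    simp only [show J = _ from funext Je]
    exact continuous_finsetSum _ fun n _ => continuous_finsetSum _ fun m _ => (cK _).const_mul _
  set E := ∑ n ∈ S, ∑ m ∈ S, if n = m then 0 else |c n * c m| * min (2/|ω n - ω m|) (4/(Δ*(ω n - ω m)^2))
  set Q := ∑ n ∈ S, c n^2
  have key : ∀ p q, q - p = Δ → |(∫ s in p..q, J s) - Q * ((V-U)*Δ + (q^2-p^2))| ≤ Δ * E := by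
    intro p q hpq
    have e1 : ∫ s in p..q, J s = ∑ n ∈ S, ∑ m ∈ S, c n * c m * ∫ s in p..q, ∫ t in (U-s)..(V+s), Real.cos (t * (ω n - ω m)) := by
      simp only [Je]
      rw [intervalIntegral.integral_finsetSum fun n _ => (continuous_finsetSum _ fun m _ => (cK _).const_mul _).intervalIntegrable _ _]
      refine Finset.sum_congr rfl fun n _ => ?_
      rw [intervalIntegral.integral_finsetSum fun m _ => ((cK _).const_mul _).intervalIntegrable _ _]
      exact Finset.sum_congr rfl fun m _ => intervalIntegral.integral_const_mul _ _
    have e2 : Q * ((V-U)*Δ + (q^2-p^2)) = ∑ n ∈ S, ∑ m ∈ S, if n = m then c n * c m * ((V-U)*Δ + (q^2-p^2)) else 0 := by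
      rw [Finset.sum_mul]
      refine Finset.sum_congr rfl fun n hn => ?_
      rw [Finset.sum_ite_eq, if_pos hn, sq]
    rw [e1, e2, ← Finset.sum_sub_distrib, Finset.mul_sum]
    refine (Finset.abs_sum_le_sum_abs _ _).trans (Finset.sum_le_sum fun n hn => ?_)
    rw [← Finset.sum_sub_distrib, Finset.mul_sum]
    refine (Finset.abs_sum_le_sum_abs _ _).trans (Finset.sum_le_sum fun m hm => ?_)
    by_cases h : n = m
    · subst h
      simp only [if_true, sub_self, mul_zero, Real.cos_zero, intervalIntegral.integral_const, smul_eq_mul, mul_one]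
      have : ∫ s in p..q, (V + s - (U - s)) = (V-U)*Δ + (q^2-p^2) := by
        have : ∀ s, V + s - (U - s) = (V - U) + 2 * s := fun s => by ring
        simp only [this]
        rw [intervalIntegral.integral_add (by simp) ((by fun_prop : Continuous _).intervalIntegrable _ _), intervalIntegral.integral_const, intervalIntegral.integral_const_mul, integral_id, smul_eq_mul, hpq]; ring
      rw [this]; simp
    · rw [if_neg h, if_neg h, sub_zero, abs_mul]
      have hx : ω n - ω m ≠ 0 := sub_ne_zero.2 (hω n hn m hm h)
      refine (mul_le_mul_of_nonneg_left (kern U V p q _ hx (by linarith)) (abs_nonneg _)).trans (le_of_eq ?_)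
      rw [mul_left_comm, mul_min_of_nonneg _ _ hΔ.le, hpq]
      congr 2
      · ring
      · field_simp
  have k1 := abs_le.1 (key 0 Δ (by ring))
  have k2 := abs_le.1 (key (-Δ) 0 (by ring))
  have JI : ∀ p q, IntervalIntegrable J volume p q := fun p q => Jc.intervalIntegrable _ _
  have u1 : Δ * J 0 ≤ ∫ s in (0:ℝ)..Δ, J s := by
    have := intervalIntegral.integral_mono_on hΔ.le (by simp) (JI 0 Δ) fun s hs => Jm hs.1
    simpa using this
  have u2 : (∫ s in (-Δ)..0, J s) ≤ Δ * J 0 := by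
    have := intervalIntegral.integral_mono_on (by linarith) (JI (-Δ) 0) (by simp) fun s hs => Jm hs.2
    simpa using this
  have J0 : J 0 = ∫ t in U..V, F t := by simp [J]
  rw [← J0, abs_le]
  constructor
  · have : 0 ≤ Δ * (J 0 - (V-U)*Q + (Δ*Q+E)) := by nlinarith
    have := nonneg_of_mul_nonneg_right this hΔ
    linarith
  · have : 0 ≤ Δ * ((Δ*Q+E) - (J 0 - (V-U)*Q)) := by nlinarith
    have := nonneg_of_mul_nonneg_right this hΔ
    linarith

lemma offd (M : ℕ) (F : ℕ → ℕ → ℝ) (hF : ∀ n m, F n m = F m n) :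
    ∑ n ∈ Finset.Icc 1 M, ∑ m ∈ Finset.Icc 1 M, (if n = m then 0 else F n m) = 2 * ∑ n ∈ Finset.Icc 1 M, ∑ i ∈ Finset.range (M-n), F n (n+1+i) := by
  have h : ∀ n m, (if n = m then 0 else F n m) = (if n < m then F n m else 0) + (if m < n then F n m else 0) := by
    intro n m; rcases lt_trichotomy n m with h | h | h
    · simp [h, h.ne, h.not_gt]
    · simp [h]
    · simp [h, h.ne', h.not_gt]
  have e : ∑ n ∈ Finset.Icc 1 M, ∑ m ∈ Finset.Icc 1 M, (if m < n then F n m else 0) = ∑ n ∈ Finset.Icc 1 M, ∑ m ∈ Finset.Icc 1 M, (if n < m then F n m else 0) := by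
    rw [Finset.sum_comm]; simp only [hF]
  simp only [h, Finset.sum_add_distrib]
  rw [e, ← two_mul]
  congr 1
  refine Finset.sum_congr rfl fun n hn => ?_
  rw [← Finset.sum_filter, show (Finset.Icc 1 M).filter (n < ·) = Finset.Ico (n+1) (M+1) from Finset.ext fun m => by
    simp only [Finset.mem_filter, Finset.mem_Icc, Finset.mem_Ico]; omega, Finset.sum_Ico_eq_sum_range]
  simp


lemma mangL : ∃ C : ℝ, 1 ≤ C ∧ ∀ T : ℝ, 3 ≤ T → ∑ n ∈ Finset.Icc 1 ⌊T^4⌋₊, Λ n / n ≤ C * Real.log T := by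
  obtain ⟨C, hC, h⟩ := SL_le
  refine ⟨Real.exp 4 * (1 + C), by nlinarith [Real.add_one_le_exp (4:ℝ)], fun T hT => ?_⟩
  have hL := log_ge_one hT
  set L := Real.log T with hLd
  have h1 := h (1/L) (by positivity) (by rw [div_le_one (by linarith)]; exact hL)
  have hs := (SL_sum (σ := 1 + 1/L) (by simp; linarith)).1
  have h2 : ∑ n ∈ Finset.Icc 1 ⌊T^4⌋₊, Λ n * (n:ℝ)^(-(1+1/L)) ≤ SL (1 + 1/L) :=
    sum_le_hasSum _ (fun n _ => mul_nonneg (vM_nn n) (by positivity)) hs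
  calc ∑ n ∈ Finset.Icc 1 ⌊T^4⌋₊, Λ n / n ≤ ∑ n ∈ Finset.Icc 1 ⌊T^4⌋₊, Real.exp 4 * (Λ n * (n:ℝ)^(-(1+1/L))) := by
        refine Finset.sum_le_sum fun n hn => ?_
        obtain ⟨n1, n2⟩ := Finset.mem_Icc.1 hn
        have n0 : (0:ℝ) < n := by exact_mod_cast n1
        have ln : Real.log n ≤ 4 * L := by
          have := Real.log_le_log n0 ((Nat.le_floor_iff (by positivity)).1 n2)
          rw [Real.log_pow] at this; exact_mod_cast this
        have e : (n:ℝ)^(-(1+1/L)) = (n:ℝ)⁻¹ * Real.exp (-(Real.log n / L)) := by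
          rw [Real.rpow_def_of_pos n0, show Real.log n * -(1+1/L) = -Real.log n + -(Real.log n / L) by ring, Real.exp_add, Real.exp_neg, Real.exp_log n0]
        have e2 : 1 ≤ Real.exp 4 * Real.exp (-(Real.log n / L)) := by
          rw [← Real.exp_add]; refine Real.one_le_exp ?_
          have : Real.log n / L ≤ 4 := by rw [div_le_iff₀ (by linarith)]; exact ln
          linarith
        rw [e]
        calc Λ n / n = Λ n * (n:ℝ)⁻¹ * 1 := by ring
          _ ≤ Λ n * (n:ℝ)⁻¹ * (Real.exp 4 * Real.exp (-(Real.log n / L))) := by have := vM_nn n; gcongr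
          _ = _ := by ring
    _ = Real.exp 4 * ∑ n ∈ Finset.Icc 1 ⌊T^4⌋₊, Λ n * (n:ℝ)^(-(1+1/L)) := (Finset.mul_sum _ _ _).symm
    _ ≤ Real.exp 4 * (L + C) := by gcongr; rw [one_div_one_div] at h1; linarith
    _ ≤ _ := by rw [mul_assoc]; gcongr; nlinarith

noncomputable def gg (x : ℝ) (n : ℕ) : ℝ := Real.exp (-|Real.log x - Real.log n|)

lemma gg_le {x : ℝ} {n : ℕ} (hx : 1 ≤ x) (hn : 1 ≤ n) : gg x n ≤ 1 ∧ n * gg x n ≤ x := by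
  have n0 : (0:ℝ) < n := by exact_mod_cast hn
  refine ⟨Real.exp_le_one_iff.2 (by simp), ?_⟩
  calc n * gg x n = Real.exp (Real.log n) * gg x n := by rw [Real.exp_log n0]
    _ = Real.exp (Real.log n + -|Real.log x - Real.log n|) := by rw [Real.exp_add]; rfl
    _ ≤ Real.exp (Real.log x) := Real.exp_le_exp.2 (by linarith [neg_abs_le (Real.log x - Real.log n)])
    _ = x := Real.exp_log (by linarith)

lemma gg_dy {x : ℝ} {n M : ℕ} (hx : 1 ≤ x) (hn : 1 ≤ n) (hM : n ≤ M) :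
    gg x n^2 ≤ ∑ j ∈ Finset.range (M+1), 4 * (1/4:ℝ)^j * if n ≤ min ⌊2^j * x⌋₊ M then 1 else 0 := by
  classical
  have n0 : (0:ℝ) < n := by exact_mod_cast hn
  have hex : ∃ j : ℕ, (n:ℝ) ≤ 2^j * x := by
    refine ⟨n, ?_⟩
    have : (n:ℝ) ≤ 2^n := by exact_mod_cast (Nat.lt_two_pow_self (n := n)).le
    nlinarith
  obtain ⟨g1, g2⟩ := gg_le hx hn
  have g0 : 0 ≤ gg x n := (Real.exp_pos _).le
  have hj := Nat.find_spec hex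
  have hjn : Nat.find hex ≤ n := Nat.find_min' hex (by
    have : (n:ℝ) ≤ 2^n := by exact_mod_cast (Nat.lt_two_pow_self (n := n)).le
    nlinarith)
  have hm : ∀ i < Nat.find hex, 2^i * x < n := fun i hi => not_le.1 (Nat.find_min hex hi)
  generalize Nat.find hex = j at *
  refine le_trans ?_ (Finset.single_le_sum (f := fun j => 4 * (1/4:ℝ)^j * if n ≤ min ⌊2^j * x⌋₊ M then 1 else 0) (fun i _ => by positivity) (Finset.mem_range.2 (show j < M+1 by omega)))
  simp only [le_min_iff, hM, and_true, Nat.le_floor hj, if_true, mul_one]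
  rcases j with _ | j
  · simp; nlinarith
  · have h := hm j (by omega)
    have : 2^j * gg x n ≤ 1 := by
      have : 2^j * x * gg x n ≤ x := (mul_le_mul_of_nonneg_right h.le g0).trans g2
      nlinarith
    have h2 : (2^j * gg x n)^2 ≤ 1 := pow_le_one₀ (by positivity) this
    rw [pow_succ (1/4:ℝ) j, show 4 * ((1/4:ℝ)^j * (1/4)) = (1/4)^j by ring, show ((1:ℝ)/4)^j = 1/(2^j)^2 by rw [← pow_mul, mul_comm, pow_mul, div_pow]; norm_num, le_div_iff₀ (by positivity)]
    linarith [mul_pow (2^j) (gg x n) 2]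

lemma near_sum : ∀ᶠ T : ℝ in atTop, ∀ x : ℝ, 1 ≤ x → x ≤ T → ∀ h : ℕ, 1 ≤ h → (h:ℝ) ≤ Real.log T^2 →
    (1 + 2 * Real.log (Real.log T)) * ∑ n ∈ Finset.Icc 1 ⌊T^4⌋₊, Λ n * Λ (n+h) * gg x n^2 ≤ 16 * √(Real.log T) * T := by
  filter_upwards [sieve, eventually_ge_atTop 3] with T hs hT x hx hxT h h1 hh
  have hL := log_ge_one hT
  obtain ⟨M, hM⟩ : ∃ M, M = ⌊T^4⌋₊ := ⟨_, rfl⟩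
  rw [← hM]
  have hM4 : (M:ℝ) ≤ T^4 := by rw [hM]; exact Nat.floor_le (by positivity)
  have l0 : 0 ≤ Real.log (Real.log T) := Real.log_nonneg hL
  have s1 : 1 ≤ √(Real.log T) := Real.one_le_sqrt.2 hL
  have a0 : ∀ n, 0 ≤ Λ n * Λ (n+h) := fun n => mul_nonneg (vM_nn _) (vM_nn _)
  have t9 : T^(9/10:ℝ) ≤ T := by
    calc T^(9/10:ℝ) ≤ T^(1:ℝ) := Real.rpow_le_rpow_of_exponent_le (by linarith) (by norm_num)
      _ = T := Real.rpow_one T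
  have q : ∑ n ∈ Finset.Icc 1 M, Λ n * Λ (n+h) * gg x n^2 ≤ ∑ j ∈ Finset.range (M+1), 4 * (1/4:ℝ)^j * ∑ n ∈ Finset.Ioc 0 (min ⌊2^j * x⌋₊ M), Λ n * Λ (n+h) := by
    calc _ ≤ ∑ n ∈ Finset.Icc 1 M, Λ n * Λ (n+h) * ∑ j ∈ Finset.range (M+1), 4 * (1/4:ℝ)^j * if n ≤ min ⌊2^j * x⌋₊ M then 1 else 0 :=
          Finset.sum_le_sum fun n hn => mul_le_mul_of_nonneg_left (gg_dy hx (Finset.mem_Icc.1 hn).1 (Finset.mem_Icc.1 hn).2) (a0 n)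
      _ = ∑ j ∈ Finset.range (M+1), ∑ n ∈ Finset.Icc 1 M, Λ n * Λ (n+h) * (4 * (1/4:ℝ)^j * if n ≤ min ⌊2^j * x⌋₊ M then 1 else 0) := by
          simp only [Finset.mul_sum]; exact Finset.sum_comm
      _ = _ := by
          refine Finset.sum_congr rfl fun j _ => ?_
          rw [Finset.mul_sum, show Finset.Ioc 0 (min ⌊2^j * x⌋₊ M) = (Finset.Icc 1 M).filter (· ≤ min ⌊2^j * x⌋₊ M) from Finset.ext fun n => by
            simp only [Finset.mem_filter, Finset.mem_Icc, Finset.mem_Ioc, le_min_iff]; omega, Finset.sum_filter]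
          refine Finset.sum_congr rfl fun n _ => ?_
          split_ifs <;> ring
  have r : ∀ j ∈ Finset.range (M+1), (1 + 2 * Real.log (Real.log T)) * (4 * (1/4:ℝ)^j * ∑ n ∈ Finset.Ioc 0 (min ⌊2^j * x⌋₊ M), Λ n * Λ (n+h)) ≤ 8 * √(Real.log T) * T * (1/2:ℝ)^j := by
    intro j _
    have b1 : ((min ⌊2^j * x⌋₊ M : ℕ):ℝ) ≤ 2^j * T := by
      calc ((min ⌊2^j * x⌋₊ M : ℕ):ℝ) ≤ (⌊2^j * x⌋₊:ℝ) := by exact_mod_cast min_le_left _ _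
        _ ≤ 2^j * x := Nat.floor_le (by positivity)
        _ ≤ _ := by gcongr
    have b2 : ((min ⌊2^j * x⌋₊ M : ℕ):ℝ) ≤ T^5 := by
      calc ((min ⌊2^j * x⌋₊ M : ℕ):ℝ) ≤ (M:ℝ) := by exact_mod_cast min_le_right _ _
        _ ≤ T^4 := hM4
        _ ≤ _ := pow_le_pow_right₀ (by linarith) (by norm_num)
    have b3 := hs h _ h1 hh b2
    have b4 : T ≤ √(Real.log T) * (2^j * T) := by
      have : (1:ℝ) ≤ 2^j := one_le_pow₀ (by norm_num)
      have : 1 * 1 ≤ √(Real.log T) * 2^j := mul_le_mul s1 this (by norm_num) (by linarith)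
      nlinarith
    calc _ = 4 * (1/4:ℝ)^j * ((1 + 2 * Real.log (Real.log T)) * ∑ n ∈ Finset.Ioc 0 (min ⌊2^j * x⌋₊ M), Λ n * Λ (n+h)) := by ring
      _ ≤ 4 * (1/4:ℝ)^j * (√(Real.log T) * (2^j * T) + √(Real.log T) * (2^j * T)) := by
          refine mul_le_mul_of_nonneg_left (b3.trans (add_le_add ?_ (t9.trans b4))) (by positivity)
          gcongr
      _ = 8 * √(Real.log T) * T * ((1/4:ℝ)^j * 2^j) := by ring
      _ = _ := by rw [← mul_pow]; norm_num
  calc _ ≤ (1 + 2 * Real.log (Real.log T)) * ∑ j ∈ Finset.range (M+1), 4 * (1/4:ℝ)^j * ∑ n ∈ Finset.Ioc 0 (min ⌊2^j * x⌋₊ M), Λ n * Λ (n+h) := by gcongr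
    _ ≤ ∑ j ∈ Finset.range (M+1), 8 * √(Real.log T) * T * (1/2:ℝ)^j := by rw [Finset.mul_sum]; exact Finset.sum_le_sum r
    _ = 8 * √(Real.log T) * T * ∑ j ∈ Finset.range (M+1), (1/2:ℝ)^j := (Finset.mul_sum _ _ _).symm
    _ ≤ 8 * √(Real.log T) * T * 2 := by
      gcongr
      exact (sum_le_hasSum _ (fun _ _ => by positivity) hasSum_geometric_two)
    _ = _ := by ring

noncomputable def cc (x T : ℝ) (n : ℕ) : ℝ := (if n = 1 then Real.log T / x else 0) - an x n

lemma pair_bd {x T Δ : ℝ} {n i H : ℕ} (hΔ : 0 < Δ) (hn : 1 ≤ n) :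
    |cc x T n * cc x T (n+1+i)| * min (2/|Real.log n - Real.log (n+1+i:ℕ)|) (4/(Δ*(Real.log n - Real.log (n+1+i:ℕ))^2)) ≤
     16/Δ * (|cc x T n| * |cc x T (n+1+i)|) + 2 * (Λ n * Λ (n+1+i) * gg x n^2) * (if i < H then 4/((i:ℝ)+1) else 16 * n/(Δ*((i:ℝ)+1)^2)) := by
  have n0 : (0:ℝ) < n := by exact_mod_cast hn
  obtain ⟨m, hm⟩ : ∃ m, m = n+1+i := ⟨_, rfl⟩
  rw [← hm]
  have m0 : (0:ℝ) < m := by rw [hm]; push_cast; positivity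
  have hmr : (m:ℝ) = n + 1 + i := by rw [hm]; push_cast; ring
  have v0 := vM_nn n
  have v1 := vM_nn m
  have R0 : 0 ≤ 2 * (Λ n * Λ m * gg x n^2) * (if i < H then 4/((i:ℝ)+1) else 16 * n/(Δ*((i:ℝ)+1)^2)) := by
    refine mul_nonneg (by positivity) ?_
    split_ifs <;> positivity
  have ξe : Real.log n - Real.log m = -Real.log (m/n) := by rw [Real.log_div m0.ne' n0.ne']; ring
  rw [ξe, abs_neg, neg_sq, abs_mul]
  rcases le_or_gt (2*n) m with h | h
  · have h2 : (1:ℝ)/2 ≤ Real.log (m/n) := by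
      refine (show (1:ℝ)/2 ≤ Real.log 2 by linarith [Real.log_two_gt_d9]).trans (Real.log_le_log (by norm_num) ?_)
      rw [le_div_iff₀ n0]; exact_mod_cast h
    have : min (2/|Real.log (m/n)|) (4/(Δ*(Real.log (m/n))^2)) ≤ 16/Δ := by
      refine (min_le_right _ _).trans ?_
      calc 4/(Δ*(Real.log (m/n))^2) ≤ 4/(Δ*(1/2)^2) := by gcongr
        _ = 16/Δ := by field_simp; norm_num
    have := mul_le_mul_of_nonneg_left this (mul_nonneg (abs_nonneg (cc x T n)) (abs_nonneg (cc x T m)))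
    linarith
  · have n1 : n ≠ 1 := by omega
    have m1 : m ≠ 1 := by omega
    have ih : 0 < (i:ℝ) + 1 := by positivity
    have hmn : (m:ℝ) ≤ 2*n := by exact_mod_cast h.le
    have lo : ((i:ℝ)+1)/(2*n) ≤ Real.log (m/n) := by
      have h1 := Real.one_sub_inv_le_log_of_pos (show (0:ℝ) < m/n by positivity)
      refine le_trans ?_ h1
      rw [inv_div, show 1 - (n:ℝ)/m = (i+1)/m by rw [hmr]; field_simp; ring]
      gcongr
    have l0 : 0 < ((i:ℝ)+1)/(2*n) := by positivity
    have ab : |cc x T n| * |cc x T m| ≤ 2 * (Λ n * Λ m * gg x n^2) / n := by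
      have e : ∀ k : ℕ, k ≠ 1 → |cc x T k| = Λ k * Real.exp (-(Real.log k/2)) * gg x k := fun k hk => by
        rw [cc, if_neg hk, zero_sub, abs_neg, abs_of_nonneg (an_nonneg x k)]; rfl
      rw [e n n1, e m m1]
      have nm : Real.log n ≤ Real.log m := Real.log_le_log n0 (by rw [hmr]; linarith [(Nat.cast_nonneg i : (0:ℝ) ≤ i)])
      have e1 : Real.exp (-(Real.log n/2)) * Real.exp (-(Real.log m/2)) ≤ 1/n := by
        rw [← Real.exp_add, one_div, ← Real.exp_log (inv_pos.2 n0), Real.log_inv]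
        exact Real.exp_le_exp.2 (by linarith)
      have e2 : gg x m ≤ 2 * gg x n := by
        calc gg x m ≤ Real.exp (Real.log (m/n) + -|Real.log x - Real.log n|) := by
              refine Real.exp_le_exp.2 ?_
              rw [Real.log_div m0.ne' n0.ne']
              have := abs_sub_abs_le_abs_sub (Real.log x - Real.log n) (Real.log x - Real.log m)
              rw [show Real.log x - Real.log n - (Real.log x - Real.log m) = Real.log m - Real.log n by ring, abs_of_nonneg (show 0 ≤ Real.log m - Real.log n by linarith)] at this
              linarith
          _ = m/n * gg x n := by rw [Real.exp_add, Real.exp_log (by positivity)]; rfl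
          _ ≤ _ := by
              refine mul_le_mul_of_nonneg_right ?_ (Real.exp_pos _).le
              rw [div_le_iff₀ n0]; exact hmn
      have g0 : 0 ≤ gg x n := (Real.exp_pos _).le
      have g1 : 0 ≤ gg x m := (Real.exp_pos _).le
      calc _ = Λ n * Λ m * (Real.exp (-(Real.log n/2)) * Real.exp (-(Real.log m/2))) * (gg x n * gg x m) := by ring
        _ ≤ Λ n * Λ m * (1/n) * (gg x n * (2 * gg x n)) := by gcongr
        _ = _ := by ring
    have ab0 : 0 ≤ 16/Δ * (|cc x T n| * |cc x T m|) := by positivity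
    have : min (2/|Real.log (m/n)|) (4/(Δ*(Real.log (m/n))^2)) ≤ n * (if i < H then 4/((i:ℝ)+1) else 16 * n/(Δ*((i:ℝ)+1)^2)) := by
      split_ifs
      · refine (min_le_left _ _).trans ?_
        rw [abs_of_pos (l0.trans_le lo)]
        calc 2 / Real.log (m/n) ≤ 2 / (((i:ℝ)+1)/(2*n)) := by gcongr
          _ = _ := by field_simp; norm_num
      · refine (min_le_right _ _).trans ?_
        calc 4/(Δ*(Real.log (m/n))^2) ≤ 4/(Δ*(((i:ℝ)+1)/(2*n))^2) := by gcongr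
          _ = _ := by field_simp; norm_num
    have mn0 : 0 ≤ min (2/|Real.log (m/n)|) (4/(Δ*(Real.log (m/n))^2)) := by positivity
    have := mul_le_mul ab this mn0 (by positivity)
    rw [show 2 * (Λ n * Λ m * gg x n^2) / n * (n * (if i < H then 4/((i:ℝ)+1) else 16 * n/(Δ*((i:ℝ)+1)^2))) = 2 * (Λ n * Λ m * gg x n^2) * (if i < H then 4/((i:ℝ)+1) else 16 * n/(Δ*((i:ℝ)+1)^2)) by field_simp] at this
    linarith


lemma cc_sum : ∃ C : ℝ, 1 ≤ C ∧ ∀ x T : ℝ, 3 ≤ T → 1 ≤ x → ∀ S : Finset ℕ, ∑ n ∈ S, |cc x T n| ≤ C * (√x + Real.log T) := by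
  obtain ⟨C, hC, h⟩ := an_sum
  refine ⟨C, hC, fun x T hT hx S => ?_⟩
  have hL := log_ge_one hT
  have e : ∀ n ∈ S, |cc x T n| ≤ (if n = 1 then Real.log T else 0) + an x n := fun n _ => by
    have h1 := an_nonneg x n
    have h2 : Real.log T / x ≤ Real.log T := div_le_self (by linarith) hx
    have h3 : 0 ≤ Real.log T / x := by positivity
    rw [cc, abs_le]; split_ifs <;> constructor <;> linarith
  have h1 : ∑ n ∈ S, (if n = 1 then Real.log T else 0) ≤ Real.log T := by
    rw [Finset.sum_ite_eq']; split_ifs <;> linarith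
  have := (Finset.sum_le_sum e).trans_eq Finset.sum_add_distrib
  have := h x hx S
  nlinarith

lemma near_tot : ∀ᶠ T : ℝ in atTop, ∀ x : ℝ, 1 ≤ x → x ≤ T →
    ∑ i ∈ Finset.range ⌊Real.log T^2⌋₊, ∑ n ∈ Finset.Icc 1 ⌊T^4⌋₊, 2 * (Λ n * Λ (n+1+i) * gg x n^2) * (4/((i:ℝ)+1)) ≤ 128 * √(Real.log T) * T := by
  filter_upwards [near_sum, eventually_ge_atTop 3] with T hs hT x hx hxT
  have hL := log_ge_one hT
  have l0 : 0 ≤ Real.log (Real.log T) := Real.log_nonneg hL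
  have e : ∀ i ∈ Finset.range ⌊Real.log T^2⌋₊, ∑ n ∈ Finset.Icc 1 ⌊T^4⌋₊, 2 * (Λ n * Λ (n+1+i) * gg x n^2) * (4/((i:ℝ)+1)) ≤ 128 * √(Real.log T) * T / (1 + 2 * Real.log (Real.log T)) * ((i:ℝ)+1)⁻¹ := by
    intro i hi
    have h1 := hs x hx hxT (i+1) (by omega) ((Nat.le_floor_iff (by positivity)).1 (by have := Finset.mem_range.1 hi; omega))
    rw [mul_comm, ← le_div_iff₀ (by linarith)] at h1
    calc _ = 8 * (∑ n ∈ Finset.Icc 1 ⌊T^4⌋₊, Λ n * Λ (n+(i+1)) * gg x n^2) * ((i:ℝ)+1)⁻¹ := by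
          rw [Finset.mul_sum, Finset.sum_mul]
          exact Finset.sum_congr rfl fun n _ => by rw [show n+1+i = n+(i+1) by ring]; ring
      _ ≤ 8 * (16 * √(Real.log T) * T / (1 + 2 * Real.log (Real.log T))) * ((i:ℝ)+1)⁻¹ := by gcongr
      _ = _ := by ring
  refine (Finset.sum_le_sum e).trans ?_
  rw [← Finset.mul_sum]
  have hh : ∑ i ∈ Finset.range ⌊Real.log T^2⌋₊, ((i:ℝ)+1)⁻¹ ≤ 1 + 2 * Real.log (Real.log T) := by
    have := harmonic_le_one_add_log ⌊Real.log T^2⌋₊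
    rw [harmonic] at this; push_cast at this
    refine this.trans ?_
    have h1 : (1:ℝ) ≤ ⌊Real.log T^2⌋₊ := by exact_mod_cast Nat.le_floor (by push_cast; exact one_le_pow₀ hL)
    have := Real.log_le_log (by linarith) (Nat.floor_le (show 0 ≤ Real.log T^2 by positivity))
    rw [Real.log_pow] at this; push_cast at this; linarith
  calc _ ≤ 128 * √(Real.log T) * T / (1 + 2 * Real.log (Real.log T)) * (1 + 2 * Real.log (Real.log T)) := by gcongr
    _ = _ := by field_simp

lemma far_tot : ∃ C : ℝ, 1 ≤ C ∧ ∀ T x Δ : ℝ, 3 ≤ T → 1 ≤ x → 0 < Δ →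
    ∑ n ∈ Finset.Icc 1 ⌊T^4⌋₊, ∑ i ∈ (Finset.range (⌊T^4⌋₊-n)).filter (¬ · < ⌊Real.log T^2⌋₊), 2 * (Λ n * Λ (n+1+i) * gg x n^2) * (16 * n/(Δ*((i:ℝ)+1)^2)) ≤ C * x^2/Δ := by
  obtain ⟨C, hC, hm⟩ := mangL
  refine ⟨256 * C, by linarith, fun T x Δ hT hx hΔ => ?_⟩
  have hL := log_ge_one hT
  have hM := hm T hT
  obtain ⟨M, dM⟩ : ∃ M, M = ⌊T^4⌋₊ := ⟨_, rfl⟩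
  obtain ⟨H, dH⟩ : ∃ H, H = ⌊Real.log T^2⌋₊ := ⟨_, rfl⟩
  obtain ⟨L, dL⟩ : ∃ L, L = Real.log T := ⟨_, rfl⟩
  rw [← dM] at hM ⊢
  rw [← dH]
  rw [← dL] at hM hL dH
  have tail : ∀ R : ℕ, ∑ i ∈ (Finset.range R).filter (¬ · < H), (((i:ℝ)+1)^2)⁻¹ ≤ 2/L^2 := by
    intro R
    rw [show (Finset.range R).filter (¬ · < H) = Finset.Ico H R from Finset.ext fun i => by
      simp only [Finset.mem_filter, Finset.mem_range, Finset.mem_Ico]; omega]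
    have h1 := Finset.sum_Ico_add' (fun i : ℕ => ((i:ℝ)^2)⁻¹) H R 1
    push_cast at h1
    rw [h1, show Finset.Ico (H+1) (R+1) = Finset.Ioo H (R+1) from Finset.ext fun i => by simp only [Finset.mem_Ioo, Finset.mem_Ico]; omega]
    refine (sum_Ioo_inv_sq_le (α := ℝ) _ _).trans ?_
    have : L^2 ≤ H + 1 := by rw [dH]; exact (Nat.lt_floor_add_one _).le
    gcongr
  have inn : ∀ n ∈ Finset.Icc 1 M, ∑ i ∈ (Finset.range (M-n)).filter (¬ · < H), 2 * (Λ n * Λ (n+1+i) * gg x n^2) * (16 * n/(Δ*((i:ℝ)+1)^2)) ≤ 256 * x^2/(Δ*L) * (Λ n/n) := by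
    intro n hn
    have n1 := (Finset.mem_Icc.1 hn).1
    have n0 : (0:ℝ) < n := by exact_mod_cast n1
    have g0 : 0 ≤ gg x n := (Real.exp_pos _).le
    have gn := (gg_le hx n1).2
    have v0 := vM_nn n
    have ng : n * gg x n^2 ≤ x^2/n := by
      rw [le_div_iff₀ n0]
      calc n * gg x n^2 * n = (n * gg x n)^2 := by ring
        _ ≤ _ := by gcongr
    calc _ ≤ ∑ i ∈ (Finset.range (M-n)).filter (¬ · < H), 128 * L / Δ * (Λ n * (x^2/n)) * (((i:ℝ)+1)^2)⁻¹ := by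
          refine Finset.sum_le_sum fun i hi => ?_
          have hiM : n + 1 + i ≤ M := by have := Finset.mem_range.1 (Finset.mem_filter.1 hi).1; omega
          have vl : Λ (n+1+i) ≤ 4 * L := by
            refine (vM_le_log _).trans ?_
            have := Real.log_le_log (by positivity) ((Nat.le_floor_iff (by positivity)).1 (dM ▸ hiM))
            rw [Real.log_pow, ← dL] at this; exact_mod_cast this
          calc _ = 32 / Δ * (Λ n * (n * gg x n^2)) * Λ (n+1+i) * (((i:ℝ)+1)^2)⁻¹ := by field_simp; ring
            _ ≤ 32 / Δ * (Λ n * (x^2/n)) * (4*L) * (((i:ℝ)+1)^2)⁻¹ := by gcongr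
            _ = _ := by ring
      _ = 128 * L / Δ * (Λ n * (x^2/n)) * ∑ i ∈ (Finset.range (M-n)).filter (¬ · < H), (((i:ℝ)+1)^2)⁻¹ := (Finset.mul_sum _ _ _).symm
      _ ≤ 128 * L / Δ * (Λ n * (x^2/n)) * (2/L^2) := by gcongr; exact tail _
      _ = _ := by field_simp; ring
  refine (Finset.sum_le_sum inn).trans ?_
  rw [← Finset.mul_sum]
  calc _ ≤ 256 * x^2/(Δ*L) * (C * L) := by gcongr
    _ = _ := by field_simp

lemma offE : ∃ C : ℝ, 1 ≤ C ∧ ∀ᶠ T : ℝ in atTop, ∀ x : ℝ, 1 ≤ x → x ≤ T →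
    (∑ n ∈ Finset.Icc 1 ⌊T^4⌋₊, ∑ m ∈ Finset.Icc 1 ⌊T^4⌋₊, if n = m then 0 else |cc x T n * cc x T m| *
      min (2/|Real.log n - Real.log m|) (4/(T/√(Real.log T)*(Real.log n - Real.log m)^2))) ≤ C * T * √(Real.log T) := by
  obtain ⟨C1, hC1, hc⟩ := cc_sum
  obtain ⟨C2, hC2, hf⟩ := far_tot
  refine ⟨2 * (64 * C1^2 + 128 + C2), by nlinarith, ?_⟩
  filter_upwards [near_tot, eventually_ge_atTop 3, (isLittleO_log_rpow_atTop (show (0:ℝ) < 1/2 by norm_num)).def (show (0:ℝ) < 1 by norm_num)] with T hn hT hlog x hx hxT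
  have hL := log_ge_one hT
  have T0 : 0 < T := by linarith
  have lT : Real.log T ≤ √T := by
    rw [Real.norm_of_nonneg (by linarith), Real.norm_of_nonneg (by positivity), one_mul, ← Real.sqrt_eq_rpow] at hlog; exact hlog
  have s1 : 1 ≤ √(Real.log T) := Real.one_le_sqrt.2 hL
  have hn := hn x hx hxT
  obtain ⟨Δ, dΔ⟩ : ∃ D, D = T/√(Real.log T) := ⟨_, rfl⟩
  have hΔ : 0 < Δ := by rw [dΔ]; positivity
  have iΔ : 1/Δ = √(Real.log T)/T := by rw [dΔ]; field_simp
  have hf := hf T x Δ hT hx hΔ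
  have hc := hc x T hT hx (Finset.Icc 1 ⌊T^4⌋₊)
  rw [← dΔ]
  generalize ⌊T^4⌋₊ = M at *
  generalize ⌊Real.log T^2⌋₊ = H at *
  rw [offd M (fun n m => |cc x T n * cc x T m| * min (2/|Real.log n - Real.log m|) (4/(Δ*(Real.log n - Real.log m)^2)))
    (fun n m => by rw [mul_comm (cc x T n), abs_sub_comm, ← neg_sub (Real.log n), neg_sq])]
  have st1 : ∑ n ∈ Finset.Icc 1 M, ∑ i ∈ Finset.range (M-n), 16/Δ * (|cc x T n| * |cc x T (n+1+i)|) ≤ 16/Δ * (C1 * (√x + Real.log T))^2 := by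
    simp only [← Finset.mul_sum]
    refine mul_le_mul_of_nonneg_left ?_ (by positivity)
    have cn : 0 ≤ ∑ n ∈ Finset.Icc 1 M, |cc x T n| := Finset.sum_nonneg fun _ _ => abs_nonneg _
    calc _ ≤ ∑ n ∈ Finset.Icc 1 M, |cc x T n| * ∑ m ∈ Finset.Icc 1 M, |cc x T m| := by
          refine Finset.sum_le_sum fun n _ => mul_le_mul_of_nonneg_left ?_ (abs_nonneg _)
          have := Finset.sum_Ico_eq_sum_range (fun m => |cc x T m|) (n+1) (M+1)
          rw [Nat.add_sub_add_right] at this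
          rw [← this]
          exact Finset.sum_le_sum_of_subset_of_nonneg (fun m hm => by
            simp only [Finset.mem_Icc, Finset.mem_Ico] at *; omega) fun _ _ _ => abs_nonneg _
      _ = (∑ m ∈ Finset.Icc 1 M, |cc x T m|)^2 := by rw [← Finset.sum_mul, sq]
      _ ≤ _ := by gcongr
  have st2 : ∑ n ∈ Finset.Icc 1 M, ∑ i ∈ Finset.range (M-n), 2 * (Λ n * Λ (n+1+i) * gg x n^2) * (if i < H then 4/((i:ℝ)+1) else 16 * n/(Δ*((i:ℝ)+1)^2)) ≤ 128 * √(Real.log T) * T + C2 * x^2/Δ := by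
    refine le_trans ?_ (add_le_add hn hf)
    rw [Finset.sum_comm, ← Finset.sum_add_distrib]
    refine Finset.sum_le_sum fun n _ => ?_
    rw [← Finset.sum_filter_add_sum_filter_not (Finset.range (M-n)) (· < H)]
    refine add_le_add ?_ (le_of_eq ?_)
    · rw [Finset.sum_congr rfl fun i hi => by rw [if_pos (Finset.mem_filter.1 hi).2]]
      refine Finset.sum_le_sum_of_subset_of_nonneg (fun i hi => Finset.mem_range.2 (Finset.mem_filter.1 hi).2) fun i _ _ => ?_
      have := vM_nn n; have := vM_nn (n+1+i); positivity
    · exact Finset.sum_congr rfl fun i hi => by rw [if_neg (Finset.mem_filter.1 hi).2]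
  have st : ∑ n ∈ Finset.Icc 1 M, ∑ i ∈ Finset.range (M-n), |cc x T n * cc x T (n+1+i)| * min (2/|Real.log n - Real.log (n+1+i:ℕ)|) (4/(Δ*(Real.log n - Real.log (n+1+i:ℕ))^2)) ≤
      16/Δ * (C1 * (√x + Real.log T))^2 + (128 * √(Real.log T) * T + C2 * x^2/Δ) := by
    refine le_trans ?_ (add_le_add st1 st2)
    rw [← Finset.sum_add_distrib]
    refine Finset.sum_le_sum fun n hn => ?_
    rw [← Finset.sum_add_distrib]
    exact Finset.sum_le_sum fun i _ => pair_bd hΔ (Finset.mem_Icc.1 hn).1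
  refine (mul_le_mul_of_nonneg_left st (by norm_num)).trans ?_
  have q1 : (√x + Real.log T)^2 ≤ 4 * T := by
    have : √x ≤ √T := Real.sqrt_le_sqrt hxT
    calc (√x + Real.log T)^2 ≤ (√T+√T)^2 := by gcongr
      _ = 4 * √T^2 := by ring
      _ = _ := by rw [Real.sq_sqrt T0.le]
  have r1 : 16/Δ * (C1 * (√x + Real.log T))^2 ≤ 64 * C1^2 * T * √(Real.log T) := by
    calc _ = 16 * C1^2 * (√x + Real.log T)^2 * (1/Δ) := by ring
      _ ≤ 16 * C1^2 * (4 * T) * (√(Real.log T)/T) := by rw [iΔ]; gcongr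
      _ = 64 * C1^2 * 1 * √(Real.log T) := by field_simp; norm_num
      _ ≤ _ := by gcongr; linarith
  have r2 : C2 * x^2/Δ ≤ C2 * T * √(Real.log T) := by
    calc _ = C2 * x^2 * (1/Δ) := by ring
      _ ≤ C2 * T^2 * (√(Real.log T)/T) := by rw [iΔ]; gcongr
      _ = _ := by field_simp
  linarith


lemma PP_eq {x T : ℝ} (hT : 3 ≤ T) (t : ℝ) : PP x T t = ∑ n ∈ Finset.Icc 1 ⌊T^4⌋₊, (cc x T n : ℂ) * Complex.exp (-((t:ℂ) * (Real.log n : ℝ)) * Complex.I) := by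
  have hM : 1 ≤ ⌊T^4⌋₊ := Nat.le_floor (by push_cast; exact one_le_pow₀ (by linarith))
  rw [PP]
  generalize ⌊T^4⌋₊ = M at *
  simp only [cc, Complex.ofReal_sub, sub_mul, Finset.sum_sub_distrib]
  congr 1
  · rw [Finset.sum_eq_single 1 (fun n _ h => by simp [h]) (fun h => absurd (Finset.mem_Icc.2 ⟨le_rfl, hM⟩) h)]; simp
  · rw [Finset.range_eq_Ico, Finset.sum_eq_sum_Ico_succ_bot (by omega)]
    rw [show an x 0 = 0 by simp [an]]
    simp only [Complex.ofReal_zero, zero_mul, zero_add]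
    rfl

lemma cc_sq {x T : ℝ} (hT : 3 ≤ T) : ∑ n ∈ Finset.Icc 1 ⌊T^4⌋₊, cc x T n^2 = Real.log T^2/x^2 + ∑ n ∈ Finset.range (⌊T^4⌋₊+1), an x n^2 := by
  have hM : 1 ≤ ⌊T^4⌋₊ := Nat.le_floor (by push_cast; exact one_le_pow₀ (by linarith))
  generalize ⌊T^4⌋₊ = M at *
  have a1 : an x 1 = 0 := by simp [an]
  have e : ∀ n, cc x T n^2 = (if n = 1 then Real.log T^2/x^2 else 0) + an x n^2 := fun n => by
    unfold cc; split_ifs with h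
    · rw [h, a1]; simp [div_pow]
    · simp
  simp only [e, Finset.sum_add_distrib]
  congr 1
  · rw [Finset.sum_ite_eq', if_pos (Finset.mem_Icc.2 ⟨le_rfl, hM⟩)]
  · rw [Finset.range_eq_Ico, Finset.sum_eq_sum_Ico_succ_bot (by omega), show an x 0 = 0 by simp [an]]
    simp; rfl

lemma PP_sup : ∃ C : ℝ, 1 ≤ C ∧ ∀ x T : ℝ, 3 ≤ T → 1 ≤ x → ∀ t, ‖PP x T t‖ ≤ C * (√x + Real.log T) := by
  obtain ⟨C, hC, h⟩ := cc_sum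
  refine ⟨C, hC, fun x T hT hx t => ?_⟩
  rw [PP_eq hT]
  refine (norm_sum_le _ _).trans (le_trans (Finset.sum_le_sum fun n _ => ?_) (h x T hT hx (Finset.Icc 1 ⌊T^4⌋₊)))
  rw [norm_mul, Complex.norm_real, Real.norm_eq_abs, ← Complex.ofReal_mul, ← Complex.ofReal_neg, Complex.norm_exp_ofReal_mul_I, mul_one]

lemma PP_mean : ∃ C : ℝ, 1 ≤ C ∧ ∀ᶠ T : ℝ in atTop, ∀ x : ℝ, 1 ≤ x → x ≤ T → ∀ U ∈ Icc T (T+1), ∀ V ∈ Icc (2*T) (2*T+1),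
    |(∫ t in U..V, ‖PP x T t‖^2) - T * (Real.log T^2/x^2 + Real.log x)| ≤ C * (T * (Real.log T^2/x^2)/√(Real.log T) + T * √(Real.log T)) := by
  obtain ⟨C1, hC1, h1⟩ := offE
  obtain ⟨C2, hC2, h2⟩ := S2
  refine ⟨2 + C1 + 3 * C2, by linarith, ?_⟩
  filter_upwards [h1, eventually_ge_atTop 3] with T h1 hT x hx hxT U hU V hV
  have hL := log_ge_one hT
  have l1 : 1 ≤ √(Real.log T) := Real.one_le_sqrt.2 hL
  have ls : √(Real.log T)^2 = Real.log T := Real.sq_sqrt (by linarith)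
  have lT : Real.log T ≤ T := Real.log_le_self (by linarith)
  have hlx : Real.log x ≤ Real.log T := Real.log_le_log (by linarith) hxT
  have hlx0 : 0 ≤ Real.log x := Real.log_nonneg hx
  have h2 := h2 x T hT hx hxT
  have h1 := h1 x hx hxT
  have hmv := mv (Finset.Icc 1 ⌊T^4⌋₊) (cc x T) (fun n => Real.log n) (U := U) (V := V) (Δ := T/√(Real.log T)) (fun n hn m hm hnm h => hnm (by
    have n0 : (0:ℝ) < n := by exact_mod_cast (Finset.mem_Icc.1 hn).1
    have m0 : (0:ℝ) < m := by exact_mod_cast (Finset.mem_Icc.1 hm).1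
    exact_mod_cast Real.log_injOn_pos n0 m0 h)) (by positivity)
  simp only [← PP_eq hT, cc_sq hT] at hmv
  have hmv2 := hmv.trans (add_le_add_right h1 _)
  clear hmv h1
  obtain ⟨a, da⟩ : ∃ a, a = Real.log T^2/x^2 := ⟨_, rfl⟩
  have a0 : 0 ≤ a := by rw [da]; positivity
  rw [← da] at hmv2 ⊢
  generalize √(Real.log T) = l at *
  generalize Real.log T = L at *
  generalize (∫ t in U..V, ‖PP x T t‖^2) = J at *
  generalize (∑ n ∈ Finset.range (⌊T^4⌋₊+1), an x n^2) = S at *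
  obtain ⟨D, dD⟩ : ∃ D, D = T / l := ⟨_, rfl⟩
  have D1 : 1 ≤ D := by rw [dD, le_div_iff₀ (by linarith)]; nlinarith
  have DT : D ≤ T * l := by rw [dD]; exact (div_le_self (by linarith) l1).trans (by nlinarith)
  have DL : D * L = T * l := by rw [dD, ← ls]; field_simp
  rw [← dD] at hmv2
  rw [show T * a / l = D * a by rw [dD]; ring]
  have Tl : T ≤ T * l := by nlinarith
  obtain ⟨s1, s2⟩ := abs_le.1 h2
  obtain ⟨m1, m2⟩ := abs_le.1 hmv2
  have S0 : S ≤ L + C2 := by linarith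
  have aS : -C2 ≤ S := by linarith
  have d1 : D * S ≤ T * l + C2 * (T * l) := by nlinarith
  have Tb : T * |S - Real.log x| ≤ T * C2 := by gcongr
  have vb : |(V - U - T) * (a + S)| ≤ D * (a + L + C2) := by
    rw [abs_mul]
    have v1 : |V - U - T| ≤ 1 := by rw [abs_le]; constructor <;> linarith [hU.1, hU.2, hV.1, hV.2]
    have v2 : |a + S| ≤ a + L + C2 := by rw [abs_le]; constructor <;> linarith
    exact mul_le_mul (v1.trans D1) v2 (abs_nonneg _) (by linarith)
  have tb : |T * (S - Real.log x)| ≤ C2 * (T * l) := by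
    rw [abs_mul, abs_of_pos (show 0 < T by linarith)]; nlinarith
  have dC : D * C2 ≤ C2 * (T * l) := by nlinarith
  have da0 : 0 ≤ D * a := mul_nonneg (by linarith) a0
  have cda : 0 ≤ (C1 + 3 * C2) * (D * a) := mul_nonneg (by linarith) da0
  obtain ⟨v3, v4⟩ := abs_le.1 vb
  obtain ⟨t3, t4⟩ := abs_le.1 tb
  rw [abs_le]
  constructor <;> linarith


lemma ptw {n p d i s m l T q1 q2 K C : ℝ} (h1 : |n - p| ≤ d) (p0 : 0 ≤ p) (hd : d ≤ K * (i + s * q1 + s * m * q2))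
    (i2 : i^2 = i) (i0 : 0 ≤ i) (s0 : 0 ≤ s) (hs : s^2 = T) (hm : m^2 = l) (m1 : 1 ≤ m) (hq1 : q1^2 ≤ 2*q2) (hq2 : q2^2 ≤ 2*q2) (q0 : 0 ≤ q1) (q20 : 0 ≤ q2)
    (hK : 1 ≤ K) (hC : 1 ≤ C) (hp : p ≤ 2 * C * s) :
    |n^2 - p^2| ≤ p^2/l + (16*K^2+4*C*K) * l * i + (16*K^2+4*C*K) * (T * l) * q2 := by
  have l1 : 1 ≤ l := by nlinarith
  have ml : m ≤ l := by nlinarith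
  have T0 : 0 ≤ T := by rw [← hs]; positivity
  obtain ⟨a, da⟩ : ∃ a, a = K * (i + s * q1) := ⟨_, rfl⟩
  obtain ⟨b, db⟩ : ∃ b, b = K * (s * m * q2) := ⟨_, rfl⟩
  have a0 : 0 ≤ a := by rw [da]; positivity
  have b0 : 0 ≤ b := by rw [db]; positivity
  have hd' : d ≤ a + b := by rw [da, db]; linarith
  have d0 : 0 ≤ d := (abs_nonneg _).trans h1
  have e1 : |n^2 - p^2| ≤ 2 * p * (a+b) + (a+b)^2 := by
    have : n^2 - p^2 = 2 * p * (n-p) + (n-p)^2 := by ring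
    rw [this]
    refine (abs_add_le _ _).trans ?_
    rw [abs_mul, abs_of_nonneg (by positivity : 0 ≤ 2 * p), abs_of_nonneg (sq_nonneg (n-p)), ← sq_abs (n-p)]
    have := h1.trans hd'
    gcongr
  have e2 : 2 * p * a ≤ p^2/l + l * a^2 := by
    have : 0 ≤ (p - l*a)^2/l := by positivity
    have e : (p - l*a)^2/l = p^2/l - 2 * p * a + l * a^2 := by field_simp; ring
    linarith
  have e3 : a^2 ≤ 2*K^2*(i + 2*T*q2) := by
    have x1 : a^2 ≤ K^2 * (2 * (i^2 + T * q1^2)) := by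
      rw [da, mul_pow, ← hs]; gcongr; nlinarith [sq_nonneg (i - s * q1)]
    have : K^2 * (2 * (i^2 + T * q1^2)) ≤ K^2 * (2 * (i + T * (2*q2))) := by rw [i2]; gcongr
    linarith
  have e4 : b^2 ≤ 2 * K^2 * (T * l * q2) := by
    have : b^2 = K^2 * (T * l) * q2^2 := by rw [db, ← hs, ← hm]; ring
    rw [this]
    calc _ ≤ K^2 * (T * l) * (2 * q2) := by gcongr
      _ = _ := by ring
  have e5 : 2 * p * b ≤ 4 * C * K * (T * l) * q2 := by
    calc _ ≤ 2 * (2 * C * s) * b := by gcongr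
      _ = 4 * C * K * (s^2 * m) * q2 := by rw [db]; ring
      _ ≤ _ := by rw [hs]; gcongr
  have e6 : (a+b)^2 ≤ 2 * a^2 + 2 * b^2 := by nlinarith [sq_nonneg (a-b)]
  have e7 : (l+2) * a^2 ≤ 3 * l * (2*K^2*(i + 2*T*q2)) := by gcongr; linarith
  have e8 : 0 ≤ (10 * K^2 + 4*C*K) * l * i := by positivity
  nlinarith

lemma Q_facts (a b : ℝ) : Q1 a b^2 ≤ 2 * Q2 a b ∧ Q2 a b^2 ≤ 2 * Q2 a b ∧ 0 ≤ Q1 a b ∧ 0 ≤ Q2 a b := by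
  have f : ∀ a : ℝ, (1/(1+|a|))^2 ≤ 1/(1+a^2) := fun a => by
    rw [div_pow, one_pow]
    apply one_div_le_one_div_of_le (by positivity)
    nlinarith [abs_nonneg a, sq_abs a]
  have g : ∀ a : ℝ, (1/(1+a^2))^2 ≤ 1/(1+a^2) := fun a => by
    have h0 : 0 ≤ 1/(1+a^2) := by positivity
    have h1 : 1/(1+a^2) ≤ 1 := by rw [div_le_one (by positivity)]; nlinarith
    nlinarith
  refine ⟨?_, ?_, Q1_nn a b, Q2_nn a b⟩
  · unfold Q1 Q2
    nlinarith [f a, f b, sq_nonneg (1/(1+|a|) - 1/(1+|b|))]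
  · unfold Q2
    nlinarith [g a, g b, sq_nonneg (1/(1+a^2) - 1/(1+b^2))]

lemma Q2_int (U V : ℝ) : Integrable (fun t => Q2 (U-t) (V-t)) ∧ ∫ t, Q2 (U-t) (V-t) = 2 * Real.pi := by
  have i : ∀ U : ℝ, Integrable (fun t : ℝ => 1/(1+(U-t)^2)) := fun U => by
    simp only [one_div]; exact integrable_inv_one_add_sq.comp_sub_left U
  have e : ∀ U : ℝ, ∫ t : ℝ, 1/(1+(U-t)^2) = Real.pi := fun U => by
    rw [integral_sub_left_eq_self (fun t : ℝ => 1/(1+t^2)) volume U]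
    simpa using integral_univ_inv_one_add_sq
  refine ⟨(i U).add (i V), ?_⟩
  unfold Q2
  rw [integral_add (i U) (i V), e, e]; ring

lemma ind_int {U V : ℝ} (h : U ≤ V) {f : ℝ → ℝ} (hf : Continuous f) : Integrable (fun t => ind U V t * f t) ∧ ∫ t, ind U V t * f t = ∫ t in U..V, f t := by
  have e : (fun t => ind U V t * f t) = (Ioo U V).indicator f := by
    ext t; simp only [ind, indicator, mem_Ioo]; split_ifs <;> simp
  rw [e, integral_indicator measurableSet_Ioo, intervalIntegral.integral_of_le h, integral_Ioc_eq_integral_Ioo]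
  refine ⟨(IntegrableOn.mono_set (hf.integrableOn_Icc (a := U) (b := V)) Ioo_subset_Icc_self).integrable_indicator measurableSet_Ioo, rfl⟩

lemma PP_cont (x T : ℝ) : Continuous fun t => PP x T t := by
  unfold PP
  refine continuous_const.sub (continuous_finsetSum _ fun n _ => ?_)
  fun_prop

lemma FFbig : ∃ C : ℝ, 1 ≤ C ∧ ∀ᶠ T : ℝ in atTop, ∀ x : ℝ, 1 ≤ x → x ≤ T → ∀ B : Finset ℂ, (∀ ρ, ρ ∈ B ↔ ρ ∈ zeroBand T) →
    |(∫ t, ‖A1 x B t‖^2) - T * (Real.log T^2/x^2 + Real.log x)| ≤ C * (T * (Real.log T^2/x^2)/√(Real.log T) + T * √(Real.log T)) := by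
  obtain ⟨K, hK, h1⟩ := contour
  obtain ⟨C, hC, h2⟩ := PP_sup
  obtain ⟨D, hD, h3⟩ := PP_mean
  obtain ⟨M, dM⟩ : ∃ M, M = 16*K^2+4*C*K := ⟨_, rfl⟩
  have M0 : 0 ≤ M := by rw [dM]; positivity
  have hlog : ∀ᶠ T : ℝ in atTop, Real.log T ≤ √T := by
    filter_upwards [(isLittleO_log_rpow_atTop (show (0:ℝ) < 1/2 by norm_num)).bound one_pos, eventually_ge_atTop 1] with T h h1
    rw [one_mul, ← Real.sqrt_eq_rpow, Real.norm_eq_abs, Real.norm_eq_abs, abs_of_nonneg (Real.sqrt_nonneg T)] at h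
    exact (le_abs_self _).trans h
  refine ⟨2 * D + 1 + 2 * M + 8 * M, by linarith, ?_⟩
  filter_upwards [h3, hlog, eventually_ge_atTop 8, Real.tendsto_log_atTop.eventually_ge_atTop 8] with T h3 hlog hT hL x hx hxT B hB
  obtain ⟨U, hU, V, hV, h1⟩ := h1 T hT hL
  have hUV : U ≤ V := by linarith [hU.2, hV.1]
  have h1 := h1 x ⟨hx, hxT⟩ B hB
  have h3 := h3 x hx hxT U hU V hV
  have sT : √T^2 = T := Real.sq_sqrt (by linarith)
  have hp : ∀ t, ‖PP x T t‖ ≤ 2 * C * √T := fun t => by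
    refine (h2 x T (by linarith) hx t).trans ?_
    have : √x ≤ √T := Real.sqrt_le_sqrt hxT
    nlinarith
  have hm : (Real.log T^(1/4:ℝ))^2 = √(Real.log T) := by
    rw [← Real.rpow_natCast, ← Real.rpow_mul (by linarith), Real.sqrt_eq_rpow]; norm_num
  have m1 : 1 ≤ Real.log T^(1/4:ℝ) := Real.one_le_rpow (by linarith) (by norm_num)
  have l1 : 1 ≤ √(Real.log T) := Real.one_le_sqrt.2 (by linarith)
  have ls : √(Real.log T)^2 = Real.log T := Real.sq_sqrt (by linarith)
  have hlx : Real.log x ≤ Real.log T := Real.log_le_log (by linarith) hxT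
  have hlx0 : 0 ≤ Real.log x := Real.log_nonneg hx
  have pt : ∀ᵐ t : ℝ, ‖‖A1 x B t‖^2 - ind U V t * ‖PP x T t‖^2‖ ≤ 
      ind U V t * (‖PP x T t‖^2/√(Real.log T)) + ind U V t * (M * √(Real.log T)) + M * (T * √(Real.log T)) * Q2 (U-t) (V-t) := by
    have n1 : ∀ᵐ t : ℝ, t ≠ U := by simp [ae_iff]
    have n2 : ∀ᵐ t : ℝ, t ≠ V := by simp [ae_iff]
    filter_upwards [n1, n2] with t t1 t2
    have h := h1 t t1 t2
    have i0 := ind_le U V t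
    have i2 : ind U V t^2 = ind U V t := by unfold ind; split_ifs <;> norm_num
    obtain ⟨q1, q2, q3, q4⟩ := Q_facts (U-t) (V-t)
    have nn : |‖A1 x B t‖ - ind U V t * ‖PP x T t‖| ≤ ‖A1 x B t - ind U V t * PP x T t‖ := by
      have := abs_norm_sub_norm_le (A1 x B t) (ind U V t * PP x T t)
      rwa [norm_mul, Complex.norm_real, Real.norm_eq_abs, abs_of_nonneg i0.1] at this
    have pp : ind U V t * ‖PP x T t‖ ≤ 2 * C * √T := (mul_le_of_le_one_left (norm_nonneg _) i0.2).trans (hp t)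
    have := ptw nn (mul_nonneg i0.1 (norm_nonneg _)) h i2 i0.1 (Real.sqrt_nonneg T) sT hm m1 q1 q2 q3 q4 hK hC pp
    rw [mul_pow, i2, ← dM] at this
    rw [Real.norm_eq_abs]
    refine this.trans (le_of_eq ?_)
    ring
  have cP : Continuous fun t => ‖PP x T t‖^2 := (PP_cont x T).norm.pow 2
  obtain ⟨iA, -⟩ := FFid hx hB
  obtain ⟨iP, eP⟩ := ind_int hUV cP
  obtain ⟨iP2, eP2⟩ := ind_int hUV (cP.div_const (√(Real.log T)))
  obtain ⟨iM, eM⟩ := ind_int hUV (f := fun _ => M * √(Real.log T)) continuous_const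
  obtain ⟨iQ, eQ⟩ := Q2_int U V
  have iQ' := iQ.const_mul (M * (T * √(Real.log T)))
  have hI := norm_integral_le_of_norm_le ((iP2.add iM).add iQ') pt
  rw [integral_sub iA iP, integral_add' (iP2.add iM) iQ', integral_add' iP2 iM, integral_const_mul, eQ, eP, eP2, eM, intervalIntegral.integral_div, intervalIntegral.integral_const, smul_eq_mul, Real.norm_eq_abs] at hI
  clear iA iP eP iP2 eP2 iM eM iQ eQ iQ' cP pt hp h1 h2 hm m1
  obtain ⟨a, da⟩ : ∃ a, a = Real.log T^2/x^2 := ⟨_, rfl⟩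
  have a0 : 0 ≤ a := by rw [da]; positivity
  rw [← da] at h3 ⊢
  generalize √(Real.log T) = l at *
  generalize Real.log T = L at *
  generalize (∫ t in U..V, ‖PP x T t‖^2) = J at *
  generalize (∫ t, ‖A1 x B t‖^2) = A at *
  have b1 : (V - U) * (M * l) ≤ 2 * M * (T * l) := by
    have : V - U ≤ 2 * T := by linarith [hV.2, hU.1]
    calc _ ≤ (2 * T) * (M * l) := by gcongr
      _ = _ := by ring
  have b2 : M * (T * l) * (2 * Real.pi) ≤ 8 * M * (T * l) := by
    have : 0 ≤ M * (T * l) := by positivity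
    nlinarith [Real.pi_lt_four]
  obtain ⟨E, dE⟩ : ∃ E, E = T * a / l + T * l := ⟨_, rfl⟩
  have E0 : 0 ≤ T * a / l := by positivity
  rw [← dE] at h3 ⊢
  have b3 : J / l ≤ E + D * E := by
    obtain ⟨_, j2⟩ := abs_le.1 h3
    have : J ≤ T * a + T * L + D * E := by nlinarith
    calc J / l ≤ (T * a + T * L + D * E)/l := by gcongr
      _ = E + D * E / l := by rw [dE, ← ls]; field_simp
      _ ≤ _ := by
        have : D * E / l ≤ D * E := div_le_self (by rw [dE]; positivity) l1
        linarith
  have : |A - T * (a + Real.log x)| ≤ |A - J| + |J - T * (a + Real.log x)| := abs_sub_le _ _ _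
  have TE : T * l ≤ E := by linarith
  have : (2 * M + 8 * M) * (T * l) ≤ (2 * M + 8 * M) * E := by gcongr
  linarith


lemma box_fin (R : ℝ) : {ρ : ℂ | IsNontrivialZero ρ ∧ 0 ≤ ρ.im ∧ ρ.im ≤ R}.Finite := by
  have hc : IsCompact (Icc (0:ℝ) 1 ×ℂ Icc (0:ℝ) R) := isCompact_Icc.reProdIm isCompact_Icc
  refine hc.inter_riemannZetaZeros_finite.subset fun ρ h => ⟨?_, h.1.1⟩
  exact ⟨⟨h.1.2.1.le, h.1.2.2.le⟩, h.2⟩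

lemma band_B {T : ℝ} (hT : 3 ≤ T) : ∃ B : Finset ℂ, ∀ ρ, ρ ∈ B ↔ ρ ∈ zeroBand T := by
  have hf : (zeroBand T).Finite := (box_fin (2*T)).subset fun ρ h => ⟨h.1, by linarith [h.2.1], h.2.2⟩
  exact ⟨hf.toFinset, fun ρ => hf.mem_toFinset⟩

lemma FFsmall (T0 : ℝ) : ∃ C : ℝ, 0 ≤ C ∧ ∀ x T : ℝ, 3 ≤ T → T ≤ T0 → 1 ≤ x → x ≤ T → ‖FF x T‖ ≤ C := by
  have hf := box_fin (2*T0)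
  obtain ⟨Z, dZ⟩ : ∃ Z, Z = hf.toFinset := ⟨_, rfl⟩
  refine ⟨|∑ ρ ∈ Z, ∑ ρ' ∈ Z, (zetaMult ρ : ℝ) * zetaMult ρ' * T0 * ‖Wweight (ρ - ρ')‖|, abs_nonneg _, fun x T hT hTT hx hxT => ?_⟩
  obtain ⟨B, hB⟩ := band_B hT
  have hBs : zeroBand T = (B : Set ℂ) := by ext ρ; exact (hB ρ).symm
  have hBZ : B ⊆ Z := fun ρ h => by
    have := (hB ρ).1 h
    rw [dZ, hf.mem_toFinset]
    exact ⟨this.1, by linarith [this.2.1], by linarith [this.2.2]⟩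
  have T00 : 0 ≤ T0 := by linarith
  refine le_trans ?_ (le_abs_self _)
  unfold FF
  rw [hBs, finsum_mem_coe_finset]
  refine (norm_sum_le _ _).trans ((Finset.sum_le_sum fun ρ h => ?_).trans (Finset.sum_le_sum_of_subset_of_nonneg hBZ fun _ _ _ => Finset.sum_nonneg fun _ _ => by positivity))
  rw [finsum_mem_coe_finset]
  refine (norm_sum_le _ _).trans ((Finset.sum_le_sum fun ρ' h' => ?_).trans (Finset.sum_le_sum_of_subset_of_nonneg hBZ fun _ _ _ => by positivity))
  rw [norm_mul, norm_mul, norm_mul, Complex.norm_natCast, Complex.norm_natCast, Complex.norm_cpow_eq_rpow_re_of_pos (by linarith)]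
  have : x ^ (ρ - ρ').re ≤ T0 := by
    have h1 := ((hB ρ).1 h).1.2.2
    have h2 := ((hB ρ').1 h').1.2.1
    calc x ^ (ρ - ρ').re ≤ x^(1:ℝ) := Real.rpow_le_rpow_of_exponent_le hx (by rw [Complex.sub_re]; linarith)
      _ ≤ T0 := by rw [Real.rpow_one]; linarith
  gcongr

/-- Unconditionally, uniformly for `1 ≤ x ≤ T` and `T ≥ 3`,
`𝓕(x,T) = (T/(2πx²)) log²T (1 + O(1/√log T)) + (T/2π) log x + O(T √log T)`. -/
theorem FF_asymptotic :
    ∃ C > 0, ∀ x T : ℝ, 3 ≤ T → 1 ≤ x → x ≤ T →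
      ∃ E₁ E₂ : ℝ, |E₁| ≤ C / Real.sqrt (Real.log T) ∧
        |E₂| ≤ C * T * Real.sqrt (Real.log T) ∧
        FF x T = ((T / (2 * Real.pi * x ^ 2) * Real.log T ^ 2 * (1 + E₁) +
          T / (2 * Real.pi) * Real.log x + E₂ : ℝ) : ℂ) := by
  obtain ⟨C, hC, hbig⟩ := FFbig
  obtain ⟨T0, hT0⟩ := eventually_atTop.1 hbig
  obtain ⟨D, hD, hsmall⟩ := FFsmall T0
  obtain ⟨N, dN⟩ : ∃ N, N = |Real.log T0| := ⟨_, rfl⟩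
  have N0 : 0 ≤ N := by rw [dN]; positivity
  refine ⟨C + D + N^2 + N, by positivity, fun x T hT hx hxT => ?_⟩
  have hL := log_ge_one hT
  have l1 : 1 ≤ √(Real.log T) := Real.one_le_sqrt.2 hL
  have hlx : Real.log x ≤ Real.log T := Real.log_le_log (by linarith) hxT
  have hlx0 : 0 ≤ Real.log x := Real.log_nonneg hx
  have pi3 := Real.pi_gt_three
  obtain ⟨B, hB⟩ := band_B hT
  obtain ⟨-, hF⟩ := FFid hx hB
  have hx0 : 0 < x := by linarith
  have hFF : FF x T = (((∫ t, ‖A1 x B t‖^2) / (2 * Real.pi) : ℝ) : ℂ) := by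
    have : (2 * Real.pi : ℂ) ≠ 0 := by simp [Real.pi_ne_zero]
    push_cast
    rw [eq_div_iff this, ← hF]; ring
  obtain ⟨a, da⟩ : ∃ a, a = Real.log T^2/x^2 := ⟨_, rfl⟩
  have a0 : 0 ≤ a := by rw [da]; positivity
  have ea : T / (2 * Real.pi * x ^ 2) * Real.log T ^ 2 = T * a / (2 * Real.pi) := by
    rw [da]; field_simp
  rw [ea]
  rcases le_total T0 T with h | h
  · have hb := hT0 T h x hx hxT B hB
    rw [← da] at hb
    rw [hFF]
    clear hsmall hbig hT0 hF hFF da ea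
    generalize √(Real.log T) = l at *
    generalize (∫ t, ‖A1 x B t‖^2) = A at *
    obtain ⟨e, de⟩ : ∃ e, e = A - T * (a + Real.log x) := ⟨_, rfl⟩
    rw [← de] at hb
    obtain ⟨G, dG⟩ : ∃ G, G = T * a / l + T * l := ⟨_, rfl⟩
    have G0 : 0 < G := by rw [dG]; positivity
    rw [← dG] at hb
    have hk : |e / G| ≤ C := by rw [abs_div, abs_of_pos G0, div_le_iff₀ G0]; exact hb
    have hCC : C ≤ C + D + N^2 + N := by nlinarith
    refine ⟨e / G / l, e / G * (T * l) / (2 * Real.pi), ?_, ?_, ?_⟩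
    · rw [abs_div, abs_of_pos (by linarith : 0 < l)]; gcongr; linarith
    · rw [abs_div, abs_mul, abs_of_pos (by positivity : 0 < T * l), abs_of_pos (by positivity : 0 < 2 * Real.pi), mul_assoc]
      refine (div_le_self (by positivity) (by linarith)).trans ?_
      gcongr; linarith
    · congr 1
      have : A = T * (a + Real.log x) + e / G * G := by rw [div_mul_cancel₀ _ G0.ne']; linarith
      rw [this]
      generalize e / G = k
      rw [dG]; field_simp; ring
  · refine ⟨0, (FF x T).re - (T * a / (2 * Real.pi) + T / (2 * Real.pi) * Real.log x), by simp; positivity, ?_, ?_⟩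
    · have hs := (Complex.abs_re_le_norm _).trans (hsmall x T hT h hx hxT)
      have hLN : Real.log T ≤ N := by
        rw [dN]; exact (Real.log_le_log (by linarith) h).trans (le_abs_self _)
      have aN : a ≤ N^2 := by
        rw [da]
        refine (div_le_self (by positivity) (one_le_pow₀ hx)).trans (by gcongr)
      have Tp : T / (2 * Real.pi) ≤ T := div_le_self (by linarith) (by linarith)
      have Tp0 : 0 ≤ T / (2 * Real.pi) := by positivity
      have m1 : T * a / (2 * Real.pi) ≤ T * N^2 := by
        rw [mul_div_right_comm]; gcongr
      have m10 : 0 ≤ T * a / (2 * Real.pi) := by positivity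
      have m2 : T / (2 * Real.pi) * Real.log x ≤ T * N := by gcongr; linarith
      have m20 : 0 ≤ T / (2 * Real.pi) * Real.log x := by positivity
      have e1 : |(FF x T).re - (T * a / (2 * Real.pi) + T / (2 * Real.pi) * Real.log x)| ≤ D + (T * N^2 + T * N) := by
        refine (abs_sub _ _).trans ?_
        rw [abs_of_nonneg (add_nonneg m10 m20)]; linarith
      have e2 : (C + D + N^2 + N) * T * 1 ≤ (C + D + N^2 + N) * T * √(Real.log T) := by gcongr
      have e3 : D ≤ D * T := le_mul_of_one_le_right hD (by linarith)
      have e4 : 0 ≤ C * T := by positivity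
      linarith
    · rw [add_zero, mul_one, add_sub_cancel, hFF, Complex.ofReal_re]
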